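/- Up to isometry, there is at most one Coxeter decomposition of the second type of the hyperbolic simplex H_11^5 with fundamental simplex H_4^5. -/

import Mathlib

noncomputable section

namespace CD

open MeasureTheory Set
open scoped ENNReal

/-! ## Coxeter diagrams, encoded as Coxeter matrices.
A Coxeter diagram on `k` nodes is encoded by its Coxeter matrix
`M : Matrix (Fin k) (Fin k) ℕ`: `M i i = 1`, and for `i ≠ j` the entry `M i j = m`
means that the corresponding facets meet at the dihedral angle `π / m`
(`2` = no edge of the diagram, and `0` encodes the label `∞`, i.e. angle `0`,
consistently with `π / 0 = 0` in Lean). -/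

/-- A Coxeter diagram: a number of nodes together with a Coxeter matrix. -/
def CM : Type := Σ k : ℕ, Matrix (Fin k) (Fin k) ℕ

/-- The Coxeter matrix on `k` nodes with the given list of labelled edges
(`(i, j, m)` is an edge between nodes `i` and `j` with label `m`). -/
def cmOfEdges (k : ℕ) (E : List (ℕ × ℕ × ℕ)) : Matrix (Fin k) (Fin k) ℕ :=
  Matrix.of fun i j =>
    if i = j then 1 else
      match E.find? (fun e => (e.1 == (i : ℕ) && e.2.1 == (j : ℕ)) ||
                              (e.1 == (j : ℕ) && e.2.1 == (i : ℕ))) with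
      | some e => e.2.2
      | none => 2

/-- The Coxeter matrix of type `A_k`. -/
def cmA (k : ℕ) : Matrix (Fin k) (Fin k) ℕ :=
  Matrix.of fun i j =>
    if i = j then 1
    else if (i : ℕ) + 1 = (j : ℕ) ∨ (j : ℕ) + 1 = (i : ℕ) then 3 else 2

/-- The Coxeter matrix of type `D_k`, with the conventions `D_2 = A_1 + A_1` and
`D_3 = A_3`. -/
def cmD (k : ℕ) : Matrix (Fin k) (Fin k) ℕ :=
  Matrix.of fun i j =>
    if i = j then 1
    else if k = 2 then 2
    else if ((i : ℕ) + 1 = (j : ℕ) ∧ (j : ℕ) ≤ k - 2) ∨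
            ((j : ℕ) + 1 = (i : ℕ) ∧ (i : ℕ) ≤ k - 2) ∨
            ((i : ℕ) = k - 3 ∧ (j : ℕ) = k - 1) ∨
            ((j : ℕ) = k - 3 ∧ (i : ℕ) = k - 1)
      then 3 else 2

/-- Direct sum (disjoint union) of two Coxeter matrices. -/
def cmSum {a b : ℕ} (M : Matrix (Fin a) (Fin a) ℕ) (N : Matrix (Fin b) (Fin b) ℕ) :
    Matrix (Fin (a + b)) (Fin (a + b)) ℕ :=
  Matrix.of fun i j =>
    if hi : (i : ℕ) < a then
      if hj : (j : ℕ) < a then M ⟨i, hi⟩ ⟨j, hj⟩ else 2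
    else
      if _hj : (j : ℕ) < a then 2
      else N ⟨(i : ℕ) - a, by have := i.isLt; omega⟩ ⟨(j : ℕ) - a, by have := j.isLt; omega⟩

def cmAdd (x y : CM) : CM := ⟨x.1 + y.1, cmSum x.2 y.2⟩

def cmNil : CM := ⟨0, Matrix.of fun _ _ => 1⟩

/-- Disjoint union of a list of Coxeter diagrams. -/
def cmList (l : List CM) : CM := l.foldr cmAdd cmNil

def cA (k : ℕ) : CM := ⟨k, cmA k⟩
def cD (k : ℕ) : CM := ⟨k, cmD k⟩
def cE6 : CM := ⟨6, cmOfEdges 6 [(0,1,3),(1,2,3),(2,3,3),(3,4,3),(2,5,3)]⟩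
def cE7 : CM := ⟨7, cmOfEdges 7 [(0,1,3),(1,2,3),(2,3,3),(3,4,3),(4,5,3),(2,6,3)]⟩
def cE8 : CM := ⟨8, cmOfEdges 8 [(0,1,3),(1,2,3),(2,3,3),(3,4,3),(4,5,3),(5,6,3),(2,7,3)]⟩
def cF4 : CM := ⟨4, cmOfEdges 4 [(0,1,3),(1,2,4),(2,3,3)]⟩
def cH3 : CM := ⟨3, cmOfEdges 3 [(0,1,5),(1,2,3)]⟩
def cH4 : CM := ⟨4, cmOfEdges 4 [(0,1,5),(1,2,3),(2,3,3)]⟩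
/-- `G₂^{(5)} = I₂(5)`. -/
def cG25 : CM := ⟨2, cmOfEdges 2 [(0,1,5)]⟩

/-- The affine (Euclidean) Coxeter matrix `Ã₃` (a 4-cycle). -/
def cmA3t : Matrix (Fin 4) (Fin 4) ℕ := cmOfEdges 4 [(0,1,3),(1,2,3),(2,3,3),(0,3,3)]
/-- The affine Coxeter matrix `D̃₄`. -/
def cmD4t : Matrix (Fin 5) (Fin 5) ℕ := cmOfEdges 5 [(0,1,3),(0,2,3),(0,3,3),(0,4,3)]
/-- The affine Coxeter matrix `C̃₄`. -/
def cmC4t : Matrix (Fin 5) (Fin 5) ℕ := cmOfEdges 5 [(0,1,4),(1,2,3),(2,3,3),(3,4,4)]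
/-- The affine Coxeter matrix `F̃₄`. -/
def cmF4t : Matrix (Fin 5) (Fin 5) ℕ := cmOfEdges 5 [(0,1,3),(1,2,3),(2,3,4),(3,4,3)]
/-- The affine Coxeter matrix `C̃₂` (the Euclidean (2,4,4)-triangle). -/
def cmC2t : Matrix (Fin 3) (Fin 3) ℕ := cmOfEdges 3 [(0,1,4),(1,2,4)]
/-- The affine Coxeter matrix `G̃₂` (the Euclidean (2,3,6)-triangle). -/
def cmG2t : Matrix (Fin 3) (Fin 3) ℕ := cmOfEdges 3 [(0,1,6),(1,2,3)]

/-- Connectedness of a Coxeter diagram. -/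
def cmConnected (c : CM) : Prop :=
  ∀ i j : Fin c.1, Relation.ReflTransGen (fun a b => 3 ≤ c.2 a b ∨ c.2 a b = 0) i j

/-! ## Hyperbolic space `H^n`: the hyperboloid model. -/

/-- The Minkowski bilinear form of signature `(n,1)` on `ℝ^{n+1}`. -/
def mink (n : ℕ) (x y : EuclideanSpace ℝ (Fin (n + 1))) : ℝ :=
  -(x 0 * y 0) + ∑ i : Fin n, x i.succ * y i.succ

/-- The hyperboloid model of hyperbolic `n`-space:
`{x ∈ ℝ^{n+1} : ⟨x,x⟩ = -1, x₀ > 0}`. -/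
def hypSet (n : ℕ) : Set (EuclideanSpace ℝ (Fin (n + 1))) :=
  {x | mink n x x = -1 ∧ 0 < x 0}

/-- The closed half-space of `H^n` with (spacelike unit) outward normal `v`. -/
def hHalf (n : ℕ) (v : EuclideanSpace ℝ (Fin (n + 1))) : Set ↥(hypSet n) :=
  {x | mink n v x.val ≤ 0}

/-- The hyperplane of `H^n` with (spacelike unit) normal `v`. -/
def hWall (n : ℕ) (v : EuclideanSpace ℝ (Fin (n + 1))) : Set ↥(hypSet n) :=
  {x | mink n v x.val = 0}

/-- Projection of the hyperboloid to the Beltrami–Klein ball. -/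
def klein (n : ℕ) (x : ↥(hypSet n)) : Fin n → ℝ := fun i => x.val i.succ / x.val 0

/-- The hyperbolic (Riemannian) volume of a subset of `H^n`, computed in the
Beltrami–Klein model, where the volume element is `(1-|y|²)^{-(n+1)/2} dy`. -/
def hVol (n : ℕ) (S : Set ↥(hypSet n)) : ℝ≥0∞ :=
  ∫⁻ y in klein n '' S,
    ENNReal.ofReal ((1 - ∑ i, y i ^ 2) ^ (-((n : ℝ) + 1) / 2)) ∂(volume)

/-- An isometry of `H^n`: a bijection preserving the Minkowski product
(equivalently, the hyperbolic distance `arcosh(-⟨x,y⟩)`). -/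
def hIsIsom (n : ℕ) (g : ↥(hypSet n) → ↥(hypSet n)) : Prop :=
  Function.Bijective g ∧ ∀ x y, mink n (g x).val (g y).val = mink n x.val y.val

/-- Two subsets of `H^n` are congruent if an isometry carries one onto the other. -/
def hCongr (n : ℕ) (A B : Set ↥(hypSet n)) : Prop :=
  ∃ g, hIsIsom n g ∧ g '' A = B

/-- The ambient reflection of `ℝ^{n+1}` in the hyperplane with spacelike unit normal `v`. -/
def hReflect (n : ℕ) (v x : EuclideanSpace ℝ (Fin (n + 1))) :
    EuclideanSpace ℝ (Fin (n + 1)) :=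
  x - (2 * mink n v x) • v

/-- `S` is a facet ((n-1)-dimensional face) of the polyhedron `P ⊆ H^n`:
`S = P ∩ Π` for a supporting hyperplane `Π` of `P`, and `S` lies in no other
hyperplane (so it is genuinely `(n-1)`-dimensional). -/
def hIsFacet (n : ℕ) (P S : Set ↥(hypSet n)) : Prop :=
  S.Nonempty ∧ ∃ v, mink n v v = 1 ∧ P ⊆ hHalf n v ∧ S = P ∩ hWall n v ∧
    ∀ u, mink n u u = 1 → S ⊆ hWall n u → hWall n u = hWall n v

/-- A convex polyhedron in `H^n`: an intersection of finitely many closed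
half-spaces with nonempty interior and finite volume. -/
def hIsPoly (n : ℕ) (P : Set ↥(hypSet n)) : Prop :=
  ∃ (k : ℕ) (v : Fin k → EuclideanSpace ℝ (Fin (n + 1))),
    (∀ i, mink n (v i) (v i) = 1) ∧ P = ⋂ i, hHalf n (v i) ∧
    (interior P).Nonempty ∧ hVol n P < ⊤

/-- A Coxeter polyhedron in `H^n`: a convex polyhedron all of whose dihedral
angles are of the form `π/k`, `k ≥ 2` (the dihedral angle along a ridge with
outward unit normals `u, v` is `π/k` iff `⟨u,v⟩ = -cos (π/k)`). -/
def hIsCoxPoly (n : ℕ) (P : Set ↥(hypSet n)) : Prop :=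
  ∃ (k : ℕ) (v : Fin k → EuclideanSpace ℝ (Fin (n + 1))),
    (∀ i, mink n (v i) (v i) = 1) ∧ P = ⋂ i, hHalf n (v i) ∧
    (interior P).Nonempty ∧ hVol n P < ⊤ ∧
    ∀ i j, hWall n (v i) ≠ hWall n (v j) →
      (∃ x ∈ P, x ∈ hWall n (v i) ∩ hWall n (v j)) →
      ∃ m : ℕ, 2 ≤ m ∧ mink n (v i) (v j) = -Real.cos (Real.pi / (m : ℝ))

/-- A simplex in `H^n` (possibly with ideal vertices): a convex polyhedron with
exactly `n+1` facets. -/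
def hIsSimplex (n : ℕ) (P : Set ↥(hypSet n)) : Prop :=
  hIsPoly n P ∧ {S | hIsFacet n P S}.ncard = n + 1

/-- A Coxeter decomposition of `P ⊆ H^n`: a decomposition of `P` into finitely
many tiles with pairwise disjoint interiors, each tile a Coxeter polyhedron,
such that any two tiles having a common facet are symmetric with respect to
(the hyperplane of) this facet. -/
def hIsCoxDecomp (n : ℕ) (P : Set ↥(hypSet n)) (𝒯 : Set (Set ↥(hypSet n))) : Prop :=
  𝒯.Finite ∧ 𝒯.Nonempty ∧ (∀ T ∈ 𝒯, hIsCoxPoly n T) ∧ ⋃₀ 𝒯 = P ∧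
  (∀ T₁ ∈ 𝒯, ∀ T₂ ∈ 𝒯, T₁ ≠ T₂ → interior T₁ ∩ interior T₂ = ∅) ∧
  (∀ T₁ ∈ 𝒯, ∀ T₂ ∈ 𝒯, T₁ ≠ T₂ → ∀ S, hIsFacet n T₁ S → hIsFacet n T₂ S →
    ∃ v, mink n v v = 1 ∧ S ⊆ hWall n v ∧
      T₂ = {y | ∃ x ∈ T₁, (y : EuclideanSpace ℝ (Fin (n + 1))) = hReflect n v x.val})

/-- A hyperplane (with unit normal `v`) is a mirror of the decomposition `𝒯` of `P`
if it contains a facet of some tile but no facet of `P`. -/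
def hIsMirror (n : ℕ) (P : Set ↥(hypSet n)) (𝒯 : Set (Set ↥(hypSet n)))
    (v : EuclideanSpace ℝ (Fin (n + 1))) : Prop :=
  mink n v v = 1 ∧ (∃ T ∈ 𝒯, ∃ S, hIsFacet n T S ∧ S ⊆ hWall n v) ∧
  ¬∃ S, hIsFacet n P S ∧ S ⊆ hWall n v

/-- The decomposition `𝒯` of `P` is of the second type: every dihedral angle of `P`
is fundamental, i.e. no mirror contains the intersection of two facets of `P`. -/
def hSecondType (n : ℕ) (P : Set ↥(hypSet n)) (𝒯 : Set (Set ↥(hypSet n))) : Prop :=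
  ∀ α β, hIsFacet n P α → hIsFacet n P β → α ≠ β → (α ∩ β).Nonempty →
    ¬∃ v, hIsMirror n P 𝒯 v ∧ α ∩ β ⊆ hWall n v

/-- Decompositions obtainable by the inductive algorithm (decompositions of the
first type), with fundamental simplex `F`: start from (isometric copies of) `F`,
and repeatedly glue two previously obtained decomposed simplices along a common
facet so that the union is again a simplex and the union of the two
decompositions is a Coxeter decomposition of it. -/
inductive hFirstType (n : ℕ) (F : Set ↥(hypSet n)) :
    Set ↥(hypSet n) → Set (Set ↥(hypSet n)) → Prop
  | base (P : Set ↥(hypSet n)) : hCongr n F P → hIsSimplex n P → hFirstType n F P {P}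
  | congr (P : Set ↥(hypSet n)) (𝒯 : Set (Set ↥(hypSet n)))
      (g : ↥(hypSet n) → ↥(hypSet n)) :
      hIsIsom n g → hFirstType n F P 𝒯 → hFirstType n F (g '' P) ((fun T => g '' T) '' 𝒯)
  | glue (P₁ P₂ : Set ↥(hypSet n)) (𝒯₁ 𝒯₂ : Set (Set ↥(hypSet n))) (S : Set ↥(hypSet n)) :
      hFirstType n F P₁ 𝒯₁ → hFirstType n F P₂ 𝒯₂ →
      hIsFacet n P₁ S → hIsFacet n P₂ S →
      interior P₁ ∩ interior P₂ = ∅ →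
      hIsSimplex n (P₁ ∪ P₂) →
      hIsCoxDecomp n (P₁ ∪ P₂) (𝒯₁ ∪ 𝒯₂) →
      hFirstType n F (P₁ ∪ P₂) (𝒯₁ ∪ 𝒯₂)

/-- A vertex of the simplex `P ⊆ H^n`: a point of `P` lying on at least `n` facets. -/
def hIsVertex (n : ℕ) (P : Set ↥(hypSet n)) (x : ↥(hypSet n)) : Prop :=
  x ∈ P ∧ n ≤ {S | hIsFacet n P S ∧ x ∈ S}.ncard

/-- The cone over `S ⊆ H^n` in `ℝ^{n+1}`. -/
def hCone (n : ℕ) (S : Set ↥(hypSet n)) : Set (EuclideanSpace ℝ (Fin (n + 1))) :=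
  {y | ∃ x ∈ S, ∃ t : ℝ, 0 < t ∧ y = t • (x : EuclideanSpace ℝ (Fin (n + 1)))}

/-- The ideal vertices of `P ⊆ H^n`: lightlike directions (normalized by `w₀ = 1`)
in the closure of the cone over `P`. -/
def hIdealVerts (n : ℕ) (P : Set ↥(hypSet n)) : Set (EuclideanSpace ℝ (Fin (n + 1))) :=
  {w | mink n w w = 0 ∧ w 0 = 1 ∧ w ∈ closure (hCone n P)}

/-- The ideal vertex `w` of `P` has horospherical link of the Euclidean type given
by the (affine) Coxeter matrix `M`: the facets of `P` incident to `w` can be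
indexed so that their unit normals have Gram matrix `-cos (π / M i j)`. -/
def hIdealLink (n : ℕ) (P : Set ↥(hypSet n)) (w : EuclideanSpace ℝ (Fin (n + 1)))
    {k : ℕ} (M : Matrix (Fin k) (Fin k) ℕ) : Prop :=
  ∃ e : Fin k → EuclideanSpace ℝ (Fin (n + 1)),
    (∀ i, mink n (e i) (e i) = 1) ∧
    (∀ i, mink n (e i) w = 0) ∧
    (∀ i j, i ≠ j → mink n (e i) (e j) = -Real.cos (Real.pi / (M i j : ℝ))) ∧
    (∀ i j, i ≠ j → hWall n (e i) ≠ hWall n (e j)) ∧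
    {S | hIsFacet n P S ∧ w ∈ closure (hCone n S)} =
      Set.range fun i => P ∩ hWall n (e i)

/-- The number of tiles of `𝒯` incident to the ideal point `w`. -/
def hTilesAt (n : ℕ) (𝒯 : Set (Set ↥(hypSet n)))
    (w : EuclideanSpace ℝ (Fin (n + 1))) : ℕ :=
  {T | T ∈ 𝒯 ∧ w ∈ closure (hCone n T)}.ncard

/-- An occurrence, in the Coxeter diagram of `P`, of a subdiagram of type `M`:
a set `𝒜` of `k` facets of `P` whose unit normals have Gram matrix
`-cos (π / M i j)`. -/
def hSubOcc (n : ℕ) (P : Set ↥(hypSet n)) {k : ℕ} (M : Matrix (Fin k) (Fin k) ℕ)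
    (𝒜 : Set (Set ↥(hypSet n))) : Prop :=
  ∃ e : Fin k → EuclideanSpace ℝ (Fin (n + 1)),
    (∀ i, mink n (e i) (e i) = 1) ∧
    (∀ i j, i ≠ j → mink n (e i) (e j) = -Real.cos (Real.pi / (M i j : ℝ))) ∧
    (∀ i, hIsFacet n P (P ∩ hWall n (e i))) ∧
    𝒜 = Set.range (fun i => P ∩ hWall n (e i)) ∧ 𝒜.ncard = k

/-- The polyhedron `P ⊆ H^n` is a Coxeter simplex with Coxeter diagram (matrix) `M`. -/
def hOfType (n : ℕ) (P : Set ↥(hypSet n)) {k : ℕ} (M : Matrix (Fin k) (Fin k) ℕ) : Prop :=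
  (∀ i, M i i = 1) ∧ (∀ i j, M i j = M j i) ∧
  ∃ e : Fin k → EuclideanSpace ℝ (Fin (n + 1)),
    (∀ i, mink n (e i) (e i) = 1) ∧
    (∀ i j, i ≠ j → mink n (e i) (e j) = -Real.cos (Real.pi / (M i j : ℝ))) ∧
    P = ⋂ i, hHalf n (e i) ∧ (∀ i, hIsFacet n P (P ∩ hWall n (e i)))

/-- Equivalence of two decompositions of the same polyhedron `P`, up to an
isometry preserving `P`. -/
def hDecompEquiv (n : ℕ) (P : Set ↥(hypSet n)) (𝒯₁ 𝒯₂ : Set (Set ↥(hypSet n))) : Prop :=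
  ∃ g, hIsIsom n g ∧ g '' P = P ∧ (fun T => g '' T) '' 𝒯₁ = 𝒯₂

/-- A Coxeter decomposition of the second type of `P` with fundamental simplex `F`. -/
def hSTDecomp (n : ℕ) (P F : Set ↥(hypSet n)) (𝒯 : Set (Set ↥(hypSet n))) : Prop :=
  hIsCoxDecomp n P 𝒯 ∧ (∀ T ∈ 𝒯, hCongr n F T) ∧ hSecondType n P 𝒯

def hCoxSimplex (n : ℕ) (P : Set ↥(hypSet n)) : Prop := hIsCoxPoly n P ∧ hIsSimplex n P

/-! ## The sphere `S^n ⊂ ℝ^{n+1}`. -/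

/-- The Euclidean dot product on `ℝ^{n+1}`. -/
def sdot (n : ℕ) (x y : EuclideanSpace ℝ (Fin (n + 1))) : ℝ := ∑ i, x i * y i

/-- The unit sphere `S^n ⊂ ℝ^{n+1}`. -/
def sSet (n : ℕ) : Set (EuclideanSpace ℝ (Fin (n + 1))) := {x | sdot n x x = 1}

/-- The closed hemisphere of `S^n` with (unit) outward normal `v`. -/
def sHalf (n : ℕ) (v : EuclideanSpace ℝ (Fin (n + 1))) : Set ↥(sSet n) :=
  {x | sdot n v x.val ≤ 0}

/-- The great hypersphere of `S^n` with (unit) normal `v`. -/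
def sWall (n : ℕ) (v : EuclideanSpace ℝ (Fin (n + 1))) : Set ↥(sSet n) :=
  {x | sdot n v x.val = 0}

/-- The spherical (Riemannian) volume of `S ⊆ S^n`: `(n+1)` times the Lebesgue
measure of the cone over `S` truncated at radius `1`. -/
def sVol (n : ℕ) (S : Set ↥(sSet n)) : ℝ≥0∞ :=
  ((n : ℝ≥0∞) + 1) *
    volume {y : Fin (n + 1) → ℝ | ∃ x ∈ S, ∃ t : ℝ, 0 < t ∧ t ≤ 1 ∧
      y = fun i => t * (x : EuclideanSpace ℝ (Fin (n + 1))) i}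

/-- An isometry of `S^n`: a bijection preserving the dot product (equivalently,
the spherical distance). -/
def sIsIsom (n : ℕ) (g : ↥(sSet n) → ↥(sSet n)) : Prop :=
  Function.Bijective g ∧ ∀ x y, sdot n (g x).val (g y).val = sdot n x.val y.val

def sCongr (n : ℕ) (A B : Set ↥(sSet n)) : Prop := ∃ g, sIsIsom n g ∧ g '' A = B

/-- The ambient reflection of `ℝ^{n+1}` in the hyperplane with unit normal `v`. -/
def sReflect (n : ℕ) (v x : EuclideanSpace ℝ (Fin (n + 1))) :
    EuclideanSpace ℝ (Fin (n + 1)) :=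
  x - (2 * sdot n v x) • v

/-- `S` is a facet of the spherical polyhedron `P`. -/
def sIsFacet (n : ℕ) (P S : Set ↥(sSet n)) : Prop :=
  S.Nonempty ∧ ∃ v, sdot n v v = 1 ∧ P ⊆ sHalf n v ∧ S = P ∩ sWall n v ∧
    ∀ u, sdot n u u = 1 → S ⊆ sWall n u → sWall n u = sWall n v

/-- A convex polyhedron in `S^n`. -/
def sIsPoly (n : ℕ) (P : Set ↥(sSet n)) : Prop :=
  ∃ (k : ℕ) (v : Fin k → EuclideanSpace ℝ (Fin (n + 1))),
    (∀ i, sdot n (v i) (v i) = 1) ∧ P = ⋂ i, sHalf n (v i) ∧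
    (interior P).Nonempty ∧ sVol n P < ⊤

/-- A Coxeter polyhedron in `S^n`. -/
def sIsCoxPoly (n : ℕ) (P : Set ↥(sSet n)) : Prop :=
  ∃ (k : ℕ) (v : Fin k → EuclideanSpace ℝ (Fin (n + 1))),
    (∀ i, sdot n (v i) (v i) = 1) ∧ P = ⋂ i, sHalf n (v i) ∧
    (interior P).Nonempty ∧ sVol n P < ⊤ ∧
    ∀ i j, sWall n (v i) ≠ sWall n (v j) →
      (∃ x ∈ P, x ∈ sWall n (v i) ∩ sWall n (v j)) →
      ∃ m : ℕ, 2 ≤ m ∧ sdot n (v i) (v j) = -Real.cos (Real.pi / (m : ℝ))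

/-- A spherical simplex in `S^n`: the intersection of `S^n` with a simplicial cone,
i.e. a convex spherical polyhedron with exactly `n+1` facets. -/
def sIsSimplex (n : ℕ) (P : Set ↥(sSet n)) : Prop :=
  sIsPoly n P ∧ {S | sIsFacet n P S}.ncard = n + 1

/-- A Coxeter decomposition of `P ⊆ S^n`. -/
def sIsCoxDecomp (n : ℕ) (P : Set ↥(sSet n)) (𝒯 : Set (Set ↥(sSet n))) : Prop :=
  𝒯.Finite ∧ 𝒯.Nonempty ∧ (∀ T ∈ 𝒯, sIsCoxPoly n T) ∧ ⋃₀ 𝒯 = P ∧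
  (∀ T₁ ∈ 𝒯, ∀ T₂ ∈ 𝒯, T₁ ≠ T₂ → interior T₁ ∩ interior T₂ = ∅) ∧
  (∀ T₁ ∈ 𝒯, ∀ T₂ ∈ 𝒯, T₁ ≠ T₂ → ∀ S, sIsFacet n T₁ S → sIsFacet n T₂ S →
    ∃ v, sdot n v v = 1 ∧ S ⊆ sWall n v ∧
      T₂ = {y | ∃ x ∈ T₁, (y : EuclideanSpace ℝ (Fin (n + 1))) = sReflect n v x.val})

/-- Mirrors of a spherical Coxeter decomposition. -/
def sIsMirror (n : ℕ) (P : Set ↥(sSet n)) (𝒯 : Set (Set ↥(sSet n)))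
    (v : EuclideanSpace ℝ (Fin (n + 1))) : Prop :=
  sdot n v v = 1 ∧ (∃ T ∈ 𝒯, ∃ S, sIsFacet n T S ∧ S ⊆ sWall n v) ∧
  ¬∃ S, sIsFacet n P S ∧ S ⊆ sWall n v

/-- Second type: every dihedral angle of `P` is fundamental. -/
def sSecondType (n : ℕ) (P : Set ↥(sSet n)) (𝒯 : Set (Set ↥(sSet n))) : Prop :=
  ∀ α β, sIsFacet n P α → sIsFacet n P β → α ≠ β → (α ∩ β).Nonempty →
    ¬∃ v, sIsMirror n P 𝒯 v ∧ α ∩ β ⊆ sWall n v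

/-- `P ⊆ S^n` is a Coxeter simplex with Coxeter diagram (matrix) `M`. -/
def sOfType (n : ℕ) (P : Set ↥(sSet n)) {k : ℕ} (M : Matrix (Fin k) (Fin k) ℕ) : Prop :=
  (∀ i, M i i = 1) ∧ (∀ i j, M i j = M j i) ∧
  ∃ e : Fin k → EuclideanSpace ℝ (Fin (n + 1)),
    (∀ i, sdot n (e i) (e i) = 1) ∧
    (∀ i j, i ≠ j → sdot n (e i) (e j) = -Real.cos (Real.pi / (M i j : ℝ))) ∧
    P = ⋂ i, sHalf n (e i) ∧ (∀ i, sIsFacet n P (P ∩ sWall n (e i)))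

/-- `P ⊆ S^n` is a Coxeter simplex of the type given by the diagram `c`. -/
def sOfTypeCM (n : ℕ) (P : Set ↥(sSet n)) (c : CM) : Prop := sOfType n P c.2

/-! ## Euclidean space `E^n`. -/

/-- The dot product on `E^n`. -/
def edot (n : ℕ) (x y : EuclideanSpace ℝ (Fin n)) : ℝ := ∑ i, x i * y i

/-- The closed affine half-space `{x : ⟨v,x⟩ ≤ c}` of `E^n`. -/
def eHalf (n : ℕ) (v : EuclideanSpace ℝ (Fin n)) (c : ℝ) : Set (EuclideanSpace ℝ (Fin n)) :=
  {x | edot n v x ≤ c}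

/-- The affine hyperplane `{x : ⟨v,x⟩ = c}` of `E^n`. -/
def eWall (n : ℕ) (v : EuclideanSpace ℝ (Fin n)) (c : ℝ) : Set (EuclideanSpace ℝ (Fin n)) :=
  {x | edot n v x = c}

/-- Reflection of `E^n` in the affine hyperplane `{x : ⟨v,x⟩ = c}` (`v` a unit vector). -/
def eReflect (n : ℕ) (v : EuclideanSpace ℝ (Fin n)) (c : ℝ) (x : EuclideanSpace ℝ (Fin n)) :
    EuclideanSpace ℝ (Fin n) :=
  x - (2 * (edot n v x - c)) • v

/-- An isometry of `E^n`. -/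
def eIsIsom (n : ℕ) (g : EuclideanSpace ℝ (Fin n) → EuclideanSpace ℝ (Fin n)) : Prop :=
  Function.Bijective g ∧ ∀ x y, dist (g x) (g y) = dist x y

def eCongr (n : ℕ) (A B : Set (EuclideanSpace ℝ (Fin n))) : Prop :=
  ∃ g, eIsIsom n g ∧ g '' A = B

/-- A similarity transformation of `E^n` carries `A` onto `B`. -/
def eSimilar (n : ℕ) (A B : Set (EuclideanSpace ℝ (Fin n))) : Prop :=
  ∃ (f : EuclideanSpace ℝ (Fin n) → EuclideanSpace ℝ (Fin n)) (r : ℝ), 0 < r ∧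
    Function.Surjective f ∧ (∀ x y, dist (f x) (f y) = r * dist x y) ∧ f '' A = B

/-- `S` is a facet of the Euclidean polyhedron `P`. -/
def eIsFacet (n : ℕ) (P S : Set (EuclideanSpace ℝ (Fin n))) : Prop :=
  S.Nonempty ∧ ∃ v c, edot n v v = 1 ∧ P ⊆ eHalf n v c ∧ S = P ∩ eWall n v c ∧
    ∀ u d, edot n u u = 1 → S ⊆ eWall n u d → eWall n u d = eWall n v c

/-- A convex polyhedron in `E^n`. -/
def eIsPoly (n : ℕ) (P : Set (EuclideanSpace ℝ (Fin n))) : Prop :=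
  ∃ (k : ℕ) (v : Fin k → EuclideanSpace ℝ (Fin n)) (c : Fin k → ℝ),
    (∀ i, edot n (v i) (v i) = 1) ∧ P = ⋂ i, eHalf n (v i) (c i) ∧
    (interior P).Nonempty ∧ volume P < ⊤

/-- A Coxeter polyhedron in `E^n`. -/
def eIsCoxPoly (n : ℕ) (P : Set (EuclideanSpace ℝ (Fin n))) : Prop :=
  ∃ (k : ℕ) (v : Fin k → EuclideanSpace ℝ (Fin n)) (c : Fin k → ℝ),
    (∀ i, edot n (v i) (v i) = 1) ∧ P = ⋂ i, eHalf n (v i) (c i) ∧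
    (interior P).Nonempty ∧ volume P < ⊤ ∧
    ∀ i j, eWall n (v i) (c i) ≠ eWall n (v j) (c j) →
      (∃ x ∈ P, x ∈ eWall n (v i) (c i) ∩ eWall n (v j) (c j)) →
      ∃ m : ℕ, 2 ≤ m ∧ edot n (v i) (v j) = -Real.cos (Real.pi / (m : ℝ))

/-- A simplex in `E^n`: a convex polyhedron with exactly `n+1` facets. -/
def eIsSimplex (n : ℕ) (P : Set (EuclideanSpace ℝ (Fin n))) : Prop :=
  eIsPoly n P ∧ {S | eIsFacet n P S}.ncard = n + 1

/-- A Coxeter decomposition of `P ⊆ E^n`. -/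
def eIsCoxDecomp (n : ℕ) (P : Set (EuclideanSpace ℝ (Fin n)))
    (𝒯 : Set (Set (EuclideanSpace ℝ (Fin n)))) : Prop :=
  𝒯.Finite ∧ 𝒯.Nonempty ∧ (∀ T ∈ 𝒯, eIsCoxPoly n T) ∧ ⋃₀ 𝒯 = P ∧
  (∀ T₁ ∈ 𝒯, ∀ T₂ ∈ 𝒯, T₁ ≠ T₂ → interior T₁ ∩ interior T₂ = ∅) ∧
  (∀ T₁ ∈ 𝒯, ∀ T₂ ∈ 𝒯, T₁ ≠ T₂ → ∀ S, eIsFacet n T₁ S → eIsFacet n T₂ S →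
    ∃ v c, edot n v v = 1 ∧ S ⊆ eWall n v c ∧ T₂ = eReflect n v c '' T₁)

/-- Mirrors of a Euclidean Coxeter decomposition. -/
def eIsMirror (n : ℕ) (P : Set (EuclideanSpace ℝ (Fin n)))
    (𝒯 : Set (Set (EuclideanSpace ℝ (Fin n))))
    (v : EuclideanSpace ℝ (Fin n)) (c : ℝ) : Prop :=
  edot n v v = 1 ∧ (∃ T ∈ 𝒯, ∃ S, eIsFacet n T S ∧ S ⊆ eWall n v c) ∧
  ¬∃ S, eIsFacet n P S ∧ S ⊆ eWall n v c

/-- Second type: every dihedral angle of `P` is fundamental. -/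
def eSecondType (n : ℕ) (P : Set (EuclideanSpace ℝ (Fin n)))
    (𝒯 : Set (Set (EuclideanSpace ℝ (Fin n)))) : Prop :=
  ∀ α β, eIsFacet n P α → eIsFacet n P β → α ≠ β → (α ∩ β).Nonempty →
    ¬∃ v c, eIsMirror n P 𝒯 v c ∧ α ∩ β ⊆ eWall n v c

/-- `P ⊆ E^n` is a Coxeter simplex with Coxeter diagram (matrix) `M`. -/
def eOfType (n : ℕ) (P : Set (EuclideanSpace ℝ (Fin n))) {k : ℕ}
    (M : Matrix (Fin k) (Fin k) ℕ) : Prop :=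
  (∀ i, M i i = 1) ∧ (∀ i j, M i j = M j i) ∧
  ∃ (e : Fin k → EuclideanSpace ℝ (Fin n)) (c : Fin k → ℝ),
    (∀ i, edot n (e i) (e i) = 1) ∧
    (∀ i j, i ≠ j → edot n (e i) (e j) = -Real.cos (Real.pi / (M i j : ℝ))) ∧
    P = ⋂ i, eHalf n (e i) (c i) ∧ (∀ i, eIsFacet n P (P ∩ eWall n (e i) (c i)))

/-! ## The particular non-compact hyperbolic Coxeter simplices occurring in the
classification, identified by the structural data given in the paper
(dimension, compactness, number and types of ideal vertices, subdiagrams of the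
Coxeter diagram, and (relative) volumes). -/

/-- The Coxeter simplex `H₃⁴ ⊂ H⁴`: non-compact, with exactly one ideal vertex,
whose horospherical link is of Euclidean type `Ã₃`; volume `≈ 0.01370778`. -/
def IsH34 {n : ℕ} (P : Set ↥(hypSet n)) : Prop :=
  n = 4 ∧ hCoxSimplex n P ∧ ¬IsCompact P ∧ (hIdealVerts n P).ncard = 1 ∧
  (∀ w ∈ hIdealVerts n P, hIdealLink n P w cmA3t) ∧
  hVol n P ∈ Set.Ioo (ENNReal.ofReal 0.0137077) (ENNReal.ofReal 0.0137078)

/-- The Coxeter simplex `H₉⁴ ⊂ H⁴`: non-compact, with exactly three ideal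
vertices, each of type `Ã₃`, of volume exactly `10` times that of `H₃⁴`. -/
def IsH94 {n : ℕ} (P : Set ↥(hypSet n)) : Prop :=
  n = 4 ∧ hCoxSimplex n P ∧ ¬IsCompact P ∧ (hIdealVerts n P).ncard = 3 ∧
  (∀ w ∈ hIdealVerts n P, hIdealLink n P w cmA3t) ∧
  ∀ F : Set ↥(hypSet n), IsH34 F → hVol n P = 10 * hVol n F

/-- The Coxeter simplex `H₄⁵ ⊂ H⁵`: non-compact, of volume `≈ 0.0010956247`. -/
def IsH45 {n : ℕ} (P : Set ↥(hypSet n)) : Prop :=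
  n = 5 ∧ hCoxSimplex n P ∧ ¬IsCompact P ∧
  hVol n P ∈ Set.Ioo (ENNReal.ofReal 0.0010956) (ENNReal.ofReal 0.0010957)

/-- The Coxeter simplex `H₅⁵ ⊂ H⁵`: non-compact, of volume `≈ 0.0018260413`,
whose Coxeter diagram contains exactly one parabolic subdiagram of type `C̃₄`
and exactly one of type `F̃₄`. -/
def IsH55 {n : ℕ} (P : Set ↥(hypSet n)) : Prop :=
  n = 5 ∧ hCoxSimplex n P ∧ ¬IsCompact P ∧
  {𝒜 | hSubOcc n P cmC4t 𝒜}.ncard = 1 ∧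
  {𝒜 | hSubOcc n P cmF4t 𝒜}.ncard = 1 ∧
  hVol n P ∈ Set.Ioo (ENNReal.ofReal 0.0018260) (ENNReal.ofReal 0.0018261)

/-- The Coxeter simplex `H₇⁵ ⊂ H⁵`: non-compact, of volume `≈ 0.0036520826`,
with three ideal vertices, whose Coxeter diagram contains no parabolic
subdiagram of type `D̃₄`. -/
def IsH75 {n : ℕ} (P : Set ↥(hypSet n)) : Prop :=
  n = 5 ∧ hCoxSimplex n P ∧ ¬IsCompact P ∧ (hIdealVerts n P).ncard = 3 ∧
  (¬∃ 𝒜, hSubOcc n P cmD4t 𝒜) ∧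
  hVol n P ∈ Set.Ioo (ENNReal.ofReal 0.0036520) (ENNReal.ofReal 0.0036521)

/-- The Coxeter simplex `H₁₁⁵ ⊂ H⁵`: non-compact, with five ideal vertices, one
of which has horospherical link of Euclidean type `D̃₄`; its volume is exactly
`20` times that of `H₄⁵` (and exactly `6` times that of `H₇⁵`). -/
def IsH115 {n : ℕ} (P : Set ↥(hypSet n)) : Prop :=
  n = 5 ∧ hCoxSimplex n P ∧ ¬IsCompact P ∧ (hIdealVerts n P).ncard = 5 ∧
  (∃ w ∈ hIdealVerts n P, hIdealLink n P w cmD4t) ∧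
  (∀ F : Set ↥(hypSet n), IsH45 F → hVol n P = 20 * hVol n F) ∧
  (∀ F : Set ↥(hypSet n), IsH75 F → hVol n P = 6 * hVol n F)

/-- The Coxeter simplex `H₁₂⁵ ⊂ H⁵`: non-compact, whose Coxeter diagram contains
exactly two parabolic subdiagrams of type `C̃₄` and exactly four of type `F̃₄`;
its volume is exactly `16` times that of `H₅⁵`. -/
def IsH125 {n : ℕ} (P : Set ↥(hypSet n)) : Prop :=
  n = 5 ∧ hCoxSimplex n P ∧ ¬IsCompact P ∧
  {𝒜 | hSubOcc n P cmC4t 𝒜}.ncard = 2 ∧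
  {𝒜 | hSubOcc n P cmF4t 𝒜}.ncard = 4 ∧
  ∀ F : Set ↥(hypSet n), IsH55 F → hVol n P = 16 * hVol n F

/-- The Coxeter simplex `H₁⁸ ⊂ H⁸`: the non-compact Coxeter simplex of minimal
volume in `H⁸`, with exactly one ideal vertex. -/
def IsH18 {n : ℕ} (P : Set ↥(hypSet n)) : Prop :=
  n = 8 ∧ hCoxSimplex n P ∧ ¬IsCompact P ∧ (hIdealVerts n P).ncard = 1 ∧
  ∀ Q : Set ↥(hypSet n), hCoxSimplex n Q → ¬IsCompact Q → hVol n P ≤ hVol n Q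

/-- The Coxeter simplex `H₄⁸ ⊂ H⁸`: non-compact, with exactly two ideal
vertices, whose Coxeter diagram contains a subdiagram of type `A₈`; its volume
is exactly `272` times that of `H₁⁸`. -/
def IsH48 {n : ℕ} (P : Set ↥(hypSet n)) : Prop :=
  n = 8 ∧ hCoxSimplex n P ∧ ¬IsCompact P ∧ (hIdealVerts n P).ncard = 2 ∧
  (∃ 𝒜, hSubOcc n P (cmA 8) 𝒜) ∧
  ∀ F : Set ↥(hypSet n), IsH18 F → hVol n P = 272 * hVol n F

/-- The Coxeter simplex `H₁⁹ ⊂ H⁹`: the non-compact Coxeter simplex of minimal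
volume in `H⁹`, with exactly one ideal vertex. -/
def IsH19 {n : ℕ} (P : Set ↥(hypSet n)) : Prop :=
  n = 9 ∧ hCoxSimplex n P ∧ ¬IsCompact P ∧ (hIdealVerts n P).ncard = 1 ∧
  ∀ Q : Set ↥(hypSet n), hCoxSimplex n Q → ¬IsCompact Q → hVol n P ≤ hVol n Q

/-- The Coxeter simplex `H₃⁹ ⊂ H⁹`: non-compact, with exactly three ideal
vertices; its volume is exactly `527` times that of `H₁⁹`. -/
def IsH39 {n : ℕ} (P : Set ↥(hypSet n)) : Prop :=
  n = 9 ∧ hCoxSimplex n P ∧ ¬IsCompact P ∧ (hIdealVerts n P).ncard = 3 ∧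
  ∀ F : Set ↥(hypSet n), IsH19 F → hVol n P = 527 * hVol n F

/-- The Lorentzian form on `ℝ⁶`. -/
def qf (x y : Fin 6 → ℝ) : ℝ :=
  -(x 0 * y 0) + x 1 * y 1 + x 2 * y 2 + x 3 * y 3 + x 4 * y 4 + x 5 * y 5

/-- The closed cone over the standard model of `H₁₁⁵`. -/
def InP (y : Fin 6 → ℝ) : Prop :=
  0 ≤ y 1 ∧ 0 ≤ y 2 ∧ 0 ≤ y 3 ∧ 0 ≤ y 4 ∧ 0 ≤ y 5 ∧ y 1 + y 2 + y 3 + y 4 + y 5 ≤ y 0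

/-- Outward unit normals of the standard cone. -/
def pN (i : Fin 6) : Fin 6 → ℝ :=
  if i = 0 then fun _ => 1 / 2 else fun j => if j = i then -1 else 0

lemma qf_comm (x y : Fin 6 → ℝ) : qf x y = qf y x := by unfold qf; ring

lemma qf_add_left (x y z : Fin 6 → ℝ) : qf (x + y) z = qf x z + qf y z := by
  simp only [qf, Pi.add_apply]; ring

lemma qf_add_right (x y z : Fin 6 → ℝ) : qf x (y + z) = qf x y + qf x z := by
  simp only [qf, Pi.add_apply]; ring

lemma qf_smul_left (a : ℝ) (x z : Fin 6 → ℝ) : qf (a • x) z = a * qf x z := by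
  simp only [qf, Pi.smul_apply, smul_eq_mul]; ring

lemma qf_smul_right (a : ℝ) (x z : Fin 6 → ℝ) : qf x (a • z) = a * qf x z := by
  simp only [qf, Pi.smul_apply, smul_eq_mul]; ring

/-- `qf` as a bilinear map. -/
def qfL : (Fin 6 → ℝ) →ₗ[ℝ] (Fin 6 → ℝ) →ₗ[ℝ] ℝ :=
  LinearMap.mk₂ ℝ qf qf_add_left qf_smul_left qf_add_right qf_smul_right

lemma qf_sum_left (a : Fin 6 → ℝ) (n : Fin 6 → Fin 6 → ℝ) (y : Fin 6 → ℝ) :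
    qf (∑ k, a k • n k) y = ∑ k, a k * qf (n k) y := by
  simp only [Fin.sum_univ_six, qf_add_left, qf_smul_left]

lemma qf_sum_right (a : Fin 6 → ℝ) (n : Fin 6 → Fin 6 → ℝ) (y : Fin 6 → ℝ) :
    qf y (∑ k, a k • n k) = ∑ k, a k * qf y (n k) := by
  rw [qf_comm, qf_sum_left]; simp only [qf_comm]

lemma qf_eq_zero {x : Fin 6 → ℝ} (h : ∀ y, qf x y = 0) : x = 0 := by
  funext i
  have := h (Pi.single i 1)
  fin_cases i <;> simpa [qf] using this

lemma qf_pN_zero (y : Fin 6 → ℝ) :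
    qf (pN 0) y = (-y 0 + y 1 + y 2 + y 3 + y 4 + y 5) / 2 := by
  simp only [qf, pN]; simp; ring

lemma qf_pN {i : Fin 6} (hi : i ≠ 0) (y : Fin 6 → ℝ) : qf (pN i) y = -y i := by
  simp only [qf, pN, hi]
  fin_cases i <;> first | exact absurd rfl hi | simp

lemma inP_iff (y : Fin 6 → ℝ) : InP y ↔ ∀ i, qf (pN i) y ≤ 0 := by
  constructor
  · rintro ⟨h1, h2, h3, h4, h5, h0⟩ i
    by_cases hi : i = 0
    · subst hi; rw [qf_pN_zero]; linarith
    · rw [qf_pN hi]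
      fin_cases i <;> first | exact absurd rfl hi | simpa
  · intro h
    have h0 := h 0
    have h1 := h 1
    have h2 := h 2
    have h3 := h 3
    have h4 := h 4
    have h5 := h 5
    rw [qf_pN_zero] at h0
    rw [qf_pN (by decide)] at h1 h2 h3 h4 h5
    refine ⟨?_, ?_, ?_, ?_, ?_, ?_⟩ <;> linarith

lemma InP.add {x y : Fin 6 → ℝ} (hx : InP x) (hy : InP y) : InP (x + y) := by
  rw [inP_iff] at *
  intro i; rw [qf_add_right]; linarith [hx i, hy i]

lemma InP.smul {x : Fin 6 → ℝ} (hx : InP x) {a : ℝ} (ha : 0 ≤ a) : InP (a • x) := by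
  rw [inP_iff] at *
  intro i; rw [qf_smul_right]; nlinarith [hx i]

lemma InP.neg_eq_zero {x : Fin 6 → ℝ} (hx : InP x) (hx' : InP (-x)) : x = 0 := by
  obtain ⟨h1, h2, h3, h4, h5, h0⟩ := hx
  obtain ⟨g1, g2, g3, g4, g5, g0⟩ := hx'
  simp only [Pi.neg_apply] at *
  funext i; fin_cases i <;> simp <;> linarith

lemma InP.zero_le {x : Fin 6 → ℝ} (hx : InP x) : 0 ≤ x 0 := by
  obtain ⟨h1, h2, h3, h4, h5, h0⟩ := hx; linarith

/-- The closed cone cut out by the outward normals `n`. -/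
def Reg (n : Fin 6 → Fin 6 → ℝ) (y : Fin 6 → ℝ) : Prop := ∀ k, qf (n k) y ≤ 0

/-- The open cone cut out by the outward normals `n`. -/
def SReg (n : Fin 6 → Fin 6 → ℝ) (y : Fin 6 → ℝ) : Prop := ∀ k, qf (n k) y < 0

/-- A Coxeter simplicial cone inside the standard cone, none of whose walls
cuts a dihedral angle of the standard cone. -/
structure Tile (n : Fin 6 → Fin 6 → ℝ) : Prop where
  unit : ∀ k, qf (n k) (n k) = 1
  cox : ∀ k l, k ≠ l → ∃ m : ℕ, 2 ≤ m ∧ qf (n k) (n l) = -Real.cos (Real.pi / m)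
  sub : ∀ y, Reg n y → InP y
  sec : ∀ k i j (α β : ℝ), i ≠ j → n k = α • pN i + β • pN j → α = 0 ∨ β = 0

/-- A decomposition of the standard cone into congruent tiles. -/
structure Fam {ι : Type} (M : Fin 6 → Fin 6 → ℝ) (N : ι → Fin 6 → Fin 6 → ℝ) : Prop where
  gram : ∀ t k l, qf (N t k) (N t l) = M k l
  tile : ∀ t, Tile (N t)
  cov : ∀ y, InP y → ∃ t, Reg (N t) y
  disj : ∀ t t' y, SReg (N t) y → SReg (N t') y → t = t'

lemma eq_zero_of_sub {n : Fin 6 → Fin 6 → ℝ} (hn : ∀ y, Reg n y → InP y) {d : Fin 6 → ℝ}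
    (h : ∀ k, qf (n k) d = 0) : d = 0 := by
  refine InP.neg_eq_zero (hn d fun k => (h k).le) (hn (-d) fun k => ?_)
  rw [← neg_one_smul ℝ d, qf_smul_right, h k]; simp

lemma exists_dual_of_sub {n : Fin 6 → Fin 6 → ℝ} (hn : ∀ y, Reg n y → InP y) :
    ∃ z : Fin 6 → Fin 6 → ℝ, ∀ k l, qf (n k) (z l) = if k = l then -1 else 0 := by
  let A : (Fin 6 → ℝ) →ₗ[ℝ] (Fin 6 → ℝ) := LinearMap.pi fun k => qfL (n k)
  have hA : ∀ d k, A d k = qf (n k) d := fun d k => rfl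
  have hinj : Function.Injective A := by
    rw [← LinearMap.ker_eq_bot, LinearMap.ker_eq_bot']
    intro d hd
    exact eq_zero_of_sub hn fun k => by rw [← hA, hd]; rfl
  have hsurj := LinearMap.injective_iff_surjective.mp hinj
  choose z hz using fun l : Fin 6 => hsurj (fun k => if k = l then -1 else 0)
  exact ⟨z, fun k l => by rw [← hA, hz]⟩

namespace Tile
variable {n : Fin 6 → Fin 6 → ℝ}

lemma eq_zero (hn : Tile n) {d : Fin 6 → ℝ} (h : ∀ k, qf (n k) d = 0) : d = 0 :=
  eq_zero_of_sub hn.sub h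

lemma exists_dual (hn : Tile n) :
    ∃ z : Fin 6 → Fin 6 → ℝ, ∀ k l, qf (n k) (z l) = if k = l then -1 else 0 :=
  exists_dual_of_sub hn.sub

/-- The basis dual (up to sign) to the normals of a tile. -/
def dual (hn : Tile n) : Fin 6 → Fin 6 → ℝ := hn.exists_dual.choose

lemma qf_dual (hn : Tile n) (k l : Fin 6) :
    qf (n k) (hn.dual l) = if k = l then -1 else 0 := hn.exists_dual.choose_spec k l

lemma qf_dual_self (hn : Tile n) (k : Fin 6) : qf (n k) (hn.dual k) = -1 := by
  simp [qf_dual]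

lemma qf_dual_ne (hn : Tile n) {k l : Fin 6} (h : k ≠ l) : qf (n k) (hn.dual l) = 0 := by
  simp [qf_dual, h]

lemma dual_reg (hn : Tile n) (l : Fin 6) : Reg n (hn.dual l) := fun k => by
  rw [hn.qf_dual]; split_ifs <;> norm_num

lemma dual_inP (hn : Tile n) (l : Fin 6) : InP (hn.dual l) := hn.sub _ (hn.dual_reg l)

lemma eq_sum_dual (hn : Tile n) (u : Fin 6 → ℝ) :
    u = ∑ k, (-qf (n k) u) • hn.dual k := by
  rw [← sub_eq_zero]
  refine hn.eq_zero fun k => ?_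
  rw [sub_eq_add_neg, qf_add_right, ← neg_one_smul ℝ (∑ k, _), qf_smul_right, qf_sum_right]
  simp [hn.qf_dual]

lemma ext_dual (hn : Tile n) {x : Fin 6 → ℝ} (h : ∀ l, qf x (hn.dual l) = 0) : x = 0 := by
  refine qf_eq_zero fun y => ?_
  rw [hn.eq_sum_dual y, qf_sum_right]
  simp [h]

lemma eq_sum_normal (hn : Tile n) (u : Fin 6 → ℝ) :
    u = ∑ k, (-qf u (hn.dual k)) • n k := by
  rw [← sub_eq_zero]
  refine hn.ext_dual fun l => ?_
  rw [sub_eq_add_neg, qf_add_left, ← neg_one_smul ℝ (∑ k, _), qf_smul_left, qf_sum_left]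
  simp [hn.qf_dual]

lemma pN_dual (hn : Tile n) (i k : Fin 6) : qf (pN i) (hn.dual k) ≤ 0 :=
  (inP_iff _).mp (hn.dual_inP k) i

lemma ne_neg_pN (hn : Tile n) (k i : Fin 6) {a : ℝ} (ha : a ≤ 0) : n k ≠ a • pN i := by
  intro h
  have := hn.qf_dual_self k
  rw [h, qf_smul_left] at this
  nlinarith [hn.pN_dual i k]

lemma injective (hn : Tile n) : Function.Injective n := by
  intro k l h
  by_contra hkl
  have h1 := hn.qf_dual_self l
  rw [← h, hn.qf_dual_ne hkl] at h1
  norm_num at h1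

/-- A point in the interior of a tile. -/
def mid (hn : Tile n) : Fin 6 → ℝ := ∑ k, (1 : ℝ) • hn.dual k

lemma mid_sreg (hn : Tile n) : SReg n hn.mid := fun k => by
  rw [mid, qf_sum_right]; simp [hn.qf_dual]

lemma pN_neg (hn : Tile n) {y : Fin 6 → ℝ} (hy : SReg n y) (i : Fin 6) : qf (pN i) y < 0 := by
  have h := hn.eq_sum_normal (pN i)
  have hle : ∀ k, (-qf (pN i) (hn.dual k)) * qf (n k) y ≤ 0 := fun k => by
    nlinarith [hn.pN_dual i k, hy k]
  have hs : qf (pN i) y = ∑ k, (-qf (pN i) (hn.dual k)) * qf (n k) y := by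
    conv_lhs => rw [h]
    rw [qf_sum_left]
  rw [hs]
  refine lt_of_le_of_ne (Finset.sum_nonpos fun k _ => hle k) fun h0 => ?_
  rw [Finset.sum_eq_zero_iff_of_nonpos fun k _ => hle k] at h0
  have hz : pN i = 0 := hn.ext_dual fun l => by
    have := h0 l (Finset.mem_univ _)
    rcases mul_eq_zero.mp this with h | h
    · linarith
    · exact absurd h (hy l).ne
  have := congrFun hz i
  by_cases hi : i = 0
  · simp [pN, hi] at this
  · simp [pN, hi] at this

end Tile

section perm
variable (σ : Equiv.Perm (Fin 6))

lemma qf_eq_sum (x y : Fin 6 → ℝ) : qf x y = ∑ i, x i * y i - 2 * (x 0 * y 0) := by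
  rw [Fin.sum_univ_six]; unfold qf; ring

variable {σ}

lemma qf_perm (hσ : σ 0 = 0) (x y : Fin 6 → ℝ) : qf (x ∘ σ) (y ∘ σ) = qf x y := by
  rw [qf_eq_sum, qf_eq_sum]
  simp only [Function.comp, hσ]
  rw [Equiv.sum_comp σ fun i => x i * y i]

lemma pN_perm (hσ : σ 0 = 0) (i : Fin 6) : pN i ∘ σ = pN (σ.symm i) := by
  have h0 : σ.symm i = 0 ↔ i = 0 := by
    rw [Equiv.symm_apply_eq, hσ]
  funext j
  by_cases hi : i = 0
  · simp only [pN, Function.comp, if_pos hi, if_pos (h0.mpr hi)]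
  · simp only [pN, Function.comp, if_neg hi, if_neg (mt h0.mp hi), Equiv.eq_symm_apply]

lemma inP_perm (hσ : σ 0 = 0) (y : Fin 6 → ℝ) : InP (y ∘ σ) ↔ InP y := by
  rw [inP_iff, inP_iff]
  constructor
  · intro h i
    rw [← qf_perm hσ, pN_perm hσ]; exact h _
  · intro h i
    have : pN i = pN (σ i) ∘ σ := by rw [pN_perm hσ]; simp
    rw [this, qf_perm hσ]; exact h _

lemma symm_zero (hσ : σ 0 = 0) : σ.symm 0 = 0 := by rw [Equiv.symm_apply_eq, hσ]

lemma Tile.perm {n : Fin 6 → Fin 6 → ℝ} (hn : Tile n) (hσ : σ 0 = 0) :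
    Tile (fun k => n k ∘ σ) where
  unit k := by rw [qf_perm hσ]; exact hn.unit k
  cox k l h := by rw [qf_perm hσ]; exact hn.cox k l h
  sub y h := by
    rw [← inP_perm (symm_zero hσ)]
    refine hn.sub _ fun k => ?_
    rw [← qf_perm hσ]
    convert h k using 2
    funext i; simp
  sec k i j α β hij h := by
    refine hn.sec k (σ i) (σ j) α β (fun h => hij (σ.injective h)) ?_
    have h' : n k = (n k ∘ σ) ∘ σ.symm := by funext i; simp
    rw [h', h]
    have h2 := pN_perm (symm_zero hσ) i
    have h3 := pN_perm (symm_zero hσ) j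
    simp only [Equiv.symm_symm] at h2 h3
    rw [← h2, ← h3]; rfl

lemma reg_perm {n : Fin 6 → Fin 6 → ℝ} (hσ : σ 0 = 0) (y : Fin 6 → ℝ) :
    Reg (fun k => n k ∘ σ) (y ∘ σ) ↔ Reg n y := by
  simp only [Reg, qf_perm hσ]

lemma sreg_perm {n : Fin 6 → Fin 6 → ℝ} (hσ : σ 0 = 0) (y : Fin 6 → ℝ) :
    SReg (fun k => n k ∘ σ) (y ∘ σ) ↔ SReg n y := by
  simp only [SReg, qf_perm hσ]

lemma Fam.perm {ι : Type} {M : Fin 6 → Fin 6 → ℝ} {N : ι → Fin 6 → Fin 6 → ℝ}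
    (hN : Fam M N) (hσ : σ 0 = 0) : Fam M (fun t k => N t k ∘ σ) where
  gram t k l := by rw [qf_perm hσ]; exact hN.gram t k l
  tile t := (hN.tile t).perm hσ
  cov y hy := by
    obtain ⟨t, ht⟩ := hN.cov (y ∘ σ.symm) ((inP_perm (symm_zero hσ) y).mpr hy)
    refine ⟨t, ?_⟩
    rw [← reg_perm hσ] at ht
    convert ht using 1
    funext i; simp
  disj t t' y h h' := by
    have e : y = (y ∘ σ.symm) ∘ σ := by funext i; simp
    rw [e, sreg_perm hσ] at h h'
    exact hN.disj t t' _ h h'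

end perm

/-- Ideal vertices of the standard cone. -/
def wv (i : Fin 6) : Fin 6 → ℝ := fun j => if j = 0 ∨ j = i then 1 else 0

lemma qf_wv {i : Fin 6} (hi : i ≠ 0) (x : Fin 6 → ℝ) : qf x (wv i) = x i - x 0 := by
  simp only [qf, wv]
  fin_cases i <;> first | exact absurd rfl hi | (simp; ring)

lemma wv_inP (i : Fin 6) : InP (wv i) := by
  fin_cases i <;> simp [InP, wv]

lemma wv_ne_zero (i : Fin 6) : wv i ≠ 0 := fun h => by simpa [wv] using congrFun h 0

lemma InP.eq_smul_of_qf {y : Fin 6 → ℝ} (hy : InP y) (h : qf (wv 5) y = 0) :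
    y = y 0 • wv 5 := by
  rw [qf_comm, qf_wv (by decide)] at h
  obtain ⟨h1, h2, h3, h4, h5, h0⟩ := hy
  funext j
  fin_cases j <;> simp [wv] <;> linarith

lemma InP.qf_wv_nonpos {y : Fin 6 → ℝ} (hy : InP y) : qf (wv 5) y ≤ 0 := by
  rw [qf_comm, qf_wv (by decide)]
  obtain ⟨h1, h2, h3, h4, h5, h0⟩ := hy
  linarith

lemma InP.eq_smul_of_sub {y : Fin 6 → ℝ} (hy : InP y) (h : InP (wv 5 - y)) :
    y = y 0 • wv 5 := by
  refine hy.eq_smul_of_qf ?_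
  have h1 := hy.qf_wv_nonpos
  have h2 := h.qf_wv_nonpos
  rw [qf_comm, qf_wv (by decide)] at *
  simp [wv] at h2
  linarith

section heavy

variable {D : Fin 6 → Fin 6 → ℝ} {μ : Fin 6 → ℝ} {k₀ : Fin 6}

/-- The combinatorics behind the absence of labels `≥ 5` in affine diagrams of rank `5`. -/
lemma no_heavy (hsymm : ∀ i j, D i j = D j i) (hnn : ∀ i j, 0 ≤ D i j)
    (h0 : ∀ k, 0 ≤ μ k) (hpos : ∀ k, k ≠ k₀ → 0 < μ k)
    (heq : ∀ l, l ≠ k₀ → μ l = ∑ k, D k l * μ k)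
    (conn : ∀ S : Finset (Fin 6), S.Nonempty → k₀ ∉ S → (∃ j, j ∉ S ∧ j ≠ k₀) →
      ∃ i ∈ S, ∃ j, j ∉ S ∧ j ≠ k₀ ∧ 1 / 2 ≤ D i j)
    (i j : Fin 6) (hi : i ≠ k₀) (hj : j ≠ k₀) (hij : i ≠ j) : D i j < 4 / 5 := by
  have key : ∀ (A : Finset (Fin 6)) l, l ≠ k₀ → ∑ k ∈ A, D k l * μ k ≤ μ l := fun A l hl => by
    rw [heq l hl]
    exact Finset.sum_le_sum_of_subset_of_nonneg (Finset.subset_univ _)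
      fun k _ _ => mul_nonneg (hnn _ _) (h0 k)
  have mul_le : ∀ (c : ℝ) k l, c ≤ D k l → c * μ k ≤ D k l * μ k := fun c k l h =>
    mul_le_mul_of_nonneg_right h (h0 k)
  have i1 : ∀ l, l ≠ k₀ → ∀ a, ∀ c, c ≤ D l a → c * μ a ≤ μ l := fun l hl a c hc => by
    have := key {a} l hl
    rw [Finset.sum_singleton] at this
    rw [hsymm] at hc
    linarith [mul_le c a l hc]
  have i2 : ∀ l, l ≠ k₀ → ∀ a b, a ≠ b → ∀ c d, c ≤ D l a → d ≤ D l b →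
      c * μ a + d * μ b ≤ μ l := fun l hl a b hab c d hc hd => by
    have := key {a, b} l hl
    rw [Finset.sum_pair hab] at this
    rw [hsymm] at hc hd
    linarith [mul_le c a l hc, mul_le d b l hd]
  have i3 : ∀ l, l ≠ k₀ → ∀ a b e, a ≠ b → a ≠ e → b ≠ e → ∀ c d f, c ≤ D l a → d ≤ D l b →
      f ≤ D l e → c * μ a + d * μ b + f * μ e ≤ μ l :=
      fun l hl a b e hab hae hbe c d f hc hd hf => by
    have := key {a, b, e} l hl
    rw [Finset.sum_insert (by simp [hab, hae]), Finset.sum_pair hbe] at this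
    rw [hsymm] at hc hd hf
    linarith [mul_le c a l hc, mul_le d b l hd, mul_le f e l hf]
  have sw : ∀ c a b, c ≤ D a b → c ≤ D b a := fun c a b h => by rwa [hsymm]
  have cn : ∀ S : Finset (Fin 6), S.Nonempty → k₀ ∉ S → S.card < 5 →
      ∃ i ∈ S, ∃ j, j ∉ S ∧ j ≠ k₀ ∧ 1 / 2 ≤ D i j := fun S hS hk hc => by
    refine conn S hS hk ?_
    by_contra! hh
    have : (Finset.univ : Finset (Fin 6)) ⊆ insert k₀ S := fun x _ => by
      rw [Finset.mem_insert]
      by_contra! h2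
      exact h2.1 (hh x h2.2)
    have h3 := Finset.card_le_card this
    rw [Finset.card_insert_of_notMem hk] at h3
    simp at h3; omega
  by_contra! hD
  -- a third node attached to the heavy edge, at the second end
  have third : ∀ i j, i ≠ k₀ → j ≠ k₀ → i ≠ j → 4 / 5 ≤ D i j →
      ∀ k, k ≠ k₀ → k ≠ i → k ≠ j → 1 / 2 ≤ D j k → False := by
    intro i j hi hj hij hD k hk hki hkj hjk
    have pi := hpos i hi
    have pj := hpos j hj
    have pk := hpos k hk
    have a1 := i1 i hi j _ hD
    have a2 := i2 j hj i k hki.symm _ _ (sw _ _ _ hD) hjk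
    have a3 := i1 k hk j _ (sw _ _ _ hjk)
    have noi : ∀ l, l ≠ k₀ → l ≠ i → l ≠ j → l ≠ k → 1 / 2 ≤ D i l → False := by
      intro l hl hli hlj hlk hil
      have b1 := i2 i hi j l (Ne.symm hlj) _ _ hD hil
      have b2 := i1 l hl i _ (sw _ _ _ hil)
      linarith
    have noj : ∀ l, l ≠ k₀ → l ≠ i → l ≠ j → l ≠ k → 1 / 2 ≤ D j l → False := by
      intro l hl hli hlj hlk hjl
      have b1 := i3 j hj i k l hki.symm hli.symm hlk.symm _ _ _ (sw _ _ _ hD) hjk hjl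
      have b2 := i1 l hl j _ (sw _ _ _ hjl)
      linarith
    obtain ⟨x, hx, l, hlS, hl, hxl⟩ := cn {i, j, k} (by simp)
      (by simp [hi.symm, hj.symm, hk.symm]) (lt_of_le_of_lt Finset.card_le_three (by norm_num))
    simp only [Finset.mem_insert, Finset.mem_singleton, not_or] at hx hlS
    obtain ⟨hli, hlj, hlk⟩ := hlS
    rcases hx with rfl | rfl | rfl
    · exact noi l hl hli hlj hlk hxl
    · exact noj l hl hli hlj hlk hxl
    have pl := hpos l hl
    have c1 := i2 x hk j l (Ne.symm hlj) _ _ (sw _ _ _ hjk) hxl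
    have c2 := i1 l hl x _ (sw _ _ _ hxl)
    obtain ⟨y, hy, p, hpS, hp, hyp⟩ := cn {i, j, x, l} (by simp)
      (by simp [hi.symm, hj.symm, hk.symm, hl.symm])
      (lt_of_le_of_lt Finset.card_le_four (by norm_num))
    simp only [Finset.mem_insert, Finset.mem_singleton, not_or] at hy hpS
    obtain ⟨hpi, hpj, hpk, hpl⟩ := hpS
    rcases hy with rfl | rfl | rfl | rfl
    · exact noi p hp hpi hpj hpk hyp
    · exact noj p hp hpi hpj hpk hyp
    · have d1 := i3 y hk j l p (Ne.symm hlj) (Ne.symm hpj) (Ne.symm hpl) _ _ _ (sw _ _ _ hjk) hxl hyp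
      have d2 := i1 p hp y _ (sw _ _ _ hyp)
      linarith
    · have d1 := i2 y hl x p (Ne.symm hpk) _ _ (sw _ _ _ hxl) hyp
      have d2 := i1 p hp y _ (sw _ _ _ hyp)
      linarith
  obtain ⟨x, hx, k, hkS, hk, hxk⟩ := cn {i, j} (by simp)
    (by simp [hi.symm, hj.symm]) (lt_of_le_of_lt Finset.card_le_two (by norm_num))
  simp only [Finset.mem_insert, Finset.mem_singleton, not_or] at hx hkS
  rcases hx with rfl | rfl
  · exact third j x hj hi hij.symm (sw _ _ _ hD) k hk hkS.2 hkS.1 hxk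
  · exact third i x hi hj hij hD k hk hkS.1 hkS.2 hxk

end heavy

lemma cos_pi_div_cases {m : ℕ} (hm : 2 ≤ m) :
    Real.cos (Real.pi / m) = 0 ∨ Real.cos (Real.pi / m) = 1 / 2 ∨
      Real.cos (Real.pi / m) = √2 / 2 ∨
      4 / 5 ≤ Real.cos (Real.pi / m) ∧ Real.cos (Real.pi / m) ≤ 1 := by
  have hpi := Real.pi_pos
  rcases Nat.lt_or_ge m 5 with h | h
  · interval_cases m
    · left; norm_num
    · right; left; norm_num
    · right; right; left; norm_num
  · refine Or.inr (Or.inr (Or.inr ⟨?_, Real.cos_le_one _⟩))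
    have h5 : Real.cos (Real.pi / 5) ≤ Real.cos (Real.pi / m) := by
      refine Real.cos_le_cos_of_nonneg_of_le_pi (by positivity) (by linarith) ?_
      gcongr
      exact_mod_cast h
    rw [Real.cos_pi_div_five] at h5
    have : (2.2 : ℝ) ≤ √5 := Real.le_sqrt_of_sq_le (by norm_num)
    linarith

namespace Tile
variable {n : Fin 6 → Fin 6 → ℝ}

lemma cox_cases (hn : Tile n) {k l : Fin 6} (h : k ≠ l) :
    -qf (n k) (n l) = 0 ∨ -qf (n k) (n l) = 1 / 2 ∨ -qf (n k) (n l) = √2 / 2 ∨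
      4 / 5 ≤ -qf (n k) (n l) ∧ -qf (n k) (n l) ≤ 1 := by
  obtain ⟨m, hm, h⟩ := hn.cox k l h
  rw [h, neg_neg]
  exact cos_pi_div_cases hm

lemma exists_touch (hn : Tile n) (h : Reg n (wv 5)) :
    ∃ k₀, qf (n k₀) (wv 5) < 0 ∧ (∀ k, k ≠ k₀ → qf (n k) (wv 5) = 0) ∧
      hn.dual k₀ = hn.dual k₀ 0 • wv 5 := by
  obtain ⟨k₀, hk₀⟩ : ∃ k, qf (n k) (wv 5) < 0 := by
    by_contra! hh
    exact wv_ne_zero 5 (hn.eq_zero fun k => le_antisymm (h k) (hh k))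
  set a := -qf (n k₀) (wv 5) with ha
  have hapos : 0 < a := by linarith
  have h1 : InP (wv 5 - a • hn.dual k₀) := by
    refine hn.sub _ fun k => ?_
    rw [sub_eq_add_neg, qf_add_right, ← neg_smul, qf_smul_right, hn.qf_dual]
    split_ifs with hk
    · subst hk; linarith
    · have := h k; linarith
  have h2 := ((hn.dual_inP k₀).smul hapos.le).eq_smul_of_sub h1
  have h3 : hn.dual k₀ = hn.dual k₀ 0 • wv 5 := by
    have := congrArg (fun v => a⁻¹ • v) h2
    simp only [smul_smul, inv_mul_cancel₀ hapos.ne', one_smul, Pi.smul_apply, smul_eq_mul,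
      inv_mul_cancel_left₀ hapos.ne'] at this
    exact this
  refine ⟨k₀, hk₀, fun k hk => ?_, h3⟩
  have h4 := hn.qf_dual_ne hk
  have h5 := hn.qf_dual_self k₀
  rw [h3, qf_smul_right] at h4 h5
  rcases mul_eq_zero.mp h4 with h6 | h6
  · rw [h6] at h5; norm_num at h5
  · exact h6

lemma touch_coef (hn : Tile n) {k₀ : Fin 6} (h : ∀ k, k ≠ k₀ → qf (n k) (wv 5) = 0)
    (k : Fin 6) (hk : k ≠ k₀) : 0 < -qf (wv 5) (hn.dual k) := by
  have h1 := (hn.dual_inP k).qf_wv_nonpos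
  refine lt_of_le_of_ne (by linarith) fun h2 => ?_
  have h3 := (hn.dual_inP k).eq_smul_of_qf (by linarith)
  have h4 := hn.qf_dual_self k
  rw [h3, qf_smul_right, h k hk] at h4
  norm_num at h4

lemma touch_coef_zero (hn : Tile n) {k₀ : Fin 6} (h : hn.dual k₀ = hn.dual k₀ 0 • wv 5) :
    -qf (wv 5) (hn.dual k₀) = 0 := by
  rw [h, qf_smul_right]; simp [qf, wv]

/-- At an ideal vertex, the labels of the link are at most `4`. -/
lemma link_cases (hn : Tile n) {k₀ : Fin 6} (hw : ∀ k, k ≠ k₀ → qf (n k) (wv 5) = 0)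
    (hd : hn.dual k₀ = hn.dual k₀ 0 • wv 5) {k l : Fin 6} (hk : k ≠ k₀) (hl : l ≠ k₀)
    (hkl : k ≠ l) :
    -qf (n k) (n l) = 0 ∨ -qf (n k) (n l) = 1 / 2 ∨ -qf (n k) (n l) = √2 / 2 := by
  set μ : Fin 6 → ℝ := fun k => -qf (wv 5) (hn.dual k) with hμ
  have hμ0 : μ k₀ = 0 := hn.touch_coef_zero hd
  have hpos : ∀ k, k ≠ k₀ → 0 < μ k := fun k hk => hn.touch_coef hw k hk
  have hnn : ∀ k, 0 ≤ μ k := fun k => by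
    by_cases h : k = k₀
    · rw [h, hμ0]
    · exact (hpos k h).le
  have hsum : wv 5 = ∑ k, μ k • n k := hn.eq_sum_normal (wv 5)
  set D : Fin 6 → Fin 6 → ℝ := fun k l => if k = l then 0 else -qf (n k) (n l) with hD
  have hDnn : ∀ i j, 0 ≤ D i j := fun i j => by
    simp only [hD]
    split_ifs with h
    · exact le_rfl
    · have h2 : 0 ≤ √2 := Real.sqrt_nonneg 2
      rcases hn.cox_cases h with h | h | h | h <;> linarith
  have hG : ∀ k l, qf (n k) (n l) = (if k = l then 1 else 0) - D k l := fun k l => by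
    simp only [hD]
    split_ifs with h
    · rw [h, hn.unit]; ring
    · ring
  have main := no_heavy (D := D) (μ := μ) (k₀ := k₀)
    (fun i j => by simp only [hD, eq_comm (a := i), qf_comm (n i)]) hDnn hnn hpos
    (fun l hl => by
      have h1 := hw l hl
      rw [qf_comm, hsum, qf_sum_left] at h1
      simp only [hG, mul_sub, mul_ite, mul_one, mul_zero, Finset.sum_sub_distrib,
        Finset.sum_ite_eq', Finset.mem_univ, if_true] at h1
      rw [sub_eq_zero] at h1
      rw [h1]
      exact Finset.sum_congr rfl fun k _ => mul_comm _ _)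
    (fun S hS hkS ⟨j, hjS, hj⟩ => by
      by_contra! hh
      have hz : ∀ i ∈ S, ∀ j, j ∉ S → j ≠ k₀ → qf (n i) (n j) = 0 := fun i hi j hj hjk => by
        have h1 := hh i hi j hj hjk
        have hij : i ≠ j := fun h => hj (h ▸ hi)
        simp only [hD, if_neg hij] at h1
        have h2 : (1 : ℝ) < √2 := by
          rw [Real.lt_sqrt] <;> norm_num
        rcases hn.cox_cases hij with h | h | h | h <;> linarith
      set v : Fin 6 → ℝ := ∑ k, (if k ∈ S then μ k else 0) • n k with hv
      have hvl : ∀ l, l ≠ k₀ → qf (n l) v = 0 := fun l hl => by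
        rw [hv, qf_sum_right]
        by_cases hlS : l ∈ S
        · have h1 := hw l hl
          rw [hsum, qf_sum_right] at h1
          refine Eq.trans (Finset.sum_congr rfl fun k _ => ?_) h1
          split_ifs with hkS'
          · rfl
          · by_cases hkk : k = k₀
            · rw [hkk, hμ0, zero_mul]
            · rw [hz l hlS k hkS' hkk]; simp
        · refine Finset.sum_eq_zero fun k _ => ?_
          split_ifs with hkS'
          · rw [qf_comm, hz k hkS' l hlS hl, mul_zero]
          · simp
      have hvz : v = (-qf (n k₀) v * hn.dual k₀ 0) • wv 5 := by
        rw [mul_smul, ← hd]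
        conv_lhs => rw [hn.eq_sum_dual v]
        rw [Finset.sum_eq_single k₀]
        · intro k _ hk
          rw [hvl k hk]; simp
        · simp
      have hco : ∀ i, -qf v (hn.dual i) = if i ∈ S then μ i else 0 := fun i => by
        rw [hv, qf_sum_left]
        simp [hn.qf_dual]
      obtain ⟨i, hi⟩ := hS
      have e1 := hco i
      have e2 := hco j
      rw [if_pos hi, hvz, qf_smul_left] at e1
      rw [if_neg hjS, hvz, qf_smul_left] at e2
      have p1 := hpos i fun h => hkS (h ▸ hi)
      have p2 := hpos j hj
      simp only [hμ] at e1 p1 p2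
      rcases mul_eq_zero.mp (neg_eq_zero.mp e2) with h | h
      · rw [h] at e1; linarith
      · linarith)
    k l hk hl hkl
  simp only [hD, if_neg hkl] at main
  rcases hn.cox_cases hkl with h | h | h | h
  · exact Or.inl h
  · exact Or.inr (Or.inl h)
  · exact Or.inr (Or.inr h)
  · linarith

end Tile

open Filter Topology in
lemma le_of_frequently_add_mul {a : ℝ} {f : ℝ → ℝ} (hf : Continuous f)
    (h : ∃ᶠ ε in 𝓝[>] (0 : ℝ), a + ε * f ε ≤ 0) : a ≤ 0 := by
  have ht : Tendsto (fun ε => a + ε * f ε) (𝓝[>] (0 : ℝ)) (𝓝 a) := by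
    have : Continuous fun ε => a + ε * f ε := by fun_prop
    have h2 := this.tendsto 0
    simp only [zero_mul, add_zero] at h2
    exact h2.mono_left nhdsWithin_le_nhds
  exact le_of_tendsto_of_frequently ht h

open Filter Topology in
lemma frequently_of_mul {f : ℝ → ℝ}
    (h : ∃ᶠ ε in 𝓝[>] (0 : ℝ), ε * f ε ≤ 0) : ∃ᶠ ε in 𝓝[>] (0 : ℝ), f ε ≤ 0 := by
  have hp : ∀ᶠ ε in 𝓝[>] (0 : ℝ), 0 < ε := eventually_mem_nhdsWithin
  refine (h.and_eventually hp).mono fun ε hε => ?_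
  by_contra! hc
  nlinarith [mul_pos hε.2 hc, hε.1]

/-- Lexicographic nonpositivity. -/
def LexNP (a b c d : ℝ) : Prop :=
  a ≤ 0 ∧ (a = 0 → b ≤ 0 ∧ (b = 0 → c ≤ 0 ∧ (c = 0 → d ≤ 0)))

open Filter Topology in
lemma lexNP_of_frequently {a b c d : ℝ}
    (h : ∃ᶠ ε in 𝓝[>] (0 : ℝ), a + ε * (b + ε * (c + ε * d)) ≤ 0) : LexNP a b c d := by
  refine ⟨le_of_frequently_add_mul (by fun_prop) h, fun ha => ?_⟩
  simp only [ha, zero_add] at h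
  replace h := frequently_of_mul h
  refine ⟨le_of_frequently_add_mul (by fun_prop) h, fun hb => ?_⟩
  simp only [hb, zero_add] at h
  replace h := frequently_of_mul h
  refine ⟨le_of_frequently_add_mul (by fun_prop) h, fun hc => ?_⟩
  simp only [hc, zero_add] at h
  replace h := frequently_of_mul h
  refine le_of_frequently_add_mul (f := fun _ => 0) (by fun_prop) (by simpa using h)

open Filter Topology in
lemma Fam.exists_flag {ι : Type} [Finite ι] {M : Fin 6 → Fin 6 → ℝ} {N : ι → Fin 6 → Fin 6 → ℝ}
    (hN : Fam M N) : ∃ t, ∀ k, LexNP (qf (N t k) (wv 5)) (qf (N t k) (wv 1))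
      (qf (N t k) (wv 3)) (qf (N t k) (wv 4)) := by
  have hev : ∀ᶠ ε in 𝓝[>] (0 : ℝ), ∃ t,
      Reg (N t) (wv 5 + ε • (wv 1 + ε • (wv 3 + ε • wv 4))) := by
    have hp : ∀ᶠ ε in 𝓝[>] (0 : ℝ), 0 < ε := eventually_mem_nhdsWithin
    refine hp.mono fun ε hε => hN.cov _ ?_
    have h := hε.le
    exact (wv_inP 5).add (((wv_inP 1).add (((wv_inP 3).add ((wv_inP 4).smul h)).smul h)).smul h)
  have hfr : ∃ t, ∃ᶠ ε in 𝓝[>] (0 : ℝ), Reg (N t) (wv 5 + ε • (wv 1 + ε • (wv 3 + ε • wv 4))) := by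
    by_contra! hh
    rw [← eventually_all] at hh
    obtain ⟨ε, ⟨t, ht⟩, h⟩ := (hev.and hh).exists
    exact h t ht
  obtain ⟨t, ht⟩ := hfr
  refine ⟨t, fun k => lexNP_of_frequently (ht.mono fun ε hε => ?_)⟩
  have := hε k
  simp only [qf_add_right, qf_smul_right] at this
  exact this

lemma qf_pN_wv (i j : Fin 6) (hi : i ≠ 0) :
    qf (pN i) (wv j) = if i = j then -1 else 0 := by
  rw [qf_pN hi]; simp [wv, hi]; split_ifs <;> simp

lemma qf_pN_zero_wv (j : Fin 6) (hj : j ≠ 0) : qf (pN 0) (wv j) = 0 := by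
  rw [qf_wv hj]; simp [pN]

namespace Tile
variable {n : Fin 6 → Fin 6 → ℝ}

/-- The flag at the ideal vertex `wv 5` lies in the tile. -/
def Flag (n : Fin 6 → Fin 6 → ℝ) : Prop :=
  ∀ k, LexNP (qf (n k) (wv 5)) (qf (n k) (wv 1)) (qf (n k) (wv 3)) (qf (n k) (wv 4))

lemma sum_eq (hn : Tile n) (p y : Fin 6 → ℝ) :
    qf p y = ∑ k, (-qf p (hn.dual k)) * qf (n k) y := by
  conv_lhs => rw [hn.eq_sum_normal p]
  rw [qf_sum_left]

lemma vanish_step (hn : Tile n) (i : Fin 6) {y : Fin 6 → ℝ} (h0 : qf (pN i) y = 0)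
    (h : ∀ k, qf (pN i) (hn.dual k) ≠ 0 → qf (n k) y ≤ 0) :
    ∀ k, qf (pN i) (hn.dual k) ≠ 0 → qf (n k) y = 0 := by
  rw [hn.sum_eq] at h0
  have hle : ∀ k ∈ Finset.univ, (-qf (pN i) (hn.dual k)) * qf (n k) y ≤ 0 := fun k _ => by
    by_cases hk : qf (pN i) (hn.dual k) = 0
    · rw [hk]; simp
    · nlinarith [h k hk, hn.pN_dual i k]
  rw [Finset.sum_eq_zero_iff_of_nonpos hle] at h0
  intro k hk
  rcases mul_eq_zero.mp (h0 k (Finset.mem_univ _)) with h1 | h1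
  · exact absurd (neg_eq_zero.mp h1) hk
  · exact h1

/-- `p = ∑ κ n` with all contributing normals in a set. -/
lemma eq_sum_support (hn : Tile n) (p : Fin 6 → ℝ) (S : Finset (Fin 6))
    (h : ∀ k, k ∉ S → qf p (hn.dual k) = 0) :
    p = ∑ k ∈ S, (-qf p (hn.dual k)) • n k := by
  conv_lhs => rw [hn.eq_sum_normal p]
  symm
  refine Finset.sum_subset (Finset.subset_univ _) fun k _ hk => ?_
  rw [h k hk]; simp

lemma pN_flag (hn : Tile n) (hf : Flag n) (i : Fin 6) (k : Fin 6)
    (hk : qf (pN i) (hn.dual k) ≠ 0) :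
    (qf (pN i) (wv 5) = 0 → qf (n k) (wv 5) = 0 ∧ (qf (pN i) (wv 1) = 0 → qf (n k) (wv 1) = 0 ∧
      (qf (pN i) (wv 3) = 0 → qf (n k) (wv 3) = 0 ∧
        (qf (pN i) (wv 4) = 0 → qf (n k) (wv 4) = 0)))) := by
  intro h5
  have v5 := hn.vanish_step i h5 fun k _ => (hf k).1
  refine ⟨v5 k hk, fun h1 => ?_⟩
  have v1 := hn.vanish_step i h1 fun k hk => ((hf k).2 (v5 k hk)).1
  refine ⟨v1 k hk, fun h3 => ?_⟩
  have v3 := hn.vanish_step i h3 fun k hk => (((hf k).2 (v5 k hk)).2 (v1 k hk)).1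
  refine ⟨v3 k hk, fun h4 => ?_⟩
  exact hn.vanish_step i h4 (fun k hk => (((hf k).2 (v5 k hk)).2 (v1 k hk)).2 (v3 k hk)) k hk

lemma exists_ne (hn : Tile n) (i : Fin 6) : ∃ k, qf (pN i) (hn.dual k) ≠ 0 := by
  by_contra! h
  have h0 := hn.ext_dual h
  have := congrFun h0 i
  by_cases hi : i = 0 <;> simp [pN, hi] at this

/-- The walls `pN 0` and `pN 2` are walls of the flag tile. -/
lemma flag_two (hn : Tile n) (hf : Flag n) : (∃ k, n k = pN 0) ∧ ∃ k, n k = pN 2 := by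
  have key : ∀ k, qf (n k) (wv 5) = 0 → qf (n k) (wv 1) = 0 → qf (n k) (wv 3) = 0 →
      qf (n k) (wv 4) = 0 → n k = pN 0 ∨ n k = pN 2 := by
    intro k h5 h1 h3 h4
    rw [qf_wv (by decide)] at h5 h1 h3 h4
    have e : n k = (2 * n k 0) • pN 0 + (n k 0 - n k 2) • pN 2 := by
      funext j
      fin_cases j <;> simp [pN] <;> linarith
    have hu := hn.unit k
    unfold qf at hu
    rcases hn.sec k 0 2 _ _ (by decide) e with h | h
    · have h0 : n k 0 = 0 := by linarith
      have hsq : (n k 2 - 1) * (n k 2 + 1) = 0 := by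
        rw [h0] at h5 h1 h3 h4 hu
        rw [sub_zero] at h5 h1 h3 h4
        rw [h5, h1, h3, h4] at hu; linarith
      rcases mul_eq_zero.mp hsq with h2 | h2
      · exfalso
        refine hn.ne_neg_pN k 2 (a := -1) (by norm_num) ?_
        rw [e, h0, show n k 2 = 1 by linarith]; simp
      · right
        rw [e, h0, show n k 2 = -1 by linarith]; simp
    · have hsq : (n k 0 - 1 / 2) * (n k 0 + 1 / 2) = 0 := by
        rw [show n k 1 = n k 0 by linarith, show n k 2 = n k 0 by linarith,
          show n k 3 = n k 0 by linarith, show n k 4 = n k 0 by linarith,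
          show n k 5 = n k 0 by linarith] at hu
        linarith
      rw [h, zero_smul, add_zero] at e
      rcases mul_eq_zero.mp hsq with h2 | h2
      · left
        rw [e, show n k 0 = 1 / 2 by linarith]; simp
      · exfalso
        exact hn.ne_neg_pN k 0 (a := 2 * n k 0) (by linarith) e
  have v0 : ∀ k, qf (pN 0) (hn.dual k) ≠ 0 → n k = pN 0 ∨ n k = pN 2 := by
    intro k hk
    have h := hn.pN_flag hf 0 k hk
    simp only [qf_pN_zero_wv _ (show (5 : Fin 6) ≠ 0 by decide),
      qf_pN_zero_wv _ (show (1 : Fin 6) ≠ 0 by decide),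
      qf_pN_zero_wv _ (show (3 : Fin 6) ≠ 0 by decide),
      qf_pN_zero_wv _ (show (4 : Fin 6) ≠ 0 by decide), forall_const] at h
    exact key k h.1 h.2.1 h.2.2.1 h.2.2.2
  have v2 : ∀ k, qf (pN 2) (hn.dual k) ≠ 0 → n k = pN 0 ∨ n k = pN 2 := by
    intro k hk
    have h := hn.pN_flag hf 2 k hk
    simp only [qf_pN_wv 2 5 (by decide), qf_pN_wv 2 1 (by decide),
      qf_pN_wv 2 3 (by decide), qf_pN_wv 2 4 (by decide),
      show ((2 : Fin 6) = 5) = False by decide, show ((2 : Fin 6) = 1) = False by decide,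
      show ((2 : Fin 6) = 3) = False by decide, show ((2 : Fin 6) = 4) = False by decide,
      if_false, forall_const] at h
    exact key k h.1 h.2.1 h.2.2.1 h.2.2.2
  have fin : ∀ i j : Fin 6, (∀ k, qf (pN i) (hn.dual k) ≠ 0 → n k = pN i ∨ n k = pN j) →
      (∀ a : ℝ, pN i ≠ a • pN j) → ∃ k, n k = pN i := by
    intro i j hv hne
    by_contra! hh
    obtain ⟨k, hk⟩ := hn.exists_ne i
    have hkj := (hv k hk).resolve_left (hh k)
    have : pN i = ∑ l ∈ {k}, (-qf (pN i) (hn.dual l)) • n l := by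
      refine hn.eq_sum_support _ _ fun l hl => ?_
      by_contra hl0
      have hlj := (hv l hl0).resolve_left (hh l)
      exact hl (by simpa using hn.injective (hlj.trans hkj.symm))
    rw [Finset.sum_singleton, hkj] at this
    exact hne _ this
  refine ⟨fin 0 2 v0 fun a h => ?_, fin 2 0 (fun k hk => (v2 k hk).symm) fun a h => ?_⟩
  · have := congrFun h 1; simp [pN] at this
  · have h1 := congrFun h 1
    have h2 := congrFun h 2
    simp [pN] at h1 h2
    rw [h1] at h2; norm_num at h2

end Tile

/-- The cosines of the labels `2`, `3`, `4`. -/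
def Lab (A : ℝ) : Prop := A = 0 ∨ A = 1 / 2 ∨ A = √2 / 2

lemma r_facts : ∃ r : ℝ, √2 / 2 = r ∧ r * r = 1 / 2 ∧ 0.7071 < r ∧ r < 0.7072 := by
  have h1 : (1.4142 : ℝ) < √2 := Real.lt_sqrt_of_sq_lt (by norm_num)
  have h2 : √2 < (1.4144 : ℝ) := (Real.sqrt_lt' (by norm_num)).mpr (by norm_num)
  have h3 : √2 * √2 = 2 := Real.mul_self_sqrt (by norm_num)
  exact ⟨√2 / 2, rfl, by nlinarith, by linarith, by linarith⟩

lemma second_wall_aux {α β γ A B : ℝ} (hα : 0 ≤ α)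
    (hA : Lab A) (hB : Lab B)
    (e1 : α - β / 2 - γ * A = -(1 / 2)) (e2 : -α / 2 + β - γ * B = 0)
    (e3 : -α / 2 + γ * (γ - α * A - β * B) = 1) :
    (A = 1 / 2 ∧ B = 0 ∧ α = 0 ∧ β = 0 ∧ γ = 1) ∨ (α = 0) ∨
      (A = √2 / 2 ∧ B = 0 ∧ α = 2 / 3 ∧ β = 1 / 3 ∧ γ = √2) := by
  obtain ⟨r, hr, hrr, hr1, hr2⟩ := r_facts
  have hr3 : √2 = 2 * r := by linarith
  have hβ : β = α / 2 + γ * B := by linarith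
  have hS : γ * (2 * A + B) = 1 + 3 / 2 * α := by linarith
  have hq : γ ^ 2 * (1 - B ^ 2) = 1 + α / 2 + α * (1 + 3 / 2 * α) / 2 := by
    rw [← hS]; rw [hβ] at e3; linarith
  have hQ : (1 + 3 / 2 * α) ^ 2 * (1 - B ^ 2) =
      (2 * A + B) ^ 2 * (1 + α / 2 + α * (1 + 3 / 2 * α) / 2) := by
    rw [← hq, ← hS]; ring
  simp only [Lab] at hA hB
  rw [hr] at hA hB ⊢
  clear e1 e2 e3 hq
  obtain ⟨X, hX⟩ : ∃ X, (1 + 3 / 2 * α) ^ 2 = X := ⟨_, rfl⟩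
  have hX1' : X - 1 = α * (3 + 9 / 4 * α) := by rw [← hX]; ring
  have hX1 : 0 ≤ X - 1 := by rw [hX1']; positivity
  replace hQ : X * (1 - B ^ 2) = (2 * A + B) ^ 2 * ((X + 2) / 3) := by
    rw [← hX]; linear_combination hQ
  have k1 := mul_nonneg hX1 (sub_nonneg.mpr hr1.le)
  have k2 := mul_nonneg hX1 (sub_nonneg.mpr hr2.le)
  have k3 : r ^ 2 * X = X / 2 := by linear_combination X * hrr
  have k4 : r ^ 2 = 1 / 2 := by linear_combination hrr
  by_cases ha : α = 0
  · subst ha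
    by_cases h : A = 1 / 2 ∧ B = 0
    · obtain ⟨rfl, rfl⟩ := h
      left
      refine ⟨rfl, rfl, rfl, by linarith, by linarith⟩
    · exact Or.inr (Or.inl rfl)
  · have hα' : 0 < α := lt_of_le_of_ne hα (Ne.symm ha)
    have hX2 : 1 < X := by
      have : 0 < X - 1 := by rw [hX1']; positivity
      linarith
    have k9 := mul_pos (sub_pos.mpr hX2) (sub_pos.mpr hr1)
    by_cases h : A = r ∧ B = 0
    · obtain ⟨rfl, rfl⟩ := h
      right; right
      have h1 : X = 4 := by ring_nf at hQ; linarith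
      have h2 : α = 2 / 3 := by
        have h3 : (3 / 2 * α - 1) * (3 / 2 * α + 3) = 0 := by linear_combination hX + h1
        rcases mul_eq_zero.mp h3 with h3 | h3 <;> linarith
      subst h2
      refine ⟨rfl, rfl, rfl, by linarith, ?_⟩
      rw [hr3]
      linear_combination A * hS - 2 * γ * hrr
    · exfalso
      clear hX hS hβ hX1'
      rcases hA with rfl | rfl | rfl <;> rcases hB with rfl | rfl | rfl <;>
        first
        | exact h ⟨rfl, rfl⟩
        | linarith only [hQ, k1, k2, k9, k3, k4, hr1, hr2]

lemma third_wall_aux {α β ζ δ A B E : ℝ} (hα : 0 ≤ α)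
    (hA : Lab A) (hB : Lab B) (hE : Lab E)
    (e1 : α - β / 2 - ζ / 2 - δ * A = -(1 / 2)) (e2 : -α / 2 + β - δ * B = 0)
    (e3 : -α / 2 + ζ - δ * E = 0)
    (e4 : -α / 2 + δ * (δ - α * A - β * B - ζ * E) = 1) :
    (α = 0 ∧ ζ = 0) ∨ (α = 0 ∧ β = 0) := by
  obtain ⟨r, hr, hrr, hr1, hr2⟩ := r_facts
  have hβ : β = α / 2 + δ * B := by linarith
  have hζ : ζ = α / 2 + δ * E := by linarith
  have hS : δ * (2 * A + B + E) = 1 + α := by linarith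
  have hq : δ ^ 2 * (1 - B ^ 2 - E ^ 2) = 1 + α / 2 + α * (1 + α) / 2 := by
    rw [← hS]; rw [hβ, hζ] at e4; linarith
  have hQ : (1 + α) ^ 2 * (1 - B ^ 2 - E ^ 2) =
      (2 * A + B + E) ^ 2 * (1 + α / 2 + α * (1 + α) / 2) := by
    rw [← hq, ← hS]; ring
  simp only [Lab, hr] at hA hB hE
  clear e1 e2 e3 e4 hq
  obtain ⟨X, hX⟩ : ∃ X, (1 + α) ^ 2 = X := ⟨_, rfl⟩
  have hX1' : X - 1 = α * (2 + α) := by rw [← hX]; ring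
  have hX1 : 0 ≤ X - 1 := by rw [hX1']; positivity
  replace hQ : X * (1 - B ^ 2 - E ^ 2) = (2 * A + B + E) ^ 2 * ((X + 1) / 2) := by
    rw [← hX]; linear_combination hQ
  have k1 := mul_nonneg hX1 (sub_nonneg.mpr hr1.le)
  have k2 := mul_nonneg hX1 (sub_nonneg.mpr hr2.le)
  have k3 : r ^ 2 * X = X / 2 := by linear_combination X * hrr
  have k4 : r ^ 2 = 1 / 2 := by linear_combination hrr
  by_cases ha : α = 0
  · subst ha
    by_cases hb : β = 0
    · exact Or.inr ⟨rfl, hb⟩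
    by_cases hz : ζ = 0
    · exact Or.inl ⟨rfl, hz⟩
    exfalso
    have hB0 : B ≠ 0 := by rintro rfl; exact hb (by linarith)
    have hE0 : E ≠ 0 := by rintro rfl; exact hz (by linarith)
    obtain rfl : X = 1 := by rw [← hX]; norm_num
    clear hX hS hβ hζ hX1'
    rcases hA with rfl | rfl | rfl <;> rcases hB with rfl | rfl | rfl <;>
      rcases hE with rfl | rfl | rfl <;>
      first
      | exact hB0 rfl
      | exact hE0 rfl
      | linarith only [hQ, k1, k2, k3, k4, hr1, hr2]
  · exfalso
    have hα' : 0 < α := lt_of_le_of_ne hα (Ne.symm ha)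
    have hX2 : 1 < X := by
      have : 0 < X - 1 := by rw [hX1']; positivity
      linarith
    have k9 := mul_pos (sub_pos.mpr hX2) (sub_pos.mpr hr1)
    clear hX hS hβ hζ hX1'
    rcases hA with rfl | rfl | rfl <;> rcases hB with rfl | rfl | rfl <;>
      rcases hE with rfl | rfl | rfl <;>
      linarith only [hQ, k1, k2, k9, k3, k4, hr1, hr2]

lemma third_wall_aux' {α β ζ δ A B E : ℝ} (hα : 0 ≤ α)
    (hA : Lab A) (hB : Lab B) (hE : Lab E)
    (e1 : α - β / 2 - √2 / 2 * ζ - δ * A = -(1 / 2)) (e2 : -α / 2 + β - δ * B = 0)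
    (e3 : -(√2 / 2 * α) + ζ - δ * E = √2 / 2 / 3)
    (e4 : -α / 2 + ζ * (√2 / 2 / 3) + δ * (δ - α * A - β * B - ζ * E) = 1) :
    α = 2 / 3 ∧ β = 1 / 3 ∧ ζ = √2 := by
  obtain ⟨r, hr, hrr, hr1, hr2⟩ := r_facts
  have hr3 : √2 = 2 * r := by linarith
  rw [hr] at e1 e3 e4
  have hβ : β = α / 2 + δ * B := by linarith
  have hζ : ζ = r / 3 + r * α + δ * E := by linarith
  have hS : 6 * δ * (2 * A + B + 2 * r * E) = 4 + 3 * α := by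
    rw [hβ, hζ] at e1; linear_combination (-12) * e1 + (-12 * α - 4) * hrr
  have hq : δ ^ 2 * (1 - B ^ 2 - E ^ 2) = 1 + α / 2 - 1 / 18 - α / 6 + α * (4 + 3 * α) / 12 := by
    rw [← hS]; rw [hβ, hζ] at e4
    linear_combination e4 - (1 / 9 + α / 3) * hrr
  have hQ : (4 + 3 * α) ^ 2 * (1 - B ^ 2 - E ^ 2) =
      (2 * A + B + 2 * r * E) ^ 2 * (18 + (4 + 3 * α) ^ 2) := by
    have : (2 * A + B + 2 * r * E) ^ 2 * (18 + (4 + 3 * α) ^ 2) =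
      (6 * (2 * A + B + 2 * r * E)) ^ 2 *
        (1 + α / 2 - 1 / 18 - α / 6 + α * (4 + 3 * α) / 12) := by ring
    rw [this, ← hq, ← hS]; ring
  simp only [Lab, hr] at hA hB hE
  clear e1 e2 e3 e4 hq
  obtain ⟨X, hX⟩ : ∃ X, (4 + 3 * α) ^ 2 = X := ⟨_, rfl⟩
  have hX16 : 0 ≤ X - 16 := by
    rw [← hX, show (4 + 3 * α) ^ 2 - 16 = α * (24 + 9 * α) by ring]; positivity
  rw [hX] at hQ
  have k1 := mul_nonneg hX16 (sub_nonneg.mpr hr1.le)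
  have k2 := mul_nonneg hX16 (sub_nonneg.mpr hr2.le)
  have k3 : r ^ 2 * X = X / 2 := by linear_combination X * hrr
  have k4 : r ^ 3 * X = r * X / 2 := by linear_combination r * X * hrr
  have k5 : r ^ 4 * X = X / 4 := by linear_combination (r ^ 2 * X + X / 2) * hrr
  have k6 : r ^ 2 = 1 / 2 := by linear_combination hrr
  have k7 : r ^ 3 = r / 2 := by linear_combination r * hrr
  have k8 : r ^ 4 = 1 / 4 := by linear_combination (r ^ 2 + 1 / 2) * hrr
  by_cases h : A = 0 ∧ B = 0 ∧ E = 1 / 2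
  · obtain ⟨rfl, rfl, rfl⟩ := h
    have h1 : X = 36 := by ring_nf at hQ; linarith
    have h2 : α = 2 / 3 := by
      have h3 : (3 * α - 2) * (3 * α + 10) = 0 := by linear_combination hX + h1
      rcases mul_eq_zero.mp h3 with h3 | h3 <;> linarith
    subst h2
    refine ⟨rfl, by linarith, ?_⟩
    rw [hr3]
    linear_combination hζ + r / 6 * hS - δ * hrr
  · exfalso
    clear hX hS hβ hζ
    rcases hA with rfl | rfl | rfl <;> rcases hB with rfl | rfl | rfl <;>
      rcases hE with rfl | rfl | rfl <;>
      first
      | exact h ⟨rfl, rfl, rfl⟩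
      | linarith only [hQ, k1, k2, k3, k4, k5, k6, k7, k8, hr1, hr2]

lemma qf_pN_pN (i j : Fin 6) (hi : i ≠ 0) : qf (pN i) (pN j) =
    if j = 0 then -(1 / 2) else if i = j then 1 else 0 := by
  rw [qf_pN hi, pN]
  split_ifs <;> simp_all

lemma pN_ne_span_two (a b : ℝ) : pN 4 ≠ a • pN 0 + b • pN 2 := by
  intro h
  have h1 := congrFun h 1
  have h2 := congrFun h 2
  have h4 := congrFun h 4
  simp [pN] at h1 h2 h4
  linarith

lemma pN_ne_span_three (a b d : ℝ) : pN 3 ≠ a • pN 0 + b • pN 2 + d • pN 4 := by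
  intro h
  have h1 := congrFun h 1
  have h3 := congrFun h 3
  simp [pN] at h1 h3
  linarith

namespace Tile
variable {n : Fin 6 → Fin 6 → ℝ}

lemma flag_reg (hf : Flag n) : Reg n (wv 5) := fun k => (hf k).1

lemma dual_coef_pos (hn : Tile n) {i k : Fin 6} (h : qf (pN i) (hn.dual k) ≠ 0) :
    0 < -qf (pN i) (hn.dual k) := by
  have := lt_of_le_of_ne (hn.pN_dual i k) h
  linarith

lemma sec_pos (hn : Tile n) {k i j : Fin 6} (hij : i ≠ j) {β γ : ℝ} (hγ : 0 < γ)
    (h : pN i = β • pN j + γ • n k) : β = 0 ∧ n k = pN i := by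
  have hk : n k = γ⁻¹ • pN i + (-(γ⁻¹ * β)) • pN j := by
    rw [h, smul_add, smul_smul, smul_smul, inv_mul_cancel₀ hγ.ne', one_smul]
    module
  have hβ : β = 0 := by
    rcases hn.sec k i j _ _ hij hk with h0 | h0
    · exact absurd h0 (inv_pos.mpr hγ).ne'
    · rcases mul_eq_zero.mp (neg_eq_zero.mp h0) with h1 | h1
      · exact absurd h1 (inv_pos.mpr hγ).ne'
      · exact h1
  refine ⟨hβ, ?_⟩
  subst hβ
  rw [zero_smul, zero_add] at h
  have hu := hn.unit k
  by_cases hi : i = 0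
  · subst hi
    have h1 : qf (pN 0) (pN 0) = 1 := by rw [qf_pN_zero]; simp [pN]; norm_num
    rw [h, qf_smul_left, qf_smul_right, hu] at h1
    rw [h, show γ = 1 by nlinarith, one_smul]
  · have h1 := qf_pN_pN i i hi
    rw [if_neg hi, if_pos rfl, h, qf_smul_left, qf_smul_right, hu] at h1
    rw [h, show γ = 1 by nlinarith, one_smul]

lemma link_lab (hn : Tile n) (hw : Reg n (wv 5)) {k l : Fin 6} (hk : qf (n k) (wv 5) = 0)
    (hl : qf (n l) (wv 5) = 0) (hkl : k ≠ l) : Lab (-qf (n k) (n l)) := by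
  obtain ⟨k₀, h1, h2, h3⟩ := hn.exists_touch hw
  refine hn.link_cases h2 h3 ?_ ?_ hkl
  · rintro rfl; exact h1.ne hk
  · rintro rfl; exact h1.ne hl

/-- The third wall of the flag tile. -/
lemma flag_three (hn : Tile n) (hf : Flag n) {kc k₂ : Fin 6} (hc : n kc = pN 0)
    (h2 : n k₂ = pN 2) : ∃ k, k ≠ kc ∧ k ≠ k₂ ∧ (∀ l, l ≠ kc → l ≠ k₂ → l ≠ k →
      qf (pN 4) (hn.dual l) = 0) ∧ qf (n k) (wv 5) = 0 ∧ (n k = pN 4 ∨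
      (qf (n k) (pN 0) = -(√2 / 2) ∧ qf (n k) (pN 2) = 0 ∧
        pN 4 = (2 / 3 : ℝ) • pN 0 + (1 / 3 : ℝ) • pN 2 + √2 • n k)) := by
  have hc2 : kc ≠ k₂ := by
    rintro rfl
    have := congrFun (hc.symm.trans h2) 0
    simp [pN] at this
  obtain ⟨k, hkc, hk2, hk⟩ : ∃ k, k ≠ kc ∧ k ≠ k₂ ∧ qf (pN 4) (hn.dual k) ≠ 0 := by
    by_contra! hh
    have := hn.eq_sum_support (pN 4) {kc, k₂} fun k hk => by
      simp only [Finset.mem_insert, Finset.mem_singleton, not_or] at hk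
      exact hh k hk.1 hk.2
    rw [Finset.sum_pair hc2, hc, h2] at this
    exact pN_ne_span_two _ _ this
  have hv := hn.pN_flag hf 4 k hk
  rw [qf_pN_wv 4 5 (by decide), qf_pN_wv 4 1 (by decide),
    qf_pN_wv 4 3 (by decide)] at hv
  obtain ⟨v5, hv⟩ := hv (by simp)
  obtain ⟨v1, hv⟩ := hv (by simp)
  obtain ⟨v3, -⟩ := hv (by simp)
  have hw5 := v5
  rw [qf_wv (by decide)] at v5 v1 v3
  have hspan : n k = (2 * n k 0) • n kc + (n k 0 - n k 2) • n k₂ + (n k 0 - n k 4) • pN 4 := by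
    rw [hc, h2]
    funext j
    fin_cases j <;> simp [pN] <;> linarith
  have hpair : ∀ l, l ≠ kc → l ≠ k₂ →
      qf (n k) (hn.dual l) = (n k 0 - n k 4) * qf (pN 4) (hn.dual l) := by
    intro l hl1 hl2
    conv_lhs => rw [hspan]
    rw [qf_add_left, qf_add_left, qf_smul_left, qf_smul_left, qf_smul_left,
      hn.qf_dual_ne hl1.symm, hn.qf_dual_ne hl2.symm]
    ring
  have hnz : n k 0 - n k 4 ≠ 0 := by
    intro h0
    have := hpair k hkc hk2
    rw [hn.qf_dual_self, h0] at this
    norm_num at this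
  have hsupp : ∀ l, l ≠ kc → l ≠ k₂ → l ≠ k → qf (pN 4) (hn.dual l) = 0 := by
    intro l hl1 hl2 hl3
    have := hpair l hl1 hl2
    rw [hn.qf_dual_ne hl3.symm] at this
    rcases mul_eq_zero.mp this.symm with h | h
    · exact absurd h hnz
    · exact h
  refine ⟨k, hkc, hk2, hsupp, hw5, ?_⟩
  have hsum := hn.eq_sum_support (pN 4) {kc, k₂, k} fun l hl => by
    simp only [Finset.mem_insert, Finset.mem_singleton, not_or] at hl
    exact hsupp l hl.1 hl.2.1 hl.2.2
  rw [Finset.sum_insert (by simp [hc2, hkc.symm]), Finset.sum_pair hk2.symm, hc, h2] at hsum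
  obtain ⟨α, hα⟩ : ∃ α, α = -qf (pN 4) (hn.dual kc) := ⟨_, rfl⟩
  obtain ⟨β, hβ⟩ : ∃ β, β = -qf (pN 4) (hn.dual k₂) := ⟨_, rfl⟩
  obtain ⟨γ, hγ⟩ : ∃ γ, γ = -qf (pN 4) (hn.dual k) := ⟨_, rfl⟩
  have hα0 : 0 ≤ α := by rw [hα]; linarith [hn.pN_dual 4 kc]
  have hγ0 : 0 < γ := by rw [hγ]; exact hn.dual_coef_pos hk
  rw [← hα, ← hβ, ← hγ] at hsum
  have hA := hn.link_lab (flag_reg hf) hw5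
    (show qf (n kc) (wv 5) = 0 by rw [hc, qf_pN_zero_wv _ (by decide)]) hkc
  have hB := hn.link_lab (flag_reg hf) hw5
    (show qf (n k₂) (wv 5) = 0 by
      rw [h2, qf_pN_wv _ _ (by decide), if_neg (by decide)]) hk2
  rw [hc] at hA
  rw [h2] at hB
  have hu := hn.unit k
  have q00 : qf (pN 0) (pN 0) = 1 := by rw [qf_pN_zero]; simp [pN]; norm_num
  have q20 : qf (pN 2) (pN 0) = -(1 / 2) := by rw [qf_pN_pN _ _ (by decide)]; simp
  have q40 : qf (pN 4) (pN 0) = -(1 / 2) := by rw [qf_pN_pN _ _ (by decide)]; simp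
  have q22 : qf (pN 2) (pN 2) = 1 := by rw [qf_pN_pN _ _ (by decide)]; simp
  have q44 : qf (pN 4) (pN 4) = 1 := by rw [qf_pN_pN _ _ (by decide)]; simp
  have q42 : qf (pN 4) (pN 2) = 0 := by rw [qf_pN_pN _ _ (by decide)]; simp
  have p1 := congrArg (fun x => qf x (pN 0)) hsum
  have p2 := congrArg (fun x => qf x (pN 2)) hsum
  have p3 := congrArg (fun x => qf x (n k)) hsum
  have p4 := congrArg (fun x => qf (pN 4) x) hsum
  simp only [qf_add_left, qf_smul_left, qf_add_right, qf_smul_right, q00, q20, q40, q22, q44, q42,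
    hu, qf_comm (pN 0) (pN 2)] at p1 p2 p3 p4
  rw [qf_comm (pN 0) (n k), qf_comm (pN 2) (n k)] at p3
  rcases second_wall_aux (β := β) (γ := γ) hα0 hA hB (by linarith) (by linarith)
    (by rw [p3] at p4; linarith) with ⟨-, -, h, h', h''⟩ | h | ⟨h1, h2', h3, h4, h5⟩
  · left
    rw [hsum, h, h', h'']; simp
  · left
    rw [h, zero_smul, zero_add] at hsum
    exact (hn.sec_pos (by decide) hγ0 hsum).2
  · right
    refine ⟨by linarith, by linarith, ?_⟩
    rw [h3, h4, h5, ← add_assoc] at hsum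
    exact hsum

/-- The flag tile contains the walls `pN 0`, `pN 2`, `pN 3`, `pN 4`. -/
lemma flag_four (hn : Tile n) (hf : Flag n) :
    ∃ kc k₂ k₃ k₄, n kc = pN 0 ∧ n k₂ = pN 2 ∧ n k₃ = pN 3 ∧ n k₄ = pN 4 := by
  obtain ⟨⟨kc, hc⟩, ⟨k₂, h2⟩⟩ := hn.flag_two hf
  obtain ⟨g, hgc, hg2, hsupp4, hg5, hg⟩ := hn.flag_three hf hc h2
  have hc2 : kc ≠ k₂ := by
    rintro rfl
    have := congrFun (hc.symm.trans h2) 0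
    simp [pN] at this
  have q00 : qf (pN 0) (pN 0) = 1 := by rw [qf_pN_zero]; simp [pN]; norm_num
  have q20 : qf (pN 2) (pN 0) = -(1 / 2) := by rw [qf_pN_pN _ _ (by decide)]; simp
  have q40 : qf (pN 4) (pN 0) = -(1 / 2) := by rw [qf_pN_pN _ _ (by decide)]; simp
  have q30 : qf (pN 3) (pN 0) = -(1 / 2) := by rw [qf_pN_pN _ _ (by decide)]; simp
  have q22 : qf (pN 2) (pN 2) = 1 := by rw [qf_pN_pN _ _ (by decide)]; simp
  have q44 : qf (pN 4) (pN 4) = 1 := by rw [qf_pN_pN _ _ (by decide)]; simp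
  have q33 : qf (pN 3) (pN 3) = 1 := by rw [qf_pN_pN _ _ (by decide)]; simp
  have q32 : qf (pN 3) (pN 2) = 0 := by rw [qf_pN_pN _ _ (by decide)]; simp
  have q34 : qf (pN 3) (pN 4) = 0 := by rw [qf_pN_pN _ _ (by decide)]; simp
  have q42 : qf (pN 4) (pN 2) = 0 := by rw [qf_pN_pN _ _ (by decide)]; simp
  have hsum4 := hn.eq_sum_support (pN 4) {kc, k₂, g} fun l hl => by
    simp only [Finset.mem_insert, Finset.mem_singleton, not_or] at hl
    exact hsupp4 l hl.1 hl.2.1 hl.2.2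
  have hg' : ∃ x y z : ℝ, n g = x • pN 0 + y • pN 2 + z • pN 4 := by
    rcases hg with hg | ⟨-, -, hg⟩
    · exact ⟨0, 0, 1, by rw [hg]; simp⟩
    · refine ⟨-(2 / 3) * (√2)⁻¹, -(1 / 3) * (√2)⁻¹, (√2)⁻¹, ?_⟩
      have hs : √2 ≠ 0 := by positivity
      have : n g = (√2)⁻¹ • (√2 • n g) := by rw [smul_smul, inv_mul_cancel₀ hs, one_smul]
      rw [this, show √2 • n g = pN 4 - (2 / 3 : ℝ) • pN 0 - (1 / 3 : ℝ) • pN 2 by rw [hg]; abel]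
      module
  obtain ⟨k, hkc, hk2, hkg, hk⟩ : ∃ k, k ≠ kc ∧ k ≠ k₂ ∧ k ≠ g ∧ qf (pN 3) (hn.dual k) ≠ 0 := by
    by_contra! hh
    have := hn.eq_sum_support (pN 3) {kc, k₂, g} fun k hk => by
      simp only [Finset.mem_insert, Finset.mem_singleton, not_or] at hk
      exact hh k hk.1 hk.2.1 hk.2.2
    obtain ⟨x, y, z, hg'⟩ := hg'
    rw [Finset.sum_insert (by simp [hc2, hgc.symm]), Finset.sum_pair hg2.symm, hc, h2, hg'] at this
    obtain ⟨a, ha⟩ : ∃ a, a = -qf (pN 3) (hn.dual kc) := ⟨_, rfl⟩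
    obtain ⟨b, hb⟩ : ∃ b, b = -qf (pN 3) (hn.dual k₂) := ⟨_, rfl⟩
    obtain ⟨d, hd⟩ : ∃ d, d = -qf (pN 3) (hn.dual g) := ⟨_, rfl⟩
    rw [← ha, ← hb, ← hd] at this
    refine pN_ne_span_three (a + d * x) (b + d * y) (d * z) ?_
    rw [this]; module
  have hv := hn.pN_flag hf 3 k hk
  rw [qf_pN_wv 3 5 (by decide), qf_pN_wv 3 1 (by decide)] at hv
  obtain ⟨v5, hv⟩ := hv (by simp)
  obtain ⟨v1, -⟩ := hv (by simp)
  have hw5 := v5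
  rw [qf_wv (by decide)] at v5 v1
  have hspan : n k = (2 * n k 0) • n kc + (n k 0 - n k 2) • n k₂ + (n k 0 - n k 3) • pN 3 +
      (n k 0 - n k 4) • pN 4 := by
    rw [hc, h2]
    funext j
    fin_cases j <;> simp [pN] <;> linarith
  have hpair : ∀ l, l ≠ kc → l ≠ k₂ → l ≠ g →
      qf (n k) (hn.dual l) = (n k 0 - n k 3) * qf (pN 3) (hn.dual l) := by
    intro l hl1 hl2 hl3
    conv_lhs => rw [hspan]
    rw [qf_add_left, qf_add_left, qf_add_left, qf_smul_left, qf_smul_left, qf_smul_left,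
      qf_smul_left, hn.qf_dual_ne hl1.symm, hn.qf_dual_ne hl2.symm, hsupp4 l hl1 hl2 hl3]
    ring
  have hnz : n k 0 - n k 3 ≠ 0 := by
    intro h0
    have := hpair k hkc hk2 hkg
    rw [hn.qf_dual_self, h0] at this
    norm_num at this
  have hsum := hn.eq_sum_support (pN 3) {kc, k₂, g, k} fun l hl => by
    simp only [Finset.mem_insert, Finset.mem_singleton, not_or] at hl
    have := hpair l hl.1 hl.2.1 hl.2.2.1
    rw [hn.qf_dual_ne (Ne.symm hl.2.2.2)] at this
    rcases mul_eq_zero.mp this.symm with h | h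
    · exact absurd h hnz
    · exact h
  rw [Finset.sum_insert (by simp [hc2, hkc.symm, hgc.symm]),
    Finset.sum_insert (by simp [hk2.symm, hg2.symm]), Finset.sum_pair hkg.symm, hc, h2] at hsum
  obtain ⟨α, hα⟩ : ∃ α, α = -qf (pN 3) (hn.dual kc) := ⟨_, rfl⟩
  obtain ⟨β, hβ⟩ : ∃ β, β = -qf (pN 3) (hn.dual k₂) := ⟨_, rfl⟩
  obtain ⟨ζ, hζ⟩ : ∃ ζ, ζ = -qf (pN 3) (hn.dual g) := ⟨_, rfl⟩
  obtain ⟨δ, hδ⟩ : ∃ δ, δ = -qf (pN 3) (hn.dual k) := ⟨_, rfl⟩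
  have hα0 : 0 ≤ α := by rw [hα]; linarith [hn.pN_dual 3 kc]
  have hδ0 : 0 < δ := by rw [hδ]; exact hn.dual_coef_pos hk
  rw [← hα, ← hβ, ← hδ, ← hζ] at hsum
  have hA := hn.link_lab (flag_reg hf) hw5
    (show qf (n kc) (wv 5) = 0 by rw [hc, qf_pN_zero_wv _ (by decide)]) hkc
  have hB := hn.link_lab (flag_reg hf) hw5
    (show qf (n k₂) (wv 5) = 0 by
      rw [h2, qf_pN_wv _ _ (by decide), if_neg (by decide)]) hk2
  have hE := hn.link_lab (flag_reg hf) hw5 hg5 hkg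
  rw [hc] at hA
  rw [h2] at hB
  have hu := hn.unit k
  have hug := hn.unit g
  have p1 := congrArg (fun x => qf x (pN 0)) hsum
  have p2 := congrArg (fun x => qf x (pN 2)) hsum
  have p3 := congrArg (fun x => qf x (n g)) hsum
  have p4 := congrArg (fun x => qf x (n k)) hsum
  have p5 := congrArg (fun x => qf (pN 3) x) hsum
  simp only [qf_add_left, qf_smul_left, qf_add_right, qf_smul_right, q00, q20, q30, q22, q33, q32,
    hu, hug, qf_comm (pN 0) (pN 2)] at p1 p2 p3 p4 p5
  rw [qf_comm (pN 0) (n k), qf_comm (pN 2) (n k), qf_comm (n g) (n k)] at p4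
  rw [qf_comm (pN 0) (n g), qf_comm (pN 2) (n g)] at p3
  rcases hg with hg | ⟨hg1, hg2', hg3⟩
  · refine ⟨kc, k₂, k, g, hc, h2, ?_, hg⟩
    have x1 : qf (n g) (pN 0) = -(1 / 2) := by rw [hg, q40]
    have x2 : qf (n g) (pN 2) = 0 := by rw [hg, q42]
    have x3 : qf (pN 3) (n g) = 0 := by rw [hg, q34]
    rw [x1, x2, x3] at p3
    rw [x1] at p1
    rw [x2] at p2
    rw [x3] at p5
    rcases third_wall_aux (β := β) (ζ := ζ) (δ := δ) hα0 hA hB hE (by linarith) (by linarith)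
      (by linarith) (by rw [p4] at p5; linarith) with ⟨h, h'⟩ | ⟨h, h'⟩
    · rw [h, h', zero_smul, zero_smul, zero_add, zero_add] at hsum
      exact (hn.sec_pos (by decide) hδ0 hsum).2
    · rw [h, h', zero_smul, zero_smul, zero_add, zero_add, hg] at hsum
      exact (hn.sec_pos (by decide) hδ0 hsum).2
  · exfalso
    have x3 : qf (pN 3) (n g) = √2 / 2 / 3 := by
      have := congrArg (fun x => qf (pN 3) x) hg3
      simp only [qf_add_right, qf_smul_right, q34, q30, q32] at this
      have h2 : √2 * √2 = 2 := Real.mul_self_sqrt (by norm_num)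
      have h3 : √2 ≠ 0 := by positivity
      have : √2 * (qf (pN 3) (n g) - √2 / 2 / 3) = 0 := by linarith
      rcases mul_eq_zero.mp this with h | h
      · exact absurd h h3
      · linarith
    rw [hg1, hg2', x3] at p3
    rw [hg1] at p1
    rw [hg2'] at p2
    rw [x3] at p5
    obtain ⟨h, h', h''⟩ := third_wall_aux' (β := β) (ζ := ζ) (δ := δ) hα0 hA hB hE (by linarith)
      (by linarith) (by linarith) (by rw [p4] at p5; linarith)
    rw [h, h', h''] at hsum
    have : pN 3 = (1 : ℝ) • pN 4 + δ • n k := by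
      rw [one_smul, hg3]; nth_rw 1 [hsum]; abel
    have := (hn.sec_pos (by decide) hδ0 this).1
    norm_num at this

end Tile

lemma reg_reindex {n : Fin 6 → Fin 6 → ℝ} (ρ : Equiv.Perm (Fin 6)) (y : Fin 6 → ℝ) :
    Reg (n ∘ ρ) y ↔ Reg n y :=
  ⟨fun h k => by simpa using h (ρ.symm k), fun h k => h (ρ k)⟩

lemma sreg_reindex {n : Fin 6 → Fin 6 → ℝ} (ρ : Equiv.Perm (Fin 6)) (y : Fin 6 → ℝ) :
    SReg (n ∘ ρ) y ↔ SReg n y :=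
  ⟨fun h k => by simpa using h (ρ.symm k), fun h k => h (ρ k)⟩

lemma pN_injective : Function.Injective pN := by
  intro i j h
  by_contra hne
  have h0 := congrFun h 0
  have hi' := congrFun h i
  by_cases hi : i = 0
  · have hj : j ≠ 0 := fun hj => hne (hi.trans hj.symm)
    simp [pN, hi, hj, hj.symm] at h0
  · by_cases hj : j = 0
    · simp [pN, hi, hj, Ne.symm hi] at h0
    · simp [pN, hi, hj, hne] at hi'

/-- A tile at the corner of the edge from `wv 5` to `wv 1`, with its walls labelled. -/
structure Corner (m : Fin 6 → Fin 6 → ℝ) : Prop where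
  tile : Tile m
  wall0 : m 0 = pN 0
  wall2 : m 2 = pN 2
  wall3 : m 3 = pN 3
  wall4 : m 4 = pN 4
  one5 : qf (m 1) (wv 5) = 0
  one1 : qf (m 1) (wv 1) < 0
  five5 : qf (m 5) (wv 5) < 0

namespace Tile
variable {n : Fin 6 → Fin 6 → ℝ}

lemma reindex (hn : Tile n) (ρ : Equiv.Perm (Fin 6)) : Tile (n ∘ ρ) where
  unit _ := hn.unit _
  cox _ _ h := hn.cox _ _ (ρ.injective.ne h)
  sub y h := hn.sub y ((reg_reindex ρ y).mp h)
  sec k i j α β h h' := hn.sec (ρ k) i j α β h h'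

lemma exists_corner (hn : Tile n) (hf : Flag n) : ∃ ρ : Equiv.Perm (Fin 6), Corner (n ∘ ρ) := by
  obtain ⟨kc, k₂, k₃, k₄, hc, h2, h3, h4⟩ := hn.flag_four hf
  obtain ⟨k₀, h01, h02, h03⟩ := hn.exists_touch (flag_reg hf)
  obtain ⟨ka, hka⟩ : ∃ ka, ka ∉ ({kc, k₂, k₃, k₄, k₀} : Finset (Fin 6)) := by
    by_contra! hh
    have h6 : (Finset.univ : Finset (Fin 6)) ⊆ {kc, k₂, k₃, k₄, k₀} := fun k _ => hh k
    have := (Finset.card_le_card h6).trans Finset.card_le_five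
    simp at this
  simp only [Finset.mem_insert, Finset.mem_singleton, not_or] at hka
  obtain ⟨a1, a2, a3, a4, a5⟩ := hka
  have ne : ∀ {k l i j}, n k = pN i → n l = pN j → i ≠ j → k ≠ l := by
    intro k l i j hk hl hij hkl
    exact hij (pN_injective (by rw [← hk, ← hl, hkl]))
  have z0 : qf (pN 0) (wv 5) = 0 := qf_pN_zero_wv _ (by decide)
  have zj : ∀ j : Fin 6, j ≠ 0 → j ≠ 5 → qf (pN j) (wv 5) = 0 := fun j h h' => by
    rw [qf_pN_wv _ _ h, if_neg h']
  have n0 : ∀ {k i}, n k = pN i → qf (pN i) (wv 5) = 0 → k ≠ k₀ := by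
    rintro k i hk hi rfl
    rw [hk, hi] at h01
    exact lt_irrefl _ h01
  have b0 := n0 hc z0
  have b2 := n0 h2 (zj 2 (by decide) (by decide))
  have b3 := n0 h3 (zj 3 (by decide) (by decide))
  have b4 := n0 h4 (zj 4 (by decide) (by decide))
  have d1 := ne hc h2 (by decide)
  have d2 := ne hc h3 (by decide)
  have d3 := ne hc h4 (by decide)
  have d4 := ne h2 h3 (by decide)
  have d5 := ne h2 h4 (by decide)
  have d6 := ne h3 h4 (by decide)
  have hinj : Function.Injective ![kc, ka, k₂, k₃, k₄, k₀] := by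
    intro i j
    fin_cases i <;> fin_cases j <;> simp [*, Ne.symm, eq_comm] <;> simp [*, Ne.symm]
  refine ⟨Equiv.ofBijective _ (Finite.injective_iff_bijective.mp hinj), ?_⟩
  refine ⟨hn.reindex _, hc, h2, h3, h4, h02 ka a5, ?_, h01⟩
  change qf (n ka) (wv 1) < 0
  have h5a := h02 ka a5
  refine lt_of_le_of_ne (((hf ka).2 h5a).1) fun h0 => ?_
  have hz : ∀ k, k ≠ k₀ → qf (n k) (wv 1) = 0 := by
    intro k hk
    have hmem : k ∈ Finset.univ.image ![kc, ka, k₂, k₃, k₄, k₀] := by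
      rw [Finset.image_univ_of_surjective (Finite.injective_iff_surjective.mp hinj)]
      simp
    obtain ⟨i, -, hi⟩ := Finset.mem_image.mp hmem
    have zj' : ∀ j : Fin 6, j ≠ 0 → j ≠ 1 → qf (pN j) (wv 1) = 0 := fun j h h' => by
      rw [qf_pN_wv _ _ h, if_neg h']
    fin_cases i
    · rw [← hi]; change qf (n kc) _ = 0; rw [hc]; exact qf_pN_zero_wv _ (by decide)
    · rw [← hi]; exact h0
    · rw [← hi]; change qf (n k₂) _ = 0; rw [h2]; exact zj' 2 (by decide) (by decide)
    · rw [← hi]; change qf (n k₃) _ = 0; rw [h3]; exact zj' 3 (by decide) (by decide)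
    · rw [← hi]; change qf (n k₄) _ = 0; rw [h4]; exact zj' 4 (by decide) (by decide)
    · exact absurd hi.symm hk
  have e : wv 1 = (qf (n k₀) (wv 1) / qf (n k₀) (wv 5)) • wv 5 := by
    rw [← sub_eq_zero]
    refine hn.eq_zero fun k => ?_
    rw [sub_eq_add_neg, qf_add_right, ← neg_one_smul ℝ (_ • wv 5), qf_smul_right, qf_smul_right]
    by_cases hk : k = k₀
    · subst hk
      have := h01.ne
      field_simp
      ring
    · rw [hz k hk, h02 k hk]; ring
  have e1 := congrFun e 1
  simp [wv] at e1

end Tile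

lemma Lab.nonneg {A : ℝ} (h : Lab A) : 0 ≤ A := by
  rcases h with rfl | rfl | rfl <;> positivity

lemma Lab.cases {A : ℝ} (h : Lab A) : A = 0 ∨ 1 / 2 ≤ A := by
  obtain ⟨r, hr, hrr, hr1, hr2⟩ := r_facts
  rcases h with rfl | rfl | rfl
  · exact Or.inl rfl
  · exact Or.inr le_rfl
  · right; rw [hr]; linarith

lemma sq_sum_aux {A A2 A3 A4 : ℝ} (hA : Lab A) (h2 : Lab A2) (h3 : Lab A3) (h4 : Lab A4)
    (h : (2 * A + A2 + A3 + A4) ^ 2 + A2 ^ 2 + A3 ^ 2 + A4 ^ 2 = 1) :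
    (A = 1 / 2 ∧ A2 = 0 ∧ A3 = 0 ∧ A4 = 0) ∨ (A = 0 ∧ A2 = √2 / 2 ∧ A3 = 0 ∧ A4 = 0) ∨
      (A = 0 ∧ A2 = 0 ∧ A3 = √2 / 2 ∧ A4 = 0) ∨ (A = 0 ∧ A2 = 0 ∧ A3 = 0 ∧ A4 = √2 / 2) := by
  have n2 := h2.nonneg
  have n3 := h3.nonneg
  have n4 := h4.nonneg
  have hS : 2 * A + A2 + A3 + A4 ≤ 1 := by nlinarith [hA.nonneg]
  have half : ∀ x : ℝ, 0 ≤ x → 2 * x ^ 2 = 1 → x = √2 / 2 := by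
    intro x hx hx2
    obtain ⟨r, hr, hrr, hr1, hr2⟩ := r_facts
    rw [hr]
    have : (x - r) * (x + r) = 0 := by linarith
    rcases mul_eq_zero.mp this with h | h <;> linarith
  rcases hA.cases with rfl | a
  · right
    rcases h2.cases with rfl | b2
    · right
      rcases h3.cases with rfl | b3
      · right
        exact ⟨rfl, rfl, rfl, half _ n4 (by linarith)⟩
      · left
        rcases h4.cases with rfl | b4
        · exact ⟨rfl, rfl, half _ n3 (by linarith), rfl⟩
        · nlinarith
    · left
      rcases h3.cases with rfl | b3
      · rcases h4.cases with rfl | b4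
        · exact ⟨rfl, half _ n2 (by linarith), rfl, rfl⟩
        · nlinarith
      · nlinarith
  · left
    exact ⟨by linarith, by linarith, by linarith, by linarith⟩

namespace Corner
variable {m : Fin 6 → Fin 6 → ℝ}

lemma reg5 (hm : Corner m) : Reg m (wv 5) := by
  have zj : ∀ j : Fin 6, j ≠ 0 → j ≠ 5 → qf (pN j) (wv 5) = 0 := fun j h h' => by
    rw [qf_pN_wv _ _ h, if_neg h']
  intro k
  fin_cases k
  · exact (congrArg (qf · (wv 5)) hm.wall0).le.trans (qf_pN_zero_wv _ (by decide)).le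
  · exact hm.one5.le
  · exact (congrArg (qf · (wv 5)) hm.wall2).le.trans (zj 2 (by decide) (by decide)).le
  · exact (congrArg (qf · (wv 5)) hm.wall3).le.trans (zj 3 (by decide) (by decide)).le
  · exact (congrArg (qf · (wv 5)) hm.wall4).le.trans (zj 4 (by decide) (by decide)).le
  · exact hm.five5.le

lemma reg_iff (hm : Corner m) (y : Fin 6 → ℝ) : Reg m y ↔ (0 ≤ y 2 ∧ 0 ≤ y 3 ∧ 0 ≤ y 4 ∧
    y 1 + y 2 + y 3 + y 4 + y 5 ≤ y 0 ∧ qf (m 1) y ≤ 0 ∧ qf (m 5) y ≤ 0) := by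
  have e0 : qf (m 0) y = _ := (congrArg (qf · y) hm.wall0).trans (qf_pN_zero y)
  have e2 : qf (m 2) y = _ := (congrArg (qf · y) hm.wall2).trans (qf_pN (by decide) y)
  have e3 : qf (m 3) y = _ := (congrArg (qf · y) hm.wall3).trans (qf_pN (by decide) y)
  have e4 : qf (m 4) y = _ := (congrArg (qf · y) hm.wall4).trans (qf_pN (by decide) y)
  constructor
  · intro h
    have h0 := h 0
    have h2 := h 2
    have h3 := h 3
    have h4 := h 4
    refine ⟨?_, ?_, ?_, ?_, h 1, h 5⟩ <;> linarith
  · rintro ⟨h2, h3, h4, h0, h1, h5⟩ k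
    fin_cases k
    · exact e0.trans_le (by linarith)
    · exact h1
    · exact e2.trans_le (by linarith)
    · exact e3.trans_le (by linarith)
    · exact e4.trans_le (by linarith)
    · exact h5

lemma sreg_iff (hm : Corner m) (y : Fin 6 → ℝ) : SReg m y ↔ (0 < y 2 ∧ 0 < y 3 ∧ 0 < y 4 ∧
    y 1 + y 2 + y 3 + y 4 + y 5 < y 0 ∧ qf (m 1) y < 0 ∧ qf (m 5) y < 0) := by
  have e0 : qf (m 0) y = _ := (congrArg (qf · y) hm.wall0).trans (qf_pN_zero y)
  have e2 : qf (m 2) y = _ := (congrArg (qf · y) hm.wall2).trans (qf_pN (by decide) y)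
  have e3 : qf (m 3) y = _ := (congrArg (qf · y) hm.wall3).trans (qf_pN (by decide) y)
  have e4 : qf (m 4) y = _ := (congrArg (qf · y) hm.wall4).trans (qf_pN (by decide) y)
  constructor
  · intro h
    have h0 := h 0
    have h2 := h 2
    have h3 := h 3
    have h4 := h 4
    refine ⟨?_, ?_, ?_, ?_, h 1, h 5⟩ <;> linarith
  · rintro ⟨h2, h3, h4, h0, h1, h5⟩ k
    fin_cases k
    · exact e0.trans_lt (by linarith)
    · exact h1
    · exact e2.trans_lt (by linarith)
    · exact e3.trans_lt (by linarith)
    · exact e4.trans_lt (by linarith)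
    · exact h5

lemma first_nonpos (hm : Corner m) : m 1 0 ≤ 0 := by
  have h := hm.tile.eq_sum_normal (pN 1)
  obtain ⟨κ, hκ⟩ : ∃ κ : Fin 6 → ℝ, κ = fun k => -qf (pN 1) (hm.tile.dual k) := ⟨_, rfl⟩
  have hκ0 : ∀ k, 0 ≤ κ k := fun k => by rw [hκ]; linarith [hm.tile.pN_dual 1 k]
  have h' : pN 1 = ∑ k, κ k • m k := by rw [hκ]; exact h
  rw [Fin.sum_univ_six, hm.wall0, hm.wall2, hm.wall3, hm.wall4] at h'
  have h5 := congrArg (qf · (wv 5)) h'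
  have zj : ∀ j : Fin 6, j ≠ 0 → j ≠ 5 → qf (pN j) (wv 5) = 0 := fun j h h' => by
    rw [qf_pN_wv _ _ h, if_neg h']
  simp only [qf_add_left, qf_smul_left, qf_pN_zero_wv 5 (by decide), hm.one5,
    zj 1 (by decide) (by decide), zj 2 (by decide) (by decide), zj 3 (by decide) (by decide),
    zj 4 (by decide) (by decide)] at h5
  have k5 : κ 5 = 0 := by
    have : κ 5 * qf (m 5) (wv 5) = 0 := by linarith
    exact (mul_eq_zero.mp this).resolve_right hm.five5.ne
  rw [k5] at h'
  have c0 := congrFun h' 0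
  have c1 := congrFun h' 1
  simp [pN] at c0 c1
  have hpos : 0 < κ 1 := by
    refine lt_of_le_of_ne (hκ0 1) fun h => ?_
    rw [← h] at c0 c1
    linarith
  nlinarith [hκ0 0]

lemma five_coef (hm : Corner m) {q : ℝ} (hq : q = m 5 0 - m 5 5) :
    ∃ κ0 κ1 : ℝ, 0 ≤ κ0 ∧ 0 ≤ κ1 ∧ 0 = κ0 / 2 + κ1 * m 1 0 + m 5 0 / q ∧
      0 = κ0 / 2 + κ1 * m 1 1 + m 5 1 / q := by
  have h := hm.tile.eq_sum_normal (pN 5)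
  obtain ⟨κ, hκ⟩ : ∃ κ : Fin 6 → ℝ, κ = fun k => -qf (pN 5) (hm.tile.dual k) := ⟨_, rfl⟩
  have hκ0 : ∀ k, 0 ≤ κ k := fun k => by rw [hκ]; linarith [hm.tile.pN_dual 5 k]
  have h' : pN 5 = ∑ k, κ k • m k := by rw [hκ]; exact h
  rw [Fin.sum_univ_six, hm.wall0, hm.wall2, hm.wall3, hm.wall4] at h'
  have c0 := congrFun h' 0
  have c1 := congrFun h' 1
  have c5 := congrFun h' 5
  have h1 := hm.one5
  have h5 := hm.five5
  rw [qf_wv (by decide)] at h1 h5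
  simp [pN] at c0 c1 c5
  have hq0 : q ≠ 0 := by rw [hq]; linarith
  have hk5 : κ 5 * q = 1 := by
    rw [hq, show m 1 5 = m 1 0 by linarith] at *
    linarith
  have e : ∀ x, κ 5 * x = x / q := fun x => by
    rw [eq_div_iff hq0]; linear_combination x * hk5
  rw [e] at c0 c1
  exact ⟨κ 0, κ 1, hκ0 0, hκ0 1, by linarith, by linarith⟩

/-- The wall of a corner tile opposite to the face `y 1 = 0`. -/
lemma first_wall (hm : Corner m) : m 1 5 = m 1 0 ∧
    ((0 < m 1 0 + 1 ∧ m 1 0 + 1 ≤ 1 ∧ m 1 1 = -1 ∧ m 1 2 = 0 ∧ m 1 3 = 0 ∧ m 1 4 = 0) ∨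
    (∃ t, 0 < t ∧ t < 1 ∧ m 1 0 = -((1 - t) * (√2 / 2)) ∧ m 1 1 = -(√2 / 2) ∧
      ((m 1 2 = √2 / 2 ∧ m 1 3 = 0 ∧ m 1 4 = 0) ∨ (m 1 2 = 0 ∧ m 1 3 = √2 / 2 ∧ m 1 4 = 0) ∨
        (m 1 2 = 0 ∧ m 1 3 = 0 ∧ m 1 4 = √2 / 2)))) := by
  have h5 := hm.one5
  have h1 := hm.one1
  rw [qf_wv (by decide)] at h5 h1
  have hn := hm.first_nonpos
  have hu := hm.tile.unit 1
  have lab : ∀ k, k ≠ 1 → qf (m k) (wv 5) = 0 → Lab (-qf (m k) (m 1)) := fun k hk hk5 =>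
    hm.tile.link_lab hm.reg5 hk5 hm.one5 hk
  have zj : ∀ j : Fin 6, j ≠ 0 → j ≠ 5 → qf (pN j) (wv 5) = 0 := fun j h h' => by
    rw [qf_pN_wv _ _ h, if_neg h']
  have l0 := lab 0 (by decide) (by rw [hm.wall0, qf_pN_zero_wv _ (by decide)])
  have l2 := lab 2 (by decide) (by rw [hm.wall2, zj _ (by decide) (by decide)])
  have l3 := lab 3 (by decide) (by rw [hm.wall3, zj _ (by decide) (by decide)])
  have l4 := lab 4 (by decide) (by rw [hm.wall4, zj _ (by decide) (by decide)])
  rw [hm.wall0, qf_pN_zero] at l0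
  rw [hm.wall2, qf_pN (by decide), neg_neg] at l2
  rw [hm.wall3, qf_pN (by decide), neg_neg] at l3
  rw [hm.wall4, qf_pN (by decide), neg_neg] at l4
  unfold qf at hu
  have h50 : m 1 5 = m 1 0 := by linarith
  rw [h50] at l0 hu
  refine ⟨h50, ?_⟩
  have hsq := sq_sum_aux l0 l2 l3 l4 (by linear_combination hu)
  have hB : ∀ j : Fin 6, j ≠ 1 → j ≠ 0 → m 1 0 = 0 → m 1 = (√2 / 2) • pN 1 + (-(√2 / 2)) • pN j →
      False := by
    intro j hj hj0 h0 h
    have h3 : √2 ≠ 0 := by positivity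
    rcases hm.tile.sec 1 1 j _ _ hj.symm h with h | h
    · have : √2 / 2 ≠ 0 := by positivity
      exact this h
    · have : √2 / 2 ≠ 0 := by positivity
      exact this (neg_eq_zero.mp h)
  have key : m 1 0 ≠ 0 → m 1 1 = -(√2 / 2) → ∃ t, 0 < t ∧ t < 1 ∧ m 1 0 = -((1 - t) * (√2 / 2)) := by
    intro h0 h11
    have hlt : m 1 0 < 0 := lt_of_le_of_ne hn h0
    have h3 : 0 < √2 / 2 := by positivity
    refine ⟨1 + m 1 0 / (√2 / 2), ?_, ?_, ?_⟩
    · have : -1 < m 1 0 / (√2 / 2) := by rw [lt_div_iff₀ h3]; linarith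
      linarith
    · have := div_neg_of_neg_of_pos hlt h3
      linarith
    · field_simp; ring
  rcases hsq with ⟨ha, h2, h3, h4⟩ | ⟨ha, h2, h3, h4⟩ | ⟨ha, h2, h3, h4⟩ | ⟨ha, h2, h3, h4⟩
  · left
    have h11 : m 1 1 = -1 := by linarith
    exact ⟨by linarith, by linarith, h11, h2, h3, h4⟩
  · right
    have h11 : m 1 1 = -(√2 / 2) := by linarith
    have h0 : m 1 0 ≠ 0 := fun h0 => by
      refine hB 2 (by decide) (by decide) h0 ?_
      funext j; fin_cases j <;> simp [pN, *]
    obtain ⟨t, ht⟩ := key h0 h11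
    exact ⟨t, ht.1, ht.2.1, ht.2.2, h11, Or.inl ⟨h2, h3, h4⟩⟩
  · right
    have h11 : m 1 1 = -(√2 / 2) := by linarith
    have h0 : m 1 0 ≠ 0 := fun h0 => by
      refine hB 3 (by decide) (by decide) h0 ?_
      funext j; fin_cases j <;> simp [pN, *]
    obtain ⟨t, ht⟩ := key h0 h11
    exact ⟨t, ht.1, ht.2.1, ht.2.2, h11, Or.inr (Or.inl ⟨h2, h3, h4⟩)⟩
  · right
    have h11 : m 1 1 = -(√2 / 2) := by linarith
    have h0 : m 1 0 ≠ 0 := fun h0 => by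
      refine hB 4 (by decide) (by decide) h0 ?_
      funext j; fin_cases j <;> simp [pN, *]
    obtain ⟨t, ht⟩ := key h0 h11
    exact ⟨t, ht.1, ht.2.1, ht.2.2, h11, Or.inr (Or.inr ⟨h2, h3, h4⟩)⟩

end Corner

/-- The possible values of `cos (π / m)`. -/
def Cox (A : ℝ) : Prop := A = 0 ∨ A = 1 / 2 ∨ A = √2 / 2 ∨ 4 / 5 ≤ A ∧ A ≤ 1

lemma Cox.cases {A : ℝ} (h : Cox A) : A = 0 ∨ 1 / 2 ≤ A := by
  obtain ⟨r, hr, hrr, hr1, hr2⟩ := r_facts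
  rcases h with rfl | rfl | rfl | h
  · exact Or.inl rfl
  · exact Or.inr le_rfl
  · right; rw [hr]; linarith
  · right; linarith [h.1]

lemma Cox.nonneg {A : ℝ} (h : Cox A) : 0 ≤ A := by
  rcases h.cases with h | h <;> linarith

lemma Cox.single {A s : ℝ} (h : Cox A) (hA : 1 / 2 ≤ A) (hs : s ≤ 1) (h2 : 2 * A ^ 2 ≤ s) :
    (A = 1 / 2 ∧ 1 / 2 ≤ s) ∨ (A = √2 / 2 ∧ s = 1) := by
  obtain ⟨r, hr, hrr, hr1, hr2⟩ := r_facts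
  rcases h with rfl | rfl | rfl | h
  · norm_num at hA
  · left; exact ⟨rfl, by linarith⟩
  · right; rw [hr] at *; exact ⟨rfl, by nlinarith⟩
  · nlinarith [h.1]

/-- Exactly one of the four values is non-zero. -/
def Single (s x y z w : ℝ) : Prop :=
  y = 0 ∧ z = 0 ∧ w = 0 ∧ ((x = 1 / 2 ∧ 1 / 2 ≤ s) ∨ (x = √2 / 2 ∧ s = 1))

lemma Single.intro {s x y z w S : ℝ} (hs0 : 0 < s) (hs : s ≤ 1) (hS : S = x + y + z + w)
    (hx : Cox x) (hy : Cox y) (hz : Cox z) (hw : Cox w)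
    (h : S ^ 2 * (2 - s) ≤ s * (1 - x ^ 2 - y ^ 2 - z ^ 2 - w ^ 2)) (hx2 : 1 / 2 ≤ x) :
    Single s x y z w := by
  have ny := hy.nonneg
  have nz := hz.nonneg
  have nw := hw.nonneg
  have hS0 : 1 / 2 ≤ S := by linarith
  have key : 1 ≤ S → False := by
    intro h1
    have h2 : 1 ≤ S ^ 2 := by nlinarith
    have h3 : 1 - x ^ 2 - y ^ 2 - z ^ 2 - w ^ 2 < 1 := by
      nlinarith [sq_nonneg y, sq_nonneg z, sq_nonneg w]
    nlinarith [mul_lt_mul_of_pos_left h3 hs0]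
  have y0 : y = 0 := hy.cases.resolve_right fun h => key (by linarith)
  have z0 : z = 0 := hz.cases.resolve_right fun h => key (by linarith)
  have w0 : w = 0 := hw.cases.resolve_right fun h => key (by linarith)
  subst y0 z0 w0
  refine ⟨rfl, rfl, rfl, hx.single hx2 hs ?_⟩
  have : S = x := by linarith
  subst this
  have h2 : 0 < S ^ 2 := by positivity
  nlinarith

lemma corner_aux {s C a c₂ c₃ c₄ S : ℝ} (hs0 : 0 < s) (hs : s ≤ 1) (hC : Cox C) (ha : Cox a)
    (h2 : Cox c₂) (h3 : Cox c₃) (h4 : Cox c₄) (hS : S = 2 * C + a + c₂ + c₃ + c₄) (hS0 : 0 < S)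
    (h : S ^ 2 * (2 - s) ≤ s * (1 - a ^ 2 - c₂ ^ 2 - c₃ ^ 2 - c₄ ^ 2)) :
    (C = 1 / 2 ∧ a = 0 ∧ c₂ = 0 ∧ c₃ = 0 ∧ c₄ = 0 ∧ s = 1) ∨ C = 0 ∧
      (Single s a c₂ c₃ c₄ ∨ Single s c₂ a c₃ c₄ ∨ Single s c₃ a c₂ c₄ ∨ Single s c₄ a c₂ c₃) := by
  have na := ha.nonneg
  have n2 := h2.nonneg
  have n3 := h3.nonneg
  have n4 := h4.nonneg
  rcases hC.cases with rfl | hC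
  · right
    refine ⟨rfl, ?_⟩
    rcases ha.cases with rfl | ha'
    · right
      rcases h2.cases with rfl | h2'
      · right
        rcases h3.cases with rfl | h3'
        · right
          rcases h4.cases with rfl | h4'
          · norm_num at hS; linarith
          · exact .intro hs0 hs (by rw [hS]; ring) h4 ha h2 h3 (h.trans_eq (by ring)) h4'
        · left
          exact .intro hs0 hs (by rw [hS]; ring) h3 ha h2 h4 (h.trans_eq (by ring)) h3'
      · left
        exact .intro hs0 hs (by rw [hS]; ring) h2 ha h3 h4 (h.trans_eq (by ring)) h2'
    · left
      exact .intro hs0 hs (by rw [hS]; ring) ha h2 h3 h4 (h.trans_eq (by ring)) ha'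
  · left
    have h1 : 1 ≤ S := by linarith
    have hSS : S ≤ S ^ 2 := by nlinarith
    have hb : S ^ 2 * (2 - s) ≤ s := by
      nlinarith [sq_nonneg a, sq_nonneg c₂, sq_nonneg c₃, sq_nonneg c₄]
    have hs1 : s = 1 := by nlinarith
    subst hs1
    have : S = 1 := by nlinarith
    exact ⟨by linarith, by linarith, by linarith, by linarith, by linarith, rfl⟩

lemma corner_aux' {s C a c₂ c₃ c₄ S : ℝ} (hs0 : 0 < s) (hs : s < 1) (hC : Cox C) (ha : Cox a)
    (h2 : Cox c₂) (h3 : Cox c₃) (h4 : Cox c₄)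
    (hS : S = 2 * C + √2 * a + c₂ + c₃ + 2 * c₄) (hS0 : 0 < S)
    (h : S ^ 2 * (2 - s) ≤
      s * (1 - (√2 * a + c₄) ^ 2 - c₂ ^ 2 - c₃ ^ 2 - c₄ ^ 2)) :
    C = 0 ∧ a = 0 ∧ c₄ = 0 ∧ ((c₂ = 1 / 2 ∧ c₃ = 0) ∨ (c₂ = 0 ∧ c₃ = 1 / 2)) := by
  obtain ⟨r, hr, hrr, hr1, hr2⟩ := r_facts
  have hr3 : √2 = 2 * r := by linarith
  have na := ha.nonneg
  have n2 := h2.nonneg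
  have n3 := h3.nonneg
  have n4 := h4.nonneg
  have nC := hC.nonneg
  obtain ⟨x, hx⟩ : ∃ x, x = √2 * a := ⟨_, rfl⟩
  have hx0 : a ≤ x := by rw [hx, hr3]; nlinarith
  rw [← hx] at hS h
  have hb : S ^ 2 + (x + c₄) ^ 2 + c₂ ^ 2 + c₃ ^ 2 + c₄ ^ 2 < 1 := by
    by_contra! hc
    have h1 : 0 < S ^ 2 := by positivity
    have h5 : 1 - (x + c₄) ^ 2 - c₂ ^ 2 - c₃ ^ 2 - c₄ ^ 2 ≤ S ^ 2 := by linarith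
    nlinarith [mul_le_mul_of_nonneg_left h5 hs0.le]
  have hlt : S < 1 := by nlinarith [sq_nonneg (x + c₄), sq_nonneg c₂, sq_nonneg c₃, sq_nonneg c₄]
  have C0 : C = 0 := hC.cases.resolve_right fun h => by linarith
  have c0 : c₄ = 0 := h4.cases.resolve_right fun h => by linarith
  have a0 : a = 0 := ha.cases.resolve_right fun h => by
    have h1 : r ≤ x := by rw [hx, hr3]; nlinarith
    nlinarith [sq_nonneg c₂, sq_nonneg c₃]
  have x0 : x = 0 := by rw [hx, a0]; simp
  subst C0 c0 x0
  refine ⟨rfl, a0, rfl, ?_⟩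
  rcases h2.cases with rfl | h2'
  · right
    refine ⟨rfl, ?_⟩
    rcases h3.cases with rfl | h3'
    · norm_num at hS; linarith
    · have hS3 : S = c₃ := by linarith
      rw [hS3] at h
      rcases h3.single h3' hs.le (by linarith) with h | h
      · exact h.1
      · exact absurd h.2 hs.ne
  · left
    rcases h3.cases with rfl | h3'
    · have hS3 : S = c₂ := by linarith
      rw [hS3] at h
      rcases h2.single h2' hs.le (by linarith) with h | h
      · exact ⟨h.1, rfl⟩
      · exact absurd h.2 hs.ne
    · linarith

lemma quad_aux {q s B Q b0 b1 : ℝ} (hb1 : b1 = B + (1 - s) * q) (hq : 0 < q)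
    (h0 : 2 * q * b0 = q ^ 2 + b1 ^ 2 + Q - 1) (h1 : b0 ≤ (1 - s) * b1) :
    (s * q) ^ 2 * (2 - s) ≤ s * (1 - Q - B ^ 2) ∨ s < 0 := by
  by_cases hs : s < 0
  · exact Or.inr hs
  left
  have : q ^ 2 + b1 ^ 2 + Q - 1 ≤ 2 * q * ((1 - s) * b1) := by
    rw [← h0]; exact mul_le_mul_of_nonneg_left h1 (by linarith)
  have h2 : q ^ 2 * (s * (2 - s)) ≤ 1 - Q - B ^ 2 := by
    rw [hb1] at this; linarith
  have h3 := mul_le_mul_of_nonneg_left h2 (not_lt.mp hs)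
  linarith

/-- Gram matrix of the star with center `0`, leaves `1, …, 4` and `5` attached to the leaf `1`. -/
def starG (k l : Fin 6) : ℝ :=
  if k = l then 1 else if (k = 0 ∧ l ≠ 5) ∨ (l = 0 ∧ k ≠ 5) ∨ (k = 1 ∧ l = 5) ∨ (k = 5 ∧ l = 1)
    then -(1 / 2) else 0

/-- The points used to compare corner tiles along the edge from `wv 5` to `wv 1`. -/
def edgePt (ε : ℝ) : Fin 6 → ℝ :=
  fun i => if i = 0 then 2 + 6 * ε else if i = 1 ∨ i = 5 then 1 + ε else ε

/-- Corner tile with a wall crossing the edge from `wv 5` to `wv 1`. -/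
structure CrossCorner (m : Fin 6 → Fin 6 → ℝ) : Prop where
  label : ∃ k l, qf (m k) (m l) = -(√2 / 2)
  edge : ∃ δ > 0, ∀ ε, 0 < ε → ε < δ → SReg m (edgePt ε)
  far : 0 < qf (m 5) (wv 1)

/-- Corner tile of star type with parameters `s`, `k`. -/
structure StarCorner (m : Fin 6 → Fin 6 → ℝ) (s : ℝ) (k : Fin 6) : Prop where
  half_le : 1 / 2 ≤ s
  le_one : s ≤ 1
  gram : ∀ i j, qf (m (Equiv.swap 1 k i)) (m (Equiv.swap 1 k j)) = starG i j
  one : ∀ y, qf (m 1) y = (1 - s) * (y 0 - y 5) - y 1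
  five : k = 1 ∧ (∀ y, 2 * s * qf (m 5) y = y 1 - y 0 + 2 * s ^ 2 * (y 0 - y 5)) ∨
    (k = 2 ∨ k = 3 ∨ k = 4) ∧ (∀ y, 2 * s * qf (m 5) y =
      -(1 - s - s ^ 2) * y 0 + (1 - s) * y 1 + s * y k - (s + s ^ 2) * y 5)

namespace Corner
variable {m : Fin 6 → Fin 6 → ℝ}

lemma cox (hm : Corner m) {k l : Fin 6} (h : k ≠ l) : Cox (-qf (m k) (m l)) := hm.tile.cox_cases h

lemma gram_zero (hm : Corner m) (k : Fin 6) : 2 * -qf (m k) (m 0) =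
    m k 0 - m k 1 - m k 2 - m k 3 - m k 4 - m k 5 := by
  rw [hm.wall0, qf_comm, qf_pN_zero]; ring

lemma gram_two (hm : Corner m) (k : Fin 6) : -qf (m k) (m 2) = m k 2 := by
  rw [hm.wall2, qf_comm, qf_pN (by decide), neg_neg]

lemma gram_three (hm : Corner m) (k : Fin 6) : -qf (m k) (m 3) = m k 3 := by
  rw [hm.wall3, qf_comm, qf_pN (by decide), neg_neg]

lemma gram_four (hm : Corner m) (k : Fin 6) : -qf (m k) (m 4) = m k 4 := by
  rw [hm.wall4, qf_comm, qf_pN (by decide), neg_neg]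

lemma unit_five (hm : Corner m) {q : ℝ} (hq : q = m 5 0 - m 5 5) :
    2 * q * m 5 0 = q ^ 2 + m 5 1 ^ 2 + (m 5 2 ^ 2 + m 5 3 ^ 2 + m 5 4 ^ 2) - 1 := by
  have h := hm.tile.unit 5
  unfold qf at h
  rw [hq]; linear_combination -h

lemma five_pos (hm : Corner m) {q : ℝ} (hq : q = m 5 0 - m 5 5) : 0 < q := by
  have h := hm.five5
  rw [qf_wv (by decide)] at h
  linarith

lemma five_le (hm : Corner m) {q s u : ℝ} (hq : q = m 5 0 - m 5 5) (hs : 0 ≤ s)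
    (h1 : m 1 1 = -u) (h0 : m 1 0 = -((1 - s) * u)) : m 5 0 ≤ (1 - s) * m 5 1 := by
  have hq0 := hm.five_pos hq
  obtain ⟨κ0, κ1, n0, n1, e0, e1⟩ := hm.five_coef hq
  rw [h0] at e0
  rw [h1] at e1
  have e : m 5 0 / q = (1 - s) * (m 5 1 / q) - s * (κ0 / 2) := by
    linear_combination (1 - s) * e1 - e0
  have e2 : m 5 0 / q ≤ (1 - s) * (m 5 1 / q) := by nlinarith
  rw [← mul_div_assoc] at e2
  exact (div_le_div_iff_of_pos_right hq0).mp e2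

lemma five_sec (hm : Corner m) {k : Fin 6} (hk : k ≠ 5)
    (h : m 5 = -(√2 / 2) • pN k + (√2 / 2) • pN 5) : False := by
  have h2 : 0 < √2 / 2 := by positivity
  rcases hm.tile.sec 5 k 5 _ _ hk h with h | h <;> linarith

/-- The gram matrix of a corner tile whose second wall meets only the central one. -/
lemma gram_star (hm : Corner m) {k : Fin 6} (hk : k = 1 ∨ k = 2 ∨ k = 3 ∨ k = 4)
    (hc1 : qf (m 1) (m 0) = -(1 / 2)) (h12 : m 1 2 = 0) (h13 : m 1 3 = 0) (h14 : m 1 4 = 0)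
    (h50 : qf (m 5) (m 0) = 0) (h5k : qf (m 5) (m k) = -(1 / 2))
    (h5 : ∀ j, j = 1 ∨ j = 2 ∨ j = 3 ∨ j = 4 → j ≠ k → qf (m 5) (m j) = 0) (i j : Fin 6) :
    qf (m (Equiv.swap 1 k i)) (m (Equiv.swap 1 k j)) = starG i j := by
  have u := hm.tile.unit
  have e12 := hm.gram_two 1
  have e13 := hm.gram_three 1
  have e14 := hm.gram_four 1
  rw [h12, neg_eq_zero] at e12
  rw [h13, neg_eq_zero] at e13
  rw [h14, neg_eq_zero] at e14
  have pp : ∀ i j : Fin 6, i ≠ 0 → qf (pN i) (pN j) =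
    if j = 0 then -(1 / 2) else if i = j then 1 else 0 := qf_pN_pN
  have e20 : qf (m 2) (m 0) = -(1 / 2) := by rw [hm.wall0, hm.wall2, pp _ _ (by decide)]; simp
  have e30 : qf (m 3) (m 0) = -(1 / 2) := by rw [hm.wall0, hm.wall3, pp _ _ (by decide)]; simp
  have e40 : qf (m 4) (m 0) = -(1 / 2) := by rw [hm.wall0, hm.wall4, pp _ _ (by decide)]; simp
  have e23 : qf (m 2) (m 3) = 0 := by rw [hm.wall3, hm.wall2, pp _ _ (by decide)]; simp
  have e24 : qf (m 2) (m 4) = 0 := by rw [hm.wall4, hm.wall2, pp _ _ (by decide)]; simp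
  have e34 : qf (m 3) (m 4) = 0 := by rw [hm.wall4, hm.wall3, pp _ _ (by decide)]; simp
  have key : ∀ k l, qf (m k) (m l) = if k = l then 1 else
      if (k = 0 ∧ l ≠ 5) ∨ (l = 0 ∧ k ≠ 5) then -(1 / 2)
      else if k = 5 then qf (m 5) (m l) else if l = 5 then qf (m 5) (m k) else 0 := by
    intro k l
    fin_cases k <;> fin_cases l <;> simp <;>
      first
        | exact u _
        | assumption
        | (rw [qf_comm]; assumption)
        | linarith
        | (rw [qf_comm]; linarith)
        | (rw [qf_comm])
  rw [key]
  clear key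
  rcases hk with rfl | rfl | rfl | rfl <;> fin_cases i <;> fin_cases j <;>
    simp [starG, Equiv.swap_apply_def] <;>
      first
        | exact h50
        | linarith
        | exact h5 1 (by decide) (by decide)
        | exact h5 2 (by decide) (by decide)
        | exact h5 3 (by decide) (by decide)
        | exact h5 4 (by decide) (by decide)

end Corner

namespace Corner
variable {m : Fin 6 → Fin 6 → ℝ}

lemma star_own (hm : Corner m) {s q : ℝ} (hq : q = m 5 0 - m 5 5) (hs2 : 1 / 2 ≤ s)
    (hs : s ≤ 1) (hone : ∀ y, qf (m 1) y = (1 - s) * (y 0 - y 5) - y 1)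
    (hc1 : qf (m 1) (m 0) = -(1 / 2)) (h12 : m 1 2 = 0) (h13 : m 1 3 = 0) (h14 : m 1 4 = 0)
    (hC : qf (m 5) (m 0) = 0) (ha : qf (m 5) (m 1) = -(1 / 2)) (h2 : m 5 2 = 0) (h3 : m 5 3 = 0)
    (h4 : m 5 4 = 0) (h1 : m 5 1 = 1 / 2 + (1 - s) * q) (hS : 1 / 2 = s * q)
    (hu : 2 * q * m 5 0 = q ^ 2 + m 5 1 ^ 2 + (m 5 2 ^ 2 + m 5 3 ^ 2 + m 5 4 ^ 2) - 1) :
    StarCorner m s 1 where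
  half_le := hs2
  le_one := hs
  one := hone
  gram := by
    refine hm.gram_star (Or.inl rfl) hc1 h12 h13 h14 hC ha fun j hj hj1 => ?_
    have e2 := hm.gram_two 5
    have e3 := hm.gram_three 5
    have e4 := hm.gram_four 5
    rcases hj with rfl | rfl | rfl | rfl
    · exact absurd rfl hj1
    all_goals linarith
  five := by
    refine Or.inl ⟨rfl, fun y => ?_⟩
    have hsq : 2 * s * q = 1 := by linarith
    have b1 : 2 * s * m 5 1 = 1 := by rw [h1]; linear_combination (1 - s) * hsq
    have b0 : 2 * s * m 5 0 = 1 - 2 * s ^ 2 := by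
      rw [h2, h3, h4] at hu
      linear_combination 2 * s ^ 2 * hu - 2 * s * m 5 0 * hsq + (2 * s * q + 1) / 2 * hsq +
        (2 * s * m 5 1 + 1) / 2 * b1
    have b5 : 2 * s * m 5 5 = -(2 * s ^ 2) := by linear_combination b0 + 2 * s * hq - hsq
    unfold qf
    rw [h2, h3, h4]
    linear_combination y 1 * b1 - y 0 * b0 + y 5 * b5

lemma star_two (hm : Corner m) {s q : ℝ} (hq : q = m 5 0 - m 5 5) (hs2 : 1 / 2 ≤ s)
    (hs : s ≤ 1) (hone : ∀ y, qf (m 1) y = (1 - s) * (y 0 - y 5) - y 1)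
    (hc1 : qf (m 1) (m 0) = -(1 / 2)) (h12 : m 1 2 = 0) (h13 : m 1 3 = 0) (h14 : m 1 4 = 0)
    (hC : qf (m 5) (m 0) = 0) (ha : qf (m 5) (m 1) = 0) (hk : m 5 2 = 1 / 2) (h3 : m 5 3 = 0)
    (h4 : m 5 4 = 0) (h1 : m 5 1 = (1 - s) * q) (hS : 1 / 2 = s * q)
    (hu : 2 * q * m 5 0 = q ^ 2 + m 5 1 ^ 2 + (m 5 2 ^ 2 + m 5 3 ^ 2 + m 5 4 ^ 2) - 1) :
    StarCorner m s 2 where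
  half_le := hs2
  le_one := hs
  one := hone
  gram := by
    have e2 := hm.gram_two 5
    have e3 := hm.gram_three 5
    have e4 := hm.gram_four 5
    refine hm.gram_star (by simp) hc1 h12 h13 h14 hC (by linarith) fun j hj hj1 => ?_
    rcases hj with rfl | rfl | rfl | rfl
    all_goals first | exact absurd rfl hj1 | linarith
  five := by
    refine Or.inr ⟨by simp, fun y => ?_⟩
    have hsq : 2 * s * q = 1 := by linarith
    have b1 : 2 * s * m 5 1 = 1 - s := by rw [h1]; linear_combination (1 - s) * hsq
    have b0 : 2 * s * m 5 0 = 1 - s - s ^ 2 := by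
      rw [hk, h3, h4] at hu
      linear_combination 2 * s ^ 2 * hu - 2 * s * m 5 0 * hsq + (2 * s * q + 1) / 2 * hsq +
        (2 * s * m 5 1 + 1 - s) / 2 * b1
    have b5 : 2 * s * m 5 5 = -(s + s ^ 2) := by linear_combination b0 + 2 * s * hq - hsq
    unfold qf
    rw [hk, h3, h4]
    linear_combination y 1 * b1 - y 0 * b0 + y 5 * b5

lemma star_three (hm : Corner m) {s q : ℝ} (hq : q = m 5 0 - m 5 5) (hs2 : 1 / 2 ≤ s)
    (hs : s ≤ 1) (hone : ∀ y, qf (m 1) y = (1 - s) * (y 0 - y 5) - y 1)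
    (hc1 : qf (m 1) (m 0) = -(1 / 2)) (h12 : m 1 2 = 0) (h13 : m 1 3 = 0) (h14 : m 1 4 = 0)
    (hC : qf (m 5) (m 0) = 0) (ha : qf (m 5) (m 1) = 0) (hk : m 5 3 = 1 / 2) (h2 : m 5 2 = 0)
    (h4 : m 5 4 = 0) (h1 : m 5 1 = (1 - s) * q) (hS : 1 / 2 = s * q)
    (hu : 2 * q * m 5 0 = q ^ 2 + m 5 1 ^ 2 + (m 5 2 ^ 2 + m 5 3 ^ 2 + m 5 4 ^ 2) - 1) :
    StarCorner m s 3 where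
  half_le := hs2
  le_one := hs
  one := hone
  gram := by
    have e2 := hm.gram_two 5
    have e3 := hm.gram_three 5
    have e4 := hm.gram_four 5
    refine hm.gram_star (by simp) hc1 h12 h13 h14 hC (by linarith) fun j hj hj1 => ?_
    rcases hj with rfl | rfl | rfl | rfl
    all_goals first | exact absurd rfl hj1 | linarith
  five := by
    refine Or.inr ⟨by simp, fun y => ?_⟩
    have hsq : 2 * s * q = 1 := by linarith
    have b1 : 2 * s * m 5 1 = 1 - s := by rw [h1]; linear_combination (1 - s) * hsq
    have b0 : 2 * s * m 5 0 = 1 - s - s ^ 2 := by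
      rw [hk, h2, h4] at hu
      linear_combination 2 * s ^ 2 * hu - 2 * s * m 5 0 * hsq + (2 * s * q + 1) / 2 * hsq +
        (2 * s * m 5 1 + 1 - s) / 2 * b1
    have b5 : 2 * s * m 5 5 = -(s + s ^ 2) := by linear_combination b0 + 2 * s * hq - hsq
    unfold qf
    rw [hk, h2, h4]
    linear_combination y 1 * b1 - y 0 * b0 + y 5 * b5

lemma star_four (hm : Corner m) {s q : ℝ} (hq : q = m 5 0 - m 5 5) (hs2 : 1 / 2 ≤ s)
    (hs : s ≤ 1) (hone : ∀ y, qf (m 1) y = (1 - s) * (y 0 - y 5) - y 1)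
    (hc1 : qf (m 1) (m 0) = -(1 / 2)) (h12 : m 1 2 = 0) (h13 : m 1 3 = 0) (h14 : m 1 4 = 0)
    (hC : qf (m 5) (m 0) = 0) (ha : qf (m 5) (m 1) = 0) (hk : m 5 4 = 1 / 2) (h2 : m 5 2 = 0)
    (h3 : m 5 3 = 0) (h1 : m 5 1 = (1 - s) * q) (hS : 1 / 2 = s * q)
    (hu : 2 * q * m 5 0 = q ^ 2 + m 5 1 ^ 2 + (m 5 2 ^ 2 + m 5 3 ^ 2 + m 5 4 ^ 2) - 1) :
    StarCorner m s 4 where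
  half_le := hs2
  le_one := hs
  one := hone
  gram := by
    have e2 := hm.gram_two 5
    have e3 := hm.gram_three 5
    have e4 := hm.gram_four 5
    refine hm.gram_star (by simp) hc1 h12 h13 h14 hC (by linarith) fun j hj hj1 => ?_
    rcases hj with rfl | rfl | rfl | rfl
    all_goals first | exact absurd rfl hj1 | linarith
  five := by
    refine Or.inr ⟨by simp, fun y => ?_⟩
    have hsq : 2 * s * q = 1 := by linarith
    have b1 : 2 * s * m 5 1 = 1 - s := by rw [h1]; linear_combination (1 - s) * hsq
    have b0 : 2 * s * m 5 0 = 1 - s - s ^ 2 := by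
      rw [hk, h2, h3] at hu
      linear_combination 2 * s ^ 2 * hu - 2 * s * m 5 0 * hsq + (2 * s * q + 1) / 2 * hsq +
        (2 * s * m 5 1 + 1 - s) / 2 * b1
    have b5 : 2 * s * m 5 5 = -(s + s ^ 2) := by linear_combination b0 + 2 * s * hq - hsq
    unfold qf
    rw [hk, h2, h3]
    linear_combination y 1 * b1 - y 0 * b0 + y 5 * b5

lemma line_outcome (hm : Corner m) (h50 : m 1 5 = m 1 0) (hs0 : 0 < m 1 0 + 1)
    (hs1 : m 1 0 + 1 ≤ 1) (h11 : m 1 1 = -1) (h12 : m 1 2 = 0) (h13 : m 1 3 = 0)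
    (h14 : m 1 4 = 0) : m = pN ∨ ∃ s k, StarCorner m s k := by
  obtain ⟨s, hs⟩ : ∃ s, s = m 1 0 + 1 := ⟨_, rfl⟩
  obtain ⟨q, hq⟩ : ∃ q, q = m 5 0 - m 5 5 := ⟨_, rfl⟩
  obtain ⟨b, hb⟩ : ∃ b, b = m 5 := ⟨_, rfl⟩
  rw [← hs] at hs0 hs1
  have h10 : m 1 0 = s - 1 := by linarith
  rw [h10] at h50
  have hone : ∀ y, qf (m 1) y = (1 - s) * (y 0 - y 5) - y 1 := fun y => by
    unfold qf; rw [h10, h50, h11, h12, h13, h14]; ring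
  have hc1 : qf (m 1) (m 0) = -(1 / 2) := by
    have := hm.gram_zero 1
    rw [h10, h50, h11, h12, h13, h14] at this
    linarith
  have hq0 := hm.five_pos hq
  have hu := hm.unit_five hq
  have hle := hm.five_le hq hs0.le h11 (by linarith)
  have xC := hm.cox (k := 5) (l := 0) (by decide)
  have xa := hm.cox (k := 5) (l := 1) (by decide)
  have x2 := hm.cox (k := 5) (l := 2) (by decide)
  have x3 := hm.cox (k := 5) (l := 3) (by decide)
  have x4 := hm.cox (k := 5) (l := 4) (by decide)
  have eC := hm.gram_zero 5
  obtain ⟨C, hC⟩ : ∃ C, C = -qf (m 5) (m 0) := ⟨_, rfl⟩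
  obtain ⟨a, ha⟩ : ∃ a, a = -qf (m 5) (m 1) := ⟨_, rfl⟩
  rw [← hC] at xC eC
  rw [← ha] at xa
  rw [hm.gram_two] at x2
  rw [hm.gram_three] at x3
  rw [hm.gram_four] at x4
  have ea : a = m 5 1 - (1 - s) * q := by
    rw [ha, qf_comm, hone, hq]; ring
  have e1 : m 5 1 = a + (1 - s) * q := by linarith
  have eS : s * q = 2 * C + a + m 5 2 + m 5 3 + m 5 4 := by rw [eC, ea, hq]; ring
  have hquad := (quad_aux e1 hq0 hu hle).resolve_right (not_lt.mpr hs0.le)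
  have hC' : C = 0 → qf (m 5) (m 0) = 0 := fun h => by linarith
  rcases corner_aux hs0 hs1 xC xa x2 x3 x4 eS (mul_pos hs0 hq0) (hquad.trans_eq (by ring)) with
    ⟨C2, a0, c2, c3, c4, s1⟩ | ⟨C0, ⟨c2, c3, c4, h⟩ | ⟨a0, c3, c4, h⟩ | ⟨a0, c2, c4, h⟩ |
      ⟨a0, c2, c3, h⟩⟩
  · left
    subst s1
    rw [C2, a0, c2, c3, c4] at eS
    have q1 : q = 1 := by linarith
    rw [q1, a0] at e1
    rw [q1, e1, c2, c3, c4] at hu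
    have m1 : m 1 = pN 1 := by funext i; fin_cases i <;> simp [pN] <;> linarith
    have m5 : m 5 = pN 5 := by funext i; fin_cases i <;> simp [pN] <;> linarith
    funext i
    fin_cases i
    exacts [hm.wall0, m1, hm.wall2, hm.wall3, hm.wall4, m5]
  · rw [C0, c2, c3, c4] at eS
    rcases h with ⟨h, hs2⟩ | ⟨h, s1⟩
    · exact Or.inr ⟨s, 1, hm.star_own hq hs2 hs1 hone hc1 h12 h13 h14 (hC' C0) (by linarith) c2 c3 c4
        (by rw [e1, h]) (by rw [eS, h]; ring) hu⟩
    · exfalso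
      obtain ⟨r, hr, hrr, -⟩ := r_facts
      subst s1
      rw [h] at e1
      rw [h] at eS
      have hq1 : q = √2 / 2 := by linarith
      rw [hq1, e1, hq1, c2, c3, c4, hr] at hu
      have hb0 : m 5 0 = 0 := by
        have : r * m 5 0 = 0 := by linarith
        refine (mul_eq_zero.mp this).resolve_left ?_
        rintro rfl
        norm_num at hrr
      refine hm.five_sec (k := 1) (by decide) ?_
      funext i
      fin_cases i <;> simp [pN] <;> linarith
  · rw [C0, a0, c3, c4] at eS
    rcases h with ⟨h, hs2⟩ | ⟨h, s1⟩
    · exact Or.inr ⟨s, 2, hm.star_two hq hs2 hs1 hone hc1 h12 h13 h14 (hC' C0) (by linarith) h c3 c4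
        (by rw [e1, a0]; ring) (by rw [eS, h]; ring) hu⟩
    · exfalso
      obtain ⟨r, hr, hrr, -⟩ := r_facts
      subst s1
      rw [a0] at e1
      rw [h] at eS
      have hq1 : q = √2 / 2 := by linarith
      rw [hq1, e1, h, c3, c4, hr] at hu
      have hb0 : m 5 0 = 0 := by
        have : r * m 5 0 = 0 := by linarith
        refine (mul_eq_zero.mp this).resolve_left ?_
        rintro rfl
        norm_num at hrr
      refine hm.five_sec (k := 2) (by decide) ?_
      funext i
      fin_cases i <;> simp [pN] <;> linarith
  · rw [C0, a0, c2, c4] at eS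
    rcases h with ⟨h, hs2⟩ | ⟨h, s1⟩
    · exact Or.inr ⟨s, 3, hm.star_three hq hs2 hs1 hone hc1 h12 h13 h14 (hC' C0) (by linarith) h c2 c4
        (by rw [e1, a0]; ring) (by rw [eS, h]; ring) hu⟩
    · exfalso
      obtain ⟨r, hr, hrr, -⟩ := r_facts
      subst s1
      rw [a0] at e1
      rw [h] at eS
      have hq1 : q = √2 / 2 := by linarith
      rw [hq1, e1, c2, h, c4, hr] at hu
      have hb0 : m 5 0 = 0 := by
        have : r * m 5 0 = 0 := by linarith
        refine (mul_eq_zero.mp this).resolve_left ?_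
        rintro rfl
        norm_num at hrr
      refine hm.five_sec (k := 3) (by decide) ?_
      funext i
      fin_cases i <;> simp [pN] <;> linarith
  · rw [C0, a0, c2, c3] at eS
    rcases h with ⟨h, hs2⟩ | ⟨h, s1⟩
    · exact Or.inr ⟨s, 4, hm.star_four hq hs2 hs1 hone hc1 h12 h13 h14 (hC' C0) (by linarith) h c2 c3
        (by rw [e1, a0]; ring) (by rw [eS, h]; ring) hu⟩
    · exfalso
      obtain ⟨r, hr, hrr, -⟩ := r_facts
      subst s1
      rw [a0] at e1
      rw [h] at eS
      have hq1 : q = √2 / 2 := by linarith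
      rw [hq1, e1, c2, c3, h, hr] at hu
      have hb0 : m 5 0 = 0 := by
        have : r * m 5 0 = 0 := by linarith
        refine (mul_eq_zero.mp this).resolve_left ?_
        rintro rfl
        norm_num at hrr
      refine hm.five_sec (k := 4) (by decide) ?_
      funext i
      fin_cases i <;> simp [pN] <;> linarith

end Corner

lemma exists_small {c d : ℝ} (hc : c < 0) : ∃ δ > 0, ∀ ε, 0 < ε → ε < δ → c + ε * d < 0 := by
  refine ⟨-c / (|d| + 1), div_pos (by linarith) (by positivity), fun ε h0 h => ?_⟩
  rw [lt_div_iff₀ (by positivity)] at h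
  nlinarith [le_abs_self d]

namespace Corner
variable {m : Fin 6 → Fin 6 → ℝ}

lemma cross_intro (hm : Corner m) {q t : ℝ} (hq : q = m 5 0 - m 5 5) (ht0 : 0 < t) (ht1 : t < 1)
    (h50 : m 1 5 = m 1 0) (h10 : m 1 0 = -((1 - t) * (√2 / 2))) (h11 : m 1 1 = -(√2 / 2))
    (hsum : m 1 2 + m 1 3 + m 1 4 = √2 / 2) (hl : ∃ l, qf (m 1) (m l) = -(√2 / 2))
    (h1 : m 5 1 = (1 - t) * q) (hS : t * q = 1 / 2)
    (hc : m 5 2 ^ 2 + m 5 3 ^ 2 + m 5 4 ^ 2 = 1 / 4) : CrossCorner m where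
  label := ⟨1, hl⟩
  far := by
    have hq0 := hm.five_pos hq
    have hu := hm.unit_five hq
    rw [qf_wv (by decide)]
    have : 2 * q * (m 5 1 - m 5 0) = 1 / 2 := by
      rw [h1] at hu ⊢
      linear_combination -hu - hc - (t * q + 1 / 2) * hS
    have h2 : 0 < 2 * q * (m 5 1 - m 5 0) := by linarith
    exact pos_of_mul_pos_right h2 (by linarith)
  edge := by
    have hq0 := hm.five_pos hq
    have hu := hm.unit_five hq
    obtain ⟨r, hr, hrr, hr1, hr2⟩ := r_facts
    rw [hr] at h10 h11 hsum
    have h3 : 2 * q * (m 5 1 - m 5 0) = 1 / 2 := by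
      rw [h1] at hu ⊢
      linear_combination -hu - hc - (t * q + 1 / 2) * hS
    have hq1 : 1 / 2 < q := by nlinarith
    have h4 : -q + (m 5 1 - m 5 0) < 0 := by nlinarith
    obtain ⟨δ, d0, hδ⟩ := exists_small (d := -6 * m 5 0 + m 5 1 + m 5 2 + m 5 3 + m 5 4 + m 5 5) h4
    obtain ⟨δ', d0', hδ'⟩ := exists_small (c := -t) (d := 5 * (1 - t)) (by linarith)
    refine ⟨min δ δ', lt_min d0 d0', fun ε e0 he => ?_⟩
    have g1 := hδ ε e0 (he.trans_le (min_le_left _ _))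
    have g2 := hδ' ε e0 (he.trans_le (min_le_right _ _))
    rw [hm.sreg_iff]
    have y0 : edgePt ε 0 = 2 + 6 * ε := rfl
    have y1 : edgePt ε 1 = 1 + ε := by simp [edgePt]
    have y2 : edgePt ε 2 = ε := by simp [edgePt]
    have y3 : edgePt ε 3 = ε := by simp [edgePt]
    have y4 : edgePt ε 4 = ε := by simp [edgePt]
    have y5 : edgePt ε 5 = 1 + ε := by simp [edgePt]
    have k1 : qf (m 1) (edgePt ε) = r * (-t + ε * (5 * (1 - t))) := by
      unfold qf
      rw [y0, y1, y2, y3, y4, y5, h50, h10, h11]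
      linear_combination ε * hsum
    have k5 : qf (m 5) (edgePt ε) = -q + (m 5 1 - m 5 0) +
        ε * (-6 * m 5 0 + m 5 1 + m 5 2 + m 5 3 + m 5 4 + m 5 5) := by
      unfold qf
      rw [y0, y1, y2, y3, y4, y5, hq]; ring
    rw [k1, k5, y0, y1, y2, y3, y4, y5]
    exact ⟨e0, e0, e0, by linarith, by nlinarith, g1⟩

lemma cross_two (hm : Corner m) {t : ℝ} (h50 : m 1 5 = m 1 0) (ht0 : 0 < t) (ht1 : t < 1)
    (h10 : m 1 0 = -((1 - t) * (√2 / 2))) (h11 : m 1 1 = -(√2 / 2)) (h12 : m 1 2 = √2 / 2)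
    (h13 : m 1 3 = 0) (h14 : m 1 4 = 0) : CrossCorner m := by
  obtain ⟨q, hq⟩ : ∃ q, q = m 5 0 - m 5 5 := ⟨_, rfl⟩
  have hq0 := hm.five_pos hq
  have hu := hm.unit_five hq
  have hle := hm.five_le hq ht0.le h11 h10
  have xC := hm.cox (k := 5) (l := 0) (by decide)
  have xa := hm.cox (k := 5) (l := 1) (by decide)
  have x2 := hm.cox (k := 5) (l := 2) (by decide)
  have x3 := hm.cox (k := 5) (l := 3) (by decide)
  have x4 := hm.cox (k := 5) (l := 4) (by decide)
  have eC := hm.gram_zero 5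
  obtain ⟨C, hC⟩ : ∃ C, C = -qf (m 5) (m 0) := ⟨_, rfl⟩
  obtain ⟨a, ha⟩ : ∃ a, a = -qf (m 5) (m 1) := ⟨_, rfl⟩
  rw [← hC] at xC eC
  rw [← ha] at xa
  rw [hm.gram_two] at x2
  rw [hm.gram_three] at x3
  rw [hm.gram_four] at x4
  have e2 : √2 ^ 2 = 2 := Real.sq_sqrt (by norm_num)
  have ea : √2 * a + m 5 2 + (1 - t) * q = m 5 1 := by
    rw [ha]; unfold qf
    rw [h50, h10, h11, h12, h13, h14, hq]
    linear_combination
      (m 5 1 - m 5 2 - (1 - t) * (m 5 0 - m 5 5)) / 2 * e2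
  have eS : t * q = 2 * C + √2 * a + m 5 3 + m 5 4 + 2 * m 5 2 := by
    rw [eC, hq]; rw [hq] at ea; linear_combination -ea
  have hquad := (quad_aux ea.symm hq0 hu hle).resolve_right (not_lt.mpr ht0.le)
  obtain ⟨C0, a0, c0, hh⟩ := corner_aux' ht0 ht1 xC xa x3 x4 x2 eS (mul_pos ht0 hq0)
    (hquad.trans_eq (by ring))
  rw [C0, a0, c0] at eS
  rw [a0, c0] at ea
  refine hm.cross_intro hq ht0 ht1 h50 h10 h11 (by rw [h12, h13, h14]; ring)
    ⟨2, by rw [← neg_neg (qf _ _), hm.gram_two, h12]⟩ (by rw [← ea]; ring) ?_ ?_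
  · rcases hh with ⟨h, h'⟩ | ⟨h, h'⟩ <;> rw [eS, h, h'] <;> norm_num
  · rcases hh with ⟨h, h'⟩ | ⟨h, h'⟩ <;> rw [h, h', c0] <;> norm_num

lemma cross_three (hm : Corner m) {t : ℝ} (h50 : m 1 5 = m 1 0) (ht0 : 0 < t) (ht1 : t < 1)
    (h10 : m 1 0 = -((1 - t) * (√2 / 2))) (h11 : m 1 1 = -(√2 / 2)) (h13 : m 1 3 = √2 / 2)
    (h12 : m 1 2 = 0) (h14 : m 1 4 = 0) : CrossCorner m := by
  obtain ⟨q, hq⟩ : ∃ q, q = m 5 0 - m 5 5 := ⟨_, rfl⟩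
  have hq0 := hm.five_pos hq
  have hu := hm.unit_five hq
  have hle := hm.five_le hq ht0.le h11 h10
  have xC := hm.cox (k := 5) (l := 0) (by decide)
  have xa := hm.cox (k := 5) (l := 1) (by decide)
  have x2 := hm.cox (k := 5) (l := 2) (by decide)
  have x3 := hm.cox (k := 5) (l := 3) (by decide)
  have x4 := hm.cox (k := 5) (l := 4) (by decide)
  have eC := hm.gram_zero 5
  obtain ⟨C, hC⟩ : ∃ C, C = -qf (m 5) (m 0) := ⟨_, rfl⟩
  obtain ⟨a, ha⟩ : ∃ a, a = -qf (m 5) (m 1) := ⟨_, rfl⟩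
  rw [← hC] at xC eC
  rw [← ha] at xa
  rw [hm.gram_two] at x2
  rw [hm.gram_three] at x3
  rw [hm.gram_four] at x4
  have e2 : √2 ^ 2 = 2 := Real.sq_sqrt (by norm_num)
  have ea : √2 * a + m 5 3 + (1 - t) * q = m 5 1 := by
    rw [ha]; unfold qf
    rw [h50, h10, h11, h12, h13, h14, hq]
    linear_combination
      (m 5 1 - m 5 3 - (1 - t) * (m 5 0 - m 5 5)) / 2 * e2
  have eS : t * q = 2 * C + √2 * a + m 5 2 + m 5 4 + 2 * m 5 3 := by
    rw [eC, hq]; rw [hq] at ea; linear_combination -ea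
  have hquad := (quad_aux ea.symm hq0 hu hle).resolve_right (not_lt.mpr ht0.le)
  obtain ⟨C0, a0, c0, hh⟩ := corner_aux' ht0 ht1 xC xa x2 x4 x3 eS (mul_pos ht0 hq0)
    (hquad.trans_eq (by ring))
  rw [C0, a0, c0] at eS
  rw [a0, c0] at ea
  refine hm.cross_intro hq ht0 ht1 h50 h10 h11 (by rw [h12, h13, h14]; ring)
    ⟨3, by rw [← neg_neg (qf _ _), hm.gram_three, h13]⟩ (by rw [← ea]; ring) ?_ ?_
  · rcases hh with ⟨h, h'⟩ | ⟨h, h'⟩ <;> rw [eS, h, h'] <;> norm_num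
  · rcases hh with ⟨h, h'⟩ | ⟨h, h'⟩ <;> rw [h, h', c0] <;> norm_num

lemma cross_four (hm : Corner m) {t : ℝ} (h50 : m 1 5 = m 1 0) (ht0 : 0 < t) (ht1 : t < 1)
    (h10 : m 1 0 = -((1 - t) * (√2 / 2))) (h11 : m 1 1 = -(√2 / 2)) (h14 : m 1 4 = √2 / 2)
    (h12 : m 1 2 = 0) (h13 : m 1 3 = 0) : CrossCorner m := by
  obtain ⟨q, hq⟩ : ∃ q, q = m 5 0 - m 5 5 := ⟨_, rfl⟩
  have hq0 := hm.five_pos hq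
  have hu := hm.unit_five hq
  have hle := hm.five_le hq ht0.le h11 h10
  have xC := hm.cox (k := 5) (l := 0) (by decide)
  have xa := hm.cox (k := 5) (l := 1) (by decide)
  have x2 := hm.cox (k := 5) (l := 2) (by decide)
  have x3 := hm.cox (k := 5) (l := 3) (by decide)
  have x4 := hm.cox (k := 5) (l := 4) (by decide)
  have eC := hm.gram_zero 5
  obtain ⟨C, hC⟩ : ∃ C, C = -qf (m 5) (m 0) := ⟨_, rfl⟩
  obtain ⟨a, ha⟩ : ∃ a, a = -qf (m 5) (m 1) := ⟨_, rfl⟩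
  rw [← hC] at xC eC
  rw [← ha] at xa
  rw [hm.gram_two] at x2
  rw [hm.gram_three] at x3
  rw [hm.gram_four] at x4
  have e2 : √2 ^ 2 = 2 := Real.sq_sqrt (by norm_num)
  have ea : √2 * a + m 5 4 + (1 - t) * q = m 5 1 := by
    rw [ha]; unfold qf
    rw [h50, h10, h11, h12, h13, h14, hq]
    linear_combination
      (m 5 1 - m 5 4 - (1 - t) * (m 5 0 - m 5 5)) / 2 * e2
  have eS : t * q = 2 * C + √2 * a + m 5 2 + m 5 3 + 2 * m 5 4 := by
    rw [eC, hq]; rw [hq] at ea; linear_combination -ea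
  have hquad := (quad_aux ea.symm hq0 hu hle).resolve_right (not_lt.mpr ht0.le)
  obtain ⟨C0, a0, c0, hh⟩ := corner_aux' ht0 ht1 xC xa x2 x3 x4 eS (mul_pos ht0 hq0)
    (hquad.trans_eq (by ring))
  rw [C0, a0, c0] at eS
  rw [a0, c0] at ea
  refine hm.cross_intro hq ht0 ht1 h50 h10 h11 (by rw [h12, h13, h14]; ring)
    ⟨4, by rw [← neg_neg (qf _ _), hm.gram_four, h14]⟩ (by rw [← ea]; ring) ?_ ?_
  · rcases hh with ⟨h, h'⟩ | ⟨h, h'⟩ <;> rw [eS, h, h'] <;> norm_num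
  · rcases hh with ⟨h, h'⟩ | ⟨h, h'⟩ <;> rw [h, h', c0] <;> norm_num

/-- The three kinds of corner tiles. -/
lemma outcome (hm : Corner m) : m = pN ∨ CrossCorner m ∨ ∃ s k, StarCorner m s k := by
  obtain ⟨h50, ⟨h1, h2, h3, h4, h5, h6⟩ | ⟨t, ht0, ht1, h10, h11, h⟩⟩ := hm.first_wall
  · rcases hm.line_outcome h50 h1 h2 h3 h4 h5 h6 with h | h
    · exact Or.inl h
    · exact Or.inr (Or.inr h)
  · right; left
    rcases h with ⟨h2, h3, h4⟩ | ⟨h2, h3, h4⟩ | ⟨h2, h3, h4⟩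
    · exact hm.cross_two h50 ht0 ht1 h10 h11 h2 h3 h4
    · exact hm.cross_three h50 ht0 ht1 h10 h11 h3 h2 h4
    · exact hm.cross_four h50 ht0 ht1 h10 h11 h4 h2 h3

end Corner

/-- A decomposition all of whose corner tiles are of star type. -/
structure StarFam {ι : Type} (M : Fin 6 → Fin 6 → ℝ) (N : ι → Fin 6 → Fin 6 → ℝ) : Prop where
  fam : Fam M N
  gram : ∃ ρ : Equiv.Perm (Fin 6), ∀ i j, M (ρ i) (ρ j) = starG i j
  corner : ∀ σ : Equiv.Perm (Fin 6), σ 0 = 0 → ∃ t, ∃ ρ : Equiv.Perm (Fin 6), ∃ s k,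
    Corner (fun j => N t (ρ j) ∘ σ) ∧ StarCorner (fun j => N t (ρ j) ∘ σ) s k

section
variable {ι : Type} {M : Fin 6 → Fin 6 → ℝ} {N : ι → Fin 6 → Fin 6 → ℝ}

lemma Fam.exists_corner [Finite ι] (hN : Fam M N) {σ : Equiv.Perm (Fin 6)} (hσ : σ 0 = 0) :
    ∃ t, ∃ ρ : Equiv.Perm (Fin 6), Corner (fun j => N t (ρ j) ∘ σ) := by
  obtain ⟨t, ht⟩ := (hN.perm hσ).exists_flag
  obtain ⟨ρ, hρ⟩ := ((hN.perm hσ).tile t).exists_corner ht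
  exact ⟨t, ρ, hρ⟩

lemma Fam.gram_corner (hN : Fam M N) {σ : Equiv.Perm (Fin 6)} (hσ : σ 0 = 0) (t : ι)
    (ρ : Equiv.Perm (Fin 6)) (i j : Fin 6) :
    qf (N t (ρ i) ∘ σ) (N t (ρ j) ∘ σ) = M (ρ i) (ρ j) := by
  rw [qf_perm hσ, hN.gram]

lemma starG_cases (i j : Fin 6) : starG i j = 1 ∨ starG i j = -(1 / 2) ∨ starG i j = 0 := by
  unfold starG; split_ifs <;> simp

lemma pN_gram_cases (i j : Fin 6) :
    qf (pN i) (pN j) = 1 ∨ qf (pN i) (pN j) = -(1 / 2) ∨ qf (pN i) (pN j) = 0 := by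
  by_cases hi : i = 0
  · subst hi
    by_cases hj : j = 0
    · subst hj; left; simp [qf, pN]; norm_num
    · rw [qf_comm, qf_pN_pN _ _ hj]; simp
  · rw [qf_pN_pN _ _ hi]; split_ifs <;> simp

lemma Fam.all_cross (hN : Fam M N) [Finite ι] {σ : Equiv.Perm (Fin 6)} (hσ : σ 0 = 0)
    (h : ∃ k l, M k l = -(√2 / 2)) :
    ∃ t, ∃ ρ : Equiv.Perm (Fin 6), Corner (fun j => N t (ρ j) ∘ σ) ∧
      CrossCorner (fun j => N t (ρ j) ∘ σ) := by
  obtain ⟨r, hr, hrr, hr1, hr2⟩ := r_facts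
  obtain ⟨t, ρ, hm⟩ := hN.exists_corner hσ
  obtain ⟨k, l, hkl⟩ := h
  refine ⟨t, ρ, hm, ?_⟩
  have hg := hN.gram_corner hσ t ρ
  rcases hm.outcome with h | h | ⟨s, k', h⟩
  · have h1 := hg (ρ.symm k) (ρ.symm l)
    rw [congrFun h (ρ.symm k), congrFun h (ρ.symm l)] at h1
    simp only [Equiv.apply_symm_apply] at h1
    have := pN_gram_cases (ρ.symm k) (ρ.symm l)
    rw [h1, hkl, hr] at this
    rcases this with h | h | h <;> linarith
  · exact h
  · have h1 := hg (ρ.symm k) (ρ.symm l)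
    have h2 := h.gram ((Equiv.swap 1 k').symm (ρ.symm k)) ((Equiv.swap 1 k').symm (ρ.symm l))
    simp only [Equiv.apply_symm_apply] at h1 h2
    rw [h1, hkl, hr] at h2
    have := starG_cases ((Equiv.swap 1 k').symm (ρ.symm k)) ((Equiv.swap 1 k').symm (ρ.symm l))
    rw [← h2] at this
    rcases this with h | h | h <;> linarith

lemma Fam.no_cross [Finite ι] (hN : Fam M N) : ¬ ∃ k l, M k l = -(√2 / 2) := by
  intro h
  obtain ⟨t, ρ, hm, hc⟩ := hN.all_cross (σ := 1) rfl h
  have hσ : Equiv.swap (1 : Fin 6) 5 0 = 0 := by decide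
  obtain ⟨t', ρ', hm', hc'⟩ := hN.all_cross hσ h
  obtain ⟨δ, d0, hδ⟩ := hc.edge
  obtain ⟨δ', d0', hδ'⟩ := hc'.edge
  have hε : 0 < min δ δ' := lt_min d0 d0'
  have h1 := hδ (min δ δ' / 2) (by linarith) (by linarith [min_le_left δ δ'])
  have h2 := hδ' (min δ δ' / 2) (by linarith) (by linarith [min_le_right δ δ'])
  have he : ∀ ε, edgePt ε ∘ (Equiv.swap (1 : Fin 6) 5) = edgePt ε := fun ε => by
    funext i; fin_cases i <;> rfl
  rw [← he] at h2
  have e1 : SReg (N t) (edgePt (min δ δ' / 2)) :=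
    (sreg_reindex (n := N t) ρ _).mp h1
  have e2 : SReg (N t') (edgePt (min δ δ' / 2)) :=
    (sreg_reindex (n := N t') ρ' _).mp
      ((sreg_perm (n := fun j => N t' (ρ' j)) hσ _).mp h2)
  have htt := hN.disj _ _ _ e1 e2
  subst htt
  have h5 : Reg (N t) (wv 5) := (reg_reindex (n := N t) ρ _).mp hm.reg5
  have h6 := hc'.far
  have hw : wv 1 = wv 5 ∘ (Equiv.swap (1 : Fin 6) 5) := by
    funext i; fin_cases i <;> rfl
  rw [hw, qf_perm hσ] at h6
  linarith [h5 (ρ' 5)]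

/-- Either there is a single tile, or all corner tiles are of star type. -/
lemma Fam.dichotomy [Finite ι] (hN : Fam M N) :
    ((∀ t y, Reg (N t) y ↔ InP y) ∧ ∃ k, ∀ l, l ≠ k → M k l = -(1 / 2)) ∨ StarFam M N := by
  by_cases hp : ∃ t, ∃ ρ σ : Equiv.Perm (Fin 6), σ 0 = 0 ∧ (fun j => N t (ρ j) ∘ σ) = pN
  · left
    obtain ⟨t, ρ, σ, hσ, h⟩ := hp
    have hreg : ∀ y, Reg (N t) y ↔ InP y := fun y => by
      rw [← inP_perm hσ, inP_iff, ← h, ← reg_reindex ρ, ← reg_perm hσ]; rfl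
    have hs : ∀ y, (∀ i, qf (pN i) y < 0) → SReg (N t) (y ∘ σ.symm) := fun y hy => by
      rw [← sreg_reindex ρ, ← sreg_perm hσ]
      have : (y ∘ σ.symm) ∘ σ = y := by funext i; simp
      rw [this]
      intro k
      have := hy k
      rw [← h] at this
      exact this
    refine ⟨fun t' => ?_, ρ 0, fun l hl => ?_⟩
    · have hmid := (hN.tile t').mid_sreg
      have hne := (hN.tile t').pN_neg hmid
      have h1 := hs ((hN.tile t').mid ∘ σ) fun i => by
        have e : pN i = (pN (σ i)) ∘ σ := by rw [pN_perm hσ]; simp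
        rw [e, qf_perm hσ]; exact hne _
      have e : ((hN.tile t').mid ∘ σ) ∘ σ.symm = (hN.tile t').mid := by funext i; simp
      rw [e] at h1
      rw [hN.disj _ _ _ hmid h1]; exact hreg
    · have h1 := hN.gram_corner hσ t ρ 0 (ρ.symm l)
      rw [congrFun h 0, congrFun h (ρ.symm l), Equiv.apply_symm_apply] at h1
      rw [← h1, qf_comm, qf_pN_pN, if_pos rfl]
      intro h0
      apply hl
      rw [← h0]; simp
  · right
    push Not at hp
    have hc : ∀ σ : Equiv.Perm (Fin 6), σ 0 = 0 → ∃ t, ∃ ρ : Equiv.Perm (Fin 6), ∃ s k,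
        Corner (fun j => N t (ρ j) ∘ σ) ∧ StarCorner (fun j => N t (ρ j) ∘ σ) s k := by
      intro σ hσ
      obtain ⟨t, ρ, hm⟩ := hN.exists_corner hσ
      rcases hm.outcome with h | h | ⟨s, k', h⟩
      · exact absurd h (hp t ρ σ hσ)
      · obtain ⟨k, l, h⟩ := h.label
        rw [hN.gram_corner hσ] at h
        exact absurd ⟨_, _, h⟩ hN.no_cross
      · exact ⟨t, ρ, s, k', hm, h⟩
    refine ⟨hN, ?_, hc⟩
    obtain ⟨t, ρ, s, k, hm, h⟩ := hc 1 rfl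
    refine ⟨(Equiv.swap 1 k).trans ρ, fun i j => ?_⟩
    rw [← h.gram i j, hN.gram_corner rfl]; rfl

lemma StarFam.perm (hN : StarFam M N) {σ : Equiv.Perm (Fin 6)} (hσ : σ 0 = 0) :
    StarFam M (fun t k => N t k ∘ σ) where
  fam := hN.fam.perm hσ
  gram := hN.gram
  corner σ' hσ' := hN.corner (σ'.trans σ) (by simp [hσ, hσ'])

end

section
/-- The standard cone, with the inequalities interpreted by `R`. -/
def PIn (R : ℝ → ℝ → Prop) (y : Fin 6 → ℝ) : Prop :=
  R 0 (y 1) ∧ R 0 (y 2) ∧ R 0 (y 3) ∧ R 0 (y 4) ∧ R 0 (y 5) ∧ R (y 1 + y 2 + y 3 + y 4 + y 5) (y 0)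

/-- The closed and the open cone of `n` are described by `P`. -/
def Desc (n : Fin 6 → Fin 6 → ℝ) (P : (ℝ → ℝ → Prop) → (Fin 6 → ℝ) → Prop) : Prop :=
  (∀ y, Reg n y ↔ P (· ≤ ·) y) ∧ (∀ y, SReg n y ↔ P (· < ·) y)

/-- A corner tile. -/
def PS (s : ℝ) (k : Fin 6) (R : ℝ → ℝ → Prop) (y : Fin 6 → ℝ) : Prop :=
  R 0 (y 2) ∧ R 0 (y 3) ∧ R 0 (y 4) ∧ R (y 1 + y 2 + y 3 + y 4 + y 5) (y 0) ∧
    R ((1 - s) * (y 0 - y 5)) (y 1) ∧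
    R (if k = 1 then y 1 - y 0 + 2 * s ^ 2 * (y 0 - y 5) else
      -(1 - s - s ^ 2) * y 0 + (1 - s) * y 1 + s * y k - (s + s ^ 2) * y 5) 0

/-- A tile cut off at the vertex `wv 5` by one wall. -/
def PA (k : Fin 6) (R : ℝ → ℝ → Prop) (y : Fin 6 → ℝ) : Prop :=
  PIn R y ∧ R (y 0 + y k) (2 * y 5)

/-- A tile along the edge from `wv 5` to `wv j`. -/
def PC (j : Fin 6) (R : ℝ → ℝ → Prop) (y : Fin 6 → ℝ) : Prop :=
  PIn R y ∧ R (y 0 - y 5) (2 * y j) ∧ R (2 * y j) (y 0 + y 5)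

/-- A tile at `wv 5` not reaching the opposite vertices. -/
def PB (k : Fin 6) (R : ℝ → ℝ → Prop) (y : Fin 6 → ℝ) : Prop :=
  PIn R y ∧ R (y 0 - y 5) (2 * y 1) ∧ R (2 * y 1 + 2 * y k) (y 0 + 3 * y 5)

lemma Corner.desc {m : Fin 6 → Fin 6 → ℝ} {s : ℝ} {k : Fin 6} (hm : Corner m)
    (h : StarCorner m s k) : Desc m (PS s k) := by
  have hs := h.half_le
  have h5 : ∀ y, 2 * s * qf (m 5) y = (if k = 1 then y 1 - y 0 + 2 * s ^ 2 * (y 0 - y 5) else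
      -(1 - s - s ^ 2) * y 0 + (1 - s) * y 1 + s * y k - (s + s ^ 2) * y 5) := fun y => by
    rcases h.five with ⟨hk, h⟩ | ⟨hk, h⟩
    · rw [if_pos hk, h]
    · rw [if_neg, h]
      rintro rfl
      simp at hk
  constructor
  · intro y
    rw [hm.reg_iff, h.one, PS, ← h5]
    refine and_congr_right fun _ => and_congr_right fun _ => and_congr_right fun _ =>
      and_congr_right fun _ => and_congr (by rw [sub_nonpos]) ?_
    constructor <;> intro h <;> nlinarith
  · intro y
    rw [hm.sreg_iff, h.one, PS, ← h5]
    refine and_congr_right fun _ => and_congr_right fun _ => and_congr_right fun _ =>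
      and_congr_right fun _ => and_congr (by rw [sub_neg]) ?_
    constructor <;> intro h <;> nlinarith

lemma desc_of_perm {n : Fin 6 → Fin 6 → ℝ} {ρ σ : Equiv.Perm (Fin 6)} (hσ : σ 0 = 0)
    {P : (ℝ → ℝ → Prop) → (Fin 6 → ℝ) → Prop} (h : Desc (fun j => n (ρ j) ∘ σ) P) :
    Desc n fun R y => P R (y ∘ σ) :=
  ⟨fun y => by
    change _ ↔ P (· ≤ ·) (y ∘ σ)
    rw [← h.1, reg_perm (n := fun j => n (ρ j)) hσ]; exact (reg_reindex ρ y).symm,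
    fun y => by
    change _ ↔ P (· < ·) (y ∘ σ)
    rw [← h.2, sreg_perm (n := fun j => n (ρ j)) hσ]; exact (sreg_reindex ρ y).symm⟩

lemma Desc.congr {n : Fin 6 → Fin 6 → ℝ} {P Q : (ℝ → ℝ → Prop) → (Fin 6 → ℝ) → Prop}
    (h : Desc n P) (h1 : ∀ y, P (· ≤ ·) y ↔ Q (· ≤ ·) y) (h2 : ∀ y, P (· < ·) y ↔ Q (· < ·) y) :
    Desc n Q := ⟨fun y => (h.1 y).trans (h1 y), fun y => (h.2 y).trans (h2 y)⟩

variable {ι : Type} {M : Fin 6 → Fin 6 → ℝ} {N : ι → Fin 6 → Fin 6 → ℝ}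

lemma StarFam.exists_desc (hN : StarFam M N) {σ : Equiv.Perm (Fin 6)} (hσ : σ 0 = 0) :
    ∃ t s k, 1 / 2 ≤ s ∧ s ≤ 1 ∧ (k = 1 ∨ k = 2 ∨ k = 3 ∨ k = 4) ∧
      Desc (N t) fun R y => PS s k R (y ∘ σ) := by
  obtain ⟨t, ρ, s, k, hm, h⟩ := hN.corner σ hσ
  refine ⟨t, s, k, h.half_le, h.le_one, ?_, desc_of_perm hσ (hm.desc h)⟩
  rcases h.five with ⟨h, -⟩ | ⟨h, -⟩ <;> tauto

lemma Desc.eq_one {n : Fin 6 → Fin 6 → ℝ} {s s' : ℝ} {k k' : Fin 6} (hs1 : s ≤ 1)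
    (hs' : 1 / 2 ≤ s') (hs1' : s' ≤ 1)
    (hk' : k' = 1 ∨ k' = 2 ∨ k' = 3 ∨ k' = 4) (h : Desc n (PS s k))
    (h' : Desc n fun R y => PS s' k' R (y ∘ Equiv.swap 1 2)) : s = 1 := by
  have h1 := (h'.1 ![11, 0, 1 - s', 0, 0, 10]).mpr (by
    rcases hk' with rfl | rfl | rfl | rfl <;>
    simp [PS, Equiv.swap_apply_def] <;> norm_num <;>
    (try refine ⟨by linarith, ?_⟩) <;> nlinarith)
  rw [h.1] at h1
  have := h1.2.2.2.2.1
  simp at this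
  linarith

lemma PS.near {s η : ℝ} {k : Fin 6} (hs : 1 / 2 ≤ s) (hs1 : s ≤ 1)
    (hk : k = 1 ∨ k = 2 ∨ k = 3 ∨ k = 4) (hη : 0 < η) {y : Fin 6 → ℝ}
    (h0 : y 0 = 11) (h5 : y 5 = 10) (h1 : y 1 = 1 - s + η) (h2 : 0 < y 2) (h3 : 0 < y 3)
    (h4 : 0 < y 4) (hsum : y 1 + y 2 + y 3 + y 4 < 1) : PS s k (· < ·) y := by
  have hss : s ^ 2 ≤ 1 := by nlinarith
  have hb : ∀ x, 0 < x → x < 1 → s * x ≤ 1 := fun x h h' => by nlinarith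
  have b1 : (1 - s) * y 1 ≤ 1 := by
    rw [h1]; nlinarith
  refine ⟨h2, h3, h4, by linarith, by rw [h0, h5, h1]; linarith, ?_⟩
  have hy1 : 0 < y 1 := by linarith
  rcases hk with rfl | rfl | rfl | rfl
  · rw [if_pos rfl, h0, h5]; linarith
  all_goals rw [if_neg (by decide), h0, h5]
  · linarith [hb (y 2) h2 (by linarith)]
  · linarith [hb (y 3) h3 (by linarith)]
  · linarith [hb (y 4) h4 (by linarith)]

lemma PS.overlap {s s' : ℝ} {k k' : Fin 6} (hs : 1 / 2 ≤ s) (hs1 : s ≤ 1)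
    (hs' : 1 / 2 ≤ s') (hs1' : s' ≤ 1) (hss : 1 < s + s')
    (hk : k = 1 ∨ k = 2 ∨ k = 3 ∨ k = 4) (hk' : k' = 1 ∨ k' = 2 ∨ k' = 3 ∨ k' = 4) :
    ∃ y, PS s k (· < ·) y ∧ PS s' k' (· < ·) (y ∘ Equiv.swap 1 2) := by
  obtain ⟨η, hη⟩ : ∃ η, η = (s + s' - 1) / 8 := ⟨_, rfl⟩
  have h0 : 0 < η := by linarith
  have h1 : 0 < 1 - s + η := by linarith
  have h1' : 0 < 1 - s' + η := by linarith
  have hsum : 1 - s + η + (1 - s' + η) + η + η < 1 := by linarith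
  refine ⟨![11, 1 - s + η, 1 - s' + η, η, η, 10],
    PS.near hs hs1 hk h0 rfl rfl rfl h1' h0 h0 hsum,
    PS.near hs' hs1' hk' h0 rfl rfl rfl h1 h0 h0 ?_⟩
  change 1 - s' + η + (1 - s + η) + η + η < 1
  linarith

lemma Desc.of_one {n : Fin 6 → Fin 6 → ℝ} {k : Fin 6} (hk : k = 1 ∨ k = 2 ∨ k = 3 ∨ k = 4)
    (h : Desc n (PS 1 k)) : Desc n (PA k) := by
  refine h.congr (fun y => ?_) (fun y => ?_) <;> dsimp only [PS, PA, PIn] <;>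
  · rcases hk with rfl | rfl | rfl | rfl <;>
    first | rw [if_pos rfl] | rw [if_neg (by decide)]
    all_goals
      constructor
      · rintro ⟨h1, h2, h3, h4, h5, h6⟩
        refine ⟨⟨?_, ?_, ?_, ?_, ?_, ?_⟩, ?_⟩ <;> linarith
      · rintro ⟨⟨h1, h2, h3, h4, h5, h6⟩, h7⟩
        refine ⟨?_, ?_, ?_, ?_, ?_, ?_⟩ <;> linarith

lemma Desc.of_half_own {n : Fin 6 → Fin 6 → ℝ} (h : Desc n (PS (1 / 2) 1)) : Desc n (PC 1) := by
  refine h.congr (fun y => ?_) (fun y => ?_) <;> dsimp only [PS, PC, PIn] <;>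
  · rw [if_pos rfl]
    constructor
    · rintro ⟨h1, h2, h3, h4, h5, h6⟩
      refine ⟨⟨?_, ?_, ?_, ?_, ?_, ?_⟩, ?_, ?_⟩ <;> linarith
    · rintro ⟨⟨h1, h2, h3, h4, h5, h6⟩, h7, h8⟩
      refine ⟨?_, ?_, ?_, ?_, ?_, ?_⟩ <;> linarith

lemma Desc.of_half_other {n : Fin 6 → Fin 6 → ℝ} {k : Fin 6} (hk : k = 2 ∨ k = 3 ∨ k = 4)
    (h : Desc n (PS (1 / 2) k)) : Desc n (PB k) := by
  refine h.congr (fun y => ?_) (fun y => ?_) <;> dsimp only [PS, PB, PIn] <;>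
  · rcases hk with rfl | rfl | rfl <;> rw [if_neg (by decide)]
    all_goals
      constructor
      · rintro ⟨h1, h2, h3, h4, h5, h6⟩
        refine ⟨⟨?_, ?_, ?_, ?_, ?_, ?_⟩, ?_, ?_⟩ <;> linarith
      · rintro ⟨⟨h1, h2, h3, h4, h5, h6⟩, h7, h8⟩
        refine ⟨?_, ?_, ?_, ?_, ?_, ?_⟩ <;> linarith

/-- The three possible shapes of a corner tile. -/
lemma StarFam.corner_shape (hN : StarFam M N) : ∃ t,
    (∃ k, (k = 1 ∨ k = 2 ∨ k = 3 ∨ k = 4) ∧ Desc (N t) (PA k)) ∨ Desc (N t) (PC 1) ∨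
      ∃ k, (k = 2 ∨ k = 3 ∨ k = 4) ∧ Desc (N t) (PB k) := by
  obtain ⟨t, s, k, hs, hs1, hk, h⟩ := hN.exists_desc (σ := 1) rfl
  obtain ⟨t', s', k', hs', hs1', hk', h'⟩ :=
    hN.exists_desc (σ := Equiv.swap 1 2) (by decide)
  change Desc (N t) (PS s k) at h
  refine ⟨t, ?_⟩
  by_cases hss : 1 < s + s'
  · left
    obtain ⟨y, hy, hy'⟩ := PS.overlap hs hs1 hs' hs1' hss hk hk'
    have htt := hN.fam.disj _ _ _ ((h.2 y).mpr hy) ((h'.2 y).mpr hy')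
    subst htt
    have h1 := h.eq_one hs1 hs' hs1' hk' h'
    subst h1
    exact ⟨k, hk, h.of_one hk⟩
  · right
    have h1 : s = 1 / 2 := by linarith
    subst h1
    rcases hk with rfl | hk
    · exact Or.inl h.of_half_own
    · exact Or.inr ⟨k, hk, h.of_half_other hk⟩

end

lemma SReg.exists_small {n : Fin 6 → Fin 6 → ℝ} {y : Fin 6 → ℝ} (hy : SReg n y)
    (d : Fin 6 → ℝ) : ∃ δ > (0 : ℝ), ∀ ε : ℝ, 0 < ε → ε < δ → SReg n (y + ε • d) := by
  choose δ h0 h using fun k => CD.exists_small (d := qf (n k) d) (hy k)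
  refine ⟨Finset.univ.inf' Finset.univ_nonempty δ, ?_, fun ε h1 h2 k => ?_⟩
  · rw [gt_iff_lt, Finset.lt_inf'_iff]
    exact fun k _ => h0 k
  · rw [qf_add_right, qf_smul_right]
    exact h k ε h1 (h2.trans_le (Finset.inf'_le _ (Finset.mem_univ k)))

lemma SReg.reg {n : Fin 6 → Fin 6 → ℝ} {y : Fin 6 → ℝ} (hy : SReg n y) : Reg n y :=
  fun k => (hy k).le

lemma SReg.add_reg {n : Fin 6 → Fin 6 → ℝ} {y z : Fin 6 → ℝ} (hy : SReg n y) (hz : Reg n z) :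
    SReg n (y + z) := fun k => by rw [qf_add_right]; linarith [hy k, hz k]

lemma SReg.smul {n : Fin 6 → Fin 6 → ℝ} {y : Fin 6 → ℝ} (hy : SReg n y) {a : ℝ} (ha : 0 < a) :
    SReg n (a • y) := fun k => by rw [qf_smul_right]; nlinarith [hy k]

lemma Reg.smul {n : Fin 6 → Fin 6 → ℝ} {y : Fin 6 → ℝ} (hy : Reg n y) {a : ℝ} (ha : 0 ≤ a) :
    Reg n (a • y) := fun k => by rw [qf_smul_right]; nlinarith [hy k]

lemma SReg.PIn {n : Fin 6 → Fin 6 → ℝ} {y : Fin 6 → ℝ} (hn : Tile n) (hy : SReg n y) :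
    PIn (· < ·) y := by
  have h0 := hn.pN_neg hy 0
  have h1 := hn.pN_neg hy 1
  have h2 := hn.pN_neg hy 2
  have h3 := hn.pN_neg hy 3
  have h4 := hn.pN_neg hy 4
  have h5 := hn.pN_neg hy 5
  rw [qf_pN_zero] at h0
  rw [qf_pN (by decide)] at h1 h2 h3 h4 h5
  refine ⟨?_, ?_, ?_, ?_, ?_, ?_⟩ <;> linarith

section
variable {ι : Type} {M : Fin 6 → Fin 6 → ℝ} {N : ι → Fin 6 → Fin 6 → ℝ}

lemma Fam.eq_of_sreg_reg (hN : Fam M N) {t t' : ι} {y : Fin 6 → ℝ} (h : SReg (N t) y)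
    (h' : Reg (N t') y) : t = t' := by
  obtain ⟨δ, h0, hδ⟩ := h.exists_small (hN.tile t').mid
  refine hN.disj t t' (y + (δ / 2) • (hN.tile t').mid) (hδ _ (by linarith) (by linarith)) ?_
  rw [add_comm]
  have hpos : 0 < δ / 2 := by linarith
  exact ((hN.tile t').mid_sreg.smul hpos).add_reg (h' : Reg (N t') y)

/-- A tile at the far end of the edge from `wv 5` to `wv a`. -/
def PT (a : Fin 6) (R : ℝ → ℝ → Prop) (y : Fin 6 → ℝ) : Prop :=
  PIn R y ∧ R (y 0 + y 5) (2 * y a)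

lemma Desc.comp {n : Fin 6 → Fin 6 → ℝ} {σ : Equiv.Perm (Fin 6)} (hσ : σ 0 = 0)
    {P : (ℝ → ℝ → Prop) → (Fin 6 → ℝ) → Prop} (h : Desc (fun j => n j ∘ σ) P) :
    Desc n fun R y => P R (y ∘ σ) := desc_of_perm (ρ := 1) hσ h

lemma StarFam.edge_one (hN : StarFam M N)
    (h : ¬ ∃ t k, (k = 1 ∨ k = 2 ∨ k = 3 ∨ k = 4) ∧ Desc (N t) (PA k)) :
    (∃ t, Desc (N t) (PC 1)) ∧ ∃ t, Desc (N t) (PT 1) := by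
  obtain ⟨t, ht⟩ := hN.corner_shape
  obtain ⟨t', ht'⟩ := (hN.perm (σ := Equiv.swap 1 5) (by decide)).corner_shape
  have hs : Equiv.swap (1 : Fin 6) 5 0 = 0 := by decide
  have key : ∀ y z, SReg (N t) y → SReg (N t') y → Reg (N t) z → ¬ Reg (N t') z → False :=
    fun y z h1 h2 h3 h4 => h4 (hN.fam.disj _ _ _ h1 h2 ▸ h3)
  rcases ht with ⟨k, hk, ht⟩ | ht | ⟨k, hk, ht⟩
  · exact absurd ⟨t, k, hk, ht⟩ h
  · have h5 : Reg (N t) ![1, 0, 0, 0, 0, 1] := (ht.1 _).mpr (by simp [PC, PIn])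
    have hy : SReg (N t) ![5.6, 3.1, 0.1, 0.1, 0.1, 2.1] :=
      (ht.2 _).mpr (by simp [PC, PIn]; norm_num)
    rcases ht' with ⟨k, hk, ht'⟩ | ht' | ⟨k, hk, ht'⟩
    · have h' := ht'.comp hs
      rcases hk with rfl | hk
      · refine ⟨⟨t, ht⟩, t', h'.congr (fun y => ?_) (fun y => ?_)⟩ <;>
        · simp only [PA, PT, PIn, Function.comp]
          have e1 : Equiv.swap (1 : Fin 6) 5 1 = 5 := by decide
          have e2 : Equiv.swap (1 : Fin 6) 5 2 = 2 := by decide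
          have e3 : Equiv.swap (1 : Fin 6) 5 3 = 3 := by decide
          have e4 : Equiv.swap (1 : Fin 6) 5 4 = 4 := by decide
          have e5 : Equiv.swap (1 : Fin 6) 5 5 = 1 := by decide
          rw [hs, e1, e2, e3, e4, e5]
          constructor <;> rintro ⟨⟨h1, h2, h3, h4, h5, h6⟩, h7⟩ <;>
            refine ⟨⟨?_, ?_, ?_, ?_, ?_, ?_⟩, ?_⟩ <;> linarith
      · exfalso
        refine key _ _ hy ((h'.2 _).mpr ?_) h5 (mt (h'.1 _).mp ?_) <;>
        rcases hk with rfl | rfl | rfl <;>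
        simp [PA, PIn, Equiv.swap_apply_def] <;> norm_num
    · exfalso
      have h' := ht'.comp hs
      refine key _ _ hy ((h'.2 _).mpr ?_) h5 (mt (h'.1 _).mp ?_) <;>
      simp [PC, PIn, Equiv.swap_apply_def]
      norm_num
    · exfalso
      have h' := ht'.comp hs
      refine key _ _ hy ((h'.2 _).mpr ?_) h5 (mt (h'.1 _).mp ?_) <;>
      rcases hk with rfl | rfl | rfl <;>
      simp [PB, PIn, Equiv.swap_apply_def] <;> norm_num
  · exfalso
    have h5 : Reg (N t) ![1, 0, 0, 0, 0, 1] := (ht.1 _).mpr (by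
      rcases hk with rfl | rfl | rfl <;> simp [PB, PIn] <;> norm_num)
    have hy : SReg (N t) ![5.6, 3.1, 0.1, 0.1, 0.1, 2.1] := (ht.2 _).mpr (by
      rcases hk with rfl | rfl | rfl <;> simp [PB, PIn] <;> norm_num)
    have hy' : SReg (N t) ![7.6, 5.1, 0.1, 0.1, 0.1, 2.1] := (ht.2 _).mpr (by
      rcases hk with rfl | rfl | rfl <;> simp [PB, PIn] <;> norm_num)
    rcases ht' with ⟨k, hk, ht'⟩ | ht' | ⟨k, hk, ht'⟩ <;> have h' := ht'.comp hs
    · rcases hk with rfl | hk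
      · refine key _ _ hy' ((h'.2 _).mpr ?_) h5 (mt (h'.1 _).mp ?_) <;>
        simp [PA, PIn, Equiv.swap_apply_def]
        norm_num
      · refine key _ _ hy ((h'.2 _).mpr ?_) h5 (mt (h'.1 _).mp ?_) <;>
        rcases hk with rfl | rfl | rfl <;>
        simp [PA, PIn, Equiv.swap_apply_def] <;> norm_num
    · refine key _ _ hy ((h'.2 _).mpr ?_) h5 (mt (h'.1 _).mp ?_) <;>
      simp [PC, PIn, Equiv.swap_apply_def]
      norm_num
    · refine key _ _ hy ((h'.2 _).mpr ?_) h5 (mt (h'.1 _).mp ?_) <;>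
      rcases hk with rfl | rfl | rfl <;>
      simp [PB, PIn, Equiv.swap_apply_def] <;> norm_num

lemma StarFam.edge (hN : StarFam M N)
    (h : ¬ ∃ t k, (k = 1 ∨ k = 2 ∨ k = 3 ∨ k = 4) ∧ Desc (N t) (PA k)) {j : Fin 6}
    (hj : j = 1 ∨ j = 2 ∨ j = 3 ∨ j = 4) :
    (∃ t, Desc (N t) (PC j)) ∧ ∃ t, Desc (N t) (PT j) := by
  have hs : Equiv.swap 1 j 0 = 0 := by rcases hj with rfl | rfl | rfl | rfl <;> decide
  have hpin : ∀ (R : ℝ → ℝ → Prop) y, PIn R (y ∘ Equiv.swap 1 j) ↔ PIn R y := by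
    intro R y
    rcases hj with rfl | rfl | rfl | rfl
    · simp
    all_goals
      simp only [PIn, Function.comp, Equiv.swap_apply_def, Fin.isValue, Fin.reduceEq, if_true,
        if_false]
      constructor
      all_goals
        rintro ⟨h1, h2, h3, h4, h5, h6⟩
        refine ⟨by assumption, by assumption, by assumption, by assumption, by assumption, ?_⟩
        convert h6 using 1
        ring
  have h5 : Equiv.swap 1 j 5 = 5 := by rcases hj with rfl | rfl | rfl | rfl <;> decide
  have hn : ¬ ∃ t k, (k = 1 ∨ k = 2 ∨ k = 3 ∨ k = 4) ∧
      Desc (fun i => N t i ∘ Equiv.swap 1 j) (PA k) := by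
    rintro ⟨t, k, hk, ht⟩
    refine h ⟨t, Equiv.swap 1 j k, ?_, (ht.comp hs).congr (fun y => ?_) (fun y => ?_)⟩
    · rcases hj with rfl | rfl | rfl | rfl <;> rcases hk with rfl | rfl | rfl | rfl <;> decide
    all_goals rw [PA, PA, hpin, Function.comp, Function.comp, Function.comp, hs, h5]
  obtain ⟨⟨t, ht⟩, t', ht'⟩ := (hN.perm hs).edge_one hn
  refine ⟨⟨t, (ht.comp hs).congr (fun y => ?_) (fun y => ?_)⟩, t',
    (ht'.comp hs).congr (fun y => ?_) (fun y => ?_)⟩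
  all_goals
    first | rw [PC, PC] | rw [PT, PT]
    rw [hpin]
    simp only [Function.comp, hs, h5, Equiv.swap_apply_left]

lemma InP.mul_eq_zero {v : Fin 6 → ℝ} (hv : InP v) (h : qf v v = 0) {i j : Fin 6}
    (hi : i ≠ 0) (hj : j ≠ 0) (hij : j ≠ i) : v i * v j = 0 := by
  obtain ⟨h1, h2, h3, h4, h5, hs⟩ := hv
  simp only [qf] at h
  have m12 := mul_nonneg h1 h2
  have m13 := mul_nonneg h1 h3
  have m14 := mul_nonneg h1 h4
  have m15 := mul_nonneg h1 h5
  have m23 := mul_nonneg h2 h3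
  have m24 := mul_nonneg h2 h4
  have m25 := mul_nonneg h2 h5
  have m34 := mul_nonneg h3 h4
  have m35 := mul_nonneg h3 h5
  have m45 := mul_nonneg h4 h5
  have hsq : (v 1 + v 2 + v 3 + v 4 + v 5) ^ 2 ≤ v 0 ^ 2 := by
    apply pow_le_pow_left₀ (by linarith) hs
  have hsum : v 1 * v 2 + v 1 * v 3 + v 1 * v 4 + v 1 * v 5 + v 2 * v 3 + v 2 * v 4 +
      v 2 * v 5 + v 3 * v 4 + v 3 * v 5 + v 4 * v 5 ≤ 0 := by nlinarith
  have z12 : v 1 * v 2 = 0 := by linarith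
  have z13 : v 1 * v 3 = 0 := by linarith
  have z14 : v 1 * v 4 = 0 := by linarith
  have z15 : v 1 * v 5 = 0 := by linarith
  have z23 : v 2 * v 3 = 0 := by linarith
  have z24 : v 2 * v 4 = 0 := by linarith
  have z25 : v 2 * v 5 = 0 := by linarith
  have z34 : v 3 * v 4 = 0 := by linarith
  have z35 : v 3 * v 5 = 0 := by linarith
  have z45 : v 4 * v 5 = 0 := by linarith
  fin_cases i <;> fin_cases j <;> simp only [Fin.reduceFinMk, Fin.isValue] <;>
  first
    | exact absurd rfl hi
    | exact absurd rfl hj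
    | exact absurd rfl hij
    | assumption
    | (rw [mul_comm]; assumption)

lemma InP.exists_wv {v : Fin 6 → ℝ} (hv : InP v) (h : qf v v = 0) (h0 : v ≠ 0) :
    ∃ i, i ≠ 0 ∧ 0 < v 0 ∧ v = v 0 • wv i := by
  have hz {i j : Fin 6} := hv.mul_eq_zero h (i := i) (j := j)
  obtain ⟨h1, h2, h3, h4, h5, hs⟩ := hv
  simp only [qf] at h
  have hp : 0 < v 0 := by
    refine lt_of_le_of_ne (by linarith) fun hz => h0 ?_
    funext i; fin_cases i <;> simp <;> linarith
  have fin : ∀ i, i ≠ 0 → (∀ j, j ≠ 0 → j ≠ i → v j = 0) →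
      ∃ i, i ≠ 0 ∧ 0 < v 0 ∧ v = v 0 • wv i := by
    clear hz
    intro i hi hz
    refine ⟨i, hi, hp, ?_⟩
    have hsq' : v i * v i = v 0 * v 0 := by
      fin_cases i
      · exact absurd rfl hi
      all_goals
        simp only [Fin.reduceFinMk, Fin.isValue] at hz ⊢
        first
          | (rw [hz 2 (by decide) (by decide), hz 3 (by decide) (by decide), hz 4 (by decide) (by decide), hz 5 (by decide) (by decide)] at h; linarith)
          | (rw [hz 1 (by decide) (by decide), hz 3 (by decide) (by decide), hz 4 (by decide) (by decide), hz 5 (by decide) (by decide)] at h; linarith)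
          | (rw [hz 1 (by decide) (by decide), hz 2 (by decide) (by decide), hz 4 (by decide) (by decide), hz 5 (by decide) (by decide)] at h; linarith)
          | (rw [hz 1 (by decide) (by decide), hz 2 (by decide) (by decide), hz 3 (by decide) (by decide), hz 5 (by decide) (by decide)] at h; linarith)
          | (rw [hz 1 (by decide) (by decide), hz 2 (by decide) (by decide), hz 3 (by decide) (by decide), hz 4 (by decide) (by decide)] at h; linarith)
    have hpos : 0 ≤ v i := by fin_cases i <;> first | exact absurd rfl hi | assumption
    have hi0 : v i = v 0 := by
      rcases mul_self_eq_mul_self_iff.mp hsq' with h | h <;> linarith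
    funext j
    by_cases hj0 : j = 0
    · subst hj0; simp [wv]
    · by_cases hji : j = i
      · subst hji; simp [wv, hi0]
      · simp [wv, hj0, hji, hz j hj0 hji]
  obtain ⟨i, hi, hvi⟩ : ∃ i, i ≠ 0 ∧ v i ≠ 0 := by
    by_contra! hc
    rw [hc 1 (by decide), hc 2 (by decide), hc 3 (by decide), hc 4 (by decide),
      hc 5 (by decide)] at h
    nlinarith [mul_pos hp hp]
  exact fin i hi fun j hj hij => (_root_.mul_eq_zero.mp (hz hi hj hij)).resolve_left hvi

end

lemma limit_nonpos {a b : ℝ} (h : ∀ ε > 0, a + ε * b ≤ 0) : a ≤ 0 := by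
  by_contra! hc
  obtain ⟨δ, h0, hδ⟩ := exists_small (c := -a) (d := -b) (by linarith)
  linarith [hδ (δ / 2) (by linarith) (by linarith), h (δ / 2) (by linarith)]

/-- A tile with the star shaped diagram. -/
structure StarTile (n : Fin 6 → Fin 6 → ℝ) : Prop where
  tile : Tile n
  gram : ∀ i j, qf (n i) (n j) = starG i j

/-- The null vector spanning the intersection of five walls of a star tile. -/
def apex (n : Fin 6 → Fin 6 → ℝ) : Fin 6 → ℝ := (2 : ℝ) • n 0 + n 1 + n 2 + n 3 + n 4

namespace StarTile
variable {n : Fin 6 → Fin 6 → ℝ}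

lemma qf_apex (hn : StarTile n) (k : Fin 6) :
    qf (n k) (apex n) = if k = 5 then -(1 / 2) else 0 := by
  simp only [apex, qf_add_right, qf_smul_right, hn.gram]
  fin_cases k <;> simp [starG]
  norm_num

lemma apex_eq (hn : StarTile n) : ∃ i, i ≠ 0 ∧ ∃ c > (0 : ℝ), apex n = c • wv i := by
  have hr : Reg n (apex n) := fun k => by rw [hn.qf_apex]; split_ifs <;> norm_num
  obtain ⟨i, hi, h0, h⟩ := (hn.tile.sub _ hr).exists_wv (by
    nth_rw 1 [apex]
    simp only [qf_add_left, qf_smul_left, hn.qf_apex]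
    simp) (fun h => by
      have := hn.qf_apex 5
      rw [h] at this
      simp [qf] at this)
  exact ⟨i, hi, _, h0, h⟩

lemma reg_of_apex (hn : StarTile n) {i : Fin 6} {c : ℝ} (hc : 0 < c) (h : apex n = c • wv i) :
    Reg n (wv i) := fun k => by
  have := hn.qf_apex k
  rw [h, qf_smul_right] at this
  have h2 : c * qf (n k) (wv i) ≤ 0 := by rw [this]; split_ifs <;> norm_num
  exact nonpos_of_mul_nonpos_right h2 hc

end StarTile

section
variable {ι : Type} {M : Fin 6 → Fin 6 → ℝ} {N : ι → Fin 6 → Fin 6 → ℝ}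

lemma StarFam.exists_star (hN : StarFam M N) :
    ∃ ρ : Equiv.Perm (Fin 6), ∀ t, StarTile (N t ∘ ρ) := by
  obtain ⟨ρ, hρ⟩ := hN.gram
  refine ⟨ρ, fun t => ⟨(hN.fam.tile t).reindex ρ, fun i j => ?_⟩⟩
  rw [← hρ, ← hN.fam.gram t]; rfl

lemma StarFam.exists_touch (hN : StarFam M N) (t : ι) : ∃ i, i ≠ 0 ∧ Reg (N t) (wv i) := by
  obtain ⟨ρ, hρ⟩ := hN.exists_star
  obtain ⟨i, hi, c, hc, h⟩ := (hρ t).apex_eq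
  exact ⟨i, hi, (reg_reindex ρ _).mp ((hρ t).reg_of_apex hc h)⟩

lemma wv_zero (i : Fin 6) : wv i 0 = 1 := by simp [wv]

lemma wv_self (i : Fin 6) : wv i i = 1 := by simp [wv]

lemma wv_ne {i j : Fin 6} (h0 : j ≠ 0) (h : j ≠ i) : wv i j = 0 := by simp [wv, h0, h]

/-- Translating far towards an ideal vertex. -/
lemma Fam.eq_of_far (hN : Fam M N) {t t' : ι} {y : Fin 6 → ℝ} (hy : SReg (N t) y) {i : Fin 6}
    (h : Reg (N t) (wv i)) (Λ : ℝ) (h0 : 0 ≤ Λ)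
    (h' : PIn (· < ·) (y + Λ • wv i) → SReg (N t') (y + Λ • wv i)) : t = t' := by
  have h1 : SReg (N t) (y + Λ • wv i) := hy.add_reg (h.smul h0)
  exact hN.disj _ _ _ h1 (h' (h1.PIn (hN.tile t)))

lemma Fam.eq_of_PA (hN : Fam M N) {t t' : ι} {k : Fin 6}
    (hk : k = 1 ∨ k = 2 ∨ k = 3 ∨ k = 4) (ht' : Desc (N t') (PA k))
    (h : Reg (N t) (wv 5)) : t = t' := by
  have hm := (hN.tile t).mid_sreg
  generalize (hN.tile t).mid = m at hm
  have hp := hm.PIn (hN.tile t)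
  obtain ⟨h1, h2, h3, h4, h5, h6⟩ := hp
  refine hN.eq_of_far hm h (m 0 + m k) ?_ fun hp => (ht'.2 _).mpr ⟨hp, ?_⟩
  · rcases hk with rfl | rfl | rfl | rfl <;> linarith
  · simp only [Pi.add_apply, Pi.smul_apply, smul_eq_mul, wv_zero, wv_self]
    rw [wv_ne (j := k)] <;> rcases hk with rfl | rfl | rfl | rfl <;>
    first | decide | linarith

lemma Fam.eq_of_PT (hN : Fam M N) {t t' : ι} {k : Fin 6}
    (hk : k = 1 ∨ k = 2 ∨ k = 3 ∨ k = 4) (ht' : Desc (N t') (PT k))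
    (h : Reg (N t) (wv k)) : t = t' := by
  have hm := (hN.tile t).mid_sreg
  generalize (hN.tile t).mid = m at hm
  have hp := hm.PIn (hN.tile t)
  obtain ⟨h1, h2, h3, h4, h5, h6⟩ := hp
  refine hN.eq_of_far hm h (m 0 + m 5) (by linarith) fun hp => (ht'.2 _).mpr ⟨hp, ?_⟩
  simp only [Pi.add_apply, Pi.smul_apply, smul_eq_mul, wv_zero, wv_self]
  rw [wv_ne (j := 5)] <;> rcases hk with rfl | rfl | rfl | rfl <;>
  first | decide | linarith

lemma StarFam.exists_no_PA (hN : StarFam M N) : ∃ σ : Equiv.Perm (Fin 6), σ 0 = 0 ∧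
    ¬ ∃ t k, (k = 1 ∨ k = 2 ∨ k = 3 ∨ k = 4) ∧ Desc (fun i => N t i ∘ σ) (PA k) := by
  obtain ⟨t, ht⟩ := hN.fam.cov ![1, 0, 0, 0, 0, 0] (by simp [InP])
  obtain ⟨i, hi, h⟩ := hN.exists_touch t
  have hσ : Equiv.swap i 5 0 = 0 := Equiv.swap_apply_of_ne_of_ne hi.symm (by decide)
  refine ⟨Equiv.swap i 5, hσ, ?_⟩
  rintro ⟨t', k, hk, ht'⟩
  have hw : wv i ∘ Equiv.swap i 5 = wv 5 := by
    revert hi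
    fin_cases i <;> intro hi <;> first | exact absurd rfl hi | skip
    all_goals
      funext j
      fin_cases j <;> simp [wv, Equiv.swap_apply_def]
  have hv : (![1, 0, 0, 0, 0, 0] : Fin 6 → ℝ) ∘ Equiv.swap i 5 = ![1, 0, 0, 0, 0, 0] := by
    revert hi
    fin_cases i <;> intro hi <;> first | exact absurd rfl hi | skip
    all_goals
      funext j
      fin_cases j <;> simp [Equiv.swap_apply_def]
  have := (hN.fam.perm hσ).eq_of_PA hk ht' (t := t) (by
    rw [← hw]; exact (reg_perm hσ _).mpr h)
  subst this
  have h2 := (ht'.1 ![1, 0, 0, 0, 0, 0]).mp (by rw [← hv]; exact (reg_perm hσ _).mpr ht)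
  have h3 := h2.2
  rcases hk with rfl | rfl | rfl | rfl <;> simp at h3 <;> linarith

/-- A tile touching `wv 5` which is neither at the start nor at the end of an edge. -/
structure Middle (n : Fin 6 → Fin 6 → ℝ) : Prop where
  reg : Reg n (wv 5)
  lt : ∀ y, SReg n y → ∀ j, (j = 1 ∨ j = 2 ∨ j = 3 ∨ j = 4) → 2 * y j < y 0 - y 5

lemma StarFam.shape_or_middle (hN : StarFam M N)
    (h : ¬ ∃ t k, (k = 1 ∨ k = 2 ∨ k = 3 ∨ k = 4) ∧ Desc (N t) (PA k)) (t : ι) :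
    (∃ j, (j = 1 ∨ j = 2 ∨ j = 3 ∨ j = 4) ∧ Desc (N t) (PT j)) ∨
    (∃ j, (j = 1 ∨ j = 2 ∨ j = 3 ∨ j = 4) ∧ Desc (N t) (PC j)) ∨ Middle (N t) := by
  obtain ⟨i, hi, hr⟩ := hN.exists_touch t
  by_cases hi5 : i = 5
  · subst hi5
    right
    by_contra! hc
    obtain ⟨hC, hM⟩ := hc
    refine hM ⟨hr, fun y hy j hj => ?_⟩
    obtain ⟨⟨t', ht'⟩, -⟩ := hN.edge h hj
    have key : ∀ z, SReg (N t) z → ¬ z 0 - z 5 < 2 * z j := by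
      intro z hz hlt
      have hp := hz.PIn (hN.fam.tile t)
      have := hN.fam.eq_of_far (t' := t') hz hr (|z j|) (abs_nonneg _) fun hp => by
        refine (ht'.2 _).mpr ⟨hp, ?_⟩
        simp only [Pi.add_apply, Pi.smul_apply, smul_eq_mul, wv_zero, wv_self]
        rw [wv_ne (j := j) (by rcases hj with rfl | rfl | rfl | rfl <;> decide)
          (by rcases hj with rfl | rfl | rfl | rfl <;> decide)]
        have hq := hz.PIn (hN.fam.tile t)
        obtain ⟨h1, h2, h3, h4, h5, h6⟩ := hq
        constructor <;> linarith [le_abs_self (z j)]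
      subst this
      exact hC j hj ht'
    by_contra! hlt
    obtain ⟨δ, hδ, hs⟩ := hy.exists_small (wv j)
    refine key _ (hs (δ / 2) (by linarith) (by linarith)) ?_
    simp only [Pi.add_apply, Pi.smul_apply, smul_eq_mul, wv_zero, wv_self]
    rw [wv_ne (j := 5) (by decide) (by rcases hj with rfl | rfl | rfl | rfl <;> decide)]
    linarith
  · left
    have hj : i = 1 ∨ i = 2 ∨ i = 3 ∨ i = 4 := by omega
    obtain ⟨-, t', ht'⟩ := hN.edge h hj
    have := hN.fam.eq_of_PT hj ht' hr
    subst this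
    exact ⟨i, hj, ht'⟩

lemma Middle.le {n : Fin 6 → Fin 6 → ℝ} (hn : Tile n) (h : Middle n) {y : Fin 6 → ℝ}
    (hy : Reg n y) {j : Fin 6} (hj : j = 1 ∨ j = 2 ∨ j = 3 ∨ j = 4) : 2 * y j ≤ y 0 - y 5 := by
  have := limit_nonpos (a := 2 * y j - (y 0 - y 5))
    (b := 2 * hn.mid j - (hn.mid 0 - hn.mid 5)) fun ε hε => by
      have := h.lt (ε • hn.mid + y) ((hn.mid_sreg.smul hε).add_reg hy) j hj
      simp only [Pi.add_apply, Pi.smul_apply, smul_eq_mul] at this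
      linarith
  linarith

lemma StarFam.reg_sub (hN : StarFam M N)
    (h : ¬ ∃ t k, (k = 1 ∨ k = 2 ∨ k = 3 ∨ k = 4) ∧ Desc (N t) (PA k)) {t : ι}
    (ht : Middle (N t)) {y : Fin 6 → ℝ} (hy : SReg (N t) y) : Reg (N t) (y - y 5 • wv 5) := by
  obtain ⟨h1, h2, h3, h4, h5, h6⟩ := hy.PIn (hN.fam.tile t)
  have e0 : (y - y 5 • wv 5) 0 = y 0 - y 5 := by simp [wv]
  have e5 : (y - y 5 • wv 5) 5 = 0 := by simp [wv]
  have ej : ∀ j : Fin 6, (j = 1 ∨ j = 2 ∨ j = 3 ∨ j = 4) → (y - y 5 • wv 5) j = y j := by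
    rintro j (rfl | rfl | rfl | rfl) <;> simp [wv]
  obtain ⟨t', ht'⟩ := hN.fam.cov (y - y 5 • wv 5) (by
    unfold InP
    rw [e0, e5, ej 1 (by simp), ej 2 (by simp), ej 3 (by simp), ej 4 (by simp)]
    refine ⟨?_, ?_, ?_, ?_, ?_, ?_⟩ <;> linarith)
  rcases hN.shape_or_middle h t' with ⟨j, hj, hd⟩ | ⟨j, hj, hd⟩ | hd
  · have := ((hd.1 _).mp ht').2
    rw [e0, e5, ej j hj] at this
    linarith [ht.lt y hy j hj]
  · have := ((hd.1 _).mp ht').2.1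
    rw [e0, e5, ej j hj] at this
    linarith [ht.lt y hy j hj]
  · have : t = t' := by
      refine hN.fam.eq_of_sreg_reg hy ?_
      have e : y = (y - y 5 • wv 5) + y 5 • wv 5 := by simp
      rw [e]
      intro k
      rw [qf_add_right]
      linarith [ht' k, (hd.reg.smul h5.le) k]
    rwa [this]

/-- A wall of a middle tile lies on the wall of the cone opposite to `wv 5`. -/
lemma StarTile.five_eq {n : Fin 6 → Fin 6 → ℝ} (hn : StarTile n) {c : ℝ} (hc : 0 < c)
    (ha : apex n = c • wv 5) (h : ∀ y, SReg n y → Reg n (y - y 5 • wv 5)) :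
    n 5 = pN 5 ∧ c = 1 / 2 := by
  have hq := hn.qf_apex 5
  rw [ha, qf_smul_right, if_pos rfl] at hq
  have hq0 : qf (n 5) (wv 5) < 0 := by
    by_contra! h0
    nlinarith [mul_nonneg hc.le h0]
  have hl : ∀ l, l ≠ 5 → qf (pN 5) (hn.tile.dual l) = 0 := by
    intro l hl
    refine le_antisymm (hn.tile.pN_dual 5 l) ?_
    have := limit_nonpos (a := -(hn.tile.dual l 5 * qf (n 5) (wv 5)))
      (b := qf (n 5) hn.tile.mid - hn.tile.mid 5 * qf (n 5) (wv 5)) fun ε hε => by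
        have := h _ ((hn.tile.mid_sreg.smul hε).add_reg (hn.tile.dual_reg l)) 5
        rw [sub_eq_add_neg, ← neg_smul, qf_add_right, qf_add_right, qf_smul_right, qf_smul_right,
          hn.tile.qf_dual_ne hl.symm] at this
        simp only [Pi.add_apply, Pi.smul_apply, smul_eq_mul] at this
        linarith
    rw [qf_pN (by decide)]
    by_contra! h3
    nlinarith
  have h1 : pN 5 = (-qf (pN 5) (hn.tile.dual 5)) • n 5 := by
    conv_lhs => rw [hn.tile.eq_sum_normal (pN 5)]
    rw [Finset.sum_eq_single 5]
    · intro l _ h5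
      rw [hl l h5]; simp
    · simp
  have h2 := hn.tile.pN_dual 5 5
  generalize -qf (pN 5) (hn.tile.dual 5) = a at h1
  have ha2 : a * a = 1 := by
    have h3 : qf (pN 5) (pN 5) = 1 := by rw [qf_pN_pN 5 5 (by decide)]; simp
    rw [h1, qf_smul_left, qf_smul_right, hn.tile.unit] at h3
    linarith
  have h5 : qf (pN 5) (wv 5) = -1 := by rw [qf_pN (by decide), wv_self]
  have ha1 : a = 1 := by
    rcases mul_self_eq_one_iff.mp ha2 with h | h
    · exact h
    · rw [h1, h, qf_smul_left] at h5
      linarith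
  rw [ha1, one_smul] at h1
  refine ⟨h1.symm, ?_⟩
  rw [← h1, h5] at hq
  linarith

end

/-- `a, b, c, d` is a rearrangement of `1, 2, 3, 4`. -/
def Fr (a b c d : Fin 6) : Prop := ∃ σ : Equiv.Perm (Fin 6),
  σ 0 = 0 ∧ σ 5 = 5 ∧ σ 1 = a ∧ σ 2 = b ∧ σ 3 = c ∧ σ 4 = d

namespace Fr
variable {a b c d : Fin 6}

lemma swap_left (h : Fr a b c d) : Fr b a c d := by
  obtain ⟨σ, h0, h5, h1, h2, h3, h4⟩ := h
  exact ⟨(Equiv.swap 1 2).trans σ, by simpa [Equiv.swap_apply_def], by simpa [Equiv.swap_apply_def],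
    by simpa [Equiv.swap_apply_def], by simpa [Equiv.swap_apply_def],
    by simpa [Equiv.swap_apply_def], by simpa [Equiv.swap_apply_def]⟩

lemma swap_right (h : Fr a b c d) : Fr a b d c := by
  obtain ⟨σ, h0, h5, h1, h2, h3, h4⟩ := h
  exact ⟨(Equiv.swap 3 4).trans σ, by simpa [Equiv.swap_apply_def], by simpa [Equiv.swap_apply_def],
    by simpa [Equiv.swap_apply_def], by simpa [Equiv.swap_apply_def],
    by simpa [Equiv.swap_apply_def], by simpa [Equiv.swap_apply_def]⟩

lemma rev (h : Fr a b c d) : Fr d c b a := by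
  obtain ⟨σ, h0, h5, h1, h2, h3, h4⟩ := h
  exact ⟨((Equiv.swap 1 4).trans (Equiv.swap 2 3)).trans σ, by simpa [Equiv.swap_apply_def],
    by simpa [Equiv.swap_apply_def],
    by simpa [Equiv.swap_apply_def], by simpa [Equiv.swap_apply_def],
    by simpa [Equiv.swap_apply_def], by simpa [Equiv.swap_apply_def]⟩

lemma sum (h : Fr a b c d) (f : Fin 6 → ℝ) : f 1 + f 2 + f 3 + f 4 = f a + f b + f c + f d := by
  obtain ⟨σ, h0, h5, rfl, rfl, rfl, rfl⟩ := h
  have := Equiv.sum_comp σ f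
  rw [Fin.sum_univ_six, Fin.sum_univ_six, h0, h5] at this
  linarith

lemma forall_iff (h : Fr a b c d) (P : Fin 6 → Prop) :
    (P 1 ∧ P 2 ∧ P 3 ∧ P 4) ↔ (P a ∧ P b ∧ P c ∧ P d) := by
  have e : ∀ {σ : Equiv.Perm (Fin 6)}, σ 0 = 0 → σ 5 = 5 → ∀ i, (i = 1 ∨ i = 2 ∨ i = 3 ∨ i = 4) →
      (σ i = 1 ∨ σ i = 2 ∨ σ i = 3 ∨ σ i = 4) := by
    intro σ h0 h5 i hi
    have n0 : σ i ≠ 0 := fun h => by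
      have := σ.injective (h.trans h0.symm); subst this; simp at hi
    have n5 : σ i ≠ 5 := fun h => by
      have := σ.injective (h.trans h5.symm); subst this; simp at hi
    omega
  obtain ⟨σ, h0, h5, rfl, rfl, rfl, rfl⟩ := h
  constructor
  · rintro ⟨h1, h2, h3, h4⟩
    have f : ∀ i, (i = 1 ∨ i = 2 ∨ i = 3 ∨ i = 4) → P i := by
      rintro i (rfl | rfl | rfl | rfl) <;> assumption
    exact ⟨f _ (e h0 h5 _ (by simp)), f _ (e h0 h5 _ (by simp)), f _ (e h0 h5 _ (by simp)),
      f _ (e h0 h5 _ (by simp))⟩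
  · rintro ⟨h1, h2, h3, h4⟩
    have f : ∀ i, (i = 1 ∨ i = 2 ∨ i = 3 ∨ i = 4) → P (σ i) := by
      rintro i (rfl | rfl | rfl | rfl) <;> assumption
    have g : ∀ i, (i = 1 ∨ i = 2 ∨ i = 3 ∨ i = 4) → P i := fun i hi => by
      have := f (σ.symm i) (e (by rw [Equiv.symm_apply_eq, h0]) (by rw [Equiv.symm_apply_eq, h5])
        i hi)
      simpa using this
    exact ⟨g _ (by simp), g _ (by simp), g _ (by simp), g _ (by simp)⟩

lemma mem (h : Fr a b c d) : a = 1 ∨ a = 2 ∨ a = 3 ∨ a = 4 :=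
  ((h.forall_iff fun i => i = 1 ∨ i = 2 ∨ i = 3 ∨ i = 4).mp (by simp)).1

lemma ne (h : Fr a b c d) : b ≠ a ∧ c ≠ a ∧ d ≠ a := by
  obtain ⟨σ, h0, h5, rfl, rfl, rfl, rfl⟩ := h
  refine ⟨?_, ?_, ?_⟩ <;> intro h <;> simpa using σ.injective h

lemma pin (h : Fr a b c d) (R : ℝ → ℝ → Prop) (y : Fin 6 → ℝ) :
    PIn R y ↔ R 0 (y a) ∧ R 0 (y b) ∧ R 0 (y c) ∧ R 0 (y d) ∧ R 0 (y 5) ∧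
      R (y a + y b + y c + y d + y 5) (y 0) := by
  have := h.forall_iff fun i => R 0 (y i)
  rw [PIn, h.sum y]
  tauto

end Fr

/-- The restriction to the middle coordinates of the Euclidean form. -/
def sp (x y : Fin 6 → ℝ) : ℝ := x 1 * y 1 + x 2 * y 2 + x 3 * y 3 + x 4 * y 4

lemma Fr.sp {a b c d : Fin 6} (h : Fr a b c d) (x y : Fin 6 → ℝ) :
    sp x y = x a * y a + x b * y b + x c * y c + x d * y d := h.sum fun i => x i * y i

lemma exists_pair {V : Fin 6 → ℝ} (h1 : V 1 = 0 ∨ V 1 = 1) (h2 : V 2 = 0 ∨ V 2 = 1)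
    (h3 : V 3 = 0 ∨ V 3 = 1) (h4 : V 4 = 0 ∨ V 4 = 1) (hs : V 1 + V 2 + V 3 + V 4 = 2) :
    ∃ a b c d, Fr a b c d ∧ V a = 1 ∧ V b = 1 ∧ V c = 0 ∧ V d = 0 := by
  have f1 : Fr 1 2 3 4 := ⟨1, by simp⟩
  have f2 : Fr 1 3 2 4 := ⟨Equiv.swap 2 3, by decide⟩
  have f3 : Fr 1 4 3 2 := ⟨Equiv.swap 2 4, by decide⟩
  rcases h1 with h1 | h1 <;> rcases h2 with h2 | h2 <;> rcases h3 with h3 | h3 <;>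
    rcases h4 with h4 | h4 <;> rw [h1, h2, h3, h4] at hs <;>
    first
    | exact ⟨_, _, _, _, f1, h1, h2, h3, h4⟩
    | exact ⟨_, _, _, _, f2, h1, h3, h2, h4⟩
    | exact ⟨_, _, _, _, f3, h1, h4, h3, h2⟩
    | exact ⟨_, _, _, _, f1.rev, h4, h3, h2, h1⟩
    | exact ⟨_, _, _, _, f2.rev, h4, h2, h3, h1⟩
    | exact ⟨_, _, _, _, f3.rev, h2, h3, h4, h1⟩
    | (exfalso; linarith)

/-- A `0`-`1` vector with exactly two ones. -/
def IsPair (V : Fin 6 → ℝ) : Prop :=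
  (∀ j, (j = 1 ∨ j = 2 ∨ j = 3 ∨ j = 4) → V j = 0 ∨ V j = 1) ∧ V 1 + V 2 + V 3 + V 4 = 2

lemma isPair_of_le {V : Fin 6 → ℝ} (h0 : ∀ j, (j = 1 ∨ j = 2 ∨ j = 3 ∨ j = 4) → 0 ≤ V j)
    (h1 : ∀ j, (j = 1 ∨ j = 2 ∨ j = 3 ∨ j = 4) → V j ≤ 1) (hs : V 1 + V 2 + V 3 + V 4 ≤ 2)
    (h : sp V V = 2) : IsPair V := by
  have e : ∀ j, (j = 1 ∨ j = 2 ∨ j = 3 ∨ j = 4) → 0 ≤ V j * (1 - V j) := fun j hj =>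
    mul_nonneg (h0 j hj) (by linarith [h1 j hj])
  have e1 := e 1 (by simp)
  have e2 := e 2 (by simp)
  have e3 := e 3 (by simp)
  have e4 := e 4 (by simp)
  unfold sp at h
  refine ⟨fun j hj => ?_, by linarith⟩
  have : V j * (1 - V j) = 0 := by rcases hj with rfl | rfl | rfl | rfl <;> linarith
  rcases mul_eq_zero.mp this with h | h
  · exact Or.inl h
  · exact Or.inr (by linarith)

lemma three_pairs {U V W : Fin 6 → ℝ} (hU : IsPair U) (hV : IsPair V) (hW : IsPair W)
    (hUV : sp U V = 1) (hUW : sp U W = 1) (hVW : sp V W = 1) :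
    ∃ a b c d, Fr a b c d ∧ (U a = 1 ∧ U b = 1 ∧ U c = 0 ∧ U d = 0) ∧
      (V a = 1 ∧ V b = 0 ∧ V c = 1 ∧ V d = 0) ∧
      ((W a = 1 ∧ W b = 0 ∧ W c = 0 ∧ W d = 1) ∨ (W a = 0 ∧ W b = 1 ∧ W c = 1 ∧ W d = 0)) := by
  have hm : ∀ {X : Fin 6 → ℝ} {a b c d}, IsPair X → Fr a b c d → (X a = 0 ∨ X a = 1) ∧
      (X b = 0 ∨ X b = 1) ∧ (X c = 0 ∨ X c = 1) ∧ (X d = 0 ∨ X d = 1) ∧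
      X a + X b + X c + X d = 2 := by
    intro X a b c d hX h
    have := (h.forall_iff fun i => X i = 0 ∨ X i = 1).mp ⟨hX.1 1 (by simp), hX.1 2 (by simp),
      hX.1 3 (by simp), hX.1 4 (by simp)⟩
    exact ⟨this.1, this.2.1, this.2.2.1, this.2.2.2, by rw [← h.sum X]; exact hX.2⟩
  obtain ⟨a, b, c, d, hf, hu⟩ := exists_pair (hU.1 1 (by simp)) (hU.1 2 (by simp))
    (hU.1 3 (by simp)) (hU.1 4 (by simp)) hU.2
  have h2 : ∃ a b c d, Fr a b c d ∧ (U a = 1 ∧ U b = 1 ∧ U c = 0 ∧ U d = 0) ∧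
      (V a = 1 ∧ V b = 0 ∧ V c = 1 ∧ V d = 0) := by
    obtain ⟨ha, hb, hc, hd, hs⟩ := hm hV hf
    obtain ⟨u1, u2, u3, u4⟩ := hu
    rw [hf.sp, u1, u2, u3, u4] at hUV
    rcases ha with ha | ha <;> rcases hb with hb | hb <;> rcases hc with hc | hc <;>
      rcases hd with hd | hd <;> rw [ha, hb, hc, hd] at hs <;> rw [ha, hb, hc, hd] at hUV <;>
      first
      | exact ⟨_, _, _, _, hf, ⟨u1, u2, u3, u4⟩, ha, hb, hc, hd⟩
      | exact ⟨_, _, _, _, hf.swap_left, ⟨u2, u1, u3, u4⟩, hb, ha, hc, hd⟩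
      | exact ⟨_, _, _, _, hf.swap_right, ⟨u1, u2, u4, u3⟩, ha, hb, hd, hc⟩
      | exact ⟨_, _, _, _, hf.swap_left.swap_right, ⟨u2, u1, u4, u3⟩, hb, ha, hd, hc⟩
      | (exfalso; linarith)
  clear hf hu
  obtain ⟨a, b, c, d, hf, ⟨u1, u2, u3, u4⟩, v1, v2, v3, v4⟩ := h2
  refine ⟨a, b, c, d, hf, ⟨u1, u2, u3, u4⟩, ⟨v1, v2, v3, v4⟩, ?_⟩
  obtain ⟨ha, hb, hc, hd, hs⟩ := hm hW hf
  rw [hf.sp, u1, u2, u3, u4] at hUW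
  rw [hf.sp, v1, v2, v3, v4] at hVW
  rcases ha with ha | ha
  · right; refine ⟨ha, ?_, ?_, ?_⟩ <;> linarith
  · left; refine ⟨ha, ?_, ?_, ?_⟩ <;> linarith

/-- The first of the three kinds of middle tiles. -/
def PE (a : Fin 6) (R : ℝ → ℝ → Prop) (y : Fin 6 → ℝ) : Prop :=
  PIn R y ∧ R (2 * y a) (y 0 - y 5) ∧ R (y 1 + y 2 + y 3 + y 4) (2 * y a)

/-- The second kind of middle tiles. -/
def PQ (a : Fin 6) (R : ℝ → ℝ → Prop) (y : Fin 6 → ℝ) : Prop :=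
  PIn R y ∧ R (2 * y a) (y 1 + y 2 + y 3 + y 4) ∧
    ∀ b, (b = 1 ∨ b = 2 ∨ b = 3 ∨ b = 4) → b ≠ a → R (y 1 + y 2 + y 3 + y 4) (2 * (y a + y b))

/-- The third kind of middle tiles. -/
def PR (a : Fin 6) (R : ℝ → ℝ → Prop) (y : Fin 6 → ℝ) : Prop :=
  PIn R y ∧
    ∀ b, (b = 1 ∨ b = 2 ∨ b = 3 ∨ b = 4) → b ≠ a → R (2 * (y a + y b)) (y 1 + y 2 + y 3 + y 4)

lemma Fr.forall_ne {a b c d : Fin 6} (h : Fr a b c d) (P : Fin 6 → Prop) :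
    (∀ i, (i = 1 ∨ i = 2 ∨ i = 3 ∨ i = 4) → i ≠ a → P i) ↔ P b ∧ P c ∧ P d := by
  have := h.forall_iff fun i => i ≠ a → P i
  have hn := h.ne
  constructor
  · intro hP
    have := this.mp ⟨hP 1 (by simp), hP 2 (by simp), hP 3 (by simp), hP 4 (by simp)⟩
    exact ⟨this.2.1 hn.1, this.2.2.1 hn.2.1, this.2.2.2 hn.2.2⟩
  · rintro ⟨hb, hc, hd⟩
    have := this.mpr ⟨fun h => absurd rfl h, fun _ => hb, fun _ => hc, fun _ => hd⟩
    rintro i (rfl | rfl | rfl | rfl)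
    exacts [this.1, this.2.1, this.2.2.1, this.2.2.2]

/-- The normal form of a middle tile. -/
structure MidTile (n : Fin 6 → Fin 6 → ℝ) : Prop where
  five : ∀ y, qf (n 5) y = -y 5
  one : ∀ y, qf (n 1) y = sp (n 1) y - (y 0 - y 5) / 2
  mid : ∀ k, (k = 2 ∨ k = 3 ∨ k = 4) → ∀ y, qf (n k) y = sp (n k) y
  zero : ∀ y, qf (n 0) y = -(sp (n 1) y + sp (n 2) y + sp (n 3) y + sp (n 4) y) / 2
  orth : ∀ k l, (k = 1 ∨ k = 2 ∨ k = 3 ∨ k = 4) → (l = 1 ∨ l = 2 ∨ l = 3 ∨ l = 4) →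
    sp (n k) (n l) = if k = l then 1 else 0
  bd : ∀ y, Reg n y → InP y ∧ ∀ j, (j = 1 ∨ j = 2 ∨ j = 3 ∨ j = 4) → 2 * y j ≤ y 0 - y 5

lemma StarTile.midTile {n : Fin 6 → Fin 6 → ℝ} (hn : StarTile n) (h5 : n 5 = pN 5)
    (ha : apex n = (1 / 2 : ℝ) • wv 5) (hm : Middle n) : MidTile n := by
  have e5 : ∀ k, n k 5 = -starG 5 k := fun k => by
    rw [← hn.gram, h5, qf_pN (by decide)]; ring
  have e0 : ∀ k, k ≠ 5 → n k 0 = n k 5 := fun k hk => by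
    have := hn.qf_apex k
    rw [ha, qf_smul_right, qf_wv (by decide), if_neg hk] at this
    linarith
  have f1 : n 1 5 = 1 / 2 := by rw [e5]; simp [starG]
  have f2 : n 2 5 = 0 := by rw [e5]; simp [starG]
  have f3 : n 3 5 = 0 := by rw [e5]; simp [starG]
  have f4 : n 4 5 = 0 := by rw [e5]; simp [starG]
  have f0 : n 0 5 = 0 := by rw [e5]; simp [starG]
  have g0 : ∀ i, i ≠ 0 → i ≠ 5 → n 0 i = -(n 1 i + n 2 i + n 3 i + n 4 i) / 2 := fun i h0 h5 => by
    have := congrFun ha i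
    simp only [apex, Pi.add_apply, Pi.smul_apply, smul_eq_mul, wv_ne h0 h5] at this
    linarith
  have one : ∀ y, qf (n 1) y = sp (n 1) y - (y 0 - y 5) / 2 := fun y => by
    simp only [qf, sp, e0 1 (by decide), f1]; ring
  have mid : ∀ k, (k = 2 ∨ k = 3 ∨ k = 4) → ∀ y, qf (n k) y = sp (n k) y := by
    rintro k (rfl | rfl | rfl) y
    · simp only [qf, sp, e0 2 (by decide), f2]; ring
    · simp only [qf, sp, e0 3 (by decide), f3]; ring
    · simp only [qf, sp, e0 4 (by decide), f4]; ring
  refine ⟨fun y => by rw [h5, qf_pN (by decide)], one, mid, fun y => ?_, ?_,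
    fun y hy => ⟨hn.tile.sub y hy, fun j hj => hm.le hn.tile hy hj⟩⟩
  · simp only [qf, sp, e0 0 (by decide), f0, g0 1 (by decide) (by decide),
      g0 2 (by decide) (by decide), g0 3 (by decide) (by decide), g0 4 (by decide) (by decide)]
    ring
  · intro k l hk hl
    have hg := hn.gram k l
    by_cases h1 : k = 1
    · subst h1
      rw [one, e0 l (by rcases hl with rfl | rfl | rfl | rfl <;> decide)] at hg
      rw [show sp (n 1) (n l) = starG 1 l by linarith]
      rcases hl with rfl | rfl | rfl | rfl <;> simp [starG]
    · rw [mid k (by tauto)] at hg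
      rw [hg]
      rcases hk with rfl | rfl | rfl | rfl <;> rcases hl with rfl | rfl | rfl | rfl <;>
        simp [starG]

lemma forall_fin_six {P : Fin 6 → Prop} : (∀ i, P i) ↔ P 0 ∧ P 1 ∧ P 2 ∧ P 3 ∧ P 4 ∧ P 5 := by
  constructor
  · intro h; exact ⟨h 0, h 1, h 2, h 3, h 4, h 5⟩
  · rintro ⟨h0, h1, h2, h3, h4, h5⟩ i
    fin_cases i <;> assumption

namespace MidTile
variable {n : Fin 6 → Fin 6 → ℝ}

lemma reg_iff (hn : MidTile n) (y : Fin 6 → ℝ) : Reg n y ↔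
    0 ≤ y 5 ∧ 2 * sp (n 1) y ≤ y 0 - y 5 ∧ sp (n 2) y ≤ 0 ∧ sp (n 3) y ≤ 0 ∧ sp (n 4) y ≤ 0 ∧
      0 ≤ sp (n 1) y + sp (n 2) y + sp (n 3) y + sp (n 4) y := by
  rw [Reg, forall_fin_six, hn.zero, hn.one, hn.mid 2 (by simp), hn.mid 3 (by simp),
    hn.mid 4 (by simp), hn.five]
  constructor
  · rintro ⟨h0, h1, h2, h3, h4, h5⟩
    refine ⟨?_, ?_, ?_, ?_, ?_, ?_⟩ <;> linarith
  · rintro ⟨h0, h1, h2, h3, h4, h5⟩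
    refine ⟨?_, ?_, ?_, ?_, ?_, ?_⟩ <;> linarith

lemma sreg_iff (hn : MidTile n) (y : Fin 6 → ℝ) : SReg n y ↔
    0 < y 5 ∧ 2 * sp (n 1) y < y 0 - y 5 ∧ sp (n 2) y < 0 ∧ sp (n 3) y < 0 ∧ sp (n 4) y < 0 ∧
      0 < sp (n 1) y + sp (n 2) y + sp (n 3) y + sp (n 4) y := by
  rw [SReg, forall_fin_six, hn.zero, hn.one, hn.mid 2 (by simp), hn.mid 3 (by simp),
    hn.mid 4 (by simp), hn.five]
  constructor
  · rintro ⟨h0, h1, h2, h3, h4, h5⟩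
    refine ⟨?_, ?_, ?_, ?_, ?_, ?_⟩ <;> linarith
  · rintro ⟨h0, h1, h2, h3, h4, h5⟩
    refine ⟨?_, ?_, ?_, ?_, ?_, ?_⟩ <;> linarith

/-- Points of the top face satisfy the bounds of a middle tile. -/
lemma bound (hn : MidTile n) {V : Fin 6 → ℝ} (h1 : sp (n 1) V ≤ 1) (h2 : sp (n 2) V ≤ 0)
    (h3 : sp (n 3) V ≤ 0) (h4 : sp (n 4) V ≤ 0)
    (h0 : 0 ≤ sp (n 1) V + sp (n 2) V + sp (n 3) V + sp (n 4) V) :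
    (∀ j, (j = 1 ∨ j = 2 ∨ j = 3 ∨ j = 4) → 0 ≤ V j) ∧
      (∀ j, (j = 1 ∨ j = 2 ∨ j = 3 ∨ j = 4) → V j ≤ 1) ∧ V 1 + V 2 + V 3 + V 4 ≤ 2 := by
  have hs : ∀ x, sp x ![2, V 1, V 2, V 3, V 4, 0] = sp x V := fun x => rfl
  obtain ⟨h, h'⟩ := hn.bd ![2, V 1, V 2, V 3, V 4, 0] (by
    rw [hn.reg_iff]
    simp only [hs]
    refine ⟨le_refl 0, ?_, h2, h3, h4, h0⟩
    change _ ≤ (2 : ℝ) - 0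
    linarith)
  obtain ⟨p1, p2, p3, p4, p5, p0⟩ := h
  change 0 ≤ V 1 at p1
  change 0 ≤ V 2 at p2
  change 0 ≤ V 3 at p3
  change 0 ≤ V 4 at p4
  change V 1 + V 2 + V 3 + V 4 + 0 ≤ 2 at p0
  refine ⟨?_, ?_, by linarith⟩
  · rintro j (rfl | rfl | rfl | rfl) <;> assumption
  · intro j hj
    have := h' j hj
    have hj2 : (![2, V 1, V 2, V 3, V 4, 0] : Fin 6 → ℝ) j = V j := by
      rcases hj with rfl | rfl | rfl | rfl <;> rfl
    rw [hj2] at this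
    change _ ≤ (2 : ℝ) - 0 at this
    linarith

lemma sp_sub (x y z : Fin 6 → ℝ) : sp x (y - z) = sp x y - sp x z := by
  simp only [sp, Pi.sub_apply]; ring

lemma sub_sp (x y z : Fin 6 → ℝ) : sp (y - z) x = sp y x - sp z x := by
  simp only [sp, Pi.sub_apply]; ring

lemma isPair (hn : MidTile n) {k : Fin 6} (hk : k = 2 ∨ k = 3 ∨ k = 4) : IsPair (n 1 - n k) := by
  have h1k : (1 : Fin 6) ≠ k := by rcases hk with rfl | rfl | rfl <;> decide
  have hk' : k = 1 ∨ k = 2 ∨ k = 3 ∨ k = 4 := Or.inr hk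
  have e : ∀ l, (l = 1 ∨ l = 2 ∨ l = 3 ∨ l = 4) →
      sp (n l) (n 1 - n k) = (if l = 1 then 1 else 0) - if l = k then 1 else 0 := fun l hl => by
    rw [sp_sub, hn.orth l 1 hl (by simp), hn.orth l k hl hk']
  have e1 := e 1 (by simp)
  have e2 := e 2 (by simp)
  have e3 := e 3 (by simp)
  have e4 := e 4 (by simp)
  obtain ⟨b0, b1, bs⟩ := hn.bound (V := n 1 - n k)
    (by rw [e1]; simp [h1k])
    (by rw [e2]; rcases hk with rfl | rfl | rfl <;> simp)
    (by rw [e3]; rcases hk with rfl | rfl | rfl <;> simp)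
    (by rw [e4]; rcases hk with rfl | rfl | rfl <;> simp)
    (by rw [e1, e2, e3, e4]; rcases hk with rfl | rfl | rfl <;> simp)
  refine isPair_of_le b0 b1 bs ?_
  rw [sub_sp, e1, e k hk']
  simp [h1k, h1k.symm]; norm_num

lemma pair_dot (hn : MidTile n) {k l : Fin 6} (hk : k = 2 ∨ k = 3 ∨ k = 4)
    (hl : l = 2 ∨ l = 3 ∨ l = 4) (hkl : k ≠ l) : sp (n 1 - n k) (n 1 - n l) = 1 := by
  have hk' : k = 1 ∨ k = 2 ∨ k = 3 ∨ k = 4 := Or.inr hk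
  have hl' : l = 1 ∨ l = 2 ∨ l = 3 ∨ l = 4 := Or.inr hl
  have h1k : k ≠ (1 : Fin 6) := by rcases hk with rfl | rfl | rfl <;> decide
  have h1l : 1 ≠ (l : Fin 6) := by rcases hl with rfl | rfl | rfl <;> decide
  rw [sub_sp, sp_sub, sp_sub, hn.orth _ _ (by simp) (by simp), hn.orth _ _ (by simp) hl',
    hn.orth _ _ hk' (by simp), hn.orth _ _ hk' hl']
  simp [h1k, h1l, hkl]

lemma pair_one (hn : MidTile n) {k : Fin 6} (hk : k = 2 ∨ k = 3 ∨ k = 4) :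
    sp (n 1) (n 1 - n k) = 1 := by
  have hk' : k = 1 ∨ k = 2 ∨ k = 3 ∨ k = 4 := Or.inr hk
  have h1k : 1 ≠ (k : Fin 6) := by rcases hk with rfl | rfl | rfl <;> decide
  rw [sp_sub, hn.orth _ _ (by simp) (by simp), hn.orth _ _ (by simp) hk']
  simp [h1k]

set_option maxHeartbeats 1000000 in
/-- Middle tiles are of three kinds. -/
lemma shape (hn : MidTile n) : ∃ a, (a = 1 ∨ a = 2 ∨ a = 3 ∨ a = 4) ∧
    (Desc n (PE a) ∨ Desc n (PQ a) ∨ Desc n (PR a)) := by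
  have s2 : (2 : Fin 6) = 2 ∨ (2 : Fin 6) = 3 ∨ (2 : Fin 6) = 4 := by simp
  have s3 : (3 : Fin 6) = 2 ∨ (3 : Fin 6) = 3 ∨ (3 : Fin 6) = 4 := by simp
  have s4 : (4 : Fin 6) = 2 ∨ (4 : Fin 6) = 3 ∨ (4 : Fin 6) = 4 := by simp
  have o2 := hn.pair_one s2
  have o3 := hn.pair_one s3
  have o4 := hn.pair_one s4
  have oo := hn.orth 1 1 (by simp) (by simp)
  rw [if_pos rfl] at oo
  obtain ⟨hb0, -, -⟩ := hn.bound (V := n 1) oo.le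
    (by rw [hn.orth _ _ (by simp) (by simp)]; simp)
    (by rw [hn.orth _ _ (by simp) (by simp)]; simp)
    (by rw [hn.orth _ _ (by simp) (by simp)]; simp)
    (by rw [oo, hn.orth _ _ (by simp) (by simp), hn.orth _ _ (by simp) (by simp),
      hn.orth _ _ (by simp) (by simp)]; simp)
  have hb : 0 ≤ n 1 1 ∧ 0 ≤ n 1 2 ∧ 0 ≤ n 1 3 ∧ 0 ≤ n 1 4 :=
    ⟨hb0 _ (by simp), hb0 _ (by simp), hb0 _ (by simp), hb0 _ (by simp)⟩
  obtain ⟨a, b, c, d, hf, hU, hV, hW⟩ := three_pairs (hn.isPair s2) (hn.isPair s3) (hn.isPair s4)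
    (hn.pair_dot s2 s3 (by decide)) (hn.pair_dot s2 s4 (by decide)) (hn.pair_dot s3 s4 (by decide))
  rw [hf.forall_iff fun i => 0 ≤ n 1 i] at hb
  obtain ⟨ba, bb, bc, bd⟩ := hb
  rw [hf.sp, hU.1, hU.2.1, hU.2.2.1, hU.2.2.2] at o2
  rw [hf.sp, hV.1, hV.2.1, hV.2.2.1, hV.2.2.2] at o3
  rw [hf.sp] at o4 oo
  simp only [Pi.sub_apply] at hU hV hW o4
  have hsum := hf.sum
  obtain ⟨u1, u2, u3, u4⟩ := hU
  obtain ⟨v1, v2, v3, v4⟩ := hV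
  rw [sub_eq_iff_eq_add] at u1 u2 u3 u4 v1 v2 v3 v4
  have finish : ∀ {P : (ℝ → ℝ → Prop) → (Fin 6 → ℝ) → Prop},
    (∀ y, (0 ≤ y 5 ∧ 2 * sp (n 1) y ≤ y 0 - y 5 ∧ sp (n 2) y ≤ 0 ∧ sp (n 3) y ≤ 0 ∧ sp (n 4) y ≤ 0 ∧
      0 ≤ sp (n 1) y + sp (n 2) y + sp (n 3) y + sp (n 4) y) ↔ P (· ≤ ·) y) →
    (∀ y, (0 < y 5 ∧ 2 * sp (n 1) y < y 0 - y 5 ∧ sp (n 2) y < 0 ∧ sp (n 3) y < 0 ∧ sp (n 4) y < 0 ∧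
      0 < sp (n 1) y + sp (n 2) y + sp (n 3) y + sp (n 4) y) ↔ P (· < ·) y) → Desc n P :=
    fun h1 h2 => ⟨fun y => (hn.reg_iff y).trans (h1 y), fun y => (hn.sreg_iff y).trans (h2 y)⟩
  rcases hW with ⟨w1, w2, w3, w4⟩ | ⟨w1, w2, w3, w4⟩
  · rw [w1, w2, w3, w4] at o4
    rw [sub_eq_iff_eq_add] at w1 w2 w3 w4
    have hs : (n 1 a - 1) * (n 1 a - 1 / 2) = 0 := by
      have xb : n 1 b = 1 - n 1 a := by linarith
      have xc : n 1 c = 1 - n 1 a := by linarith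
      have xd : n 1 d = 1 - n 1 a := by linarith
      rw [xb, xc, xd] at oo
      linarith
    rcases mul_eq_zero.mp hs with hs | hs
    · have xa : n 1 a = 1 := by linarith
      have xb : n 1 b = 0 := by linarith
      have xc : n 1 c = 0 := by linarith
      have xd : n 1 d = 0 := by linarith
      refine ⟨a, hf.mem, Or.inl (finish (fun y => ?_) (fun y => ?_))⟩ <;>
      · rw [PE, hf.pin, hsum y, hf.sp, hf.sp, hf.sp, hf.sp,
          show n 2 a = 0 by linarith only [u1, xa], show n 2 b = -1 by linarith only [u2, xb],
          show n 2 c = 0 by linarith only [u3, xc], show n 2 d = 0 by linarith only [u4, xd],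
          show n 3 a = 0 by linarith only [v1, xa], show n 3 b = 0 by linarith only [v2, xb],
          show n 3 c = -1 by linarith only [v3, xc], show n 3 d = 0 by linarith only [v4, xd],
          show n 4 a = 0 by linarith only [w1, xa], show n 4 b = 0 by linarith only [w2, xb],
          show n 4 c = 0 by linarith only [w3, xc], show n 4 d = -1 by linarith only [w4, xd],
          xa, xb, xc, xd]
        clear * -
        constructor
        · rintro ⟨h0, h1, h2, h3, h4, h5⟩
          refine ⟨⟨?_, ?_, ?_, ?_, ?_, ?_⟩, ?_, ?_⟩ <;> linarith
        · rintro ⟨⟨h0, h1, h2, h3, h4, h5⟩, h6, h7⟩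
          refine ⟨?_, ?_, ?_, ?_, ?_, ?_⟩ <;> linarith
    · have xa : n 1 a = 1 / 2 := by linarith
      have xb : n 1 b = 1 / 2 := by linarith
      have xc : n 1 c = 1 / 2 := by linarith
      have xd : n 1 d = 1 / 2 := by linarith
      refine ⟨a, hf.mem, Or.inr (Or.inl (finish (fun y => ?_) (fun y => ?_)))⟩ <;>
      · rw [PQ, hf.forall_ne fun i => _, hf.pin, hsum y, hf.sp, hf.sp, hf.sp, hf.sp,
          show n 2 a = -1 / 2 by linarith only [u1, xa], show n 2 b = -1 / 2 by linarith only [u2, xb],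
          show n 2 c = 1 / 2 by linarith only [u3, xc], show n 2 d = 1 / 2 by linarith only [u4, xd],
          show n 3 a = -1 / 2 by linarith only [v1, xa], show n 3 b = 1 / 2 by linarith only [v2, xb],
          show n 3 c = -1 / 2 by linarith only [v3, xc], show n 3 d = 1 / 2 by linarith only [v4, xd],
          show n 4 a = -1 / 2 by linarith only [w1, xa], show n 4 b = 1 / 2 by linarith only [w2, xb],
          show n 4 c = 1 / 2 by linarith only [w3, xc], show n 4 d = -1 / 2 by linarith only [w4, xd],
          xa, xb, xc, xd]
        clear * -
        constructor
        · rintro ⟨h0, h1, h2, h3, h4, h5⟩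
          refine ⟨⟨?_, ?_, ?_, ?_, ?_, ?_⟩, ?_, ?_, ?_, ?_⟩ <;> linarith
        · rintro ⟨⟨h0, h1, h2, h3, h4, h5⟩, h6, h7, h8, h9⟩
          refine ⟨?_, ?_, ?_, ?_, ?_, ?_⟩ <;> linarith
  · rw [w1, w2, w3, w4] at o4
    rw [sub_eq_iff_eq_add] at w1 w2 w3 w4
    have xa : n 1 a = 1 / 2 := by linarith
    have xb : n 1 b = 1 / 2 := by linarith
    have xc : n 1 c = 1 / 2 := by linarith
    have xd : n 1 d = 1 / 2 := by
      have h : (n 1 d - 1 / 2) * (n 1 d + 1 / 2) = 0 := by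
        rw [xa, xb, xc] at oo
        linear_combination oo
      rcases mul_eq_zero.mp h with h | h <;> linarith only [h, bd]
    refine ⟨d, hf.rev.mem, Or.inr (Or.inr (finish (fun y => ?_) (fun y => ?_)))⟩ <;>
    · rw [PR, hf.rev.forall_ne fun i => _, hf.pin, hsum y, hf.sp, hf.sp, hf.sp, hf.sp,
        show n 2 a = -1 / 2 by linarith only [u1, xa], show n 2 b = -1 / 2 by linarith only [u2, xb],
        show n 2 c = 1 / 2 by linarith only [u3, xc], show n 2 d = 1 / 2 by linarith only [u4, xd],
        show n 3 a = -1 / 2 by linarith only [v1, xa], show n 3 b = 1 / 2 by linarith only [v2, xb],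
        show n 3 c = -1 / 2 by linarith only [v3, xc], show n 3 d = 1 / 2 by linarith only [v4, xd],
        show n 4 a = 1 / 2 by linarith only [w1, xa], show n 4 b = -1 / 2 by linarith only [w2, xb],
        show n 4 c = -1 / 2 by linarith only [w3, xc], show n 4 d = 1 / 2 by linarith only [w4, xd],
        xa, xb, xc, xd]
      clear * -
      constructor
      · rintro ⟨h0, h1, h2, h3, h4, h5⟩
        refine ⟨⟨?_, ?_, ?_, ?_, ?_, ?_⟩, ?_, ?_, ?_⟩ <;> linarith
      · rintro ⟨⟨h0, h1, h2, h3, h4, h5⟩, h6, h7, h8⟩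
        refine ⟨?_, ?_, ?_, ?_, ?_, ?_⟩ <;> linarith

end MidTile

lemma Fr.swap_mid {a b c d : Fin 6} (h : Fr a b c d) : Fr a c b d := by
  obtain ⟨σ, h0, h5, rfl, rfl, rfl, rfl⟩ := h
  refine ⟨(Equiv.swap 2 3).trans σ, ?_⟩
  simp [Equiv.swap_apply_def, h0, h5]

lemma Fr.exists {a : Fin 6} (ha : a = 1 ∨ a = 2 ∨ a = 3 ∨ a = 4) : ∃ b c d, Fr a b c d := by
  rcases ha with rfl | rfl | rfl | rfl
  · exact ⟨2, 3, 4, 1, by decide⟩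
  · exact ⟨1, 3, 4, Equiv.swap 1 2, by decide⟩
  · exact ⟨2, 1, 4, Equiv.swap 1 3, by decide⟩
  · exact ⟨2, 3, 1, Equiv.swap 1 4, by decide⟩

lemma Fr.exists_ne {a b : Fin 6} (ha : a = 1 ∨ a = 2 ∨ a = 3 ∨ a = 4)
    (hb : b = 1 ∨ b = 2 ∨ b = 3 ∨ b = 4) (hab : b ≠ a) : ∃ c d, Fr a b c d := by
  obtain ⟨b', c', d', h⟩ := Fr.exists ha
  have := (h.forall_ne fun i => b = i → ∃ c d, Fr a b c d).mpr ⟨?_, ?_, ?_⟩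
  · exact this b hb hab rfl
  · rintro rfl; exact ⟨c', d', h⟩
  · rintro rfl; exact ⟨b', d', h.swap_mid⟩
  · rintro rfl; exact ⟨b', c', h.swap_right.swap_mid⟩

/-- The twenty regions of the standard decomposition. -/
def Std (P : (ℝ → ℝ → Prop) → (Fin 6 → ℝ) → Prop) : Prop :=
  ∃ a, (a = 1 ∨ a = 2 ∨ a = 3 ∨ a = 4) ∧
    (P = PT a ∨ P = PC a ∨ P = PE a ∨ P = PQ a ∨ P = PR a)

/-- The regions of the standard decomposition do not overlap. -/
lemma Std.eq {P Q : (ℝ → ℝ → Prop) → (Fin 6 → ℝ) → Prop} (hP : Std P) (hQ : Std Q)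
    {y : Fin 6 → ℝ} (h : P (· < ·) y) (h' : Q (· < ·) y) : P = Q := by
  obtain ⟨a, ha, hP⟩ := hP
  obtain ⟨a', ha', hQ⟩ := hQ
  by_cases haa : a' = a
  · subst haa
    obtain ⟨b, c, d, hf⟩ := Fr.exists ha
    rcases hP with rfl | rfl | rfl | rfl | rfl <;> rcases hQ with rfl | rfl | rfl | rfl | rfl <;>
    first
    | rfl
    | (exfalso
       simp only [PT, PC, PE, PQ, PR, hf.forall_ne, hf.pin, hf.sum y] at h h'
       linarith)
  · obtain ⟨c, d, hf⟩ := Fr.exists_ne ha ha' haa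
    have hg := hf.swap_left
    exfalso
    rcases hP with rfl | rfl | rfl | rfl | rfl <;> rcases hQ with rfl | rfl | rfl | rfl | rfl <;>
    · simp only [PT, PC, PE, PQ, PR, hf.forall_ne, hg.forall_ne, hf.pin, hf.sum y] at h h'
      linarith

section
variable {ι : Type} {M : Fin 6 → Fin 6 → ℝ} {N : ι → Fin 6 → Fin 6 → ℝ}

lemma StarFam.shape (hN : StarFam M N)
    (h : ¬ ∃ t k, (k = 1 ∨ k = 2 ∨ k = 3 ∨ k = 4) ∧ Desc (N t) (PA k)) (t : ι) :
    ∃ P, Std P ∧ Desc (N t) P := by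
  rcases hN.shape_or_middle h t with ⟨j, hj, hd⟩ | ⟨j, hj, hd⟩ | hd
  · exact ⟨_, ⟨j, hj, Or.inl rfl⟩, hd⟩
  · exact ⟨_, ⟨j, hj, Or.inr (Or.inl rfl)⟩, hd⟩
  obtain ⟨ρ, hρ⟩ := hN.exists_star
  have hm : Middle (N t ∘ ρ) :=
    ⟨(reg_reindex ρ _).mpr hd.reg, fun y hy => hd.lt y ((sreg_reindex ρ _).mp hy)⟩
  obtain ⟨i, hi, c, hc, ha⟩ := (hρ t).apex_eq
  have hr := (reg_reindex ρ _).mp ((hρ t).reg_of_apex hc ha)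
  have hi5 : i = 5 := by
    by_contra hi5
    have hj : i = 1 ∨ i = 2 ∨ i = 3 ∨ i = 4 := by omega
    obtain ⟨-, t', ht'⟩ := hN.edge h hj
    have := hN.fam.eq_of_PT hj ht' hr
    subst this
    have hs := (hN.fam.tile t).mid_sreg
    obtain ⟨⟨h1, h2, h3, h4, h5, h6⟩, h7⟩ := (ht'.2 _).mp hs
    linarith [hd.lt _ hs i hj]
  subst hi5
  obtain ⟨h5, rfl⟩ := (hρ t).five_eq hc ha fun y hy =>
    (reg_reindex ρ _).mpr (hN.reg_sub h hd ((sreg_reindex ρ _).mp hy))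
  obtain ⟨a, ha, hP⟩ := ((hρ t).midTile h5 ha hm).shape
  have key : ∀ P, Desc (N t ∘ ρ) P → Desc (N t) P := fun P hP =>
    ⟨fun y => (reg_reindex ρ y).symm.trans (hP.1 y), fun y =>
      (sreg_reindex ρ y).symm.trans (hP.2 y)⟩
  rcases hP with hP | hP | hP
  · exact ⟨_, ⟨a, ha, by simp⟩, key _ hP⟩
  · exact ⟨_, ⟨a, ha, by simp⟩, key _ hP⟩
  · exact ⟨_, ⟨a, ha, by simp⟩, key _ hP⟩

lemma StarFam.exists_std (hN : StarFam M N) : ∃ σ : Equiv.Perm (Fin 6), σ 0 = 0 ∧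
    ∀ t, ∃ P, Std P ∧ Desc (fun i => N t i ∘ σ) P := by
  obtain ⟨σ, hσ, h⟩ := hN.exists_no_PA
  exact ⟨σ, hσ, (hN.perm hσ).shape h⟩

/-- Every tile of a standard decomposition is a tile of any other one. -/
lemma Fam.exists_eq {ι' : Type} {M' : Fin 6 → Fin 6 → ℝ} {N' : ι' → Fin 6 → Fin 6 → ℝ}
    (hN : Fam M N) (hN' : Fam M' N') (h : ∀ t, ∃ P, Std P ∧ Desc (N t) P)
    (h' : ∀ t, ∃ P, Std P ∧ Desc (N' t) P) (t : ι) : ∃ t', ∀ y, Reg (N t) y ↔ Reg (N' t') y := by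
  have hs := (hN.tile t).mid_sreg
  obtain ⟨t', ht'⟩ := hN'.cov _ ((hN.tile t).sub _ hs.reg)
  obtain ⟨δ, h0, hδ⟩ := hs.exists_small (hN'.tile t').mid
  have h1 := hδ (δ / 2) (by linarith) (by linarith)
  have h2 := ((hN'.tile t').mid_sreg.smul (half_pos h0)).add_reg ht'
  rw [add_comm] at h2
  obtain ⟨P, hP, hd⟩ := h t
  obtain ⟨Q, hQ, hd'⟩ := h' t'
  obtain rfl := hP.eq hQ ((hd.2 _).mp h1) ((hd'.2 _).mp h2)
  exact ⟨t', fun y => (hd.1 y).trans (hd'.1 y).symm⟩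

lemma StarFam.not_trivial (hN : StarFam M N) : ¬ ∃ k, ∀ l, l ≠ k → M k l = -(1 / 2) := by
  rintro ⟨k, hk⟩
  obtain ⟨ρ, hρ⟩ := hN.gram
  obtain ⟨i, rfl⟩ := ρ.surjective k
  have : ∃ j, j ≠ i ∧ starG i j = 0 := by
    fin_cases i
    · exact ⟨5, by decide, by simp [starG]⟩
    · exact ⟨2, by decide, by simp [starG]⟩
    · exact ⟨1, by decide, by simp [starG]⟩
    · exact ⟨1, by decide, by simp [starG]⟩
    · exact ⟨1, by decide, by simp [starG]⟩
    · exact ⟨0, by decide, by simp [starG]⟩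
  obtain ⟨j, hj, h0⟩ := this
  have := hk (ρ j) fun h => hj (ρ.injective h)
  rw [hρ, h0] at this
  norm_num at this

end

lemma Fam.unique {ι ι' : Type} [Finite ι] [Finite ι'] {M : Fin 6 → Fin 6 → ℝ}
    {N : ι → Fin 6 → Fin 6 → ℝ} {N' : ι' → Fin 6 → Fin 6 → ℝ} (hN : Fam M N) (hN' : Fam M N') :
    ∃ σ : Equiv.Perm (Fin 6), σ 0 = 0 ∧
      (∀ t, ∃ t', ∀ y, Reg (N t) y ↔ Reg (N' t') (y ∘ σ)) ∧
      ∀ t', ∃ t, ∀ y, Reg (N t) y ↔ Reg (N' t') (y ∘ σ) := by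
  rcases hN.dichotomy with ⟨h, hk⟩ | h <;> rcases hN'.dichotomy with ⟨h', hk'⟩ | h'
  · refine ⟨1, rfl, fun t => ?_, fun t => ?_⟩
    · obtain ⟨t', -⟩ := hN'.cov 0 (by simp [InP])
      exact ⟨t', fun y => (h t y).trans (h' t' y).symm⟩
    · obtain ⟨t', -⟩ := hN.cov 0 (by simp [InP])
      exact ⟨t', fun y => (h t' y).trans (h' t y).symm⟩
  · exact absurd hk h'.not_trivial
  · exact absurd hk' h.not_trivial
  obtain ⟨σ, hσ, hs⟩ := h.exists_std
  obtain ⟨τ, hτ, hs'⟩ := h'.exists_std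
  have hf := hN.perm hσ
  have hf' := hN'.perm hτ
  have e : ∀ t t', (∀ y, Reg (fun i => N t i ∘ σ) y ↔ Reg (fun i => N' t' i ∘ τ) y) →
      ∀ y, Reg (N t) y ↔ Reg (N' t') (y ∘ (σ * τ⁻¹ : Equiv.Perm (Fin 6))) := fun t t' h y => by
    rw [← reg_perm hσ, h, ← reg_perm hτ (y ∘ (σ * τ⁻¹ : Equiv.Perm (Fin 6)))]
    have : (y ∘ (σ * τ⁻¹ : Equiv.Perm (Fin 6))) ∘ τ = y ∘ σ := by funext i; simp
    rw [this]
  refine ⟨σ * τ⁻¹, ?_, fun t => ?_, fun t' => ?_⟩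
  · rw [Equiv.Perm.mul_apply, Equiv.Perm.inv_eq_iff_eq.mpr hτ.symm, hσ]
  · obtain ⟨t', h⟩ := hf.exists_eq hf' hs hs' t
    exact ⟨t', e _ _ h⟩
  · obtain ⟨t, h⟩ := hf'.exists_eq hf hs' hs t'
    exact ⟨t, e _ _ fun y => (h y).symm⟩

section
variable {n : ℕ}

lemma mink_comm (x y : EuclideanSpace ℝ (Fin (n + 1))) : mink n x y = mink n y x := by
  simp only [mink, mul_comm]

lemma mink_add_left (x y z : EuclideanSpace ℝ (Fin (n + 1))) :
    mink n (x + y) z = mink n x z + mink n y z := by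
  simp only [mink, PiLp.add_apply, add_mul, Finset.sum_add_distrib]; ring

lemma mink_smul_left (a : ℝ) (x z : EuclideanSpace ℝ (Fin (n + 1))) :
    mink n (a • x) z = a * mink n x z := by
  simp only [mink, PiLp.smul_apply, smul_eq_mul, mul_assoc, ← Finset.mul_sum]; ring

lemma mink_add_right (x y z : EuclideanSpace ℝ (Fin (n + 1))) :
    mink n x (y + z) = mink n x y + mink n x z := by
  simp only [mink_comm x, mink_add_left]

lemma mink_smul_right (a : ℝ) (x z : EuclideanSpace ℝ (Fin (n + 1))) :
    mink n x (a • z) = a * mink n x z := by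
  simp only [mink_comm x, mink_smul_left]

lemma mink_neg_left (x z : EuclideanSpace ℝ (Fin (n + 1))) : mink n (-x) z = -mink n x z := by
  rw [← neg_one_smul ℝ x, mink_smul_left]; ring

lemma mink_neg_right (x z : EuclideanSpace ℝ (Fin (n + 1))) : mink n x (-z) = -mink n x z := by
  rw [mink_comm, mink_neg_left, mink_comm]

lemma mink_sub_left (x y z : EuclideanSpace ℝ (Fin (n + 1))) :
    mink n (x - y) z = mink n x z - mink n y z := by
  rw [sub_eq_add_neg, mink_add_left, mink_neg_left]; ring

lemma mink_sub_right (x y z : EuclideanSpace ℝ (Fin (n + 1))) :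
    mink n x (y - z) = mink n x y - mink n x z := by
  rw [sub_eq_add_neg, mink_add_right, mink_neg_right]; ring

lemma mink_sum_left {ι : Type*} (s : Finset ι) (f : ι → EuclideanSpace ℝ (Fin (n + 1)))
    (z : EuclideanSpace ℝ (Fin (n + 1))) : mink n (∑ i ∈ s, f i) z = ∑ i ∈ s, mink n (f i) z := by
  classical
  induction s using Finset.induction_on with
  | empty => simp [mink]
  | insert a s h ih => rw [Finset.sum_insert h, Finset.sum_insert h, mink_add_left, ih]

lemma mink_sum_right {ι : Type*} (s : Finset ι) (f : ι → EuclideanSpace ℝ (Fin (n + 1)))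
    (z : EuclideanSpace ℝ (Fin (n + 1))) : mink n z (∑ i ∈ s, f i) = ∑ i ∈ s, mink n z (f i) := by
  simp only [mink_comm z, mink_sum_left]

/-- The time direction. -/
def e0 : EuclideanSpace ℝ (Fin (n + 1)) := EuclideanSpace.single 0 1

lemma mink_e0 (x : EuclideanSpace ℝ (Fin (n + 1))) : mink n x e0 = -x 0 := by
  simp [mink, e0]

lemma mink_single_succ (x : EuclideanSpace ℝ (Fin (n + 1))) (i : Fin n) :
    mink n x (EuclideanSpace.single i.succ 1) = x i.succ := by
  simp [mink, (Fin.succ_ne_zero i).symm]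

lemma mink_eq_zero {x : EuclideanSpace ℝ (Fin (n + 1))} (h : ∀ y, mink n x y = 0) : x = 0 := by
  ext i
  refine Fin.cases ?_ (fun i => ?_) i
  · simpa [mink_e0] using h e0
  · simpa [mink_single_succ] using h (EuclideanSpace.single i.succ 1)

lemma continuous_mink (x : EuclideanSpace ℝ (Fin (n + 1))) : Continuous (mink n x) := by
  unfold mink; fun_prop

lemma continuous_mink_self : Continuous fun x : EuclideanSpace ℝ (Fin (n + 1)) => mink n x x := by
  unfold mink; fun_prop

/-- The reversed Cauchy–Schwarz inequality for future vectors, one of them timelike. -/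
lemma mink_neg {x y : EuclideanSpace ℝ (Fin (n + 1))} (hx : mink n x x < 0) (hx0 : 0 < x 0)
    (hy : mink n y y ≤ 0) (hy0 : 0 < y 0) : mink n x y < 0 := by
  unfold mink at *
  have hc := Finset.sum_mul_sq_le_sq_mul_sq Finset.univ (fun i : Fin n => x i.succ)
    (fun i => y i.succ)
  simp only [← pow_two] at *
  have hX : 0 ≤ ∑ i : Fin n, x i.succ ^ 2 := Finset.sum_nonneg fun i _ => sq_nonneg _
  have hY : 0 ≤ ∑ i : Fin n, y i.succ ^ 2 := Finset.sum_nonneg fun i _ => sq_nonneg _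
  generalize (∑ i : Fin n, x i.succ ^ 2) = X at *
  generalize (∑ i : Fin n, y i.succ ^ 2) = Y at *
  have hxy := mul_pos hx0 hy0
  have : (∑ i : Fin n, x i.succ * y i.succ) ^ 2 < (x 0 * y 0) ^ 2 := by
    have h1 : X * Y ≤ X * y 0 ^ 2 := mul_le_mul_of_nonneg_left (by linarith) hX
    have h2 : X * y 0 ^ 2 < x 0 ^ 2 * y 0 ^ 2 :=
      mul_lt_mul_of_pos_right (by linarith) (by positivity)
    rw [mul_pow]; linarith
  have := lt_of_pow_lt_pow_left₀ 2 hxy.le this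
  linarith

lemma mink_neg_of_hyp (x : ↥(hypSet n)) {y : EuclideanSpace ℝ (Fin (n + 1))}
    (hy : mink n y y ≤ 0) (hy0 : 0 < y 0) : mink n x.val y < 0 :=
  mink_neg (by rw [x.2.1]; norm_num) x.2.2 hy hy0

/-- A future causal vector plus a positive multiple of a future timelike vector. -/
lemma mink_add_neg {x y : EuclideanSpace ℝ (Fin (n + 1))} (hx : mink n x x < 0) (hx0 : 0 < x 0)
    (hy : mink n y y ≤ 0) (hy0 : 0 < y 0) : mink n (y + x) (y + x) < 0 := by
  have := mink_neg hx hx0 hy hy0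
  simp only [mink_add_left, mink_add_right, mink_comm y x]
  linarith

lemma exists_point {y : EuclideanSpace ℝ (Fin (n + 1))} (hy : mink n y y < 0) (h0 : 0 < y 0) :
    ∃ q : ↥(hypSet n), ∃ c > (0 : ℝ), q.val = c • y := by
  have hs : 0 < √(-mink n y y) := Real.sqrt_pos.mpr (by linarith)
  have hc : 0 < (√(-mink n y y))⁻¹ := inv_pos.mpr hs
  refine ⟨⟨(√(-mink n y y))⁻¹ • y, ?_, ?_⟩, _, hc, rfl⟩
  · rw [mink_smul_left, mink_smul_right]
    have := Real.mul_self_sqrt (x := -mink n y y) (by linarith)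
    generalize √(-mink n y y) = r at *
    have h1 : mink n y y = -(r * r) := by linarith
    rw [h1]
    field_simp
  · simpa using mul_pos hc h0

lemma mem_hHalf_of_smul {v y : EuclideanSpace ℝ (Fin (n + 1))} {q : ↥(hypSet n)} {c : ℝ}
    (hc : 0 < c) (h : q.val = c • y) : q ∈ hHalf n v ↔ mink n v y ≤ 0 := by
  change mink n v q.val ≤ 0 ↔ _
  rw [h, mink_smul_right]
  exact ⟨fun h => nonpos_of_mul_nonpos_right h hc, fun h => by nlinarith⟩

lemma mem_hWall_of_smul {v y : EuclideanSpace ℝ (Fin (n + 1))} {q : ↥(hypSet n)} {c : ℝ}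
    (hc : 0 < c) (h : q.val = c • y) : q ∈ hWall n v ↔ mink n v y = 0 := by
  change mink n v q.val = 0 ↔ _
  rw [h, mink_smul_right, mul_eq_zero, or_iff_right (ne_of_gt hc)]

/-- Small perturbations of an interior point stay inside. -/
lemma exists_move {P : Set ↥(hypSet n)} {p : ↥(hypSet n)} (hp : p ∈ interior P)
    (z : EuclideanSpace ℝ (Fin (n + 1))) :
    ∃ δ > (0 : ℝ), ∀ ε, |ε| < δ → ∃ q ∈ P, ∃ c > (0 : ℝ), q.val = c • (p.val + ε • z) := by
  obtain ⟨U, hU, hUP⟩ := isOpen_induced_iff.mp (isOpen_interior (s := P))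
  let f : ℝ → EuclideanSpace ℝ (Fin (n + 1)) := fun ε =>
    (√(-mink n (p.val + ε • z) (p.val + ε • z)))⁻¹ • (p.val + ε • z)
  have hf0 : f 0 = p.val := by
    simp only [f, zero_smul, add_zero, p.2.1]; simp
  have h1 : Continuous fun ε : ℝ => mink n (p.val + ε • z) (p.val + ε • z) :=
    continuous_mink_self.comp (by fun_prop)
  have h2 : Continuous fun ε : ℝ => (p.val + ε • z) 0 := by fun_prop
  have hf : ContinuousAt f 0 := by
    have h3 : ContinuousAt (fun ε : ℝ => p.val + ε • z) 0 := by fun_prop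
    refine ContinuousAt.smul (ContinuousAt.inv₀ h1.neg.sqrt.continuousAt ?_) h3
    change √(-mink n (p.val + (0 : ℝ) • z) (p.val + (0 : ℝ) • z)) ≠ 0
    rw [zero_smul, add_zero, p.2.1]; simp
  have ev : ∀ᶠ ε in nhds (0 : ℝ), f ε ∈ U ∧ mink n (p.val + ε • z) (p.val + ε • z) < 0 ∧
      0 < (p.val + ε • z) 0 := by
    refine (hf.eventually_mem (hU.mem_nhds ?_)).and (Filter.Eventually.and ?_ ?_)
    · rw [hf0]
      have : p ∈ Subtype.val ⁻¹' U := by rw [hUP]; exact hp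
      exact this
    · refine h1.continuousAt.eventually_lt continuousAt_const ?_
      simp only [zero_smul, add_zero, p.2.1]; simp
    · refine continuousAt_const.eventually_lt h2.continuousAt ?_
      simpa using p.2.2
  obtain ⟨δ, hδ, hb⟩ := Metric.eventually_nhds_iff.mp ev
  refine ⟨δ, hδ, fun ε hε => ?_⟩
  obtain ⟨hu, hn, h0⟩ := hb (by simpa using hε)
  have hs : 0 < √(-mink n (p.val + ε • z) (p.val + ε • z)) := Real.sqrt_pos.mpr (by linarith)
  obtain ⟨q, c, hc, hq⟩ := exists_point hn h0
  have hcs : c = (√(-mink n (p.val + ε • z) (p.val + ε • z)))⁻¹ := by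
    have h3 := q.2.1
    rw [hq, mink_smul_left, mink_smul_right] at h3
    have := Real.mul_self_sqrt (x := -mink n (p.val + ε • z) (p.val + ε • z)) (by linarith)
    generalize √(-mink n (p.val + ε • z) (p.val + ε • z)) = r at *
    have h4 : (c * r) * (c * r) = 1 := by nlinarith
    rcases mul_self_eq_one_iff.mp h4 with h | h
    · exact eq_inv_of_mul_eq_one_left h
    · nlinarith [mul_pos hc hs]
  refine ⟨q, ?_, c, hc, hq⟩
  have : q ∈ Subtype.val ⁻¹' U := by
    change q.val ∈ U
    rw [hq, hcs]; exact hu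
  rw [hUP] at this
  exact interior_subset this

lemma interior_strict {P : Set ↥(hypSet n)} {p : ↥(hypSet n)} (hp : p ∈ interior P)
    {v : EuclideanSpace ℝ (Fin (n + 1))} (hv : mink n v v = 1) (h : P ⊆ hHalf n v) :
    mink n v p.val < 0 := by
  obtain ⟨δ, hδ, hm⟩ := exists_move hp v
  obtain ⟨q, hq, c, hc, e⟩ := hm (δ / 2) (by rw [abs_of_pos (by linarith)]; linarith)
  have := (mem_hHalf_of_smul hc e).mp (h hq)
  rw [mink_add_right, mink_smul_right, hv] at this
  linarith

lemma mem_interior_of_strict {k : ℕ} {v : Fin k → EuclideanSpace ℝ (Fin (n + 1))}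
    {p : ↥(hypSet n)} (h : ∀ i, mink n (v i) p.val < 0) :
    p ∈ interior (⋂ i, hHalf n (v i)) := by
  rw [mem_interior]
  refine ⟨⋂ i, {x | mink n (v i) x.val < 0}, ?_, ?_, ?_⟩
  · exact iInter_mono fun i x (hx : mink n (v i) x.val < 0) => hx.le
  · exact isOpen_iInter_of_finite fun i =>
      isOpen_lt ((continuous_mink _).comp continuous_subtype_val) continuous_const
  · exact mem_iInter.mpr h

/-- A unit vector vanishing on a wall is, up to sign, the normal of the wall. -/
lemma eq_or_neg_of_hWall {u v : EuclideanSpace ℝ (Fin (n + 1))} (hu : mink n u u = 1)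
    (hv : mink n v v = 1) (h : hWall n v ⊆ hWall n u) : u = v ∨ u = -v := by
  have key : ∀ y, mink n y y < 0 → 0 < y 0 → mink n v y = 0 → mink n u y = 0 := by
    intro y h1 h2 h3
    obtain ⟨q, c, hc, hq⟩ := exists_point h1 h2
    exact (mem_hWall_of_smul hc hq).mp (h ((mem_hWall_of_smul hc hq).mpr h3))
  set x : EuclideanSpace ℝ (Fin (n + 1)) := e0 - (mink n v e0) • v with hx
  have hvx : mink n v x = 0 := by rw [hx, mink_sub_right, mink_smul_right, hv]; ring
  have hx0 : x 0 = 1 + v 0 ^ 2 := by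
    rw [hx, mink_e0]; simp [e0]; ring
  have hxx : mink n x x = -1 - v 0 ^ 2 := by
    conv_lhs => rw [hx, mink_sub_left, mink_smul_left, ← hx, hvx, mink_comm, mink_e0, hx0]
    ring
  have hux := key x (by nlinarith [sq_nonneg (v 0)]) (by nlinarith [sq_nonneg (v 0)]) hvx
  have hz : ∀ z, mink n v z = 0 → mink n u z = 0 := by
    intro z hz
    have h1 : ContinuousAt (fun ε : ℝ => mink n (x + ε • z) (x + ε • z)) 0 :=
      (continuous_mink_self.comp (f := fun ε : ℝ => x + ε • z) (by fun_prop)).continuousAt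
    have h2 : ContinuousAt (fun ε : ℝ => (x + ε • z) 0) 0 :=
      (by fun_prop : Continuous fun ε : ℝ => (x + ε • z) 0).continuousAt
    have ev := (h1.eventually_lt (continuousAt_const (y := (0 : ℝ))) (by
      simp only [zero_smul, add_zero, hxx]; nlinarith [sq_nonneg (v 0)])).and
      ((continuousAt_const (y := (0 : ℝ))).eventually_lt h2 (by
      simp only [zero_smul, add_zero, hx0]; nlinarith [sq_nonneg (v 0)]))
    obtain ⟨δ, hδ, hb⟩ := Metric.eventually_nhds_iff.mp ev
    obtain ⟨g1, g2⟩ := hb (y := δ / 2) (by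
      rw [Real.dist_eq, sub_zero, abs_of_pos (by linarith)]; linarith)
    have := key _ g1 g2 (by rw [mink_add_right, mink_smul_right, hvx, hz]; simp)
    rw [mink_add_right, mink_smul_right, hux, zero_add] at this
    exact (mul_eq_zero.mp this).resolve_left (by linarith)
  have hu' : u = (mink n u v) • v := by
    rw [← sub_eq_zero]
    refine mink_eq_zero fun y => ?_
    have := hz (y - mink n v y • v) (by rw [mink_sub_right, mink_smul_right, hv]; ring)
    rw [mink_sub_right, mink_smul_right] at this
    rw [mink_sub_left, mink_smul_left]; linarith
  have hsq : mink n u v * mink n u v = 1 := by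
    have := hu
    conv_lhs at this => rw [hu', mink_smul_left, mink_smul_right, hv]
    linarith
  rcases mul_self_eq_one_iff.mp hsq with h | h <;> rw [h] at hu'
  · left; simpa using hu'
  · right; simpa using hu'

end

section
variable {n : ℕ} {P : Set ↥(hypSet n)}

/-- The outward unit normals of the facets. -/
def FN (n : ℕ) (P : Set ↥(hypSet n)) : Set (EuclideanSpace ℝ (Fin (n + 1))) :=
  {v | mink n v v = 1 ∧ P ⊆ hHalf n v ∧ hIsFacet n P (P ∩ hWall n v)}

lemma exists_FN {S : Set ↥(hypSet n)} (h : hIsFacet n P S) : ∃ v ∈ FN n P, S = P ∩ hWall n v := by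
  obtain ⟨-, v, hv, hP, hS, -⟩ := id h
  exact ⟨v, ⟨hv, hP, hS ▸ h⟩, hS⟩

lemma eq_or_neg_of_FN {u v : EuclideanSpace ℝ (Fin (n + 1))} (hv : v ∈ FN n P)
    (hu : mink n u u = 1) (h : P ∩ hWall n v ⊆ hWall n u) : u = v ∨ u = -v := by
  obtain ⟨hv1, -, -, w, hw, -, -, hall⟩ := hv
  exact eq_or_neg_of_hWall hu hv1 ((hall v hv1 inter_subset_right).trans (hall u hu h).symm).subset

lemma neg_not_mem (hP : (interior P).Nonempty) {v : EuclideanSpace ℝ (Fin (n + 1))}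
    (hv : mink n v v = 1) (h : P ⊆ hHalf n v) : ¬ P ⊆ hHalf n (-v) := by
  intro h'
  obtain ⟨p, hp⟩ := hP
  have h1 := interior_strict hp hv h
  have h2 := interior_strict hp (v := -v) (by rw [mink_neg_left, mink_neg_right, hv]; ring) h'
  rw [mink_neg_left] at h2
  linarith

lemma eq_of_FN (hP : (interior P).Nonempty) {u v : EuclideanSpace ℝ (Fin (n + 1))}
    (hv : v ∈ FN n P) (hu : mink n u u = 1) (hu' : P ⊆ hHalf n u)
    (h : P ∩ hWall n v ⊆ hWall n u) : u = v := by
  rcases eq_or_neg_of_FN hv hu h with h | h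
  · exact h
  · exact absurd (h ▸ hu') (neg_not_mem hP hv.1 hv.2.1)

lemma ncard_FN (hP : (interior P).Nonempty) :
    (FN n P).ncard = {S | hIsFacet n P S}.ncard := by
  rw [← InjOn.ncard_image (f := fun v => P ∩ hWall n v) (s := FN n P)]
  · congr 1
    ext S
    constructor
    · rintro ⟨v, hv, rfl⟩; exact hv.2.2
    · intro h
      obtain ⟨v, hv, rfl⟩ := exists_FN h
      exact ⟨v, hv, rfl⟩
  · intro u hu v hv h
    exact eq_of_FN hP hv hu.1 hu.2.1 (h.symm.subset.trans inter_subset_right)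

lemma FN_subset_range (hP : (interior P).Nonempty) {k : ℕ}
    {v : Fin k → EuclideanSpace ℝ (Fin (n + 1))}
    (hv : ∀ i, mink n (v i) (v i) = 1) (h : P = ⋂ i, hHalf n (v i)) : FN n P ⊆ range v := by
  intro u hu
  by_contra hr
  have hPv : ∀ i, P ⊆ hHalf n (v i) := fun i => h.subset.trans (iInter_subset _ i)
  have : ∀ i, ∃ x ∈ P ∩ hWall n u, mink n (v i) x.val < 0 := by
    intro i
    by_contra! hc
    refine hr ⟨i, eq_of_FN hP hu (hv i) (hPv i) fun x hx => ?_⟩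
    exact le_antisymm (hPv i hx.1) (hc x hx)
  choose x hx hneg using this
  obtain ⟨x₀, hx₀⟩ := hu.2.2.1
  have hs : ∀ s : Finset (Fin k), mink n (x₀.val + ∑ i ∈ s, (x i).val)
      (x₀.val + ∑ i ∈ s, (x i).val) < 0 ∧ 0 < (x₀.val + ∑ i ∈ s, (x i).val) 0 := by
    intro s
    induction s using Finset.induction_on with
    | empty => simpa [x₀.2.1] using x₀.2.2
    | insert a s ha ih =>
      rw [Finset.sum_insert ha, ← add_assoc, add_right_comm]
      refine ⟨mink_add_neg (by rw [(x a).2.1]; norm_num) (x a).2.2 ih.1.le ih.2, ?_⟩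
      exact add_pos ih.2 (x a).2.2
  obtain ⟨q, c, hc, hq⟩ := exists_point (hs Finset.univ).1 (hs Finset.univ).2
  have hpi : q ∈ interior P := by
    rw [h]
    refine mem_interior_of_strict fun i => ?_
    rw [hq, mink_smul_right, mink_add_right, mink_sum_right]
    refine mul_neg_of_pos_of_neg hc ?_
    have h1 : mink n (v i) x₀.val ≤ 0 := hPv i hx₀.1
    have h2 : ∑ j, mink n (v i) (x j).val < 0 :=
      Finset.sum_neg' (fun j _ => hPv i (hx j).1) ⟨i, Finset.mem_univ i, hneg i⟩
    linarith
  have h3 := interior_strict hpi hu.1 hu.2.1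
  rw [hq, mink_smul_right, mink_add_right, mink_sum_right, Finset.sum_eq_zero fun j _ => (hx j).2,
    show mink n u x₀.val = 0 from hx₀.2] at h3
  simp at h3

lemma mem_FN_of_irredundant (hP : (interior P).Nonempty) {v : EuclideanSpace ℝ (Fin (n + 1))}
    (hv : mink n v v = 1) {Q : Set ↥(hypSet n)} (h : P = Q ∩ hHalf n v)
    (hQ : ∀ x ∈ Q, ∀ y ∈ Q, ∀ (a b c : ℝ) (z : ↥(hypSet n)), 0 ≤ a → 0 ≤ b → 0 < c →
      z.val = c • (a • x.val + b • y.val) → z ∈ Q)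
    {x : ↥(hypSet n)} (hx : x ∈ Q) (hx' : x ∉ hHalf n v) : v ∈ FN n P := by
  have hxv : 0 < mink n v x.val := not_le.mp hx'
  have hcross : ∀ q : ↥(hypSet n), q ∈ P → mink n v q.val < 0 →
      ∃ z ∈ P ∩ hWall n v, ∃ c > (0 : ℝ), z.val =
        c • (mink n v x.val • q.val + (-mink n v q.val) • x.val) := by
    intro q hq hqv
    have t1 : mink n (mink n v x.val • q.val + (-mink n v q.val) • x.val)
        (mink n v x.val • q.val + (-mink n v q.val) • x.val) < 0 :=
      by
        have h1 : mink n x.val q.val < 0 := mink_neg_of_hyp x (by rw [q.2.1]; norm_num) q.2.2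
        simp only [mink_add_left, mink_add_right, mink_smul_left, mink_smul_right, x.2.1, q.2.1,
          mink_comm q.val x.val]
        nlinarith [mul_pos hxv (neg_pos.mpr hqv), mul_pos (mul_pos hxv (neg_pos.mpr hqv))
          (neg_pos.mpr h1), mul_pos hxv hxv, mul_pos_of_neg_of_neg hqv hqv]
    have t2 : 0 < (mink n v x.val • q.val + (-mink n v q.val) • x.val) 0 := by
      simp only [PiLp.add_apply, PiLp.smul_apply, smul_eq_mul]
      nlinarith [mul_pos hxv q.2.2, mul_pos (neg_pos.mpr hqv) x.2.2]
    obtain ⟨z, c, hc, hz⟩ := exists_point t1 t2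
    have hzw : z ∈ hWall n v := by
      rw [mem_hWall_of_smul hc hz, mink_add_right, mink_smul_right, mink_smul_right]; ring
    refine ⟨z, ⟨?_, hzw⟩, c, hc, hz⟩
    rw [h] at hq ⊢
    exact ⟨hQ _ hq.1 _ hx _ _ c z hxv.le (by linarith) hc hz, (le_of_eq hzw : _)⟩
  have hPv : P ⊆ hHalf n v := h.subset.trans inter_subset_right
  obtain ⟨p, hp⟩ := hP
  have hpv := interior_strict hp hv hPv
  refine ⟨hv, hPv, ?_, v, hv, hPv, rfl, fun u hu hS => ?_⟩
  · obtain ⟨z, hz, -⟩ := hcross p (interior_subset hp) hpv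
    exact ⟨z, hz⟩
  have key : ∀ q : ↥(hypSet n), q ∈ P → mink n v q.val < 0 →
      mink n v x.val * mink n u q.val = mink n v q.val * mink n u x.val := by
    intro q hq hqv
    obtain ⟨z, hz, c, hc, e⟩ := hcross q hq hqv
    have := (mem_hWall_of_smul hc e).mp (hS hz)
    rw [mink_add_right, mink_smul_right, mink_smul_right] at this
    linarith
  have hlin : ∀ y, mink n v x.val * mink n u y = mink n v y * mink n u x.val := by
    intro y
    obtain ⟨δ, hδ, hm⟩ := exists_move hp y
    obtain ⟨δ', hδ', hm'⟩ := CD.exists_small (d := mink n v y) hpv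
    have h0 : 0 < min δ δ' / 2 := by positivity
    obtain ⟨q, hq, c, hc, e⟩ := hm (min δ δ' / 2) (by
      rw [abs_of_pos h0]; linarith [min_le_left δ δ', lt_min hδ hδ'])
    have h1 := hm' (min δ δ' / 2) h0 (by linarith [min_le_right δ δ', lt_min hδ hδ'])
    have hk := key q hq (by
      rw [e, mink_smul_right, mink_add_right, mink_smul_right]
      exact mul_neg_of_pos_of_neg hc h1)
    have hkp := key p (interior_subset hp) hpv
    rw [e] at hk
    simp only [mink_smul_right, mink_add_right] at hk
    generalize min δ δ' / 2 = ε at *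
    have : c * ε * (mink n v x.val * mink n u y - mink n v y * mink n u x.val) = 0 := by
      linear_combination hk - c * hkp
    rcases mul_eq_zero.mp this with h | h
    · exact absurd h (by positivity)
    · linarith
  have hsq : mink n v x.val * mink n v x.val = mink n u x.val * mink n u x.val := by
    have h1 := hlin u
    have h2 := hlin v
    rw [hu] at h1; rw [hv] at h2
    rw [mink_comm u v] at h2
    linear_combination (mink n v x.val) * h1 + (mink n u x.val) * h2
  have hux : mink n u x.val ≠ 0 := fun h0 => by
    rw [h0] at hsq; nlinarith
  ext y
  change mink n u y.val = 0 ↔ mink n v y.val = 0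
  have := hlin y.val
  constructor
  · intro h0
    rw [h0, mul_zero, eq_comm, mul_eq_zero] at this
    exact this.resolve_right hux
  · intro h0
    rw [h0, zero_mul, mul_eq_zero] at this
    exact this.resolve_left hxv.ne'

lemma eq_iInter_FN (hP : (interior P).Nonempty) {k : ℕ}
    {v : Fin k → EuclideanSpace ℝ (Fin (n + 1))}
    (hv : ∀ i, mink n (v i) (v i) = 1) (h : P = ⋂ i, hHalf n (v i)) :
    P = ⋂ u ∈ FN n P, hHalf n u := by
  refine Subset.antisymm (subset_iInter₂ fun u hu => hu.2.1) ?_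
  obtain ⟨J, hJ, hmin⟩ := Finset.exists_minimal (s := Finset.univ.filter fun J : Finset (Fin k) =>
    P = ⋂ i ∈ J, hHalf n (v i)) ⟨Finset.univ, by simpa using h⟩
  have hJP : P = ⋂ i ∈ J, hHalf n (v i) := by simpa using hJ
  have hfn : ∀ i ∈ J, v i ∈ FN n P := by
    intro i hi
    have hsplit : P = (⋂ j ∈ J.erase i, hHalf n (v j)) ∩ hHalf n (v i) := by
      conv_lhs => rw [hJP, ← Finset.insert_erase hi, Finset.set_biInter_insert]
      rw [inter_comm]
    have hne : ¬ (⋂ j ∈ J.erase i, hHalf n (v j)) ⊆ hHalf n (v i) := by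
      intro hsub
      have hsplit' := hsplit
      rw [inter_eq_left.mpr hsub] at hsplit'
      have := hmin (Finset.mem_filter.mpr ⟨Finset.mem_univ _, hsplit'⟩) (Finset.erase_subset i J)
      exact Finset.notMem_erase i J (this hi)
    obtain ⟨x, hx, hx'⟩ := not_subset.mp hne
    refine mem_FN_of_irredundant hP (hv i) hsplit ?_ hx hx'
    intro x hx y hy a b c z ha hb hc hz
    simp only [mem_iInter] at hx hy ⊢
    intro j hj
    rw [mem_hHalf_of_smul hc hz, mink_add_right, mink_smul_right, mink_smul_right]
    have h1 : mink n (v j) x.val ≤ 0 := hx j hj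
    have h2 : mink n (v j) y.val ≤ 0 := hy j hj
    nlinarith
  conv_rhs => rw [hJP]
  exact subset_iInter₂ fun i hi => iInter₂_subset (v i) (hfn i hi)

/-- The outward normals of a Coxeter simplex. -/
structure IsNormals (n : ℕ) (P : Set ↥(hypSet n))
    (ν : Fin (n + 1) → EuclideanSpace ℝ (Fin (n + 1))) : Prop where
  inj : Function.Injective ν
  range : range ν = FN n P
  eq : P = ⋂ k, hHalf n (ν k)
  int : (interior P).Nonempty
  cox : ∀ k l, k ≠ l → (∃ x ∈ P, x ∈ hWall n (ν k) ∩ hWall n (ν l)) →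
    ∃ m : ℕ, 2 ≤ m ∧ mink n (ν k) (ν l) = -Real.cos (Real.pi / (m : ℝ))

lemma hCoxSimplex.exists_normals (h : hCoxSimplex n P) : ∃ ν, IsNormals n P ν := by
  obtain ⟨⟨k, v, hv, hP, hpi, -, hcox⟩, -, hcard⟩ := h
  rw [← ncard_FN hpi] at hcard
  have hfin : (FN n P).Finite := finite_of_ncard_pos (by omega)
  have : Nat.card (FN n P) = n + 1 := hcard
  have : Finite (FN n P) := hfin
  let e : Fin (n + 1) ≃ FN n P := (Fin.castOrderIso (by assumption)).symm.toEquiv.trans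
    (Finite.equivFin (FN n P)).symm
  have hr : range (fun i => (e i).val) = FN n P := by
    ext x
    constructor
    · rintro ⟨i, rfl⟩; exact (e i).2
    · exact fun hx => ⟨e.symm ⟨x, hx⟩, by simp⟩
  refine ⟨fun i => (e i).val, fun i j h => e.injective (Subtype.ext h), hr, ?_, hpi, ?_⟩
  · rw [← biInter_range (f := fun i => (e i).val) (g := fun u => hHalf n u), hr]
    exact eq_iInter_FN hpi hv hP
  · intro i j hij hx
    obtain ⟨i', hi⟩ := FN_subset_range hpi hv hP (e i).2
    obtain ⟨j', hj⟩ := FN_subset_range hpi hv hP (e j).2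
    have hne : hWall n (v i') ≠ hWall n (v j') := by
      rw [hi, hj]
      intro hw
      refine hij (e.injective (Subtype.ext ?_))
      exact eq_of_FN hpi (e j).2 (e i).2.1 (e i).2.2.1 (by rw [hw]; exact inter_subset_right)
    have := hcox i' j' hne
    rw [hi, hj] at this
    exact this hx

end

section
variable {n : ℕ} {P : Set ↥(hypSet n)}

lemma exists_hyp_span (n : ℕ) : ∃ (b : Fin (n + 1) → ↥(hypSet n))
    (c : EuclideanSpace ℝ (Fin (n + 1)) →ₗ[ℝ] (Fin (n + 1) → ℝ)),
    ∀ v, v = ∑ j, c v j • (b j).val := by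
  have h0 : mink n e0 (e0 : EuclideanSpace ℝ (Fin (n + 1))) = -1 := by
    rw [mink_e0]; simp [e0]
  have hs : ∀ i : Fin n, mink n (√2 • e0 + EuclideanSpace.single i.succ 1)
      (√2 • e0 + EuclideanSpace.single i.succ 1) = -1 := by
    intro i
    have := Real.mul_self_sqrt (x := 2) (by norm_num)
    have h1 : mink n e0 (EuclideanSpace.single i.succ 1) = 0 := by
      rw [mink_single_succ]; simp [e0, Fin.succ_ne_zero]
    have h2 : mink n (EuclideanSpace.single i.succ 1) (EuclideanSpace.single i.succ 1) = 1 := by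
      rw [mink_single_succ]; simp
    rw [mink_add_right, mink_smul_right, mink_add_left, mink_add_left, mink_smul_left,
      mink_smul_left, mink_comm (EuclideanSpace.single i.succ 1) e0, h0, h1, h2]
    linarith
  refine ⟨Fin.cons ⟨e0, h0, by simp [e0]⟩ fun i =>
    ⟨√2 • e0 + EuclideanSpace.single i.succ 1, hs i, ?_⟩,
    { toFun := fun v => Fin.cons (v 0 - √2 * ∑ i : Fin n, v i.succ) fun i => v i.succ
      map_add' := ?_
      map_smul' := ?_ }, ?_⟩
  · simp [e0, (Fin.succ_ne_zero i).symm]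
  · intro v w
    ext j
    refine Fin.cases ?_ (fun j => ?_) j
    · simp [Finset.sum_add_distrib]; ring
    · simp
  · intro a v
    ext j
    refine Fin.cases ?_ (fun j => ?_) j
    · simp [← Finset.mul_sum]; ring
    · simp
  · intro v
    ext j
    simp only [LinearMap.coe_mk, AddHom.coe_mk, Fin.sum_univ_succ, Fin.cons_zero, Fin.cons_succ]
    refine Fin.cases ?_ (fun j => ?_) j
    · simp [e0, (Fin.succ_ne_zero _).symm, ← Finset.sum_mul]; ring
    · simp [e0, Fin.succ_ne_zero, Pi.single_apply]

/-- An isometry of hyperbolic space extends to a linear isometry of the Lorentzian space. -/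
lemma hIsIsom.exists_linear {g : ↥(hypSet n) → ↥(hypSet n)} (hg : hIsIsom n g) :
    ∃ G : EuclideanSpace ℝ (Fin (n + 1)) ≃ₗ[ℝ] EuclideanSpace ℝ (Fin (n + 1)),
      (∀ x y, mink n (G x) (G y) = mink n x y) ∧ ∀ p : ↥(hypSet n), (g p).val = G p.val := by
  obtain ⟨b, c, hbc⟩ := exists_hyp_span n
  let A : EuclideanSpace ℝ (Fin (n + 1)) →ₗ[ℝ] EuclideanSpace ℝ (Fin (n + 1)) :=
    ∑ j, ((LinearMap.proj j).comp c).smulRight (g (b j)).val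
  have hA : ∀ v, A v = ∑ j, c v j • (g (b j)).val := by
    intro v; simp [A]
  have h1 : ∀ p v, mink n (g p).val (A v) = mink n p.val v := by
    intro p v
    conv_rhs => rw [hbc v]
    rw [hA, mink_sum_right, mink_sum_right]
    exact Finset.sum_congr rfl fun j _ => by rw [mink_smul_right, mink_smul_right, hg.2]
  have h2 : ∀ x y, mink n (A x) (A y) = mink n x y := by
    intro x y
    conv_rhs => rw [hbc x]
    rw [hA x, mink_sum_left, mink_sum_left]
    exact Finset.sum_congr rfl fun j _ => by rw [mink_smul_left, mink_smul_left, h1]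
  have hinj : Function.Injective A := by
    rw [← LinearMap.ker_eq_bot, LinearMap.ker_eq_bot']
    intro d hd
    refine mink_eq_zero fun y => ?_
    rw [← h2, hd, ← zero_smul ℝ (0 : EuclideanSpace ℝ (Fin (n + 1))), mink_smul_left, zero_mul]
  refine ⟨LinearEquiv.ofInjectiveEndo A hinj, h2, fun p => ?_⟩
  rw [← sub_eq_zero]
  refine mink_eq_zero fun y => ?_
  obtain ⟨z, rfl⟩ := (LinearEquiv.ofInjectiveEndo A hinj).surjective y
  change mink n ((g p).val - A p.val) (A z) = 0
  rw [mink_sub_left, h1, h2, sub_self]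

/-- Outward unit normals of a tile. -/
structure IsTileNormals (n : ℕ) (T : Set ↥(hypSet n)) (M : Fin (n + 1) → Fin (n + 1) → ℝ)
    (N : Fin (n + 1) → EuclideanSpace ℝ (Fin (n + 1))) : Prop where
  gram : ∀ k l, mink n (N k) (N l) = M k l
  eq : T = ⋂ k, hHalf n (N k)
  mem : ∀ k, N k ∈ FN n T
  cox : ∀ k l, k ≠ l → (∃ x ∈ T, x ∈ hWall n (N k) ∩ hWall n (N l)) →
    ∃ m : ℕ, 2 ≤ m ∧ mink n (N k) (N l) = -Real.cos (Real.pi / (m : ℝ))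

lemma FN_image {g : ↥(hypSet n) → ↥(hypSet n)} (hg : hIsIsom n g)
    {G : EuclideanSpace ℝ (Fin (n + 1)) ≃ₗ[ℝ] EuclideanSpace ℝ (Fin (n + 1))}
    (hG : ∀ x y, mink n (G x) (G y) = mink n x y) (hp : ∀ p : ↥(hypSet n), (g p).val = G p.val)
    {v : EuclideanSpace ℝ (Fin (n + 1))} (hv : v ∈ FN n P) : G v ∈ FN n (g '' P) := by
  have hw : ∀ u p, g p ∈ hWall n (G u) ↔ p ∈ hWall n u := fun u p => by
    change mink n (G u) (g p).val = 0 ↔ _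
    rw [hp, hG]; rfl
  obtain ⟨hv1, hv2, ⟨x, hx⟩, w, hw1, hw2, hw3, hw4⟩ := hv
  have hvw := hw4 v hv1 inter_subset_right
  have him : g '' P ∩ hWall n (G v) = g '' (P ∩ hWall n v) := by
    ext y
    constructor
    · rintro ⟨⟨p, hpP, rfl⟩, h⟩
      exact ⟨p, ⟨hpP, (hw v p).mp h⟩, rfl⟩
    · rintro ⟨p, ⟨hpP, h⟩, rfl⟩
      exact ⟨⟨p, hpP, rfl⟩, (hw v p).mpr h⟩
  have hsub : g '' P ⊆ hHalf n (G v) := by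
    rintro _ ⟨p, hpP, rfl⟩
    change mink n (G v) (g p).val ≤ 0
    rw [hp, hG]
    exact hv2 hpP
  refine ⟨by rw [hG, hv1], hsub, ⟨g x, ⟨x, hx.1, rfl⟩, (hw v x).mpr hx.2⟩, G v, by rw [hG, hv1],
    hsub, rfl, fun u hu hsu => ?_⟩
  obtain ⟨u, rfl⟩ := G.surjective u
  have := hw4 u (by rw [← hG, hu]) fun p hpp => (hw u p).mp (hsu (him ▸ ⟨p, hpp, rfl⟩))
  ext y
  obtain ⟨p, rfl⟩ := hg.1.2 y
  rw [hw, hw, this, hvw]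

lemma IsNormals.exists_tile {F T : Set ↥(hypSet n)}
    {ν : Fin (n + 1) → EuclideanSpace ℝ (Fin (n + 1))} (hν : IsNormals n F ν)
    (h : hCongr n F T) : ∃ N, IsTileNormals n T (fun k l => mink n (ν k) (ν l)) N := by
  obtain ⟨g, hg, rfl⟩ := h
  obtain ⟨G, hG, hp⟩ := hg.exists_linear
  refine ⟨fun k => G (ν k), fun k l => hG _ _, ?_, fun k => ?_, ?_⟩
  · ext y
    obtain ⟨p, rfl⟩ := hg.1.2 y
    rw [hg.1.1.mem_set_image, hν.eq]
    simp only [mem_iInter]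
    refine forall_congr' fun k => ?_
    change mink n (ν k) p.val ≤ 0 ↔ mink n (G (ν k)) (g p).val ≤ 0
    rw [hp, hG]
  · exact FN_image hg hG hp (hν.range ▸ mem_range_self k)
  · rintro k l hkl ⟨_, ⟨x, hx, rfl⟩, h1, h2⟩
    change mink n (G (ν k)) (g x).val = 0 at h1
    change mink n (G (ν l)) (g x).val = 0 at h2
    rw [hp, hG] at h1 h2
    obtain ⟨m, hm, e⟩ := hν.cox k l hkl ⟨x, hx, h1, h2⟩
    exact ⟨m, hm, by rw [hG, e]⟩

end

section

lemma continuous_qf (x : Fin 6 → ℝ) : Continuous (qf x) := by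
  unfold qf; fun_prop

lemma continuous_qf_self : Continuous fun y : Fin 6 → ℝ => qf y y := by
  unfold qf; fun_prop

lemma InP.qf_self_nonpos {y : Fin 6 → ℝ} (hy : InP y) : qf y y ≤ 0 := by
  have h0 := hy.zero_le
  obtain ⟨h1, h2, h3, h4, h5, hs⟩ := hy
  have h6 : (y 1 + y 2 + y 3 + y 4 + y 5) * (y 1 + y 2 + y 3 + y 4 + y 5) ≤ y 0 * y 0 :=
    mul_self_le_mul_self (by positivity) hs
  simp only [qf]
  nlinarith [mul_nonneg h1 h2, mul_nonneg h1 h3, mul_nonneg h1 h4, mul_nonneg h1 h5,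
    mul_nonneg h2 h3, mul_nonneg h2 h4, mul_nonneg h2 h5, mul_nonneg h3 h4, mul_nonneg h3 h5,
    mul_nonneg h4 h5]

lemma zero_ne_of_qf_neg {y : Fin 6 → ℝ} (h : qf y y < 0) : y 0 ≠ 0 := by
  intro h0
  simp only [qf, h0] at h
  nlinarith [mul_self_nonneg (y 1), mul_self_nonneg (y 2), mul_self_nonneg (y 3),
    mul_self_nonneg (y 4), mul_self_nonneg (y 5)]

lemma InP.zero_pos {y : Fin 6 → ℝ} (hy : InP y) (h : qf y y < 0) : 0 < y 0 :=
  lt_of_le_of_ne hy.zero_le (zero_ne_of_qf_neg h).symm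

/-- A linear isometry from the standard Lorentzian form, preserving the future. -/
structure IsLor (Ψ : (Fin 6 → ℝ) ≃ₗ[ℝ] EuclideanSpace ℝ (Fin (5 + 1))) : Prop where
  form : ∀ x y, mink 5 (Ψ x) (Ψ y) = qf x y
  fut : ∀ x, qf x x < 0 → 0 < x 0 → 0 < Ψ x 0

namespace IsLor
variable {Ψ : (Fin 6 → ℝ) ≃ₗ[ℝ] EuclideanSpace ℝ (Fin (5 + 1))}

lemma form_symm (h : IsLor Ψ) (x y : EuclideanSpace ℝ (Fin (5 + 1))) :
    qf (Ψ.symm x) (Ψ.symm y) = mink 5 x y := by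
  rw [← h.form, Ψ.apply_symm_apply, Ψ.apply_symm_apply]

lemma qf_symm (h : IsLor Ψ) (x : EuclideanSpace ℝ (Fin (5 + 1))) (y : Fin 6 → ℝ) :
    qf (Ψ.symm x) y = mink 5 x (Ψ y) := by
  rw [← h.form, Ψ.apply_symm_apply]

lemma qf_hyp (h : IsLor Ψ) (p : ↥(hypSet 5)) : qf (Ψ.symm p.val) (Ψ.symm p.val) = -1 := by
  rw [h.form_symm, p.2.1]

lemma zero_pos (h : IsLor Ψ) (p : ↥(hypSet 5)) : 0 < Ψ.symm p.val 0 := by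
  have h1 := h.qf_hyp p
  have h2 : qf (Ψ.symm p.val) (Ψ.symm p.val) < 0 := by rw [h1]; norm_num
  by_contra h3
  have h4 := lt_of_le_of_ne (not_lt.mp h3) (zero_ne_of_qf_neg h2)
  have h5 := h.fut (-Ψ.symm p.val) (by simpa [qf] using h2) (by simpa using h4)
  rw [map_neg, Ψ.apply_symm_apply] at h5
  have := p.2.2
  simp only [PiLp.neg_apply] at h5
  linarith

lemma exists_point (h : IsLor Ψ) {y : Fin 6 → ℝ} (hy : qf y y < 0) (h0 : 0 < y 0) :
    ∃ q : ↥(hypSet 5), ∃ c > (0 : ℝ), q.val = c • Ψ y :=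
  CD.exists_point (by rw [h.form]; exact hy) (h.fut y hy h0)

end IsLor

/-- A tile in coordinates. -/
structure IsTileCone (Ψ : (Fin 6 → ℝ) ≃ₗ[ℝ] EuclideanSpace ℝ (Fin (5 + 1)))
    (P T : Set ↥(hypSet 5)) (N : Fin 6 → EuclideanSpace ℝ (Fin (5 + 1))) : Prop where
  lor : IsLor Ψ
  eqP : P = ⋂ k, hHalf 5 (Ψ (pN k))
  eqT : T = ⋂ k, hHalf 5 (N k)
  sub : T ⊆ P
  int : (interior T).Nonempty
  unit : ∀ k, mink 5 (N k) (N k) = 1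

lemma mem_P_iff {Ψ : (Fin 6 → ℝ) ≃ₗ[ℝ] EuclideanSpace ℝ (Fin (5 + 1))}
    {P : Set ↥(hypSet 5)} (lor : IsLor Ψ) (eqP : P = ⋂ k, hHalf 5 (Ψ (pN k)))
    {q : ↥(hypSet 5)} {y : Fin 6 → ℝ} {c : ℝ} (hc : 0 < c) (h : q.val = c • Ψ y) :
    q ∈ P ↔ InP y := by
  rw [eqP, mem_iInter, inP_iff]
  exact forall_congr' fun k => by rw [mem_hHalf_of_smul hc h, lor.form]

namespace IsTileCone
variable {Ψ : (Fin 6 → ℝ) ≃ₗ[ℝ] EuclideanSpace ℝ (Fin (5 + 1))} {P T : Set ↥(hypSet 5)}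
  {N : Fin 6 → EuclideanSpace ℝ (Fin (5 + 1))}

lemma mem_T_iff (h : IsTileCone Ψ P T N) {q : ↥(hypSet 5)} {y : Fin 6 → ℝ} {c : ℝ}
    (hc : 0 < c) (e : q.val = c • Ψ y) : q ∈ T ↔ Reg (fun k => Ψ.symm (N k)) y := by
  rw [h.eqT, mem_iInter]
  exact forall_congr' fun k => by rw [mem_hHalf_of_smul hc e, h.lor.qf_symm]

lemma inP_of_reg (h : IsTileCone Ψ P T N) {y : Fin 6 → ℝ} (hy : qf y y < 0) (h0 : 0 < y 0)
    (hr : Reg (fun k => Ψ.symm (N k)) y) : InP y := by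
  obtain ⟨q, c, hc, e⟩ := h.lor.exists_point hy h0
  exact (mem_P_iff h.lor h.eqP hc e).mp (h.sub ((h.mem_T_iff hc e).mpr hr))

/-- A strictly regular vector in general position with respect to the base point. -/
lemma inP_of_generic (h : IsTileCone Ψ P T N) {p y : Fin 6 → ℝ} (hp : qf p p < 0) (hp' : InP p)
    (hps : SReg (fun k => Ψ.symm (N k)) p) (hy : SReg (fun k => Ψ.symm (N k)) y)
    (hg : ∀ i, i ≠ 0 → ∀ a b c : ℝ, a • p + b • y = c • wv i → b = 0) : InP y := by
  let f : ℝ → Fin 6 → ℝ := fun s => (1 - s) • p + s • y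
  have hf : Continuous f := by fun_prop
  have hcl : IsClosed {s | InP (f s)} := by
    simp only [inP_iff, ofPred_forall]
    exact isClosed_iInter fun i => isClosed_le ((continuous_qf _).comp hf) continuous_const
  have key : Icc (0 : ℝ) 1 ⊆ {s | InP (f s)} := by
    refine IsClosed.Icc_subset_of_forall_mem_nhdsWithin (hcl.inter isClosed_Icc) (by simpa [f])
      fun s ⟨hs, hs0, hs1⟩ => ?_
    have hneg : qf (f s) (f s) < 0 := by
      refine lt_of_le_of_ne hs.qf_self_nonpos fun h0 => ?_
      rcases hs0.eq_or_lt with rfl | hs0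
      · simp [f] at h0; linarith
      · by_cases hz : f s = 0
        · exact hs0.ne' (hg 1 (by decide) (1 - s) s 0 (by rw [zero_smul]; exact hz))
        · obtain ⟨i, hi, -, e⟩ := hs.exists_wv h0 hz
          exact hs0.ne' (hg i hi (1 - s) s _ e)
    have hsr : SReg (fun k => Ψ.symm (N k)) (f s) := fun k => by
      simp only [f, qf_add_right, qf_smul_right]
      have h1 := hps k
      have h2 := hy k
      nlinarith
    refine mem_nhdsWithin_of_mem_nhds ?_
    have e1 : ∀ᶠ r in nhds s, qf (f r) (f r) < 0 :=
      (continuous_qf_self.comp hf).continuousAt.eventually_lt continuousAt_const hneg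
    have e2 : ∀ᶠ r in nhds s, 0 < f r 0 :=
      continuousAt_const.eventually_lt ((continuous_apply 0).comp hf).continuousAt
        (hs.zero_pos hneg)
    have e3 : ∀ᶠ r in nhds s, ∀ k, qf (Ψ.symm (N k)) (f r) < 0 :=
      Filter.eventually_all.mpr fun k =>
        ((continuous_qf _).comp hf).continuousAt.eventually_lt continuousAt_const (hsr k)
    filter_upwards [e1, e2, e3] with r h1 h2 h3
    exact h.inP_of_reg h1 h2 (SReg.reg h3)
  have := key (right_mem_Icc.mpr zero_le_one)
  simpa [f] using this

lemma exists_generic (p y : Fin 6 → ℝ) : ∃ d : Fin 6 → ℝ, ∀ i, ∀ a b c : ℝ,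
    d ≠ a • p + b • y + c • wv i := by
  let S : Fin 6 → Submodule ℝ (Fin 6 → ℝ) := fun i => Submodule.span ℝ (range ![p, y, wv i])
  have hS : ∀ i, S i ≠ ⊤ := by
    intro i hi
    have h1 := finrank_range_le_card (R := ℝ) ![p, y, wv i]
    rw [Set.finrank] at h1
    change Module.finrank ℝ (S i) ≤ _ at h1
    rw [hi, finrank_top] at h1
    simp at h1
  have := Subspace.biUnion_ne_univ_of_top_notMem (s := Finset.univ.image S) (by simpa using hS)
  obtain ⟨d, hd⟩ := (Set.ne_univ_iff_exists_notMem _).mp this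
  refine ⟨d, fun i a b c e => hd ?_⟩
  simp only [mem_iUnion]
  refine ⟨S i, by simp, ?_⟩
  rw [e]
  refine (S i).add_mem ((S i).add_mem ?_ ?_) ?_ <;> refine (S i).smul_mem _ (Submodule.subset_span ?_)
  · exact ⟨0, rfl⟩
  · exact ⟨1, rfl⟩
  · exact ⟨2, rfl⟩

lemma inP (h : IsTileCone Ψ P T N) (y : Fin 6 → ℝ) (hy : Reg (fun k => Ψ.symm (N k)) y) :
    InP y := by
  obtain ⟨q, hq⟩ := h.int
  set p := Ψ.symm q.val with hpdef
  have hp : qf p p < 0 := by rw [h.lor.qf_hyp]; norm_num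
  have hps : SReg (fun k => Ψ.symm (N k)) p := fun k => by
    rw [h.lor.form_symm]
    refine interior_strict hq (h.unit k) ?_
    rw [h.eqT]
    exact iInter_subset _ k
  have hp' : InP p := h.inP_of_reg hp (h.lor.zero_pos q) hps.reg
  rw [inP_iff]
  intro i
  refine limit_nonpos (b := qf (pN i) p) fun ε hε => ?_
  rw [← qf_smul_right, ← qf_add_right]
  have hsr : SReg (fun k => Ψ.symm (N k)) (y + ε • p) := fun k => by
    rw [qf_add_right, qf_smul_right]
    nlinarith [hy k, hps k]
  obtain ⟨d, hd⟩ := exists_generic p (y + ε • p)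
  obtain ⟨δ, hδ, hsm⟩ := hsr.exists_small d
  by_contra hpos
  push Not at hpos
  obtain ⟨δ', hδ', hsm'⟩ := exists_small (c := -qf (pN i) (y + ε • p)) (d := -qf (pN i) d)
    (by linarith)
  obtain ⟨r, hr0, hr⟩ := exists_between (lt_min hδ hδ')
  have h1 := hsm r hr0 (hr.trans_le (min_le_left _ _))
  have h2 := hsm' r hr0 (hr.trans_le (min_le_right _ _))
  have h3 := h.inP_of_generic hp hp' hps h1 fun j _ a b c e => by
    by_contra hb
    refine hd j (-(a / (b * r))) (-(1 / r)) (c / (b * r)) ?_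
    have : (b * r) • d = c • wv j - a • p - b • (y + ε • p) := by
      rw [← e]; module
    have hbr : b * r ≠ 0 := mul_ne_zero hb hr0.ne'
    have h4 : d = (b * r)⁻¹ • (c • wv j - a • p - b • (y + ε • p)) := by
      rw [← this, inv_smul_smul₀ hbr]
    rw [h4]
    have h5 : (b * r)⁻¹ * b = 1 / r := by field_simp
    simp only [smul_sub, smul_smul, h5, div_eq_inv_mul]
    module
  have h4 := (inP_iff _).mp h3 i
  rw [qf_add_right, qf_smul_right] at h4
  linarith

end IsTileCone

end

section
variable {Ψ : (Fin 6 → ℝ) ≃ₗ[ℝ] EuclideanSpace ℝ (Fin (5 + 1))} {P F T : Set ↥(hypSet 5)}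
  {N : Fin 6 → EuclideanSpace ℝ (Fin (5 + 1))} {M : Fin 6 → Fin 6 → ℝ}

/-- A vector of the standard cone lying on two prescribed walls. -/
lemma exists_inP_two (i j : Fin 6) :
    ∃ y, InP y ∧ qf y y < 0 ∧ qf (pN i) y = 0 ∧ qf (pN j) y = 0 := by
  let g : Fin 6 → ℝ := fun k => if k = i ∨ k = j then 0 else 1
  refine ⟨fun k => if k = 0 then g 1 + g 2 + g 3 + g 4 + g 5 else g k, ?_, ?_, ?_, ?_⟩
  · have h : ∀ k, 0 ≤ g k := fun k => by simp only [g]; split_ifs <;> norm_num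
    exact ⟨h 1, h 2, h 3, h 4, h 5, le_refl _⟩
  · fin_cases i <;> fin_cases j <;> simp [qf, g] <;> norm_num
  · rcases eq_or_ne i 0 with rfl | hi
    · rw [qf_pN_zero]; simp; ring
    · rw [qf_pN hi]; simp [hi, g]
  · rcases eq_or_ne j 0 with rfl | hj
    · rw [qf_pN_zero]; simp; ring
    · rw [qf_pN hj]; simp [hj, g]

lemma exists_pN_dual (i : Fin 6) : ∃ z, qf (pN i) z ≠ 0 ∧ ∀ j, j ≠ i → qf (pN j) z = 0 := by
  rcases eq_or_ne i 0 with rfl | hi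
  · exact ⟨fun k => if k = 0 then 1 else 0, by rw [qf_pN_zero]; simp,
      fun j hj => by rw [qf_pN hj]; simp [hj]⟩
  · refine ⟨wv i, by rw [qf_pN_wv _ _ hi]; simp, fun j hj => ?_⟩
    rcases eq_or_ne j 0 with rfl | hj0
    · exact qf_pN_zero_wv i hi
    · rw [qf_pN_wv _ _ hj0, if_neg hj]

lemma pN_indep {i j l : Fin 6} {α β γ : ℝ} (hij : i ≠ j)
    (h : α • pN i + β • pN j = γ • pN l) : α = 0 ∨ β = 0 := by
  rcases ne_or_eq l i with hl | rfl
  · obtain ⟨z, hz, hz'⟩ := exists_pN_dual i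
    have := congrArg (qf · z) h
    simp only [qf_add_left, qf_smul_left, hz' j hij.symm, hz' l hl, mul_zero, add_zero] at this
    exact Or.inl ((mul_eq_zero.mp this).resolve_right hz)
  · obtain ⟨z, hz, hz'⟩ := exists_pN_dual j
    have := congrArg (qf · z) h
    simp only [qf_add_left, qf_smul_left, hz' l hij, mul_zero, zero_add] at this
    exact Or.inr ((mul_eq_zero.mp this).resolve_right hz)

/-- The vectors `wv i` span extreme rays of the standard cone. -/
lemma InP.eq_smul_wv {u v : Fin 6 → ℝ} (hu : InP u) (hv : InP v) {i : Fin 6} (hi : i ≠ 0) {c : ℝ}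
    (h : u + v = c • wv i) : u = u 0 • wv i := by
  have hc := fun k => congrFun h k
  simp only [Pi.add_apply, Pi.smul_apply, smul_eq_mul, wv] at hc
  obtain ⟨h1, h2, h3, h4, h5, hs⟩ := hu
  obtain ⟨h1', h2', h3', h4', h5', hs'⟩ := hv
  have c0 := hc 0
  have c1 := hc 1
  have c2 := hc 2
  have c3 := hc 3
  have c4 := hc 4
  have c5 := hc 5
  clear hc h
  fin_cases i <;> first | exact absurd rfl hi | skip
  all_goals
    simp at c0 c1 c2 c3 c4 c5
    funext k
    fin_cases k <;> simp [wv] <;> linarith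

lemma IsTileCone.cox (h : IsTileCone Ψ P T N) (hN : IsTileNormals 5 T M N) {k l : Fin 6}
    (hkl : k ≠ l) :
    ∃ m : ℕ, 2 ≤ m ∧ qf (Ψ.symm (N k)) (Ψ.symm (N l)) = -Real.cos (Real.pi / (m : ℝ)) := by
  obtain ⟨z, hz⟩ := exists_dual_of_sub h.inP
  have hzr : ∀ a, Reg (fun k => Ψ.symm (N k)) (z a) := fun a b => by
    rw [hz]; split_ifs <;> norm_num
  obtain ⟨a, b, hab, hak, hal, hbk, hbl⟩ : ∃ a b : Fin 6, a ≠ b ∧ a ≠ k ∧ a ≠ l ∧ b ≠ k ∧ b ≠ l := by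
    revert k l; decide
  have hr : Reg (fun k => Ψ.symm (N k)) (z a + z b) := fun c => by
    rw [qf_add_right]; linarith [hzr a c, hzr b c]
  have hin := h.inP _ hr
  have hneg : qf (z a + z b) (z a + z b) < 0 := by
    refine lt_of_le_of_ne hin.qf_self_nonpos fun h0 => ?_
    have haa : qf (Ψ.symm (N a)) (z a) = -1 := by rw [hz, if_pos rfl]
    have hbb : qf (Ψ.symm (N b)) (z b) = -1 := by rw [hz, if_pos rfl]
    have hba : qf (Ψ.symm (N b)) (z a) = 0 := by rw [hz, if_neg hab.symm]
    have hab' : qf (Ψ.symm (N a)) (z b) = 0 := by rw [hz, if_neg hab]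
    have hne : z a + z b ≠ 0 := by
      intro hzero
      have := qf_add_right (Ψ.symm (N a)) (z a) (z b)
      rw [hzero, haa, hab', ← zero_smul ℝ (0 : Fin 6 → ℝ), qf_smul_right] at this
      linarith
    obtain ⟨i, hi, -, e⟩ := hin.exists_wv h0 hne
    have ea := (h.inP _ (hzr a)).eq_smul_wv (h.inP _ (hzr b)) hi e
    have eb := (h.inP _ (hzr b)).eq_smul_wv (h.inP _ (hzr a)) hi (by rw [add_comm, ← e])
    rw [ea, qf_smul_right] at haa hba
    rw [eb, qf_smul_right] at hbb
    rcases mul_eq_zero.mp hba with h1 | h1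
    · rw [h1] at haa; linarith
    · rw [h1] at hbb; linarith
  obtain ⟨q, c, hc, e⟩ := h.lor.exists_point hneg (hin.zero_pos hneg)
  rw [h.lor.form_symm]
  refine hN.cox k l hkl ⟨q, (h.mem_T_iff hc e).mpr hr, ?_, ?_⟩
  · rw [mem_hWall_of_smul hc e, ← h.lor.qf_symm, qf_add_right, hz, hz, if_neg hak.symm,
      if_neg hbk.symm, add_zero]
  · rw [mem_hWall_of_smul hc e, ← h.lor.qf_symm, qf_add_right, hz, hz, if_neg hal.symm,
      if_neg hbl.symm, add_zero]

/-- A linear identification of `P` with the standard cone. -/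
structure IsFrame (Ψ : (Fin 6 → ℝ) ≃ₗ[ℝ] EuclideanSpace ℝ (Fin (5 + 1)))
    (P : Set ↥(hypSet 5)) : Prop where
  lor : IsLor Ψ
  eqP : P = ⋂ k, hHalf 5 (Ψ (pN k))
  int : (interior P).Nonempty
  mem : ∀ k, Ψ (pN k) ∈ FN 5 P
  range : ∀ u ∈ FN 5 P, ∃ l, u = Ψ (pN l)

lemma IsFrame.sec (hf : IsFrame Ψ P) {𝒯 : Set (Set ↥(hypSet 5))} (h2 : hSecondType 5 P 𝒯)
    (hT : T ∈ 𝒯) (hN : IsTileNormals 5 T M N) (k i j : Fin 6) (α β : ℝ) (hij : i ≠ j)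
    (h : Ψ.symm (N k) = α • pN i + β • pN j) : α = 0 ∨ β = 0 := by
  have hNk : N k = α • Ψ (pN i) + β • Ψ (pN j) := by
    rw [← map_smul, ← map_smul, ← map_add, ← h, Ψ.apply_symm_apply]
  have hne : P ∩ hWall 5 (Ψ (pN i)) ≠ P ∩ hWall 5 (Ψ (pN j)) := by
    intro he
    have := eq_of_FN hf.int (hf.mem i) (hf.mem j).1 (hf.mem j).2.1 (by rw [he]; exact inter_subset_right)
    obtain ⟨z, hz, hz'⟩ := exists_pN_dual i
    exact hz (by rw [← Ψ.injective this]; exact hz' j hij.symm)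
  have hmeet : ((P ∩ hWall 5 (Ψ (pN i))) ∩ (P ∩ hWall 5 (Ψ (pN j)))).Nonempty := by
    obtain ⟨y, hy, hy', hi, hj⟩ := exists_inP_two i j
    obtain ⟨q, c, hc, e⟩ := hf.lor.exists_point hy' (hy.zero_pos hy')
    have hq := (mem_P_iff hf.lor hf.eqP hc e).mpr hy
    refine ⟨q, ⟨hq, ?_⟩, hq, ?_⟩
    · rw [mem_hWall_of_smul hc e, hf.lor.form, hi]
    · rw [mem_hWall_of_smul hc e, hf.lor.form, hj]
  have hnm := h2 _ _ (hf.mem i).2.2 (hf.mem j).2.2 hne hmeet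
  have hS : ∃ S, hIsFacet 5 P S ∧ S ⊆ hWall 5 (N k) := by
    by_contra hno
    refine hnm ⟨N k, ⟨(hN.mem k).1, ⟨T, hT, _, (hN.mem k).2.2, inter_subset_right⟩, hno⟩, ?_⟩
    rintro x ⟨⟨-, h1⟩, -, h3⟩
    change mink 5 _ _ = 0 at h1 h3
    change mink 5 _ _ = 0
    rw [hNk, mink_add_left, mink_smul_left, mink_smul_left, h1, h3]; ring
  obtain ⟨S, hS, hSw⟩ := hS
  obtain ⟨u, hu, rfl⟩ := exists_FN hS
  obtain ⟨l, rfl⟩ := hf.range u hu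
  rcases eq_or_neg_of_FN hu (hN.mem k).1 hSw with e | e
  · rw [e, Ψ.symm_apply_apply] at h
    exact pN_indep (γ := 1) (l := l) hij (by rw [one_smul, h])
  · rw [e, map_neg, Ψ.symm_apply_apply] at h
    exact pN_indep (γ := -1) (l := l) hij (by rw [neg_one_smul, h])

lemma IsFrame.exists_fam (hf : IsFrame Ψ P) {ν : Fin 6 → EuclideanSpace ℝ (Fin (5 + 1))}
    (hν : IsNormals 5 F ν) {𝒯 : Set (Set ↥(hypSet 5))} (h : hSTDecomp 5 P F 𝒯) :
    ∃ N : ↥𝒯 → Fin 6 → EuclideanSpace ℝ (Fin (5 + 1)), (∀ T, T.val = ⋂ k, hHalf 5 (N T k)) ∧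
      Fam (fun k l => mink 5 (ν k) (ν l)) fun T k => Ψ.symm (N T k) := by
  obtain ⟨⟨hfin, -, hcox, hun, hdis, -⟩, hcong, hsec⟩ := h
  have hex : ∀ T : ↥𝒯, ∃ N, IsTileNormals 5 T.val (fun k l => mink 5 (ν k) (ν l)) N :=
    fun T => hν.exists_tile (hcong _ T.2)
  choose N hN using hex
  have hcone : ∀ T : ↥𝒯, IsTileCone Ψ P T.val (N T) := fun T =>
    { lor := hf.lor
      eqP := hf.eqP
      eqT := (hN T).eq
      sub := by rw [← hun]; exact subset_sUnion_of_mem T.2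
      int := by
        obtain ⟨_, _, -, -, hi, -⟩ := hcox _ T.2
        exact hi
      unit := fun k => ((hN T).mem k).1 }
  have htile : ∀ T : ↥𝒯, Tile fun k => Ψ.symm (N T k) := fun T =>
    { unit := fun k => by rw [hf.lor.form_symm]; exact (hcone T).unit k
      cox := fun k l hkl => (hcone T).cox (hN T) hkl
      sub := (hcone T).inP
      sec := hf.sec hsec T.2 (hN T) }
  refine ⟨N, fun T => (hN T).eq, fun T k l => ?_, htile, fun y hy => ?_, fun T T' y h1 h2 => ?_⟩
  · rw [hf.lor.form_symm, (hN T).gram]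
  · have : Finite ↥𝒯 := hfin
    have hcl : IsClosed {x | ∃ T : ↥𝒯, Reg (fun k => Ψ.symm (N T k)) x} := by
      simp only [Reg, ofPred_exists, ofPred_forall]
      exact isClosed_iUnion_of_finite fun T => isClosed_iInter fun k =>
        isClosed_le (continuous_qf _) continuous_const
    let c : Fin 6 → ℝ := ![6, 1, 1, 1, 1, 1]
    have hev : ∀ ε ∈ Ioi (0 : ℝ), y + ε • c ∈ {x | ∃ T : ↥𝒯, Reg (fun k => Ψ.symm (N T k)) x} := by
      intro ε (hε : 0 < ε)
      have hc : InP c := by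
        refine ⟨?_, ?_, ?_, ?_, ?_, ?_⟩ <;> simp [c]
        norm_num
      have hin : InP (y + ε • c) := hy.add (hc.smul hε.le)
      have hneg : qf (y + ε • c) (y + ε • c) < 0 := by
        have h1 := hy.qf_self_nonpos
        have h2 : qf c c < 0 := by simp [qf, c]; norm_num
        have h3 : qf y c ≤ 0 := by
          have := hy.zero_le
          obtain ⟨_, _, _, _, _, _⟩ := hy
          simp [qf, c]; linarith
        simp only [qf_add_left, qf_add_right, qf_smul_left, qf_smul_right, qf_comm c y]
        nlinarith [mul_pos hε hε, mul_nonneg hε.le (neg_nonneg.mpr h3)]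
      obtain ⟨q, r, hr, e⟩ := hf.lor.exists_point hneg (hin.zero_pos hneg)
      have hq := (mem_P_iff hf.lor hf.eqP hr e).mpr hin
      rw [← hun] at hq
      obtain ⟨T, hT, hqT⟩ := hq
      exact ⟨⟨T, hT⟩, ((hcone ⟨T, hT⟩).mem_T_iff hr e).mp hqT⟩
    have h0 : (0 : ℝ) ∈ closure (Ioi (0 : ℝ)) := by simp
    have hcont : Continuous fun ε : ℝ => y + ε • c := by fun_prop
    have := map_mem_closure hcont h0 hev
    rw [hcl.closure_eq] at this
    simpa using this
  · by_contra hne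
    have hin := (htile T).sub y h1.reg
    have hneg : qf y y < 0 := by
      refine lt_of_le_of_ne hin.qf_self_nonpos fun h0 => ?_
      have hy0 : y ≠ 0 := by
        rintro rfl
        have := h1 0
        rw [← zero_smul ℝ (0 : Fin 6 → ℝ), qf_smul_right, zero_mul] at this
        exact lt_irrefl _ this
      obtain ⟨i, hi, -, e⟩ := hin.exists_wv h0 hy0
      have := (htile T).pN_neg h1 0
      rw [e, qf_smul_right, qf_pN_zero_wv i hi] at this
      linarith
    obtain ⟨q, r, hr, e⟩ := hf.lor.exists_point hneg (hin.zero_pos hneg)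
    have hmem : ∀ T : ↥𝒯, SReg (fun k => Ψ.symm (N T k)) y → q ∈ interior T.val := by
      intro T hs
      rw [(hN T).eq]
      refine mem_interior_of_strict fun k => ?_
      rw [e, mink_smul_right, ← hf.lor.qf_symm]
      exact mul_neg_of_pos_of_neg hr (hs k)
    have := hdis T.val T.2 T'.val T'.2 fun h => hne (Subtype.ext h)
    exact (this ▸ ⟨hmem T h1, hmem T' h2⟩ : q ∈ (∅ : Set _))

end

section
variable {Ψ : (Fin 6 → ℝ) ≃ₗ[ℝ] EuclideanSpace ℝ (Fin (5 + 1))} {P F T : Set ↥(hypSet 5)}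

lemma IsLor.exists_perm_isom (h : IsLor Ψ) {σ : Equiv.Perm (Fin 6)} (hσ : σ 0 = 0) :
    ∃ g, hIsIsom 5 g ∧ ∀ p : ↥(hypSet 5), Ψ.symm (g p).val = Ψ.symm p.val ∘ σ := by
  have hmem : ∀ (τ : Equiv.Perm (Fin 6)), τ 0 = 0 → ∀ p : ↥(hypSet 5),
      Ψ (Ψ.symm p.val ∘ τ) ∈ hypSet 5 := by
    intro τ hτ p
    have h1 : qf (Ψ.symm p.val ∘ τ) (Ψ.symm p.val ∘ τ) = -1 := by rw [qf_perm hτ, h.qf_hyp]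
    refine ⟨by rw [h.form, h1], h.fut _ (by rw [h1]; norm_num) ?_⟩
    simpa [hτ] using h.zero_pos p
  refine ⟨fun p => ⟨_, hmem σ hσ p⟩, ⟨⟨fun p q hpq => ?_, fun q => ?_⟩, fun p q => ?_⟩,
    fun p => Ψ.symm_apply_apply _⟩
  · have := Ψ.injective (congrArg Subtype.val hpq)
    exact Subtype.ext (Ψ.symm.injective (σ.surjective.injective_comp_right this))
  · refine ⟨⟨_, hmem σ.symm (symm_zero hσ) q⟩, Subtype.ext ?_⟩
    simp [Function.comp_assoc]
  · rw [h.form, qf_perm hσ, h.form_symm]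

lemma IsLor.mem_iff (h : IsLor Ψ) {N : Fin 6 → EuclideanSpace ℝ (Fin (5 + 1))}
    (hT : T = ⋂ k, hHalf 5 (N k)) (p : ↥(hypSet 5)) :
    p ∈ T ↔ Reg (fun k => Ψ.symm (N k)) (Ψ.symm p.val) := by
  rw [hT, mem_iInter]
  exact forall_congr' fun k => by rw [h.form_symm]; rfl

lemma IsFrame.decompEquiv (hf : IsFrame Ψ P) {ν : Fin 6 → EuclideanSpace ℝ (Fin (5 + 1))}
    (hν : IsNormals 5 F ν) {𝒯₁ 𝒯₂ : Set (Set ↥(hypSet 5))} (h₁ : hSTDecomp 5 P F 𝒯₁)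
    (h₂ : hSTDecomp 5 P F 𝒯₂) : hDecompEquiv 5 P 𝒯₁ 𝒯₂ := by
  obtain ⟨N₁, hN₁, f₁⟩ := hf.exists_fam hν h₁
  obtain ⟨N₂, hN₂, f₂⟩ := hf.exists_fam hν h₂
  have : Finite ↥𝒯₁ := h₁.1.1
  have : Finite ↥𝒯₂ := h₂.1.1
  obtain ⟨σ, hσ, hl, hr⟩ := f₁.unique f₂
  obtain ⟨g, hg, hgσ⟩ := hf.lor.exists_perm_isom hσ
  have himage : ∀ {A B : Set ↥(hypSet 5)}, (∀ p, p ∈ A ↔ g p ∈ B) → g '' A = B := by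
    intro A B hAB
    ext q
    obtain ⟨p, rfl⟩ := hg.1.2 q
    rw [hg.1.1.mem_set_image, hAB]
  have hP : ∀ p, p ∈ P ↔ InP (Ψ.symm p.val) := fun p =>
    mem_P_iff hf.lor hf.eqP one_pos (by rw [one_smul, Ψ.apply_symm_apply])
  have htile : ∀ (t : ↥𝒯₁) (t' : ↥𝒯₂), (∀ y, Reg (fun k => Ψ.symm (N₁ t k)) y ↔
      Reg (fun k => Ψ.symm (N₂ t' k)) (y ∘ σ)) → g '' t.val = t'.val := fun t t' h =>
    himage fun p => by
      rw [hf.lor.mem_iff (hN₁ t), hf.lor.mem_iff (hN₂ t'), hgσ, h]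
  refine ⟨g, hg, himage fun p => by rw [hP, hP, hgσ, inP_perm hσ], ?_⟩
  ext S
  constructor
  · rintro ⟨T, hT, rfl⟩
    obtain ⟨t', h⟩ := hl ⟨T, hT⟩
    change g '' T ∈ 𝒯₂
    rw [htile _ _ h]
    exact t'.2
  · intro hS
    obtain ⟨t, h⟩ := hr ⟨S, hS⟩
    exact ⟨t.val, t.2, htile _ _ h⟩

end

section
variable {n : ℕ} {P : Set ↥(hypSet n)} {w : EuclideanSpace ℝ (Fin (n + 1))}

lemma IsNormals.biInter {ν : Fin (n + 1) → EuclideanSpace ℝ (Fin (n + 1))} (hν : IsNormals n P ν) :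
    P = ⋂ v ∈ FN n P, hHalf n v := by
  rw [← hν.range, biInter_range]
  exact hν.eq

lemma IsNormals.cox_FN {ν : Fin (n + 1) → EuclideanSpace ℝ (Fin (n + 1))} (hν : IsNormals n P ν)
    {u v : EuclideanSpace ℝ (Fin (n + 1))} (hu : u ∈ FN n P) (hv : v ∈ FN n P) (huv : u ≠ v)
    (h : ∃ x ∈ P, x ∈ hWall n u ∩ hWall n v) :
    ∃ m : ℕ, 2 ≤ m ∧ mink n u v = -Real.cos (Real.pi / (m : ℝ)) := by
  rw [← hν.range] at hu hv
  obtain ⟨k, rfl⟩ := hu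
  obtain ⟨l, rfl⟩ := hv
  exact hν.cox k l (fun h => huv (by rw [h])) h

lemma mink_nonpos_of_closure {S : Set ↥(hypSet n)} {v : EuclideanSpace ℝ (Fin (n + 1))}
    (hS : S ⊆ hHalf n v) (hw : w ∈ closure (hCone n S)) : mink n v w ≤ 0 := by
  have hcl : IsClosed {y | mink n v y ≤ 0} := isClosed_le (continuous_mink v) continuous_const
  refine closure_minimal ?_ hcl hw
  rintro _ ⟨x, hx, t, ht, rfl⟩
  change mink n v (t • x.val) ≤ 0
  rw [mink_smul_right]
  have : mink n v x.val ≤ 0 := hS hx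
  nlinarith

lemma mem_closure_hCone {S : Set ↥(hypSet n)} (hw : mink n w w = 0) (h0 : 0 < w 0)
    (x : ↥(hypSet n)) (h : ∀ q : ↥(hypSet n), ∀ ε > (0 : ℝ), ∀ c > (0 : ℝ),
      q.val = c • (w + ε • x.val) → q ∈ S) : w ∈ closure (hCone n S) := by
  have h1 : (0 : ℝ) ∈ closure (Ioi (0 : ℝ)) := by simp
  have hcont : Continuous fun ε : ℝ => w + ε • x.val := by fun_prop
  have hev : ∀ ε ∈ Ioi (0 : ℝ), w + ε • x.val ∈ hCone n S := by
    intro ε (hε : 0 < ε)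
    have hx : mink n (ε • x.val) (ε • x.val) < 0 := by
      rw [mink_smul_left, mink_smul_right, x.2.1]
      nlinarith [mul_pos hε hε]
    have hx0 : 0 < (ε • x.val) 0 := by simpa using mul_pos hε x.2.2
    obtain ⟨q, c, hc, e⟩ := exists_point (mink_add_neg hx hx0 hw.le h0)
      (by simpa using add_pos h0 hx0)
    refine ⟨q, h q ε hε c hc e, c⁻¹, inv_pos.mpr hc, ?_⟩
    rw [e, inv_smul_smul₀ hc.ne']
  simpa using map_mem_closure hcont h1 hev

lemma IsNormals.mem_idealVerts {ν : Fin (n + 1) → EuclideanSpace ℝ (Fin (n + 1))}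
    (hν : IsNormals n P ν) (hw : mink n w w = 0) (h0 : w 0 = 1) :
    w ∈ hIdealVerts n P ↔ ∀ v ∈ FN n P, mink n v w ≤ 0 := by
  constructor
  · exact fun h v hv => mink_nonpos_of_closure hv.2.1 h.2.2
  · intro h
    obtain ⟨x, hx⟩ := hν.int
    have hx := interior_subset hx
    refine ⟨hw, h0, mem_closure_hCone hw (by rw [h0]; norm_num) x fun q ε hε c hc e => ?_⟩
    rw [hν.biInter]
    refine mem_iInter₂.mpr fun v hv => ?_
    rw [mem_hHalf_of_smul hc e, mink_add_right, mink_smul_right]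
    have h1 : mink n v x.val ≤ 0 := hv.2.1 hx
    nlinarith [h v hv]

end

section
variable {P : Set ↥(hypSet 5)} {w : EuclideanSpace ℝ (Fin (5 + 1))}

lemma gram_cmD4t {e : Fin 5 → EuclideanSpace ℝ (Fin (5 + 1))} (h1 : ∀ i, mink 5 (e i) (e i) = 1)
    (h2 : ∀ i j, i ≠ j → mink 5 (e i) (e j) = -Real.cos (Real.pi / (cmD4t i j : ℝ))) (i j : Fin 5) :
    mink 5 (e i) (e j) = if i = j then 1 else if i = 0 ∨ j = 0 then -1 / 2 else 0 := by
  by_cases hij : i = j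
  · subst hij; rw [if_pos rfl, h1]
  · rw [if_neg hij, h2 i j hij]
    have : cmD4t i j = if i = 0 ∨ j = 0 then 3 else 2 := by
      fin_cases i <;> fin_cases j <;> first | exact absurd rfl hij | rfl
    rw [this]
    split_ifs
    · rw [Nat.cast_ofNat, Real.cos_pi_div_three]; norm_num
    · rw [Nat.cast_ofNat, Real.cos_pi_div_two, neg_zero]

/-- The normals of the facets through the ideal vertex, up to signs, and the remaining one. -/
lemma IsNormals.exists_link {ν : Fin (5 + 1) → EuclideanSpace ℝ (Fin (5 + 1))}
    (hν : IsNormals 5 P ν) (hw : w ∈ hIdealVerts 5 P) (hl : hIdealLink 5 P w cmD4t) :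
    ∃ (e : Fin 5 → EuclideanSpace ℝ (Fin (5 + 1))) (s : Fin 5 → ℝ)
      (b : EuclideanSpace ℝ (Fin (5 + 1))), (∀ i, s i = 1 ∨ s i = -1) ∧ s 0 = 1 ∧
      (∀ i j, mink 5 (e i) (e j) = if i = j then 1 else if i = 0 ∨ j = 0 then -1 / 2 else 0) ∧
      (∀ i, mink 5 (e i) w = 0) ∧ FN 5 P = insert b (Set.range fun i => s i • e i) ∧
      mink 5 b w < 0 := by
  obtain ⟨e, h1, hew, h2, hne, hr⟩ := hl
  have hg := gram_cmD4t h1 h2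
  have hex : ∀ i, ∃ s : ℝ, (s = 1 ∨ s = -1) ∧ s • e i ∈ FN 5 P := by
    intro i
    have hf : P ∩ hWall 5 (e i) ∈ Set.range fun i => P ∩ hWall 5 (e i) := mem_range_self i
    rw [← hr] at hf
    obtain ⟨v, hv, hvS⟩ := exists_FN hf.1
    rcases eq_or_neg_of_FN hv (h1 i) (by rw [← hvS]; exact inter_subset_right) with h | h
    · exact ⟨1, Or.inl rfl, by rw [one_smul, h]; exact hv⟩
    · exact ⟨-1, Or.inr rfl, by rw [h, neg_one_smul, neg_neg]; exact hv⟩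
  choose s hs hsF using hex
  have hs2 : ∀ i, s i * s i = 1 := fun i => by rcases hs i with h | h <;> rw [h] <;> norm_num
  have hwall : ∀ i, hWall 5 (s i • e i) = hWall 5 (e i) := by
    intro i
    ext x
    change mink 5 _ _ = 0 ↔ mink 5 _ _ = 0
    rw [mink_smul_left, mul_eq_zero, or_iff_right]
    intro h0
    have := hs2 i
    rw [h0] at this
    norm_num at this
  have hinj : Function.Injective fun i => s i • e i := by
    intro i j hij
    by_contra h
    exact hne i j h (by rw [← hwall, ← hwall]; exact congrArg _ hij)
  have hcard : (FN 5 P).ncard = 6 := by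
    rw [← hν.range, ← image_univ, ncard_image_of_injective _ hν.inj]; simp
  have hcard' : (Set.range fun i => s i • e i).ncard = 5 := by
    rw [← image_univ, ncard_image_of_injective _ hinj]; simp
  have hsub : (Set.range fun i => s i • e i) ⊆ FN 5 P := by
    rintro _ ⟨i, rfl⟩; exact hsF i
  have hfin : (FN 5 P).Finite := finite_of_ncard_pos (by omega)
  have hd : (FN 5 P \ Set.range fun i => s i • e i).ncard = 1 := by
    rw [ncard_sdiff hsub (hfin.subset hsub)]; omega
  obtain ⟨b, hb⟩ := ncard_eq_one.mp hd
  have hFN : FN 5 P = insert b (Set.range fun i => s i • e i) := by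
    rw [insert_eq, ← hb, sdiff_union_of_subset hsub]
  have hbF : b ∈ FN 5 P := by rw [hFN]; exact mem_insert _ _
  have hbn : b ∉ Set.range fun i => s i • e i := by
    have : b ∈ FN 5 P \ Set.range fun i => s i • e i := by rw [hb]; rfl
    exact this.2
  have hbw : mink 5 b w < 0 := by
    refine lt_of_le_of_ne (mink_nonpos_of_closure hbF.2.1 hw.2.2) fun h0 => ?_
    have hmem : P ∩ hWall 5 b ∈ {S | hIsFacet 5 P S ∧ w ∈ closure (hCone 5 S)} := by
      refine ⟨hbF.2.2, ?_⟩
      obtain ⟨x, hxP, hxb⟩ := hbF.2.2.1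
      refine mem_closure_hCone hw.1 (by rw [hw.2.1]; norm_num) x fun q ε hε c hc eq => ⟨?_, ?_⟩
      · rw [hν.biInter]
        refine mem_iInter₂.mpr fun v hv => ?_
        rw [mem_hHalf_of_smul hc eq, mink_add_right, mink_smul_right]
        have h3 : mink 5 v x.val ≤ 0 := hv.2.1 hxP
        have h4 := mink_nonpos_of_closure hv.2.1 hw.2.2
        nlinarith
      · rw [mem_hWall_of_smul hc eq, mink_add_right, mink_smul_right, h0]
        have : mink 5 b x.val = 0 := hxb
        rw [this]; ring
    rw [hr] at hmem
    obtain ⟨i, hi⟩ := hmem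
    refine hbn ⟨i, ?_⟩
    refine eq_of_FN hν.int hbF (hsF i).1 (hsF i).2.1 ?_
    rw [hwall]
    exact (show P ∩ hWall 5 (e i) = P ∩ hWall 5 b from hi) ▸ inter_subset_right
  refine ⟨fun i => s 0 • e i, fun i => s 0 * s i, b, fun i => ?_, hs2 0, fun i j => ?_, fun i => ?_,
    ?_, hbw⟩
  · rcases hs 0 with h | h <;> rcases hs i with h' | h' <;> simp [h, h']
  · rw [mink_smul_left, mink_smul_right, ← mul_assoc, hs2, one_mul, hg]
  · rw [mink_smul_left, hew, mul_zero]
  · rw [hFN]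
    congr 2
    funext i
    rw [smul_smul, show s 0 * s i * s 0 = s i * (s 0 * s 0) by ring, hs2, mul_one]

end

section
variable {P : Set ↥(hypSet 5)} {w : EuclideanSpace ℝ (Fin (5 + 1))}

/-- A Lorentz basis gives a linear isometry. -/
lemma exists_equiv_of_gram (F : Fin 6 → EuclideanSpace ℝ (Fin (5 + 1)))
    (hF : ∀ k l, mink 5 (F k) (F l) = qf (Pi.single k 1) (Pi.single l 1)) :
    ∃ Ψ : (Fin 6 → ℝ) ≃ₗ[ℝ] EuclideanSpace ℝ (Fin (5 + 1)), (∀ k, Ψ (Pi.single k 1) = F k) ∧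
      ∀ x y, mink 5 (Ψ x) (Ψ y) = qf x y := by
  let A := Fintype.linearCombination ℝ F
  have hA : ∀ x y, mink 5 (A x) (A y) = qf x y := by
    intro x y
    have hx : x = ∑ k, x k • Pi.single k (1 : ℝ) := pi_eq_sum_univ' x
    have hy : y = ∑ k, y k • Pi.single k (1 : ℝ) := pi_eq_sum_univ' y
    conv_rhs => rw [hx, hy]
    simp only [A, Fintype.linearCombination_apply, qf_sum_left, qf_sum_right, mink_sum_left,
      mink_sum_right, mink_smul_left, mink_smul_right, hF]
  have hinj : Function.Injective A := by
    refine (injective_iff_map_eq_zero A).mpr fun x hx => qf_eq_zero fun y => ?_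
    rw [← hA, hx, ← zero_smul ℝ (0 : EuclideanSpace ℝ (Fin (5 + 1))), mink_smul_left, zero_mul]
  refine ⟨A.linearEquivOfInjective hinj (by simp), fun k => ?_, fun x y => hA x y⟩
  simp [A]

/-- A Lorentz isometry adapted to an orthonormal family orthogonal to a null vector. -/
lemma exists_lor (f : Fin 4 → EuclideanSpace ℝ (Fin (5 + 1)))
    (hf : ∀ i j, mink 5 (f i) (f j) = if i = j then 1 else 0) (hw : mink 5 w w = 0) (h0 : 0 < w 0)
    (hfw : ∀ i, mink 5 (f i) w = 0) :
    ∃ Ψ, IsLor Ψ ∧ (∀ i : Fin 4, Ψ (pN i.succ.castSucc) = f i) ∧ Ψ (wv 5) = w := by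
  let t := e0 - ∑ j, mink 5 e0 (f j) • f j
  have htf : ∀ i, mink 5 t (f i) = 0 := by
    intro i
    simp only [t, mink_sub_left, mink_sum_left, mink_smul_left, hf]
    simp
  have htw : mink 5 t w = -w 0 := by
    simp only [t, mink_sub_left, mink_sum_left, mink_smul_left, hfw]
    rw [mink_comm, mink_e0]; simp
  have hft : ∀ i, mink 5 (f i) t = 0 := fun i => by rw [mink_comm, htf]
  have hwf : ∀ i, mink 5 w (f i) = 0 := fun i => by rw [mink_comm, hfw]
  have hwt : mink 5 w t = -w 0 := by rw [mink_comm, htw]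
  obtain ⟨u, huf, hfu, huw, hwu, huu⟩ : ∃ u, (∀ i, mink 5 u (f i) = 0) ∧ (∀ i, mink 5 (f i) u = 0) ∧
      mink 5 u w = -1 ∧ mink 5 w u = -1 ∧ mink 5 u u = 0 := by
    refine ⟨(w 0)⁻¹ • t + ((w 0)⁻¹ * (w 0)⁻¹ * mink 5 t t / 2) • w, fun i => ?_, fun i => ?_, ?_,
      ?_, ?_⟩ <;>
      simp only [mink_add_left, mink_smul_left, mink_add_right, mink_smul_right, htf, hft, hfw, hwf,
        htw, hwt, hw] <;> field_simp <;> ring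
  obtain ⟨Ψ, hΨ, hform⟩ := exists_equiv_of_gram
    ![u + (1 / 2 : ℝ) • w, -f 0, -f 1, -f 2, -f 3, (1 / 2 : ℝ) • w - u] (by
      intro k l
      fin_cases k <;> fin_cases l <;>
        simp [qf, mink_add_left, mink_smul_left, mink_add_right, mink_smul_right, mink_neg_left,
          mink_neg_right, mink_sub_left, mink_sub_right, hf, hfw, hwf, huf, hfu, huw, hwu, huu,
          hw] <;> norm_num)
  have hΨw : Ψ (wv 5) = w := by
    have : wv 5 = Pi.single 0 1 + Pi.single 5 1 := by
      funext k; fin_cases k <;> simp [wv]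
    rw [this, map_add, hΨ, hΨ]
    simp
    module
  refine ⟨Ψ, ⟨hform, fun x hx hx0 => ?_⟩, fun i => ?_, hΨw⟩
  · have h1 : mink 5 (Ψ x) w < 0 := by
      rw [← hΨw, hform, qf_wv (by decide)]
      simp only [qf] at hx
      nlinarith [mul_self_nonneg (x 1), mul_self_nonneg (x 2), mul_self_nonneg (x 3),
        mul_self_nonneg (x 4)]
    rw [← hform] at hx
    by_contra h2
    rcases (not_lt.mp h2).eq_or_lt with h3 | h3
    · unfold mink at hx
      rw [h3] at hx
      have : 0 ≤ ∑ i : Fin 5, Ψ x i.succ * Ψ x i.succ :=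
        Finset.sum_nonneg fun i _ => mul_self_nonneg _
      linarith
    · have := mink_neg (x := -Ψ x) (y := w) (by rwa [mink_neg_left, mink_neg_right, neg_neg])
        (by simpa using h3) hw.le h0
      rw [mink_neg_left] at this
      linarith
  · have : pN i.succ.castSucc = -Pi.single i.succ.castSucc 1 := by
      funext k
      have : i.succ.castSucc ≠ 0 := by
        rw [Ne, Fin.castSucc_eq_zero_iff]; exact Fin.succ_ne_zero i
      simp only [pN, this, Pi.neg_apply, Pi.single_apply, if_false]
      split_ifs <;> simp
    rw [this, map_neg, hΨ]
    fin_cases i <;> simp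

/-- The ideal vertices other than `w`, in coordinates where `w` is a multiple of `wv 5`. -/
lemma IsNormals.ncard_coord {ν : Fin (5 + 1) → EuclideanSpace ℝ (Fin (5 + 1))}
    (hν : IsNormals 5 P ν) {Ψ : (Fin 6 → ℝ) ≃ₗ[ℝ] EuclideanSpace ℝ (Fin (5 + 1))} (hΨ : IsLor Ψ)
    {c : ℝ} (hc : 0 < c) (hw : w ∈ hIdealVerts 5 P) (hΨw : Ψ (wv 5) = c • w)
    (hcard : (hIdealVerts 5 P).ncard = 5) :
    {y | qf y y = 0 ∧ y 5 - y 0 = -1 ∧ ∀ v ∈ FN 5 P, mink 5 v (Ψ y) ≤ 0}.ncard = 4 := by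
  have hyw : ∀ y, y 5 - y 0 = c * mink 5 (Ψ y) w := fun y => by
    rw [← mink_smul_right, ← hΨw, hΨ.form, qf_wv (by decide)]
  have hpos : ∀ y, qf y y = 0 → y 5 - y 0 = -1 → 0 < Ψ y 0 := by
    intro y hy h1
    rw [hyw] at h1
    rw [← hΨ.form] at hy
    have h2 : mink 5 (Ψ y) w < 0 := by
      by_contra h
      nlinarith [mul_nonneg hc.le (not_lt.mp h)]
    unfold mink at h2 hy
    have hw1 := hw.1
    have hw2 := hw.2.1
    unfold mink at hw1
    have hcs := Finset.sum_mul_sq_le_sq_mul_sq Finset.univ (fun i : Fin 5 => Ψ y i.succ)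
      (fun i => w i.succ)
    simp only [pow_two (Ψ y _), pow_two (w _)] at hcs
    rw [hw2] at h2 hw1
    generalize (∑ i : Fin 5, Ψ y i.succ * w i.succ) = A at *
    generalize (∑ i : Fin 5, Ψ y i.succ * Ψ y i.succ) = B at *
    generalize (∑ i : Fin 5, w i.succ * w i.succ) = C at *
    by_contra h
    nlinarith
  have hdiff : (hIdealVerts 5 P \ {w}).ncard = 4 := by
    rw [ncard_sdiff_singleton_of_mem hw, hcard]
  rw [← hdiff]
  refine ncard_congr (fun y _ => (Ψ y 0)⁻¹ • Ψ y) ?_ ?_ ?_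
  · rintro y ⟨h1, h2, h3⟩
    have h0 := hpos y h1 h2
    have hinv := inv_pos.mpr h0
    refine ⟨(hν.mem_idealVerts ?_ ?_).mpr fun v hv => ?_, fun he => ?_⟩
    · rw [mink_smul_left, mink_smul_right, hΨ.form, h1, mul_zero, mul_zero]
    · simpa using inv_mul_cancel₀ h0.ne'
    · rw [mink_smul_right]
      nlinarith [h3 v hv]
    · have h4 := hyw y
      have h5 : mink 5 ((Ψ y 0)⁻¹ • Ψ y) w = 0 := by
        rw [show (Ψ y 0)⁻¹ • Ψ y = w from he, hw.1]
      rw [mink_smul_left, mul_eq_zero, or_iff_right hinv.ne'] at h5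
      rw [h5, h2] at h4
      linarith
  · rintro y y' ⟨h1, h2, -⟩ ⟨h1', h2', -⟩ he
    have h0 := hpos y h1 h2
    have h0' := hpos y' h1' h2'
    have e : Ψ y = (Ψ y 0 * (Ψ y' 0)⁻¹) • Ψ y' := by
      rw [mul_smul, ← show (Ψ y 0)⁻¹ • Ψ y = (Ψ y' 0)⁻¹ • Ψ y' from he,
        smul_inv_smul₀ h0.ne']
    have h3 := hyw y
    rw [e, mink_smul_left, mul_left_comm, ← hyw, h2, h2'] at h3
    have h4 : Ψ y 0 * (Ψ y' 0)⁻¹ = 1 := by linarith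
    rw [h4, one_smul] at e
    exact Ψ.injective e
  · rintro u ⟨hu, huw⟩
    have hneg : mink 5 u w < 0 := by
      have h1 : mink 5 (u - w) (u - w) = -2 * mink 5 u w := by
        simp only [mink_sub_left, mink_sub_right, hu.1, hw.1, mink_comm w u]; ring
      have h2 : 0 < mink 5 (u - w) (u - w) := by
        have hz : (u - w) 0 = 0 := by simp [hu.2.1, hw.2.1]
        unfold mink
        rw [hz]
        have hnn : 0 ≤ ∑ i : Fin 5, (u - w) i.succ * (u - w) i.succ :=
          Finset.sum_nonneg fun i _ => mul_self_nonneg _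
        refine lt_of_le_of_ne (by linarith) fun h => huw ?_
        have h3 := (Finset.sum_eq_zero_iff_of_nonneg
          (fun i _ => mul_self_nonneg ((u - w) (Fin.succ i)))).mp (show _ = (0 : ℝ) by linarith)
        refine sub_eq_zero.mp (show u - w = 0 from ?_)
        ext i
        refine Fin.cases hz (fun i => ?_) i
        exact mul_self_eq_zero.mp (h3 i (Finset.mem_univ i))
      linarith
    have hd : c * mink 5 u w < 0 := mul_neg_of_pos_of_neg hc hneg
    have hd' : 0 < -(c * mink 5 u w)⁻¹ := by
      rw [neg_pos]; exact inv_neg''.mpr hd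
    refine ⟨-(c * mink 5 u w)⁻¹ • Ψ.symm u, ⟨?_, ?_, fun v hv => ?_⟩, ?_⟩
    · rw [qf_smul_left, qf_smul_right, hΨ.form_symm, hu.1, mul_zero, mul_zero]
    · rw [hyw, map_smul, Ψ.apply_symm_apply, mink_smul_left]
      field_simp [hd.ne, hneg.ne]
    · rw [map_smul, Ψ.apply_symm_apply, mink_smul_right]
      have := (hν.mem_idealVerts hu.1 hu.2.1).mp hu v hv
      nlinarith
    · simp only [map_smul, Ψ.apply_symm_apply]
      rw [PiLp.smul_apply, hu.2.1, smul_eq_mul, mul_one, inv_smul_smul₀ hd'.ne']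

end

section
variable {b c : Fin 6 → ℝ}

/-- The null vector opposite to `wv 5`. -/
def nv : Fin 6 → ℝ := ![1 / 2, 0, 0, 0, 0, -1 / 2]

/-- A parabola of null vectors. -/
def par (j : Fin 6) (t : ℝ) : Fin 6 → ℝ := nv + t • Pi.single j 1 + (t * t / 2) • wv 5

lemma qf_nv (x : Fin 6 → ℝ) : qf x nv = -(x 0 + x 5) / 2 := by
  simp [qf, nv]; ring

lemma qf_single {j : Fin 6} (hj : j ≠ 0) (x : Fin 6 → ℝ) : qf x (Pi.single j 1) = x j := by
  fin_cases j <;> first | exact absurd rfl hj | simp [qf]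

lemma qf_par {j : Fin 6} (hj : j ≠ 0) (x : Fin 6 → ℝ) (t : ℝ) :
    qf x (par j t) = -(x 0 + x 5) / 2 + t * x j + t * t / 2 * (x 5 - x 0) := by
  rw [par, qf_add_right, qf_add_right, qf_smul_right, qf_smul_right, qf_nv, qf_single hj,
    qf_wv (by decide)]

lemma par_apply {j k : Fin 6} (h0 : k ≠ 0) (h5 : k ≠ 5) (t : ℝ) :
    par j t k = if k = j then t else 0 := by
  have : nv k = 0 := by
    fin_cases k <;> first | exact absurd rfl h0 | exact absurd rfl h5 | simp [nv]
  simp [par, this, wv, h0, h5, Pi.single_apply]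

lemma par_zero {j : Fin 6} (h0 : j ≠ 0) (t : ℝ) : par j t 0 = (1 + t * t) / 2 := by
  simp only [par, Pi.add_apply, Pi.smul_apply, Pi.single_apply, if_neg h0.symm]
  simp [nv, wv]; ring

lemma par_five {j : Fin 6} (h5 : j ≠ 5) (t : ℝ) : par j t 5 = (t * t - 1) / 2 := by
  simp only [par, Pi.add_apply, Pi.smul_apply, Pi.single_apply, if_neg h5.symm]
  simp [nv, wv]; ring

lemma par_null {j : Fin 6} (h0 : j ≠ 0) (h5 : j ≠ 5) (t : ℝ) : qf (par j t) (par j t) = 0 := by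
  rw [qf_par h0, par_zero h0, par_five h5, par_apply h0 h5, if_pos rfl]; ring

lemma par_sub {j : Fin 6} (h0 : j ≠ 0) (h5 : j ≠ 5) (t : ℝ) : par j t 5 - par j t 0 = -1 := by
  rw [par_zero h0, par_five h5]; ring

lemma par_injective {j : Fin 6} (h0 : j ≠ 0) (h5 : j ≠ 5) : Function.Injective (par j) := by
  intro t t' h
  have := congrFun h j
  rwa [par_apply h0 h5, par_apply h0 h5, if_pos rfl, if_pos rfl] at this

/-- A wall of the wrong sign would allow infinitely many ideal vertices. -/
lemma sign_of_finite {s : Fin 6 → ℝ} (hc : ∀ k, k ≠ 0 → k ≠ 5 → c k = 1 / 2) (hc5 : c 5 = c 0)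
    (hb : b 5 - b 0 < 0)
    (hK : {y | qf y y = 0 ∧ y 5 - y 0 = -1 ∧ qf b y ≤ 0 ∧ qf c y ≤ 0 ∧
      ∀ k, k ≠ 0 → k ≠ 5 → 0 ≤ s k * y k}.Finite)
    {j : Fin 6} (h0 : j ≠ 0) (h5 : j ≠ 5) : s j ≠ -1 := by
  intro hs
  set B := b 0 - b 5 with hB
  have hBpos : 0 < B := by linarith
  set R := |b 0 + b 5| + 2 * |b j| with hR
  have hinf : (Ici (max 1 (max (2 * |c 0|) (R / B)))).Infinite := Ici_infinite _
  refine hinf (Finite.of_finite_image (f := fun t => par j (-t)) (hK.subset ?_)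
    fun t _ t' _ h => neg_injective (par_injective h0 h5 h))
  rintro _ ⟨t, ht, rfl⟩
  simp only [mem_Ici, max_le_iff] at ht
  obtain ⟨h1, h2, h3⟩ := ht
  refine ⟨par_null h0 h5 _, par_sub h0 h5 _, ?_, ?_, fun k hk0 hk5 => ?_⟩
  · rw [qf_par h0]
    rw [div_le_iff₀ hBpos] at h3
    have h4 := neg_abs_le (b 0 + b 5)
    have h5 := neg_abs_le (b j)
    have h6 := abs_nonneg (b 0 + b 5)
    nlinarith [mul_nonneg (sub_nonneg.mpr h1) h6]
  · rw [qf_par h0, hc5, hc j h0 h5]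
    have := neg_abs_le (c 0)
    linarith
  · simp only [par_apply hk0 hk5]
    split_ifs with h
    · rw [h, hs]; linarith
    · rw [mul_zero]

/-- The vertices of the section of the link cone. -/
def lv : Fin 5 → Fin 6 → ℝ := ![nv, wv 1, wv 2, wv 3, wv 4]

lemma par_at_zero (j : Fin 6) : par j 0 = nv := by simp [par]

lemma par_at_one {j : Fin 6} (h0 : j ≠ 0) (h5 : j ≠ 5) : par j 1 = wv j := by
  funext k
  rcases eq_or_ne k 0 with rfl | hk0
  · rw [par_zero h0]; simp [wv]
  · rcases eq_or_ne k 5 with rfl | hk5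
    · rw [par_five h5]; simp [wv, h5.symm]
    · rw [par_apply hk0 hk5]; simp [wv, hk0]

lemma lv_injective : Function.Injective lv := by
  intro i j h
  have h1 := congrFun h 1
  have h2 := congrFun h 2
  have h3 := congrFun h 3
  have h4 := congrFun h 4
  fin_cases i <;> fin_cases j <;> first | rfl | simp [lv, nv, wv] at h1 h2 h3 h4

/-- The ideal points of the simplex in coordinates. -/
def idealK (b : Fin 6 → ℝ) : Set (Fin 6 → ℝ) :=
  {y | qf y y = 0 ∧ y 5 - y 0 = -1 ∧ qf b y ≤ 0 ∧ ∀ k, k ≠ 5 → qf (pN k) y ≤ 0}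

lemma par_mem_idealK {j : Fin 6} (h0 : j ≠ 0) (h5 : j ≠ 5) {t : ℝ} (ht : t ∈ Icc (0 : ℝ) 1)
    (h : qf b (par j t) ≤ 0) : par j t ∈ idealK b := by
  refine ⟨par_null h0 h5 t, par_sub h0 h5 t, h, fun k hk => ?_⟩
  rw [qf_par h0]
  obtain ⟨t0, t1⟩ := ht
  rcases eq_or_ne k 0 with rfl | hk0
  · simp only [pN]; simp; linarith
  · simp only [pN, hk0, if_false, hk0.symm, hk.symm]
    split_ifs <;> linarith

lemma qf_par_end_nonneg (hK : (idealK b).Finite) {j : Fin 6} (h0 : j ≠ 0) (h5 : j ≠ 5) {t : ℝ}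
    (ht : t ∈ Icc (0 : ℝ) 1) : 0 ≤ qf b (par j t) := by
  by_contra hneg
  push Not at hneg
  have hcont : Continuous fun t => qf b (par j t) := by
    simp only [qf_par h0]; fun_prop
  have hU : IsOpen {t | qf b (par j t) < 0} := isOpen_lt hcont continuous_const
  rw [← closure_Ioo zero_ne_one] at ht
  obtain ⟨x, hx⟩ := mem_closure_iff.mp ht _ hU hneg
  refine infinite_of_mem_nhds x ((hU.inter isOpen_Ioo).mem_nhds hx)
    (Finite.of_finite_image (f := par j) (hK.subset ?_) (par_injective h0 h5).injOn)
  rintro _ ⟨s, ⟨hs, hs'⟩, rfl⟩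
  exact par_mem_idealK h0 h5 (Ioo_subset_Icc_self hs') (le_of_lt hs)

lemma qf_lv_nonneg (hK : (idealK b).Finite) (v : Fin 5) : 0 ≤ qf b (lv v) := by
  have h1 := fun j (h0 : j ≠ 0) (h5 : j ≠ 5) =>
    qf_par_end_nonneg hK h0 h5 (right_mem_Icc.mpr zero_le_one)
  have h2 := qf_par_end_nonneg hK (j := 1) (by decide) (by decide)
    (left_mem_Icc.mpr zero_le_one)
  rw [par_at_zero] at h2
  fin_cases v
  · exact h2
  all_goals
    refine (h1 _ ?_ ?_).trans_eq (congrArg _ (par_at_one ?_ ?_)) <;> decide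

lemma idealK_eq (hK : (idealK b).Finite) (hb : b 5 < b 0) :
    idealK b = lv '' {v | qf b (lv v) = 0} := by
  have hl := qf_lv_nonneg hK
  refine Subset.antisymm ?_ ?_
  · rintro y ⟨hn, h5, hby, hk⟩
    suffices h : ∃ v, lv v = y by
      obtain ⟨v, rfl⟩ := h
      exact ⟨v, le_antisymm hby (hl v), rfl⟩
    have k0 := hk 0 (by decide)
    have k1 := hk 1 (by decide)
    have k2 := hk 2 (by decide)
    have k3 := hk 3 (by decide)
    have k4 := hk 4 (by decide)
    rw [qf_pN_zero] at k0
    rw [qf_pN (by decide)] at k1 k2 k3 k4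
    have l0 := hl 0
    have l1 := hl 1
    have l2 := hl 2
    have l3 := hl 3
    have l4 := hl 4
    simp only [lv] at l0 l1 l2 l3 l4
    simp [qf_nv, qf_wv] at l0 l1 l2 l3 l4
    have hy5 : y 5 = y 0 - 1 := by linarith
    have hy0 : y 0 = (1 + y 1 * y 1 + y 2 * y 2 + y 3 * y 3 + y 4 * y 4) / 2 := by
      simp only [qf, hy5] at hn; linarith
    have key : qf b y = y 1 * (b 1 - b 0) + y 2 * (b 2 - b 0) + y 3 * (b 3 - b 0) +
        y 4 * (b 4 - b 0) + (1 - (y 1 + y 2 + y 3 + y 4)) * (-(b 0 + b 5) / 2) +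
        (y 1 * (1 - y 1) + y 2 * (1 - y 2) + y 3 * (1 - y 3) + y 4 * (1 - y 4)) *
          ((b 0 - b 5) / 2) := by
      simp only [qf, hy5, hy0]; ring
    have m1 : 0 ≤ y 1 * (b 1 - b 0) := mul_nonneg (by linarith) (by linarith)
    have m2 : 0 ≤ y 2 * (b 2 - b 0) := mul_nonneg (by linarith) (by linarith)
    have m3 : 0 ≤ y 3 * (b 3 - b 0) := mul_nonneg (by linarith) (by linarith)
    have m4 : 0 ≤ y 4 * (b 4 - b 0) := mul_nonneg (by linarith) (by linarith)
    have m0 : 0 ≤ (1 - (y 1 + y 2 + y 3 + y 4)) * (-(b 0 + b 5) / 2) :=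
      mul_nonneg (by linarith) (by linarith)
    have n1 : 0 ≤ y 1 * (1 - y 1) := mul_nonneg (by linarith) (by linarith)
    have n2 : 0 ≤ y 2 * (1 - y 2) := mul_nonneg (by linarith) (by linarith)
    have n3 : 0 ≤ y 3 * (1 - y 3) := mul_nonneg (by linarith) (by linarith)
    have n4 : 0 ≤ y 4 * (1 - y 4) := mul_nonneg (by linarith) (by linarith)
    have hs : y 1 * (1 - y 1) + y 2 * (1 - y 2) + y 3 * (1 - y 3) + y 4 * (1 - y 4) ≤ 0 := by
      by_contra h
      have := mul_pos (not_le.mp h) (show 0 < (b 0 - b 5) / 2 by linarith)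
      linarith
    have z : ∀ x : ℝ, x * (1 - x) = 0 → x = 0 ∨ x = 1 := fun x h => by
      rcases mul_eq_zero.mp h with h | h
      · exact Or.inl h
      · exact Or.inr (by linarith)
    have fin : ∀ v, lv v 1 = y 1 → lv v 2 = y 2 → lv v 3 = y 3 → lv v 4 = y 4 →
        lv v 0 = y 0 → ∃ v, lv v = y := by
      intro v h1 h2 h3 h4 h0
      refine ⟨v, ?_⟩
      have h5' : lv v 5 = lv v 0 - 1 := by
        fin_cases v <;> simp [lv, nv, wv]
        norm_num
      funext k
      fin_cases k
      · exact h0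
      · exact h1
      · exact h2
      · exact h3
      · exact h4
      · exact h5'.trans (by rw [h0]; exact hy5.symm)
    rcases z (y 1) (by linarith) with e1 | e1 <;> rcases z (y 2) (by linarith) with e2 | e2 <;>
      rcases z (y 3) (by linarith) with e3 | e3 <;> rcases z (y 4) (by linarith) with e4 | e4 <;>
      first
      | exfalso; linarith
      | (rw [e1, e2, e3, e4] at hy0
         first
         | (refine fin 0 ?_ ?_ ?_ ?_ ?_ <;> simp [e1, e2, e3, e4, hy0, lv, nv, wv]; done)
         | (refine fin 1 ?_ ?_ ?_ ?_ ?_ <;> simp [e1, e2, e3, e4, hy0, lv, nv, wv]; done)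
         | (refine fin 2 ?_ ?_ ?_ ?_ ?_ <;> simp [e1, e2, e3, e4, hy0, lv, nv, wv]; done)
         | (refine fin 3 ?_ ?_ ?_ ?_ ?_ <;> simp [e1, e2, e3, e4, hy0, lv, nv, wv]; done)
         | (refine fin 4 ?_ ?_ ?_ ?_ ?_ <;> simp [e1, e2, e3, e4, hy0, lv, nv, wv]))
  · rintro _ ⟨v, hv : qf b (lv v) = 0, rfl⟩
    fin_cases v
    · have : lv 0 = par 1 0 := (par_at_zero 1).symm
      change lv 0 ∈ _
      rw [this]
      exact par_mem_idealK (by decide) (by decide) (left_mem_Icc.mpr zero_le_one)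
        (by rw [← this]; exact hv.le)
    · have : lv 1 = par 1 1 := (par_at_one (by decide) (by decide)).symm
      change lv 1 ∈ _
      rw [this]
      exact par_mem_idealK (by decide) (by decide) (right_mem_Icc.mpr zero_le_one)
        (by rw [← this]; exact hv.le)
    · have : lv 2 = par 2 1 := (par_at_one (by decide) (by decide)).symm
      change lv 2 ∈ _
      rw [this]
      exact par_mem_idealK (by decide) (by decide) (right_mem_Icc.mpr zero_le_one)
        (by rw [← this]; exact hv.le)
    · have : lv 3 = par 3 1 := (par_at_one (by decide) (by decide)).symm
      change lv 3 ∈ _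
      rw [this]
      exact par_mem_idealK (by decide) (by decide) (right_mem_Icc.mpr zero_le_one)
        (by rw [← this]; exact hv.le)
    · have : lv 4 = par 4 1 := (par_at_one (by decide) (by decide)).symm
      change lv 4 ∈ _
      rw [this]
      exact par_mem_idealK (by decide) (by decide) (right_mem_Icc.mpr zero_le_one)
        (by rw [← this]; exact hv.le)

/-- The last normal is determined by the number of ideal vertices. -/
lemma eq_pN_five (hbb : qf b b = 1) (hb : b 5 < b 0) (hK : (idealK b).ncard = 4)
    (hcox : ∀ k y, k ≠ 5 → qf y y < 0 → 0 < y 0 → (∀ l, l ≠ 5 → qf (pN l) y ≤ 0) →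
      qf (pN k) y = 0 → qf b y = 0 →
      ∃ m : ℕ, 2 ≤ m ∧ qf b (pN k) = -Real.cos (Real.pi / (m : ℝ))) : b = pN 5 := by
  have hfin : (idealK b).Finite := finite_of_ncard_pos (by omega)
  have hnn := qf_lv_nonneg hfin
  rw [idealK_eq hfin hb, ncard_image_of_injective _ lv_injective] at hK
  have hcompl : {v | qf b (lv v) = 0}ᶜ.ncard = 1 := by
    have := ncard_add_ncard_compl {v : Fin 5 | qf b (lv v) = 0}
    rw [hK, Nat.card_eq_fintype_card, Fintype.card_fin] at this
    omega
  obtain ⟨v₀, hv₀⟩ := ncard_eq_one.mp hcompl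
  have hpos : 0 < qf b (lv v₀) := by
    refine lt_of_le_of_ne (hnn v₀) fun h => ?_
    have : v₀ ∈ {v | qf b (lv v) = 0}ᶜ := by rw [hv₀]; rfl
    exact this h.symm
  have hzero : ∀ v, v ≠ v₀ → qf b (lv v) = 0 := by
    intro v hv
    by_contra h
    have : v ∈ {v | qf b (lv v) = 0}ᶜ := h
    rw [hv₀] at this
    exact hv this
  have hcos : ∀ m : ℕ, 2 ≤ m → 0 ≤ Real.cos (Real.pi / (m : ℝ)) := by
    intro m hm
    have hm' : (2 : ℝ) ≤ m := by exact_mod_cast hm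
    have h0 : 0 ≤ Real.pi / (m : ℝ) := by positivity
    refine Real.cos_nonneg_of_neg_pi_div_two_le_of_le (by linarith [Real.pi_pos]) ?_
    exact div_le_div_of_nonneg_left Real.pi_pos.le (by norm_num) hm'
  have hpN : ∀ x l, (InP x) → qf (pN l) x ≤ 0 := fun x l h => (inP_iff x).mp h l
  have htri : ∀ j k l : Fin 6, (j ≠ 0 ∧ k ≠ 0 ∧ l ≠ 0) → (j ≠ k ∧ j ≠ l ∧ k ≠ l) → b j = b 0 →
      b k = b 0 → b l = b 0 → -b 0 + b 1 + b 2 + b 3 + b 4 + b 5 ≤ 0 := by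
    rintro j k l ⟨hj, hk, hl⟩ ⟨hjk, hjl, hkl⟩ ej ek el
    obtain ⟨m, hm, e⟩ := hcox 0 (wv j + wv k + wv l) (by decide)
      (by simp only [qf_add_right, qf_wv hj, qf_wv hk, qf_wv hl, Pi.add_apply, wv]
          simp [hj, hk, hl, hjk, hjl, hkl, hjk.symm, hjl.symm, hkl.symm]; norm_num)
      (by simp only [Pi.add_apply, wv]; norm_num)
      (fun l' _ => hpN _ _ (((wv_inP j).add (wv_inP k)).add (wv_inP l)))
      (by simp only [qf_add_right, qf_pN_zero_wv _ hj, qf_pN_zero_wv _ hk, qf_pN_zero_wv _ hl]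
          norm_num)
      (by simp only [qf_add_right, qf_wv hj, qf_wv hk, qf_wv hl, ej, ek, el]; norm_num)
    rw [qf_comm, qf_pN_zero] at e
    have := hcos m hm
    linarith
  fin_cases v₀
  · have z1 := hzero 1 (by decide)
    have z2 := hzero 2 (by decide)
    have z3 := hzero 3 (by decide)
    have z4 := hzero 4 (by decide)
    simp [lv, qf_wv, qf_nv] at z1 z2 z3 z4 hpos
    obtain ⟨m, hm, e⟩ := hcox 1 (wv 2 + wv 3) (by decide) (by simp [qf, wv]; norm_num)
      (by simp [wv]) (fun l _ => hpN _ _ ((wv_inP 2).add (wv_inP 3)))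
      (by rw [qf_pN (by decide)]; simp [wv])
      (by rw [qf_add_right, qf_wv (by decide), qf_wv (by decide)]; linarith)
    rw [qf_comm, qf_pN (by decide), neg_inj] at e
    have hcm := hcos m hm
    have h1 : b 1 = b 0 := by linarith
    have h2 : b 2 = b 0 := by linarith
    have h3 : b 3 = b 0 := by linarith
    have h4 : b 4 = b 0 := by linarith
    rw [h1] at e
    rw [← e] at hcm
    simp only [qf, h1, h2, h3, h4] at hbb
    have hlt : b 0 < 1 / 2 := by nlinarith
    have hm2 : m = 2 := by
      by_contra hne
      have hm3 : (3 : ℝ) ≤ m := by exact_mod_cast (by omega : 3 ≤ m)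
      have : Real.cos (Real.pi / 3) ≤ Real.cos (Real.pi / (m : ℝ)) := by
        refine Real.cos_le_cos_of_nonneg_of_le_pi (by positivity) ?_ ?_
        · linarith [Real.pi_pos]
        · exact div_le_div_of_nonneg_left Real.pi_pos.le (by norm_num) hm3
      rw [Real.cos_pi_div_three] at this
      linarith
    rw [hm2, Nat.cast_ofNat, Real.cos_pi_div_two] at e
    have h5 : b 5 = -1 := by
      rw [e] at hbb hpos
      nlinarith
    funext k
    fin_cases k <;> simp [pN, h1, h2, h3, h4, h5, e]
  all_goals
    exfalso
    have z0 := hzero 0 (by decide)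
    simp [lv, qf_nv] at z0
    simp [lv, qf_wv] at hpos
  · have z2 := hzero 2 (by decide)
    have z3 := hzero 3 (by decide)
    have z4 := hzero 4 (by decide)
    simp [lv, qf_wv] at z2 z3 z4
    have := htri 2 3 4 (by decide) (by decide) (by linarith) (by linarith) (by linarith)
    linarith
  · have z1 := hzero 1 (by decide)
    have z3 := hzero 3 (by decide)
    have z4 := hzero 4 (by decide)
    simp [lv, qf_wv] at z1 z3 z4
    have := htri 1 3 4 (by decide) (by decide) (by linarith) (by linarith) (by linarith)
    linarith
  · have z1 := hzero 1 (by decide)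
    have z2 := hzero 2 (by decide)
    have z4 := hzero 4 (by decide)
    simp [lv, qf_wv] at z1 z2 z4
    have := htri 1 2 4 (by decide) (by decide) (by linarith) (by linarith) (by linarith)
    linarith
  · have z1 := hzero 1 (by decide)
    have z2 := hzero 2 (by decide)
    have z3 := hzero 3 (by decide)
    simp [lv, qf_wv] at z1 z2 z3
    have := htri 1 2 3 (by decide) (by decide) (by linarith) (by linarith) (by linarith)
    linarith

end

section
variable {P F : Set ↥(hypSet 5)} {w : EuclideanSpace ℝ (Fin (5 + 1))}

lemma exists_succ_castSucc {k : Fin 6} (h0 : k ≠ 0) (h5 : k ≠ 5) :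
    ∃ i : Fin 4, k = i.succ.castSucc := by
  revert k; decide

lemma succ_castSucc_ne_zero (i : Fin 4) : (i.succ.castSucc : Fin 6) ≠ 0 := by revert i; decide

lemma succ_castSucc_ne_five (i : Fin 4) : (i.succ.castSucc : Fin 6) ≠ 5 := by revert i; decide

/-- The signs of the normals through the ideal vertex are all the same, and the central normal
is determined by the other ones. -/
lemma IsNormals.link_normals {ν : Fin (5 + 1) → EuclideanSpace ℝ (Fin (5 + 1))}
    (hν : IsNormals 5 P ν) (hw : w ∈ hIdealVerts 5 P) (hcard : (hIdealVerts 5 P).ncard = 5)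
    {e : Fin 5 → EuclideanSpace ℝ (Fin (5 + 1))} {s : Fin 5 → ℝ}
    {b : EuclideanSpace ℝ (Fin (5 + 1))} (hs : ∀ i, s i = 1 ∨ s i = -1) (hs0 : s 0 = 1)
    (hg : ∀ i j, mink 5 (e i) (e j) = if i = j then 1 else if i = 0 ∨ j = 0 then -1 / 2 else 0)
    (hew : ∀ i, mink 5 (e i) w = 0) (hFN : FN 5 P = insert b (Set.range fun i => s i • e i))
    (hbw : mink 5 b w < 0) :
    FN 5 P = insert b (Set.range e) ∧
      ∃ a > (0 : ℝ), e 0 = a • w - (1 / 2 : ℝ) • (e 1 + e 2 + e 3 + e 4) := by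
  obtain ⟨Φ, hΦ, hΦf, hΦw⟩ := exists_lor (fun i => e i.succ)
    (fun i j => by rw [hg]; simp [Fin.succ_ne_zero]) hw.1 (by rw [hw.2.1]; norm_num)
    fun i => hew _
  set c := Φ.symm (e 0) with hc
  have hck : ∀ k, k ≠ 0 → k ≠ 5 → c k = 1 / 2 := by
    intro k h0 h5
    have h1 := qf_pN h0 c
    obtain ⟨i, rfl⟩ := exists_succ_castSucc h0 h5
    rw [qf_comm, hΦ.qf_symm, hΦf, hg, if_neg (Fin.succ_ne_zero i).symm, if_pos (Or.inl rfl)] at h1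
    linarith
  have hc5 : c 5 = c 0 := by
    have h1 := qf_wv (show (5 : Fin 6) ≠ 0 by decide) c
    rw [hΦ.qf_symm, hΦw, hew] at h1
    linarith
  have hb : Φ.symm b 5 - Φ.symm b 0 < 0 := by
    rwa [← qf_wv (by decide), hΦ.qf_symm, hΦw]
  have hone : ∀ i, s i = 1 := by
    intro i
    refine Fin.cases hs0 (fun j => (hs j.succ).resolve_right ?_) i
    have hfin := hν.ncard_coord hΦ one_pos hw (by rw [hΦw, one_smul]) hcard
    have := sign_of_finite (b := Φ.symm b) (s := ![0, s 1, s 2, s 3, s 4, 0]) hck hc5 hb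
      ((finite_of_ncard_pos (by rw [hfin]; norm_num)).subset ?_) (j := j.succ.castSucc)
      (succ_castSucc_ne_zero j) (succ_castSucc_ne_five j)
    · fin_cases j <;> exact this
    · rintro y ⟨h1, h2, h3, h4, h5⟩
      refine ⟨h1, h2, fun v hv => ?_⟩
      rw [hFN] at hv
      rcases hv with rfl | ⟨i, rfl⟩
      · rwa [← hΦ.qf_symm]
      · dsimp only
        rw [mink_smul_left]
        induction i using Fin.cases with
        | zero => rwa [hs0, one_mul, ← hΦ.qf_symm]
        | succ i =>
          rw [← hΦf i, hΦ.form, qf_pN (succ_castSucc_ne_zero i)]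
          have h6 := h5 i.succ.castSucc (succ_castSucc_ne_zero i) (succ_castSucc_ne_five i)
          have h7 : (![0, s 1, s 2, s 3, s 4, 0] : Fin 6 → ℝ) i.succ.castSucc = s i.succ := by
            fin_cases i <;> rfl
          rw [h7] at h6
          linarith
  have hFN' : FN 5 P = insert b (Set.range e) := by
    rw [hFN]; simp only [hone, one_smul]
  refine ⟨hFN', c 0, ?_, ?_⟩
  · obtain ⟨p, hp⟩ := hν.int
    have hst : ∀ i, mink 5 (e i) p.val < 0 := fun i => by
      have : e i ∈ FN 5 P := by rw [hFN']; exact mem_insert_of_mem _ (mem_range_self i)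
      exact interior_strict hp this.1 this.2.1
    have hpk : ∀ i : Fin 4, 0 < Φ.symm p.val i.succ.castSucc := fun i => by
      have h1 := hst i.succ
      rw [← hΦ.form_symm, ← hΦf i, Φ.symm_apply_apply, qf_pN (succ_castSucc_ne_zero i)] at h1
      linarith
    have h0 := hst 0
    have hpw := mink_neg_of_hyp p hw.1.le (by rw [hw.2.1]; norm_num)
    rw [← hΦw, ← hΦ.qf_symm, qf_wv (by decide)] at hpw
    rw [← hΦ.form_symm, ← hc] at h0
    have p1 : 0 < Φ.symm p.val 1 := hpk 0
    have p2 : 0 < Φ.symm p.val 2 := hpk 1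
    have p3 : 0 < Φ.symm p.val 3 := hpk 2
    have p4 : 0 < Φ.symm p.val 4 := hpk 3
    simp only [qf, hc5, hck 1 (by decide) (by decide), hck 2 (by decide) (by decide),
      hck 3 (by decide) (by decide), hck 4 (by decide) (by decide)] at h0
    by_contra h
    nlinarith
  · have h1 : c = c 0 • wv 5 - (1 / 2 : ℝ) • (pN 1 + pN 2 + pN 3 + pN 4) := by
      funext k
      rcases eq_or_ne k 0 with rfl | h0
      · simp [wv, pN]
      rcases eq_or_ne k 5 with rfl | h5
      · simp [wv, pN, hc5]
      · rw [hck k h0 h5]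
        fin_cases k <;> first | exact absurd rfl h0 | exact absurd rfl h5 | simp [wv, pN]
    have h2 := congrArg Φ h1
    rw [hc, Φ.apply_symm_apply, ← hc] at h2
    simp only [map_sub, map_smul, map_add, hΦw] at h2
    rw [h2]
    congr 2
    rw [show Φ (pN 1) = e 1 from hΦf 0, show Φ (pN 2) = e 2 from hΦf 1,
      show Φ (pN 3) = e 3 from hΦf 2, show Φ (pN 4) = e 4 from hΦf 3]

lemma IsNormals.exists_frame {ν : Fin (5 + 1) → EuclideanSpace ℝ (Fin (5 + 1))}
    (hν : IsNormals 5 P ν) (hw : w ∈ hIdealVerts 5 P) (hl : hIdealLink 5 P w cmD4t)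
    (hcard : (hIdealVerts 5 P).ncard = 5) : ∃ Ψ, IsFrame Ψ P := by
  obtain ⟨e, s, b, hs, hs0, hg, hew, hFN, hbw⟩ := hν.exists_link hw hl
  obtain ⟨hFN, a, ha, he⟩ := hν.link_normals hw hcard hs hs0 hg hew hFN hbw
  have ha2 : 0 < 2 * a := by linarith
  obtain ⟨Ψ, hΨ, hΨf, hΨw⟩ := exists_lor (w := (2 * a) • w) (fun i => e i.succ)
    (fun i j => by rw [hg]; simp [Fin.succ_ne_zero])
    (by rw [mink_smul_left, mink_smul_right, hw.1]; ring)
    (by simp [hw.2.1, ha]) fun i => by rw [mink_smul_right, hew, mul_zero]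
  have hΨe : ∀ i : Fin 5, Ψ (pN i.castSucc) = e i := by
    intro i
    refine Fin.cases ?_ hΨf i
    have h1 : pN 0 = (1 / 2 : ℝ) • wv 5 - (1 / 2 : ℝ) • (pN 1 + pN 2 + pN 3 + pN 4) := by
      funext k
      fin_cases k <;> simp [wv, pN]
    change Ψ (pN 0) = _
    rw [h1]
    simp only [map_sub, map_smul, map_add, hΨw]
    rw [show Ψ (pN 1) = e 1 from hΨf 0, show Ψ (pN 2) = e 2 from hΨf 1,
      show Ψ (pN 3) = e 3 from hΨf 2, show Ψ (pN 4) = e 4 from hΨf 3, he]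
    module
  have hk : ∀ k : Fin 6, k ≠ 5 → ∃ i : Fin 5, k = i.castSucc := by decide
  have hbF : b ∈ FN 5 P := by rw [hFN]; exact mem_insert _ _
  have heF : ∀ i, e i ∈ FN 5 P := fun i => by
    rw [hFN]; exact mem_insert_of_mem _ (mem_range_self i)
  have hFNy : ∀ y, (∀ v ∈ FN 5 P, mink 5 v (Ψ y) ≤ 0) ↔
      qf (Ψ.symm b) y ≤ 0 ∧ ∀ k, k ≠ 5 → qf (pN k) y ≤ 0 := by
    intro y
    rw [hFN, forall_mem_insert, forall_mem_range, hΨ.qf_symm]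
    refine and_congr_right fun _ => ⟨fun h k h5 => ?_, fun h i => ?_⟩
    · obtain ⟨i, rfl⟩ := hk k h5
      rw [← hΨ.form, hΨe]; exact h i
    · rw [← hΨe, hΨ.form]; exact h _ (by revert i; decide)
  have hb5 : Ψ.symm b = pN 5 := by
    refine eq_pN_five (by rw [hΨ.form_symm, hbF.1]) ?_ ?_ fun k y h5 hy hy0 hyk hyk0 hyb => ?_
    · rw [← sub_neg, ← qf_wv (by decide), hΨ.qf_symm, hΨw, mink_smul_right]
      exact mul_neg_of_pos_of_neg ha2 hbw
    · rw [← hν.ncard_coord hΨ ha2 hw hΨw hcard]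
      simp only [hFNy]
      rfl
    · obtain ⟨q, c, hc, eq⟩ := hΨ.exists_point hy hy0
      obtain ⟨i, rfl⟩ := hk k h5
      have hne : b ≠ e i := fun h => by
        rw [h, hew] at hbw
        exact lt_irrefl _ hbw
      rw [hΨ.qf_symm, hΨe]
      refine hν.cox_FN hbF (heF i) hne ⟨q, ?_, ?_, ?_⟩
      · rw [hν.biInter]
        refine mem_iInter₂.mpr fun v hv => ?_
        rw [mem_hHalf_of_smul hc eq]
        exact (hFNy y).mpr ⟨hyb.le, hyk⟩ v hv
      · rw [mem_hWall_of_smul hc eq, ← hΨ.qf_symm, hyb]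
      · rw [mem_hWall_of_smul hc eq, ← hΨe, hΨ.form, hyk0]
  have hb5' : Ψ (pN 5) = b := by rw [← hb5, Ψ.apply_symm_apply]
  have hrange : (Set.range fun k => Ψ (pN k)) = FN 5 P := by
    rw [hFN]
    refine Subset.antisymm ?_ ?_
    · rintro _ ⟨k, rfl⟩
      rcases eq_or_ne k 5 with rfl | h5
      · exact Or.inl hb5'
      · obtain ⟨i, rfl⟩ := hk k h5
        exact Or.inr ⟨i, (hΨe i).symm⟩
    · rintro _ (rfl | ⟨i, rfl⟩)
      · exact ⟨5, hb5'⟩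
      · exact ⟨i.castSucc, hΨe i⟩
  refine ⟨Ψ, hΨ, ?_, hν.int, fun k => ?_, fun u hu => ?_⟩
  · conv_lhs => rw [hν.biInter, ← hrange, biInter_range]
  · rw [← hrange]; exact mem_range_self k
  · rw [← hrange] at hu
    obtain ⟨k, rfl⟩ := hu
    exact ⟨k, rfl⟩

end

/-- **(Lemma 8 of the paper.)** Up to isometry, there is at most one Coxeter
decomposition of the second type of the hyperbolic simplex `H₁₁⁵` with
fundamental simplex `H₄⁵`. -/
theorem statement16 (P F : Set ↥(hypSet 5)) (hF : IsH45 F) (hP : IsH115 P) :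
    ∀ 𝒯₁ 𝒯₂, hSTDecomp 5 P F 𝒯₁ → hSTDecomp 5 P F 𝒯₂ →
      hDecompEquiv 5 P 𝒯₁ 𝒯₂ := by
  obtain ⟨-, hPs, -, hcard, ⟨w, hw, hl⟩, -⟩ := hP
  obtain ⟨ν, hν⟩ := hPs.exists_normals
  obtain ⟨μ, hμ⟩ := hF.2.1.exists_normals
  obtain ⟨Ψ, hΨ⟩ := hν.exists_frame hw hl hcard
  exact fun _ _ h₁ h₂ => hΨ.decompEquiv hμ h₁ h₂

end CD
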